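/- Let T be an ABC-tile having exactly 14 neighbors. Then the topological boundary ∂T of T (with the subspace topology inherited from ℝ³) is homeomorphic to the 2-sphere S² = {x ∈ ℝ³ : |x| = 1}. -/

import Mathlib

open MeasureTheory

noncomputable def Mmat (A B C : ℤ) : Matrix (Fin 3) (Fin 3) ℝ :=
  !![0, 0, -(C : ℝ); 1, 0, -(B : ℝ); 0, 1, -(A : ℝ)]

def Ddig (C : ℤ) : Set (Fin 3 → ℝ) :=
  {d | ∃ i : ℤ, 0 ≤ i ∧ i < C ∧ d = ![(i : ℝ), 0, 0]}

def toR (α : Fin 3 → ℤ) : Fin 3 → ℝ := fun i => (α i : ℝ)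

def tileTranslate (v : Fin 3 → ℝ) (T : Set (Fin 3 → ℝ)) : Set (Fin 3 → ℝ) :=
  (fun x => x + v) '' T

def IsABCTile (A B C : ℤ) (T : Set (Fin 3 → ℝ)) : Prop :=
  1 ≤ A ∧ A ≤ B ∧ B < C ∧
  T.Nonempty ∧ IsCompact T ∧ 0 < volume T ∧
  (Mmat A B C).mulVec '' T = ⋃ d ∈ Ddig C, tileTranslate d T

def Neighbors (T : Set (Fin 3 → ℝ)) : Set (Fin 3 → ℤ) :=
  {α | α ≠ 0 ∧ (T ∩ tileTranslate (toR α) T).Nonempty}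


section
open Set Metric

namespace ABCT

variable {α β : Type*} [MetricSpace α] [MetricSpace β]

/-- A decreasing sequence of closed relations that become injective and single valued in the limit
gives a homeomorphism. -/
theorem homeo_of_relations_mem {X : Set α} {Y : Set β} (hX : IsCompact X) (hY : IsCompact Y)
    (R : ℕ → Set (α × β)) (hcl : ∀ k, IsClosed (R k)) (hanti : ∀ k, R (k+1) ⊆ R k)
    (hsub : ∀ k, R k ⊆ X ×ˢ Y)
    (htX : ∀ k, ∀ x ∈ X, ∃ y, (x, y) ∈ R k) (htY : ∀ k, ∀ y ∈ Y, ∃ x, (x, y) ∈ R k)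
    (h1 : ∀ ε > 0, ∃ k, ∀ x y y', (x, y) ∈ R k → (x, y') ∈ R k → dist y y' ≤ ε)
    (h2 : ∀ ε > 0, ∃ k, ∀ x x' y, (x, y) ∈ R k → (x', y) ∈ R k → dist x x' ≤ ε) :
    ∃ e : X ≃ₜ Y, ∀ x : X, ∀ k, ((x : α), (e x : β)) ∈ R k := by
  classical
  set S : Set (α × β) := ⋂ k, R k with hS
  have hcomp : ∀ k, IsCompact (R k) := fun k => (hX.prod hY).of_isClosed_subset (hcl k) (hsub k)
  have hSc : IsCompact S := by
    refine (hX.prod hY).of_isClosed_subset (isClosed_iInter hcl) ?_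
    exact (iInter_subset _ 0).trans (hsub 0)
  have hSX : ∀ z ∈ S, z.1 ∈ X := fun z hz => (hsub 0 (mem_iInter.1 hz 0)).1
  have hSY : ∀ z ∈ S, z.2 ∈ Y := fun z hz => (hsub 0 (mem_iInter.1 hz 0)).2
  have exX : ∀ x ∈ X, ∃ y, (x, y) ∈ S := by
    intro x hx
    have := IsCompact.nonempty_iInter_of_sequence_nonempty_isCompact_isClosed
      (fun k => R k ∩ (Prod.fst ⁻¹' {x})) (fun k => inter_subset_inter_left _ (hanti k))
      (fun k => by obtain ⟨y, hy⟩ := htX k x hx; exact ⟨(x, y), hy, rfl⟩)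
      ((hcomp 0).inter_right (isClosed_singleton.preimage continuous_fst))
      (fun k => (hcl k).inter (isClosed_singleton.preimage continuous_fst))
    obtain ⟨z, hz⟩ := this
    refine ⟨z.2, ?_⟩
    have hz1 : z.1 = x := (mem_iInter.1 hz 0).2
    rw [← hz1]
    exact mem_iInter.2 fun k => (mem_iInter.1 hz k).1
  have exY : ∀ y ∈ Y, ∃ x, (x, y) ∈ S := by
    intro x hx
    have := IsCompact.nonempty_iInter_of_sequence_nonempty_isCompact_isClosed
      (fun k => R k ∩ (Prod.snd ⁻¹' {x})) (fun k => inter_subset_inter_left _ (hanti k))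
      (fun k => by obtain ⟨y, hy⟩ := htY k x hx; exact ⟨(y, x), hy, rfl⟩)
      ((hcomp 0).inter_right (isClosed_singleton.preimage continuous_snd))
      (fun k => (hcl k).inter (isClosed_singleton.preimage continuous_snd))
    obtain ⟨z, hz⟩ := this
    refine ⟨z.1, ?_⟩
    have hz1 : z.2 = x := (mem_iInter.1 hz 0).2
    rw [← hz1]
    exact mem_iInter.2 fun k => (mem_iInter.1 hz k).1
  have : CompactSpace S := isCompact_iff_compactSpace.1 hSc
  let f1 : S → X := fun z => ⟨z.1.1, hSX _ z.2⟩
  let f2 : S → Y := fun z => ⟨z.1.2, hSY _ z.2⟩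
  have c1 : Continuous f1 := (continuous_fst.comp continuous_subtype_val).subtype_mk _
  have c2 : Continuous f2 := (continuous_snd.comp continuous_subtype_val).subtype_mk _
  have b1 : Function.Bijective f1 := by
    constructor
    · rintro ⟨⟨x, y⟩, h⟩ ⟨⟨x', y'⟩, h'⟩ e
      have e1 : x = x' := congrArg Subtype.val e
      subst e1
      have : dist y y' ≤ 0 := by
        apply le_of_forall_pos_le_add
        intro ε hε
        obtain ⟨k, hk⟩ := h1 ε hε
        simpa using hk x y y' (mem_iInter.1 h k) (mem_iInter.1 h' k)
      have : y = y' := dist_le_zero.1 this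
      subst this; rfl
    · rintro ⟨x, hx⟩
      obtain ⟨y, hy⟩ := exX x hx
      exact ⟨⟨(x, y), hy⟩, rfl⟩
  have b2 : Function.Bijective f2 := by
    constructor
    · rintro ⟨⟨x, y⟩, h⟩ ⟨⟨x', y'⟩, h'⟩ e
      have e1 : y = y' := congrArg Subtype.val e
      subst e1
      have : dist x x' ≤ 0 := by
        apply le_of_forall_pos_le_add
        intro ε hε
        obtain ⟨k, hk⟩ := h2 ε hε
        simpa using hk x x' y (mem_iInter.1 h k) (mem_iInter.1 h' k)
      have : x = x' := dist_le_zero.1 this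
      subst this; rfl
    · rintro ⟨y, hy⟩
      obtain ⟨x, hx⟩ := exY y hy
      exact ⟨⟨(x, y), hx⟩, rfl⟩
  refine ⟨(c1.homeoOfEquivCompactToT2 (f := Equiv.ofBijective f1 b1)).symm.trans
    (c2.homeoOfEquivCompactToT2 (f := Equiv.ofBijective f2 b2)), ?_⟩
  intro x k
  obtain ⟨z, rfl⟩ := (c1.homeoOfEquivCompactToT2 (f := Equiv.ofBijective f1 b1)).surjective x
  rw [Homeomorph.trans_apply, Homeomorph.symm_apply_apply]
  exact mem_iInter.1 z.2 k

theorem homeo_of_relations {X : Set α} {Y : Set β} (hX : IsCompact X) (hY : IsCompact Y)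
    (R : ℕ → Set (α × β)) (hcl : ∀ k, IsClosed (R k)) (hanti : ∀ k, R (k+1) ⊆ R k)
    (hsub : ∀ k, R k ⊆ X ×ˢ Y)
    (htX : ∀ k, ∀ x ∈ X, ∃ y, (x, y) ∈ R k) (htY : ∀ k, ∀ y ∈ Y, ∃ x, (x, y) ∈ R k)
    (h1 : ∀ ε > 0, ∃ k, ∀ x y y', (x, y) ∈ R k → (x, y') ∈ R k → dist y y' ≤ ε)
    (h2 : ∀ ε > 0, ∃ k, ∀ x x' y, (x, y) ∈ R k → (x', y) ∈ R k → dist x x' ≤ ε) :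
    Nonempty (X ≃ₜ Y) := by
  obtain ⟨e, -⟩ := homeo_of_relations_mem hX hY R hcl hanti hsub htX htY h1 h2
  exact ⟨e⟩

def IsArc (γ : Set α) (a b : α) : Prop :=
  ∃ p : ℝ → α, ContinuousOn p (Icc 0 1) ∧ InjOn p (Icc 0 1) ∧ p 0 = a ∧ p 1 = b ∧
    p '' Icc 0 1 = γ

structure IsCut (D J γ : Set α) (a b : α) (D1 J1 D2 J2 : Set α) : Prop where
  ne : a ≠ b
  union : D1 ∪ D2 = D
  inter : D1 ∩ D2 = γ
  arc : IsArc γ a b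
  arcJ : γ ∩ J = {a, b}
  eJ1 : J1 = (J ∩ D1) ∪ γ
  eJ2 : J2 = (J ∩ D2) ∪ γ
  conn1 : IsPreconnected ((J ∩ D1) \ {a, b})
  conn2 : IsPreconnected ((J ∩ D2) \ {a, b})

def IsDisc (P Q : Set β) : Prop :=
  ∃ ψ : ℂ → β, ContinuousOn ψ (closedBall 0 1) ∧ InjOn ψ (closedBall 0 1) ∧
    ψ '' closedBall 0 1 = P ∧ ψ '' sphere 0 1 = Q

structure Piece (α β : Type*) where
  D : Set α
  J : Set α
  P : Set β
  f : α → β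

structure Valid (𝒟 : Set α → Set α → Prop) (x : Piece α β) : Prop where
  mem : 𝒟 x.D x.J
  disc : IsDisc x.P (x.f '' x.J)
  cont : ContinuousOn x.f x.J
  inj : InjOn x.f x.J

structure IsRep (𝒟 : Set α → Set α → Prop) (x : Piece α β) {ι : Type} (y : ι → Piece α β) :
    Prop where
  fin : Finite ι
  unionD : ⋃ i, (y i).D = x.D
  unionP : ⋃ i, (y i).P = x.P
  valid : ∀ i, Valid 𝒟 (y i)
  bdD : ∀ i, (y i).D ∩ x.J ⊆ (y i).J
  bdf : ∀ i, ∀ p ∈ (y i).D ∩ x.J, (y i).f p = x.f p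
  bdP : ∀ i, (y i).P ∩ x.f '' x.J ⊆ x.f '' ((y i).D ∩ x.J)
  interD : ∀ i j, i ≠ j → (y i).D ∩ (y j).D ⊆ (y i).J ∩ (y j).J
  interf : ∀ i j, i ≠ j → ∀ p ∈ (y i).D ∩ (y j).D, (y i).f p = (y j).f p
  interP : ∀ i j, i ≠ j → (y i).P ∩ (y j).P ⊆ (y i).f '' ((y i).D ∩ (y j).D)

theorem IsDisc.subset {P Q : Set β} (h : IsDisc P Q) : Q ⊆ P := by
  obtain ⟨ψ, -, -, rfl, rfl⟩ := h
  exact image_mono sphere_subset_closedBall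

theorem IsDisc.isCompact {P Q : Set β} (h : IsDisc P Q) : IsCompact P := by
  obtain ⟨ψ, c, -, rfl, -⟩ := h
  exact (isCompact_closedBall 0 1).image_of_continuousOn c

theorem IsDisc.nonempty {P Q : Set β} (h : IsDisc P Q) : Q.Nonempty := by
  obtain ⟨ψ, c, -, -, rfl⟩ := h
  exact ⟨ψ 1, 1, by simp, rfl⟩

theorem IsRep.comp {𝒟 : Set α → Set α → Prop} {x : Piece α β} {ι : Type} {y : ι → Piece α β}
    (h : IsRep 𝒟 x y) {κ : ι → Type} {z : ∀ i, κ i → Piece α β} (hz : ∀ i, IsRep 𝒟 (y i) (z i)) :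
    IsRep 𝒟 x (fun s : Σ i, κ i => z s.1 s.2) := by
  have := h.fin
  have := fun i => (hz i).fin
  have subD : ∀ i k, (z i k).D ⊆ (y i).D := fun i k => by
    rw [← (hz i).unionD]; exact subset_iUnion (fun k => (z i k).D) k
  have subP : ∀ i k, (z i k).P ⊆ (y i).P := fun i k => by
    rw [← (hz i).unionP]; exact subset_iUnion (fun k => (z i k).P) k
  refine ⟨inferInstance, ?_, ?_, fun s => (hz s.1).valid s.2, ?_, ?_, ?_, ?_, ?_, ?_⟩
  · rw [iUnion_sigma, ← h.unionD]
    exact iUnion_congr fun i => (hz i).unionD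
  · rw [iUnion_sigma, ← h.unionP]
    exact iUnion_congr fun i => (hz i).unionP
  · rintro ⟨i, k⟩ p ⟨hp, hpJ⟩
    exact (hz i).bdD k ⟨hp, h.bdD i ⟨subD i k hp, hpJ⟩⟩
  · rintro ⟨i, k⟩ p ⟨hp, hpJ⟩
    have := h.bdD i ⟨subD i k hp, hpJ⟩
    exact ((hz i).bdf k p ⟨hp, this⟩).trans (h.bdf i p ⟨subD i k hp, hpJ⟩)
  · rintro ⟨i, k⟩ w ⟨hw, hwJ⟩
    obtain ⟨p, ⟨hpD, hpJ⟩, rfl⟩ := h.bdP i ⟨subP i k hw, hwJ⟩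
    have hpJi := h.bdD i ⟨hpD, hpJ⟩
    have e := h.bdf i p ⟨hpD, hpJ⟩
    rw [← e] at hw
    obtain ⟨p', ⟨hp'D, hp'J⟩, e'⟩ := (hz i).bdP k ⟨hw, mem_image_of_mem _ hpJi⟩
    have := (h.valid i).inj hp'J hpJi e'
    subst this
    exact ⟨p', ⟨hp'D, hpJ⟩, rfl⟩
  · rintro ⟨i, k⟩ ⟨j, l⟩ hne p ⟨hp, hp'⟩
    by_cases hij : i = j
    · subst hij
      have hkl : k ≠ l := fun e => hne (by rw [e])
      exact (hz i).interD k l hkl ⟨hp, hp'⟩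
    · have := h.interD i j hij ⟨subD i k hp, subD j l hp'⟩
      exact ⟨(hz i).bdD k ⟨hp, this.1⟩, (hz j).bdD l ⟨hp', this.2⟩⟩
  · rintro ⟨i, k⟩ ⟨j, l⟩ hne p ⟨hp, hp'⟩
    by_cases hij : i = j
    · subst hij
      have hkl : k ≠ l := fun e => hne (by rw [e])
      exact (hz i).interf k l hkl p ⟨hp, hp'⟩
    · have := h.interD i j hij ⟨subD i k hp, subD j l hp'⟩
      change (z i k).f p = (z j l).f p
      rw [(hz i).bdf k p ⟨hp, this.1⟩, (hz j).bdf l p ⟨hp', this.2⟩]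
      exact h.interf i j hij p ⟨subD i k hp, subD j l hp'⟩
  · rintro ⟨i, k⟩ ⟨j, l⟩ hne w ⟨hw, hw'⟩
    by_cases hij : i = j
    · subst hij
      have hkl : k ≠ l := fun e => hne (by rw [e])
      exact (hz i).interP k l hkl ⟨hw, hw'⟩
    · obtain ⟨p, ⟨hpi, hpj⟩, rfl⟩ := h.interP i j hij ⟨subP i k hw, subP j l hw'⟩
      have hJ := h.interD i j hij ⟨hpi, hpj⟩
      have ef := h.interf i j hij p ⟨hpi, hpj⟩
      obtain ⟨p1, ⟨h1D, h1J⟩, e1⟩ := (hz i).bdP k ⟨hw, mem_image_of_mem _ hJ.1⟩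
      have := (h.valid i).inj h1J hJ.1 e1
      subst this
      change (y i).f p1 ∈ (z j l).P at hw'
      rw [ef] at hw'
      obtain ⟨p2, ⟨h2D, h2J⟩, e2⟩ := (hz j).bdP l ⟨hw', mem_image_of_mem _ hJ.2⟩
      have := (h.valid j).inj h2J hJ.2 e2
      subst this
      exact ⟨p2, ⟨h1D, h2D⟩, (hz i).bdf k p2 ⟨h1D, h1J⟩⟩

theorem IsRep.self {𝒟 : Set α → Set α → Prop} {x : Piece α β} (hJ : x.J ⊆ x.D)
    (h : Valid 𝒟 x) : IsRep 𝒟 x (fun _ : Unit => x) := by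
  refine ⟨inferInstance, iUnion_const _, iUnion_const _, fun _ => h, fun _ => inter_subset_right, fun _ _ _ => rfl,
    ?_, fun i j hij => (hij rfl).elim, fun i j hij => (hij rfl).elim, fun i j hij => (hij rfl).elim⟩
  intro i
  rw [inter_eq_right.2 hJ]
  exact inter_subset_right

/-- transport of a representation along an injection of the model side -/
theorem IsRep.map {β' : Type*} [MetricSpace β'] {𝒟 : Set α → Set α → Prop} {x : Piece α β}
    {ι : Type} {y : ι → Piece α β} (h : IsRep 𝒟 x y) (hx : x.f '' x.J ⊆ x.P) (ψ : β → β')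
    (hc : ContinuousOn ψ x.P)
    (hi : InjOn ψ x.P) :
    IsRep 𝒟 (⟨x.D, x.J, ψ '' x.P, ψ ∘ x.f⟩ : Piece α β')
      (fun i => ⟨(y i).D, (y i).J, ψ '' (y i).P, ψ ∘ (y i).f⟩) := by
  have subP : ∀ i, (y i).P ⊆ x.P := fun i => by
    rw [← h.unionP]; exact subset_iUnion (fun k => (y k).P) i
  have fP : ∀ i, (y i).f '' (y i).J ⊆ x.P := fun i => (h.valid i).disc.subset.trans (subP i)
  refine ⟨h.fin, h.unionD, ?_, ?_, h.bdD, ?_, ?_, h.interD, ?_, ?_⟩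
  · rw [← h.unionP, image_iUnion]
  · intro i
    refine ⟨(h.valid i).mem, ?_, ?_, ?_⟩
    · obtain ⟨φ, c, j, e1, e2⟩ := (h.valid i).disc
      refine ⟨ψ ∘ φ, hc.comp c ?_, hi.comp j ?_, ?_, ?_⟩
      · intro w hw; exact subP i (e1 ▸ mem_image_of_mem _ hw)
      · intro w hw; exact subP i (e1 ▸ mem_image_of_mem _ hw)
      · rw [image_comp, e1]
      · rw [image_comp, e2, image_comp]
    · exact hc.comp (h.valid i).cont fun p hp => fP i (mem_image_of_mem _ hp)
    · exact hi.comp (h.valid i).inj fun p hp => fP i (mem_image_of_mem _ hp)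
  · intro i p hp
    simp [h.bdf i p hp]
  · rintro i w ⟨⟨u, hu, rfl⟩, p, hp, e⟩
    have : x.f p = u := hi (hx (mem_image_of_mem _ hp)) (subP i hu) e
    subst this
    obtain ⟨p', hp', e'⟩ := h.bdP i ⟨hu, mem_image_of_mem _ hp⟩
    exact ⟨p', hp', by simp [e']⟩
  · intro i j hij p hp
    simp [h.interf i j hij p hp]
  · rintro i j hij w ⟨⟨u, hu, rfl⟩, v, hv, e⟩
    have : v = u := hi (subP j hv) (subP i hu) e
    subst this
    obtain ⟨p', hp', e'⟩ := h.interP i j hij ⟨hu, hv⟩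
    exact ⟨p', hp', by simp [e']⟩

end ABCT
end

section
open Set Metric

namespace ABCT

def side (u v p : ℂ) : ℝ := (v.re - u.re) * (p.im - u.im) - (v.im - u.im) * (p.re - u.re)

theorem side_swap (u v p : ℂ) : side v u p = - side u v p := by unfold side; ring

theorem side_cont (u v : ℂ) : Continuous (side u v) := by unfold side; fun_prop

structure Body (P : Set ℂ) : Prop where
  comp : IsCompact P
  conv : Convex ℝ P
  int : (interior P).Nonempty

theorem Body.isDisc {P : Set ℂ} (h : Body P) : IsDisc P (frontier P) := by
  obtain ⟨e, -, h2, h3⟩ := exists_homeomorph_image_interior_closure_frontier_eq_unitBall h.conv h.int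
    h.comp.isBounded
  rw [h.comp.isClosed.closure_eq] at h2
  refine ⟨e.symm, e.symm.continuous.continuousOn, e.symm.injective.injOn, ?_, ?_⟩
  · rw [← h2, ← image_comp]; simp
  · rw [← h3, ← image_comp]; simp

/-- the chord `u v` of the body `P` -/
structure Chord (P : Set ℂ) (u v : ℂ) : Prop where
  ne : u ≠ v
  hu : u ∈ frontier P
  hv : v ∈ frontier P
  w : ∃ w ∈ openSegment ℝ u v, w ∈ interior P

theorem Chord.symm {P : Set ℂ} {u v : ℂ} (h : Chord P u v) : Chord P v u :=
  ⟨h.ne.symm, h.hv, h.hu, by rw [openSegment_symm]; exact h.w⟩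

theorem normSq_pos_of_ne {u v : ℂ} (h : u ≠ v) : 0 < (v.re - u.re)^2 + (v.im - u.im)^2 := by
  by_contra hc
  push Not at hc
  have h1 : v.re - u.re = 0 := by nlinarith [sq_nonneg (v.re - u.re), sq_nonneg (v.im - u.im)]
  have h2 : v.im - u.im = 0 := by nlinarith [sq_nonneg (v.re - u.re), sq_nonneg (v.im - u.im)]
  exact h (Complex.ext (by linarith) (by linarith))

/-- moving orthogonally -/
def orth (u v p : ℂ) (t : ℝ) : ℂ := ⟨p.re - t * (v.im - u.im), p.im + t * (v.re - u.re)⟩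

theorem side_orth (u v p : ℂ) (t : ℝ) :
    side u v (orth u v p t) = side u v p + t * ((v.re - u.re)^2 + (v.im - u.im)^2) := by
  unfold side orth; ring

theorem orth_cont (u v p : ℂ) : Continuous (orth u v p) := by
  have : orth u v p = fun t : ℝ => p + (t : ℂ) * ⟨-(v.im - u.im), v.re - u.re⟩ := by
    funext t
    apply Complex.ext <;> simp [orth]
    ring
  rw [this]; fun_prop

theorem orth_zero (u v p : ℂ) : orth u v p 0 = p := by
  apply Complex.ext <;> simp [orth]

theorem exists_orth_mem {u v p : ℂ} {U : Set ℂ} (hU : U ∈ nhds p) :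
    ∃ t > 0, orth u v p t ∈ U ∧ orth u v p (-t) ∈ U := by
  have h1 : Filter.Tendsto (orth u v p) (nhds 0) (nhds p) := by
    have := (orth_cont u v p).tendsto 0
    rwa [orth_zero] at this
  have h2 := h1 hU
  rw [Filter.mem_map, Metric.mem_nhds_iff] at h2
  obtain ⟨ε, hε, hb⟩ := h2
  refine ⟨ε/2, by positivity, hb ?_, hb ?_⟩
  · simp [abs_of_pos hε, hε]
  · simp [abs_of_pos hε, hε]

theorem Chord.extreme {P : Set ℂ} (hP : Body P) {u v : ℂ} (h : Chord P u v) :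
    (∃ q ∈ frontier P, 0 < side u v q) ∧ (∃ q ∈ frontier P, side u v q < 0) := by
  have hd := normSq_pos_of_ne h.ne
  have key : ∀ x ∈ interior P, ∃ t > 0, orth u v x t ∈ interior P ∧ orth u v x (-t) ∈ interior P :=
    fun x hx => exists_orth_mem (isOpen_interior.mem_nhds hx)
  obtain ⟨w, hw, hwi⟩ := h.w
  have hw0 : side u v w = 0 := by
    obtain ⟨a, b, ha, hb, hab, rfl⟩ := hw
    have : a = 1 - b := by linarith
    subst this
    simp [side]; ring
  obtain ⟨t, ht, h1, h2⟩ := key w hwi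
  constructor
  · obtain ⟨m, hm, hmax⟩ := hP.comp.exists_isMaxOn ⟨w, interior_subset hwi⟩ (side_cont u v).continuousOn
    have hm1 : side u v (orth u v w t) ≤ side u v m := hmax (interior_subset h1)
    rw [side_orth, hw0] at hm1
    refine ⟨m, ?_, by nlinarith⟩
    rw [hP.comp.isClosed.frontier_eq]
    refine ⟨hm, fun hmi => ?_⟩
    obtain ⟨s, hs, h3, -⟩ := key m hmi
    have : side u v (orth u v m s) ≤ side u v m := hmax (interior_subset h3)
    rw [side_orth] at this
    nlinarith
  · obtain ⟨m, hm, hmin⟩ := hP.comp.exists_isMinOn ⟨w, interior_subset hwi⟩ (side_cont u v).continuousOn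
    have hm1 : side u v m ≤ side u v (orth u v w (-t)) := hmin (interior_subset h2)
    rw [side_orth, hw0] at hm1
    refine ⟨m, ?_, by nlinarith⟩
    rw [hP.comp.isClosed.frontier_eq]
    refine ⟨hm, fun hmi => ?_⟩
    obtain ⟨s, hs, -, h3⟩ := key m hmi
    have : side u v m ≤ side u v (orth u v m (-s)) := hmin (interior_subset h3)
    rw [side_orth] at this
    nlinarith

theorem side_seg {u v w : ℂ} (hw : w ∈ segment ℝ u v) : side u v w = 0 := by
  obtain ⟨a, b, ha, hb, hab, rfl⟩ := hw
  have : a = 1 - b := by linarith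
  subst this
  simp [side]; ring

theorem exists_param {u v p : ℂ} (h : u ≠ v) (hp : side u v p = 0) :
    ∃ t : ℝ, p = u + t • (v - u) := by
  have hd := normSq_pos_of_ne h
  set n := (v.re - u.re)^2 + (v.im - u.im)^2 with hn
  refine ⟨((p.re - u.re) * (v.re - u.re) + (p.im - u.im) * (v.im - u.im)) / n, ?_⟩
  unfold side at hp
  apply Complex.ext
  · simp
    field_simp
    rw [hn]
    linear_combination (-(v.im - u.im)) * hp
  · simp
    field_simp
    rw [hn]
    linear_combination (v.re - u.re) * hp

theorem Chord.mem_seg {P : Set ℂ} (hP : Body P) {u v : ℂ} (h : Chord P u v) {p : ℂ} (hp : p ∈ P)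
    (h0 : side u v p = 0) : p ∈ segment ℝ u v := by
  obtain ⟨w, hw, hwi⟩ := h.w
  have hcl := hP.comp.isClosed
  have hu := h.hu
  have hv := h.hv
  rw [hcl.frontier_eq] at hu hv
  obtain ⟨t, rfl⟩ := exists_param h.ne h0
  rw [segment_eq_image'] 
  rw [openSegment_eq_image'] at hw
  obtain ⟨s, ⟨hs0, hs1⟩, rfl⟩ := hw
  refine ⟨t, ⟨?_, ?_⟩, rfl⟩
  · by_contra ht
    push Not at ht
    refine hu.2 (hP.conv.openSegment_interior_self_subset_interior hwi hp ?_)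
    rw [openSegment_eq_image']
    refine ⟨s / (s - t), ⟨by apply div_pos <;> linarith, by rw [div_lt_one] <;> linarith⟩, ?_⟩
    have : s - t ≠ 0 := by linarith
    have e : s + s / (s - t) * (t - s) = 0 := by field_simp; ring
    simp only [add_sub_add_left_eq_sub, ← sub_smul, smul_smul, add_assoc, ← add_smul, e]
    simp
  · by_contra ht
    push Not at ht
    refine hv.2 (hP.conv.openSegment_interior_self_subset_interior hwi hp ?_)
    rw [openSegment_eq_image']
    refine ⟨(1 - s) / (t - s), ⟨by apply div_pos <;> linarith, by rw [div_lt_one] <;> linarith⟩, ?_⟩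
    have : t - s ≠ 0 := by linarith
    have e : s + (1 - s) / (t - s) * (t - s) = 1 := by field_simp; ring
    simp only [add_sub_add_left_eq_sub, ← sub_smul, smul_smul, add_assoc, ← add_smul, e]
    simp

theorem Chord.open_sub {P : Set ℂ} (hP : Body P) {u v : ℂ} (h : Chord P u v) :
    openSegment ℝ u v ⊆ interior P := by
  obtain ⟨w, hw, hwi⟩ := h.w
  have hcl := hP.comp.isClosed
  have hu := h.hu
  have hv := h.hv
  rw [hcl.frontier_eq] at hu hv
  rw [openSegment_eq_image'] at hw
  obtain ⟨s, ⟨hs0, hs1⟩, rfl⟩ := hw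
  intro p hp
  rw [openSegment_eq_image'] at hp
  obtain ⟨t, ⟨ht0, ht1⟩, rfl⟩ := hp
  rcases lt_trichotomy t s with hts | rfl | hts
  · refine hP.conv.openSegment_interior_self_subset_interior hwi hu.1 ?_
    rw [openSegment_eq_image']
    refine ⟨(s - t) / s, ⟨by apply div_pos <;> linarith, by rw [div_lt_one] <;> linarith⟩, ?_⟩
    have e : s + (s - t) / s * (-s) = t := by field_simp; ring
    have e2 : u - (u + s • (v - u)) = (-s) • (v - u) := by rw [neg_smul]; abel
    simp only [e2, smul_smul, add_assoc, ← add_smul, e]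
  · exact hwi
  · refine hP.conv.openSegment_interior_self_subset_interior hwi hv.1 ?_
    rw [openSegment_eq_image']
    refine ⟨(t - s) / (1 - s), ⟨by apply div_pos <;> linarith, by rw [div_lt_one] <;> linarith⟩, ?_⟩
    have : 1 - s ≠ 0 := by linarith
    have e : s + (t - s) / (1 - s) * (1 - s) = t := by field_simp; ring
    have e2 : v - (u + s • (v - u)) = (1 - s) • (v - u) := by rw [sub_smul, one_smul]; abel
    simp only [e2, smul_smul, add_assoc, ← add_smul, e]

theorem Chord.inter_frontier {P : Set ℂ} (hP : Body P) {u v : ℂ} (h : Chord P u v) {p : ℂ}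
    (hp : p ∈ frontier P) (h0 : side u v p = 0) : p = u ∨ p = v := by
  rw [hP.comp.isClosed.frontier_eq] at hp
  have h1 := h.mem_seg hP hp.1 h0
  rw [← insert_endpoints_openSegment] at h1
  rcases h1 with h1 | h1 | h1
  · exact Or.inl h1
  · exact Or.inr h1
  · exact (hp.2 (h.open_sub hP h1)).elim

theorem Chord.half {P : Set ℂ} (hP : Body P) {u v : ℂ} (h : Chord P u v) :
    Body (P ∩ {p | 0 ≤ side u v p}) ∧
    frontier (P ∩ {p | 0 ≤ side u v p}) = (frontier P ∩ {p | 0 ≤ side u v p}) ∪ segment ℝ u v := by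
  have hd := normSq_pos_of_ne h.ne
  have hcl : IsClosed {p | 0 ≤ side u v p} := isClosed_le continuous_const (side_cont u v)
  have hintr : interior {p | 0 ≤ side u v p} = {p | 0 < side u v p} := by
    apply Subset.antisymm
    · intro p hp
      have h0 : 0 ≤ side u v p := by simpa using interior_subset hp
      rcases h0.lt_or_eq with h1 | h1
      · exact h1
      · obtain ⟨t, ht, -, h2⟩ := exists_orth_mem (u := u) (v := v) (isOpen_interior.mem_nhds hp)
        have := interior_subset h2
        simp only [mem_ofPred_eq, side_orth, ← h1] at this
        nlinarith
    · exact interior_maximal (fun p hp => by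
        simp only [mem_ofPred_eq] at hp ⊢; exact hp.le) (isOpen_lt continuous_const (side_cont u v))
  have hpc := hP.comp.isClosed
  have hu : u ∈ P := by have := h.hu; rw [hpc.frontier_eq] at this; exact this.1
  have hv : v ∈ P := by have := h.hv; rw [hpc.frontier_eq] at this; exact this.1
  refine ⟨⟨hP.comp.inter_right hcl, hP.conv.inter ?_, ?_⟩, ?_⟩
  · intro x hx y hy a b ha hb hab
    have : side u v (a • x + b • y) = a * side u v x + b * side u v y := by
      have : a = 1 - b := by linarith
      subst this
      simp [side]; ring
    simp only [mem_ofPred_eq] at *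
    rw [this]; positivity
  · obtain ⟨w, hw, hwi⟩ := h.w
    obtain ⟨t, ht, h1, -⟩ := exists_orth_mem (u := u) (v := v) (isOpen_interior.mem_nhds hwi)
    refine ⟨orth u v w t, ?_⟩
    rw [interior_inter, hintr]
    refine ⟨h1, ?_⟩
    simp only [mem_ofPred_eq, side_orth, side_seg (openSegment_subset_segment _ _ _ hw)]
    positivity
  · rw [(hpc.inter hcl).frontier_eq, interior_inter, hintr, hpc.frontier_eq]
    ext p
    simp only [mem_sdiff, mem_inter_iff, mem_ofPred_eq, mem_union]
    constructor
    · rintro ⟨⟨h1, h2⟩, h3⟩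
      by_cases hpi : p ∈ interior P
      · right
        apply h.mem_seg hP h1
        by_contra hne
        exact h3 ⟨hpi, lt_of_le_of_ne h2 (Ne.symm hne)⟩
      · exact Or.inl ⟨⟨h1, hpi⟩, h2⟩
    · rintro (⟨⟨h1, h2⟩, h3⟩ | h1)
      · exact ⟨⟨h1, h3⟩, fun h => h2 h.1⟩
      · have := side_seg h1
        exact ⟨⟨hP.conv.segment_subset hu hv h1, this.ge⟩, fun h => h.2.ne' this⟩

theorem exists_cont_inv {α β : Type*} [TopologicalSpace α] [TopologicalSpace β] [T2Space β]
    [Nonempty α] {K : Set α}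
    (hK : IsCompact K) {p : α → β} (hc : ContinuousOn p K) (hi : InjOn p K) :
    ∃ g : β → α, ContinuousOn g (p '' K) ∧ ∀ x ∈ K, g (p x) = x := by
  refine ⟨Function.invFunOn p K, ?_, fun x hx => hi.leftInvOn_invFunOn hx⟩
  have : CompactSpace K := isCompact_iff_compactSpace.1 hK
  let e : K ≃ (p '' K) := Equiv.Set.imageOfInjOn p K hi
  have he : Continuous e := (continuousOn_iff_continuous_domRestrict.1 hc).subtype_mk _
  let E := he.homeoOfEquivCompactToT2
  rw [continuousOn_iff_continuous_domRestrict]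
  have : (p '' K).domRestrict (Function.invFunOn p K) = fun y => (E.symm y : α) := by
    funext y
    obtain ⟨z, rfl⟩ := E.surjective y
    rw [E.symm_apply_apply]
    exact hi.leftInvOn_invFunOn z.2
  rw [this]
  exact continuous_subtype_val.comp E.symm.continuous

theorem IsArc.exists_inv {α : Type*} [MetricSpace α] {γ : Set α} {a b : α} (h : IsArc γ a b) :
    IsCompact γ ∧ a ∈ γ ∧ b ∈ γ ∧
    ∃ g : α → ℝ, ContinuousOn g γ ∧ InjOn g γ ∧ g '' γ = Icc 0 1 ∧ g a = 0 ∧ g b = 1 := by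
  obtain ⟨p, hc, hi, rfl, rfl, rfl⟩ := h
  refine ⟨isCompact_Icc.image_of_continuousOn hc, ⟨0, by simp, rfl⟩, ⟨1, by simp, rfl⟩, ?_⟩
  obtain ⟨g, gc, hg⟩ := exists_cont_inv isCompact_Icc hc hi
  refine ⟨g, gc, ?_, ?_, hg 0 (by simp), hg 1 (by simp)⟩
  · rintro _ ⟨x, hx, rfl⟩ _ ⟨y, hy, rfl⟩ e
    rw [hg x hx, hg y hy] at e; rw [e]
  · ext t
    constructor
    · rintro ⟨_, ⟨x, hx, rfl⟩, rfl⟩; rw [hg x hx]; exact hx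
    · intro ht; exact ⟨p t, mem_image_of_mem _ ht, hg t ht⟩

end ABCT
end

section
open Set Metric

namespace ABCT

variable {α : Type*} [MetricSpace α]

theorem iUnion_bool {β : Type*} (s : Bool → Set β) : ⋃ i, s i = s false ∪ s true := by
  ext x; simp [Bool.exists_bool]

theorem IsCut.symm {D J γ : Set α} {a b : α} {D1 J1 D2 J2 : Set α}
    (h : IsCut D J γ a b D1 J1 D2 J2) : IsCut D J γ a b D2 J2 D1 J1 :=
  ⟨h.ne, by rw [union_comm]; exact h.union, by rw [inter_comm]; exact h.inter, h.arc, h.arcJ,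
    h.eJ2, h.eJ1, h.conn2, h.conn1⟩

/-- standing hypotheses on the family of discs -/
def GoodFam (𝒟 : Set α → Set α → Prop) : Prop :=
  ∀ D J, 𝒟 D J → IsCompact D ∧ IsCompact J ∧ J ⊆ D

structure CPiece (𝒟 : Set α → Set α → Prop) (x : Piece α ℂ) : Prop where
  mem : 𝒟 x.D x.J
  body : Body x.P
  bd : x.f '' x.J = frontier x.P
  cont : ContinuousOn x.f x.J
  inj : InjOn x.f x.J

theorem CPiece.valid {𝒟 : Set α → Set α → Prop} {x : Piece α ℂ} (h : CPiece 𝒟 x) : Valid 𝒟 x :=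
  ⟨h.mem, by rw [h.bd]; exact h.body.isDisc, h.cont, h.inj⟩

theorem cut_oriented {𝒟 : Set α → Set α → Prop} (hG : GoodFam 𝒟) {x : Piece α ℂ} (hx : CPiece 𝒟 x)
    {γ : Set α} {a b : α} {D1 J1 D2 J2 : Set α} (hc : IsCut x.D x.J γ a b D1 J1 D2 J2)
    (h1 : 𝒟 D1 J1) (h2 : 𝒟 D2 J2) (hch : Chord x.P (x.f a) (x.f b))
    (o1 : ∀ p ∈ x.J ∩ D1, 0 ≤ side (x.f a) (x.f b) (x.f p))
    (o2 : ∀ p ∈ x.J ∩ D2, side (x.f a) (x.f b) (x.f p) ≤ 0) :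
    ∃ g : α → ℂ, IsRep 𝒟 x (fun i : Bool => if i then ⟨D1, J1, x.P ∩ {p | 0 ≤ side (x.f a) (x.f b) p}, g⟩
      else ⟨D2, J2, x.P ∩ {p | 0 ≤ side (x.f b) (x.f a) p}, g⟩) ∧
      CPiece 𝒟 ⟨D1, J1, x.P ∩ {p | 0 ≤ side (x.f a) (x.f b) p}, g⟩ ∧
      CPiece 𝒟 ⟨D2, J2, x.P ∩ {p | 0 ≤ side (x.f b) (x.f a) p}, g⟩ := by
  classical
  obtain ⟨D, J, P, f⟩ := x
  obtain ⟨hmem, hP, him, hfc, hfi⟩ := hx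
  simp only at *
  set u := f a with hu
  set v := f b with hv
  obtain ⟨γc, aγ, bγ, g, gc, gi, gim, ga, gb⟩ := hc.arc.exists_inv
  have hJ := (hG _ _ hmem).2.1.isClosed
  have aJ : a ∈ J := by have : a ∈ γ ∩ J := by rw [hc.arcJ]; simp
                        exact this.2
  have bJ : b ∈ J := by have : b ∈ γ ∩ J := by rw [hc.arcJ]; simp
                        exact this.2
  have γJ : ∀ p ∈ γ, p ∈ J → p = a ∨ p = b := by
    intro p h h'
    have : p ∈ γ ∩ J := ⟨h, h'⟩
    rw [hc.arcJ] at this; simpa using this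
  set F : α → ℂ := fun p => if p ∈ γ then AffineMap.lineMap u v (g p) else f p with hF
  have FJ : ∀ p ∈ J, F p = f p := by
    intro p hp
    by_cases h : p ∈ γ
    · simp only [hF, h, if_true]
      rcases γJ p h hp with rfl | rfl
      · simp [ga, hu]
      · simp [gb, hv]
    · simp [hF, h]
  have Fγ : ∀ p ∈ γ, F p = AffineMap.lineMap u v (g p) := fun p hp => by simp [hF, hp]
  have Fγim : F '' γ = segment ℝ u v := by
    rw [segment_eq_image_lineMap, ← gim, image_image]
    exact image_congr Fγ
  have Fc : ContinuousOn F (J ∪ γ) := by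
    apply ContinuousOn.union_of_isClosed _ _ hJ γc.isClosed
    · exact hfc.congr FJ
    · exact ((AffineMap.lineMap_continuous (R := ℝ)).comp_continuousOn gc).congr Fγ
  have Fseg : ∀ p ∈ γ, side u v (F p) = 0 := fun p hp => side_seg (by rw [← Fγim]; exact ⟨p, hp, rfl⟩)
  have hfr : ∀ p ∈ J, f p ∈ frontier P := fun p hp => by rw [← him]; exact ⟨p, hp, rfl⟩
  have key : ∀ p ∈ J, side u v (f p) = 0 → p = a ∨ p = b := by
    intro p hp h0
    rcases hch.inter_frontier hP (hfr p hp) h0 with h | h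
    · exact Or.inl (hfi hp aJ h)
    · exact Or.inr (hfi hp bJ h)
  have key2 : ∀ p ∈ J, side u v (f p) = 0 → p ∈ γ := by
    intro p hp h0
    rcases key p hp h0 with rfl | rfl <;> assumption
  have Fiγ : InjOn F γ := by
    intro p hp q hq h
    rw [Fγ p hp, Fγ q hq] at h
    exact gi hp hq (AffineMap.lineMap_injective ℝ hch.ne h)
  have Fi : InjOn F (J ∪ γ) := by
    have aux : ∀ p ∈ J, ∀ q ∈ γ, F p = F q → p = q := by
      intro p hp q hq h
      have h0 := Fseg q hq
      rw [← h, FJ p hp] at h0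
      exact Fiγ (key2 p hp h0) hq h
    rintro p (hp | hp) q (hq | hq) h
    · rw [FJ p hp, FJ q hq] at h; exact hfi hp hq h
    · exact aux p hp q hq h
    · exact (aux q hq p hp h.symm).symm
    · exact Fiγ hp hq h
  have γ1 : γ ⊆ D1 := by rw [← hc.inter]; exact inter_subset_left
  have γ2 : γ ⊆ D2 := by rw [← hc.inter]; exact inter_subset_right
  have JD : J ⊆ D1 ∪ D2 := by rw [hc.union]; exact (hG _ _ hmem).2.2
  have mem1 : ∀ p ∈ J, 0 ≤ side u v (f p) → p ∈ D1 := by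
    intro p hp h
    rcases JD hp with h1 | h1
    · exact h1
    · exact γ1 (key2 p hp (le_antisymm (o2 p ⟨hp, h1⟩) h))
  have mem2 : ∀ p ∈ J, 0 ≤ side v u (f p) → p ∈ D2 := by
    intro p hp h
    rw [side_swap] at h
    rcases JD hp with h1 | h1
    · exact γ2 (key2 p hp (le_antisymm (by linarith) (o1 p ⟨hp, h1⟩)))
    · exact h1
  have J1s : J1 ⊆ J ∪ γ := by rw [hc.eJ1]; exact union_subset_union_left _ inter_subset_left
  have J2s : J2 ⊆ J ∪ γ := by rw [hc.eJ2]; exact union_subset_union_left _ inter_subset_left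
  have FJi : ∀ E ⊆ J, F '' E = f '' E := fun E hE => image_congr fun p hp => FJ p (hE hp)
  have P1 : CPiece 𝒟 ⟨D1, J1, P ∩ {p | 0 ≤ side u v p}, F⟩ := by
    refine ⟨h1, (hch.half hP).1, ?_, Fc.mono J1s, Fi.mono J1s⟩
    simp only
    rw [(hch.half hP).2, hc.eJ1, image_union, Fγim, FJi _ inter_subset_left]
    congr 1
    ext p
    constructor
    · rintro ⟨q, hq, rfl⟩; exact ⟨hfr q hq.1, o1 q hq⟩
    · rintro ⟨h3, h4⟩
      rw [← him] at h3
      obtain ⟨q, hq, rfl⟩ := h3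
      exact ⟨q, ⟨hq, mem1 q hq h4⟩, rfl⟩
  have P2 : CPiece 𝒟 ⟨D2, J2, P ∩ {p | 0 ≤ side v u p}, F⟩ := by
    refine ⟨h2, (hch.symm.half hP).1, ?_, Fc.mono J2s, Fi.mono J2s⟩
    simp only
    rw [(hch.symm.half hP).2, hc.eJ2, image_union, Fγim, FJi _ inter_subset_left, segment_symm]
    congr 1
    ext p
    constructor
    · rintro ⟨q, hq, rfl⟩
      refine ⟨hfr q hq.1, ?_⟩
      have := o2 q hq
      simp only [mem_ofPred_eq]
      rw [side_swap]; linarith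
    · rintro ⟨h3, h4⟩
      rw [← him] at h3
      obtain ⟨q, hq, rfl⟩ := h3
      exact ⟨q, ⟨hq, mem2 q hq h4⟩, rfl⟩
  refine ⟨F, ?_, P1, P2⟩
  have inP : (P ∩ {p | 0 ≤ side u v p}) ∩ (P ∩ {p | 0 ≤ side v u p}) ⊆ F '' γ := by
    rintro p ⟨⟨h3, h4⟩, -, h5⟩
    simp only [mem_ofPred_eq] at h4 h5
    rw [side_swap] at h5
    rw [Fγim]
    exact hch.mem_seg hP h3 (by linarith)
  have γJ1 : γ ⊆ J1 := by rw [hc.eJ1]; exact subset_union_right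
  have γJ2 : γ ⊆ J2 := by rw [hc.eJ2]; exact subset_union_right
  constructor
  · infer_instance
  · rw [ABCT.iUnion_bool]; simpa [union_comm] using hc.union
  · rw [ABCT.iUnion_bool, union_comm]
    simp only [if_true, Bool.false_eq_true, if_false]
    rw [← inter_union_distrib_left, inter_eq_left]
    intro p _
    rcases le_total 0 (side u v p) with h | h
    · exact Or.inl h
    · right; simp only [mem_ofPred_eq]; rw [side_swap]; linarith
  · rintro (_ | _)
    · exact P2.valid
    · exact P1.valid
  · rintro (_ | _)
    · rintro p ⟨h3, h4⟩; simp only [Bool.false_eq_true, if_false] at h3 ⊢; rw [hc.eJ2]; exact Or.inl ⟨h4, h3⟩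
    · rintro p ⟨h3, h4⟩; simp only [if_true] at h3 ⊢; rw [hc.eJ1]; exact Or.inl ⟨h4, h3⟩
  · rintro (_ | _) p ⟨h3, h4⟩
    · exact FJ p h4
    · exact FJ p h4
  · rintro (_ | _)
    · rintro _ ⟨⟨h3, h4⟩, p, hp, rfl⟩; exact ⟨p, ⟨mem2 p hp h4, hp⟩, rfl⟩
    · rintro _ ⟨⟨h3, h4⟩, p, hp, rfl⟩; exact ⟨p, ⟨mem1 p hp h4, hp⟩, rfl⟩
  · rintro (_ | _) (_ | _) hij
    · exact absurd rfl hij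
    · simp only [if_true, Bool.false_eq_true, if_false]
      rw [inter_comm, hc.inter]; exact subset_inter γJ2 γJ1
    · simp only [if_true, Bool.false_eq_true, if_false]
      rw [hc.inter]; exact subset_inter γJ1 γJ2
    · exact absurd rfl hij
  · rintro (_ | _) (_ | _) hij p hp
    · exact absurd rfl hij
    · rfl
    · rfl
    · exact absurd rfl hij
  · rintro (_ | _) (_ | _) hij
    · exact absurd rfl hij
    · simp only [if_true, Bool.false_eq_true, if_false]
      rw [inter_comm, inter_comm D2, hc.inter]; exact inP
    · simp only [if_true, Bool.false_eq_true, if_false]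
      rw [hc.inter]; exact inP
    · exact absurd rfl hij

theorem cut_rep {𝒟 : Set α → Set α → Prop} (hG : GoodFam 𝒟) {x : Piece α ℂ} (hx : CPiece 𝒟 x)
    {γ : Set α} {a b : α} {D1 J1 D2 J2 : Set α} (hc : IsCut x.D x.J γ a b D1 J1 D2 J2)
    (h1 : 𝒟 D1 J1) (h2 : 𝒟 D2 J2) (hch : Chord x.P (x.f a) (x.f b)) :
    ∃ y : Bool → Piece α ℂ, IsRep 𝒟 x y ∧ (∀ i, CPiece 𝒟 (y i)) ∧
      (y true).P = x.P ∩ {p | 0 ≤ side (x.f a) (x.f b) p} ∧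
      (y false).P = x.P ∩ {p | 0 ≤ side (x.f b) (x.f a) p} ∧
      (∀ i, ((y i).D = D1 ∧ (y i).J = J1) ∨ ((y i).D = D2 ∧ (y i).J = J2)) := by
  set u := x.f a with hu
  set v := x.f b with hv
  have aJ : a ∈ x.J := by have : a ∈ γ ∩ x.J := by rw [hc.arcJ]; simp
                          exact this.2
  have bJ : b ∈ x.J := by have : b ∈ γ ∩ x.J := by rw [hc.arcJ]; simp
                          exact this.2
  have sgn : ∀ E, IsPreconnected ((x.J ∩ E) \ {a, b}) →
      (∀ p ∈ x.J ∩ E, 0 ≤ side u v (x.f p)) ∨ (∀ p ∈ x.J ∩ E, side u v (x.f p) ≤ 0) := by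
    intro E hE
    have hcont : ContinuousOn (fun p => side u v (x.f p)) ((x.J ∩ E) \ {a, b}) :=
      (side_cont u v).comp_continuousOn (hx.cont.mono (sdiff_subset.trans inter_subset_left))
    have him := hE.image _ hcont
    have a0 : side u v (x.f a) = 0 := by rw [← hu]; simp [side]
    have b0 : side u v (x.f b) = 0 := by rw [← hv]; simp [side]; ring
    by_contra hcon
    push Not at hcon
    obtain ⟨⟨p, hp, hp0⟩, q, hq, hq0⟩ := hcon
    have hmem : ∀ r ∈ x.J ∩ E, side u v (x.f r) ≠ 0 → r ∈ (x.J ∩ E) \ {a, b} := by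
      intro r hr h
      refine ⟨hr, ?_⟩
      rintro (rfl | h')
      · exact h a0
      · rw [mem_singleton_iff] at h'; subst h'; exact h b0
    have h0 := him.ordConnected.out ⟨p, hmem p hp hp0.ne, rfl⟩ ⟨q, hmem q hq hq0.ne', rfl⟩
      (show (0:ℝ) ∈ Icc _ _ from ⟨hp0.le, hq0.le⟩)
    obtain ⟨r, hr, hr0⟩ := h0
    have hf : x.f r ∈ frontier x.P := by rw [← hx.bd]; exact ⟨r, hr.1.1, rfl⟩
    rcases hch.inter_frontier hx.body hf hr0 with h | h
    · exact hr.2 (Or.inl (hx.inj hr.1.1 aJ h))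
    · exact hr.2 (Or.inr (hx.inj hr.1.1 bJ h))
  obtain ⟨⟨p, hp, hp0⟩, ⟨q, hq, hq0⟩⟩ := hch.extreme hx.body
  rw [← hx.bd] at hp hq
  obtain ⟨p, hpJ, rfl⟩ := hp
  obtain ⟨q, hqJ, rfl⟩ := hq
  have JD : x.J ⊆ D1 ∪ D2 := by rw [hc.union]; exact (hG _ _ hx.mem).2.2
  have fin : ∀ {D1 J1 D2 J2 : Set α}, IsCut x.D x.J γ a b D1 J1 D2 J2 → 𝒟 D1 J1 → 𝒟 D2 J2 →
     (∀ p ∈ x.J ∩ D1, 0 ≤ side u v (x.f p)) → (∀ p ∈ x.J ∩ D2, side u v (x.f p) ≤ 0) →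
    ∃ y : Bool → Piece α ℂ, IsRep 𝒟 x y ∧ (∀ i, CPiece 𝒟 (y i)) ∧
      (y true).P = x.P ∩ {p | 0 ≤ side (x.f a) (x.f b) p} ∧
      (y false).P = x.P ∩ {p | 0 ≤ side (x.f b) (x.f a) p} ∧
      (∀ i, ((y i).D = D1 ∧ (y i).J = J1) ∨ ((y i).D = D2 ∧ (y i).J = J2)) := by
    intro D1 J1 D2 J2 hc h1 h2 o1 o2
    obtain ⟨g, r, c1, c2⟩ := cut_oriented hG hx hc h1 h2 hch o1 o2
    refine ⟨_, r, ?_, rfl, rfl, ?_⟩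
    · rintro (_ | _)
      · exact c2
      · exact c1
    · rintro (_ | _)
      · right; exact ⟨rfl, rfl⟩
      · left; exact ⟨rfl, rfl⟩
  rcases sgn D1 hc.conn1 with h3 | h3 <;> rcases sgn D2 hc.conn2 with h4 | h4
  · exfalso
    rcases JD hqJ with h | h
    · linarith [h3 q ⟨hqJ, h⟩]
    · linarith [h4 q ⟨hqJ, h⟩]
  · exact fin hc h1 h2 h3 h4
  · obtain ⟨y, r, c, e1, e2, e3⟩ := fin hc.symm h2 h1 h4 h3
    exact ⟨y, r, c, e1, e2, fun i => (e3 i).symm⟩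
  · exfalso
    rcases JD hpJ with h | h
    · linarith [h3 p ⟨hpJ, h⟩]
    · linarith [h4 p ⟨hpJ, h⟩]

end ABCT
end

section
open Set Metric Filter Topology

namespace ABCT

variable {α β : Type*} [MetricSpace α] [MetricSpace β]

theorem IsRep.congr {𝒟 : Set α → Set α → Prop} {x : Piece α β} {ι : Type} {y : ι → Piece α β}
    (h : IsRep 𝒟 x y) {f : α → β} (hf : EqOn x.f f x.J) :
    IsRep 𝒟 ⟨x.D, x.J, x.P, f⟩ y := by
  refine ⟨h.fin, h.unionD, h.unionP, h.valid, h.bdD, ?_, ?_, h.interD, h.interf, h.interP⟩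
  · intro i p hp
    rw [h.bdf i p hp]; exact hf hp.2
  · intro i
    simp only
    have := h.bdP i
    rw [image_congr (fun p hp => hf hp), image_congr (s := (y i).D ∩ x.J) (fun p hp => hf hp.2)] at this
    exact this

theorem IsRep.subP {𝒟 : Set α → Set α → Prop} {x : Piece α β} {ι : Type} {y : ι → Piece α β}
    (h : IsRep 𝒟 x y) (i : ι) : (y i).P ⊆ x.P := by
  rw [← h.unionP]; exact subset_iUnion (fun k => (y k).P) i

theorem IsRep.subD {𝒟 : Set α → Set α → Prop} {x : Piece α β} {ι : Type} {y : ι → Piece α β}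
    (h : IsRep 𝒟 x y) (i : ι) : (y i).D ⊆ x.D := by
  rw [← h.unionD]; exact subset_iUnion (fun k => (y k).D) i

theorem body_ball : Body (closedBall (0 : ℂ) 1) :=
  ⟨isCompact_closedBall _ _, convex_closedBall _ _, 0, by
    rw [interior_closedBall _ one_ne_zero]; simp⟩

theorem Valid.round {𝒟 : Set α → Set α → Prop} {x : Piece α β} (h : Valid 𝒟 x) :
    ∃ (g : α → ℂ) (ψ : ℂ → β), CPiece 𝒟 ⟨x.D, x.J, closedBall 0 1, g⟩ ∧
      ContinuousOn ψ (closedBall 0 1) ∧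
      ∀ {ι : Type} {y : ι → Piece α ℂ}, IsRep 𝒟 ⟨x.D, x.J, closedBall 0 1, g⟩ y →
        IsRep 𝒟 x (fun i => ⟨(y i).D, (y i).J, ψ '' (y i).P, ψ ∘ (y i).f⟩) := by
  obtain ⟨ψ, c, i, e1, e2⟩ := h.disc
  obtain ⟨k, kc, hk⟩ := exists_cont_inv (isCompact_closedBall (0:ℂ) 1) c i
  have hs : ∀ p ∈ x.J, ∃ z ∈ sphere (0:ℂ) 1, ψ z = x.f p := by
    intro p hp
    have : x.f p ∈ ψ '' sphere 0 1 := by rw [e2]; exact ⟨p, hp, rfl⟩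
    exact this
  have hψ : ∀ p ∈ x.J, ψ (k (x.f p)) = x.f p := by
    intro p hp
    obtain ⟨z, hz, e⟩ := hs p hp
    rw [← e, hk z (sphere_subset_closedBall hz)]
  have hcp : CPiece 𝒟 ⟨x.D, x.J, closedBall 0 1, k ∘ x.f⟩ := by
    refine ⟨h.mem, body_ball, ?_, ?_, ?_⟩
    · simp only
      rw [frontier_closedBall _ one_ne_zero, image_comp, ← e2, image_image]
      ext z
      constructor
      · rintro ⟨w, hw, rfl⟩
        simp only
        rw [hk w (sphere_subset_closedBall hw)]; exact hw
      · intro hz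
        exact ⟨z, hz, hk z (sphere_subset_closedBall hz)⟩
    · refine kc.comp h.cont ?_
      intro p hp
      obtain ⟨z, hz, e⟩ := hs p hp
      rw [← e]; exact ⟨z, sphere_subset_closedBall hz, rfl⟩
    · intro p hp q hq e
      have := congrArg ψ e
      simp only [Function.comp] at this
      rw [hψ p hp, hψ q hq] at this
      exact h.inj hp hq this
  refine ⟨k ∘ x.f, ψ, hcp, c, ?_⟩
  intro ι y hy
  have h1 := (hy.map hcp.valid.disc.subset ψ c i).congr (f := x.f) (fun p hp => hψ p hp)
  simp only at h1
  rw [e1] at h1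
  exact h1

/-- recursive cuttability into small pieces -/
inductive Cuttable (𝒟 : Set α → Set α → Prop) (ε : ℝ) : Set α → Set α → Prop
  | leaf (D J : Set α) : (∀ p ∈ D, ∀ q ∈ D, dist p q ≤ ε) → Cuttable 𝒟 ε D J
  | node (D J γ : Set α) (a b : α) (D1 J1 D2 J2 : Set α) : IsCut D J γ a b D1 J1 D2 J2 → 𝒟 D1 J1 →
      𝒟 D2 J2 → Cuttable 𝒟 ε D1 J1 → Cuttable 𝒟 ε D2 J2 → Cuttable 𝒟 ε D J

theorem chord_ball {u v : ℂ} (h : u ≠ v) (hu : u ∈ sphere (0:ℂ) 1) (hv : v ∈ sphere (0:ℂ) 1) :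
    Chord (closedBall 0 1) u v := by
  refine ⟨h, by rwa [frontier_closedBall _ one_ne_zero], by rwa [frontier_closedBall _ one_ne_zero],
    ?_⟩
  have hw : midpoint ℝ u v ∈ openSegment ℝ u v := by
    rw [midpoint_eq_smul_add, smul_add]
    exact ⟨⅟2, ⅟2, by norm_num, by norm_num, by norm_num, rfl⟩
  exact ⟨_, hw, (strictConvex_closedBall ℝ (0:ℂ) 1).openSegment_subset (sphere_subset_closedBall hu)
    (sphere_subset_closedBall hv) h hw⟩

theorem real_mesh {𝒟 : Set α → Set α → Prop} (hG : GoodFam 𝒟) {ε : ℝ} {D J : Set α}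
    (hcut : Cuttable 𝒟 ε D J) : ∀ x : Piece α β, x.D = D → x.J = J → Valid 𝒟 x →
      ∃ (ι : Type) (y : ι → Piece α β), IsRep 𝒟 x y ∧
        ∀ i, ∀ p ∈ (y i).D, ∀ q ∈ (y i).D, dist p q ≤ ε := by
  induction hcut with
  | leaf D J h =>
    rintro x rfl rfl hx
    exact ⟨Unit, fun _ => x, IsRep.self (hG _ _ hx.mem).2.2 hx, fun _ => h⟩
  | node D J γ a b D1 J1 D2 J2 hc h1 h2 _ _ ih1 ih2 =>
    rintro x rfl rfl hx
    obtain ⟨g, ψ, hcp, -, hmap⟩ := hx.round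
    have aJ : a ∈ x.J := by have : a ∈ γ ∩ x.J := by rw [hc.arcJ]; simp
                            exact this.2
    have bJ : b ∈ x.J := by have : b ∈ γ ∩ x.J := by rw [hc.arcJ]; simp
                            exact this.2
    have hfr : ∀ p ∈ x.J, g p ∈ sphere (0:ℂ) 1 := by
      intro p hp
      have := hcp.bd
      simp only [frontier_closedBall (0:ℂ) one_ne_zero] at this
      rw [← this]; exact ⟨p, hp, rfl⟩
    obtain ⟨y, hy, -, -, -, hy2⟩ := cut_rep hG hcp (γ := γ) (a := a) (b := b) hc h1 h2
      (chord_ball (fun e => hc.ne (hcp.inj aJ bJ e)) (hfr a aJ) (hfr b bJ))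
    have hy' := hmap hy
    have : ∀ i, ∃ (κ : Type) (z : κ → Piece α β),
        IsRep 𝒟 ⟨(y i).D, (y i).J, ψ '' (y i).P, ψ ∘ (y i).f⟩ z ∧
        ∀ k, ∀ p ∈ (z k).D, ∀ q ∈ (z k).D, dist p q ≤ ε := by
      intro i
      rcases hy2 i with ⟨e1, e2⟩ | ⟨e1, e2⟩
      · exact ih1 _ e1 e2 (hy'.valid i)
      · exact ih2 _ e1 e2 (hy'.valid i)
    choose κ z hz1 hz2 using this
    exact ⟨_, _, hy'.comp hz1, fun s => hz2 s.1 s.2⟩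

/-- cuts with prescribed approximate ends -/
def HasCuts (𝒟 : Set α → Set α → Prop) : Prop :=
  ∀ D J, 𝒟 D J → ∀ a ∈ J, ∀ b ∈ J, a ≠ b → ∀ r > 0, ∃ γ a' b' D1 J1 D2 J2,
    IsCut D J γ a' b' D1 J1 D2 J2 ∧ dist a' a < r ∧ dist b' b < r ∧ 𝒟 D1 J1 ∧ 𝒟 D2 J2

theorem exists_exit {P : Set ℂ} (hP : Body P) {o d : ℂ} (ho : o ∈ interior P) (hd : d ≠ 0) :
    ∃ t : ℝ, 0 < t ∧ o + t • d ∈ frontier P := by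
  have hc : Continuous (fun t : ℝ => o + t • d) := by fun_prop
  have hev : ∀ᶠ t : ℝ in 𝓝 0, o + t • d ∈ interior P := by
    apply hc.continuousAt.eventually_mem
    simpa using isOpen_interior.mem_nhds ho
  set K := {t : ℝ | o + t • d ∈ P} with hK
  have hKc : IsClosed K := hP.comp.isClosed.preimage hc
  obtain ⟨R, hR⟩ := hP.comp.isBounded.subset_closedBall o
  have hb : ∀ t ∈ K, |t| * ‖d‖ ≤ R := by
    intro t ht
    have := hR ht
    simpa [dist_eq_norm, norm_smul] using this
  have hdp : 0 < ‖d‖ := norm_pos_iff.2 hd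
  have hbd : K ⊆ Icc (-(R / ‖d‖)) (R / ‖d‖) := by
    intro t ht
    have := hb t ht
    rw [mem_Icc, ← abs_le, le_div_iff₀ hdp]; exact this
  have hcomp : IsCompact K := isCompact_Icc.of_isClosed_subset hKc hbd
  have h0 : (0:ℝ) ∈ K := by simpa [hK] using interior_subset ho
  obtain ⟨t, ht, hmax⟩ := hcomp.exists_isMaxOn ⟨0, h0⟩ continuousOn_id
  obtain ⟨δ, hδ, hball⟩ := Metric.eventually_nhds_iff.1 hev
  refine ⟨t, ?_, ?_⟩
  · have h1 : δ / 2 ∈ K := (interior_subset : interior P ⊆ P) (hball (y := δ / 2) (by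
      rw [dist_eq_norm, Real.norm_eq_abs, sub_zero, abs_of_pos (half_pos hδ)]; exact half_lt_self hδ))
    have := hmax h1
    simp at this; linarith
  · rw [hP.comp.isClosed.frontier_eq]
    refine ⟨ht, fun hti => ?_⟩
    have hev2 : ∀ᶠ s : ℝ in 𝓝 t, o + s • d ∈ interior P :=
      hc.continuousAt.eventually_mem (isOpen_interior.mem_nhds hti)
    obtain ⟨δ, hδ, hball⟩ := Metric.eventually_nhds_iff.1 hev2
    have h1 : t + δ / 2 ∈ K := (interior_subset : interior P ⊆ P) (hball (y := t + δ / 2) (by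
      rw [dist_eq_norm, Real.norm_eq_abs, add_sub_cancel_left, abs_of_pos (half_pos hδ)]; exact half_lt_self hδ))
    have := hmax h1
    simp at this; linarith

theorem width_step {𝒟 : Set α → Set α → Prop} (hG : GoodFam 𝒟) (hC : HasCuts 𝒟) {d : ℂ} (hd : d ≠ 0)
    {x : Piece α ℂ} (hx : CPiece 𝒟 x) {lo w : ℝ} (hw : 0 < w)
    (hlo : ∀ p ∈ x.P, lo ≤ side 0 d p ∧ side 0 d p ≤ lo + w) :
    ∃ (ι : Type) (y : ι → Piece α ℂ), IsRep 𝒟 x y ∧ (∀ i, CPiece 𝒟 (y i)) ∧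
      ∀ i, ∃ lo', ∀ p ∈ (y i).P, lo' ≤ side 0 d p ∧ side 0 d p ≤ lo' + 3 / 4 * w := by
  set c := lo + w / 2 with hcdef
  by_cases ho : ∃ o ∈ interior x.P, side 0 d o = c
  · obtain ⟨o, ho, hoc⟩ := ho
    obtain ⟨t, ht, hv⟩ := exists_exit hx.body ho hd
    obtain ⟨s, hs, hu⟩ := exists_exit hx.body ho (neg_ne_zero.2 hd)
    set v := o + t • d with hvd
    set u := o + s • (-d) with hud
    have hL : 0 < t + s := by linarith
    have hside : ∀ p, side u v p = (t + s) * (side 0 d p - c) := by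
      intro p; rw [← hoc, hvd, hud]; simp [side]; ring
    set τ := (t + s) * (w / 4) with hτ
    have hτp : 0 < τ := by positivity
    set θ := s / (t + s) with hθ
    have hθ0 : 0 < θ := by positivity
    have hθ1 : θ < 1 := by rw [hθ, div_lt_one hL]; linarith
    have hol : AffineMap.lineMap u v θ = o := by
      rw [AffineMap.lineMap_apply_module, hvd, hud, hθ]
      have h1 : (1 - s / (t + s)) • (o + s • -d) + (s / (t + s)) • (o + t • d) =
          o + ((s / (t + s)) * t - (1 - s / (t + s)) * s) • d := by module
      have h2 : (s / (t + s)) * t - (1 - s / (t + s)) * s = 0 := by field_simp; ring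
      rw [h1, h2]; simp
    have huv : u ≠ v := by
      intro e
      have h1 : v - u = (t + s) • d := by rw [hvd, hud, add_smul]; simp
      rw [e, sub_self] at h1
      rcases smul_eq_zero.1 h1.symm with h | h
      · linarith
      · exact hd h
    have E1 : ∀ᶠ z : ℂ × ℂ in 𝓝 (u, v), z.1 ≠ z.2 :=
      (isOpen_ne_fun continuous_fst continuous_snd).mem_nhds huv
    have E2 : ∀ᶠ z : ℂ × ℂ in 𝓝 (u, v), AffineMap.lineMap z.1 z.2 θ ∈ interior x.P := by
      have hcc : Continuous (fun z : ℂ × ℂ => AffineMap.lineMap z.1 z.2 θ) := by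
        simp only [AffineMap.lineMap_apply_module]; fun_prop
      apply hcc.continuousAt.eventually_mem
      simp only [hol]
      exact isOpen_interior.mem_nhds ho
    have E3 : ∀ᶠ z : ℂ × ℂ in 𝓝 (u, v), ∀ p ∈ x.P, |side z.1 z.2 p - side u v p| < τ := by
      apply hx.body.comp.eventually_forall_of_forall_eventually
      intro p hp
      have hcc : Continuous (fun q : (ℂ × ℂ) × ℂ => |side q.1.1 q.1.2 q.2 - side u v q.2|) := by
        unfold side; fun_prop
      apply hcc.continuousAt.eventually_lt continuousAt_const
      simpa using hτp
    obtain ⟨r, hr, hball⟩ := Metric.eventually_nhds_iff.1 (E1.and (E2.and E3))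
    rw [← hx.bd] at hu hv
    obtain ⟨a0, ha0, ea⟩ := hu
    obtain ⟨b0, hb0, eb⟩ := hv
    obtain ⟨r1, hr1, h1⟩ := Metric.continuousOn_iff.1 hx.cont a0 ha0 r hr
    obtain ⟨r2, hr2, h2⟩ := Metric.continuousOn_iff.1 hx.cont b0 hb0 r hr
    have hab : a0 ≠ b0 := by rintro rfl; exact huv (ea.symm.trans eb)
    obtain ⟨γ, a, b, D1, J1, D2, J2, hc, hda, hdb, hD1, hD2⟩ :=
      hC _ _ hx.mem a0 ha0 b0 hb0 hab (min r1 r2) (lt_min hr1 hr2)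
    have aJ : a ∈ x.J := by have : a ∈ γ ∩ x.J := by rw [hc.arcJ]; simp
                            exact this.2
    have bJ : b ∈ x.J := by have : b ∈ γ ∩ x.J := by rw [hc.arcJ]; simp
                            exact this.2
    have da := h1 a aJ (hda.trans_le (min_le_left _ _))
    have db := h2 b bJ (hdb.trans_le (min_le_right _ _))
    rw [ea] at da
    rw [eb] at db
    obtain ⟨g1, g2, g3⟩ := hball (y := (x.f a, x.f b)) (by
      rw [Prod.dist_eq]; exact max_lt da db)
    simp only at g1 g2 g3
    have hch : Chord x.P (x.f a) (x.f b) := by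
      refine ⟨g1, by rw [← hx.bd]; exact ⟨a, aJ, rfl⟩, by rw [← hx.bd]; exact ⟨b, bJ, rfl⟩, _, ?_, g2⟩
      rw [openSegment_eq_image_lineMap]
      exact ⟨θ, ⟨hθ0, hθ1⟩, rfl⟩
    obtain ⟨y, hy, hy1, e1, e2, -⟩ := cut_rep hG hx hc hD1 hD2 hch
    refine ⟨Bool, y, hy, hy1, ?_⟩
    rintro (_ | _)
    · rw [e2]
      refine ⟨lo, ?_⟩
      rintro p ⟨hp, hp2⟩
      refine ⟨(hlo p hp).1, ?_⟩
      simp only [mem_ofPred_eq] at hp2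
      rw [side_swap] at hp2
      have := (abs_lt.1 (g3 p hp))
      rw [hside] at this
      have h5 : (t + s) * (side 0 d p - c) < (t + s) * (w / 4) := by linarith [this.1]
      have := lt_of_mul_lt_mul_left h5 hL.le
      linarith
    · rw [e1]
      refine ⟨lo + w / 4, ?_⟩
      rintro p ⟨hp, hp2⟩
      simp only [mem_ofPred_eq] at hp2
      have := (abs_lt.1 (g3 p hp))
      rw [hside] at this
      have h5 : (t + s) * (-(w / 4)) < (t + s) * (side 0 d p - c) := by linarith [this.2]
      have := lt_of_mul_lt_mul_left h5 hL.le
      refine ⟨by linarith, by linarith [(hlo p hp).2]⟩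
  · refine ⟨Unit, fun _ => x, IsRep.self (hG _ _ hx.mem).2.2 hx.valid, fun _ => hx, fun _ => ?_⟩
    have hcl : x.P ⊆ closure (interior x.P) := by
      rw [hx.body.conv.closure_interior_eq_closure_of_nonempty_interior hx.body.int]
      exact subset_closure
    have hor : (∀ p ∈ interior x.P, side 0 d p ≤ c) ∨ (∀ p ∈ interior x.P, c ≤ side 0 d p) := by
      by_contra hcon
      push Not at hcon
      obtain ⟨⟨p, hp, hp1⟩, q, hq, hq1⟩ := hcon
      have hpre : IsPreconnected (interior x.P) := hx.body.conv.interior.isPreconnected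
      have := (hpre.image _ (side_cont 0 d).continuousOn).ordConnected.out ⟨q, hq, rfl⟩ ⟨p, hp, rfl⟩
        (show c ∈ Icc _ _ from ⟨hq1.le, hp1.le⟩)
      exact ho this
    rcases hor with h | h
    · refine ⟨lo, fun p hp => ⟨(hlo p hp).1, ?_⟩⟩
      have : x.P ⊆ {p | side 0 d p ≤ c} :=
        hcl.trans (closure_minimal h (isClosed_le (side_cont 0 d) continuous_const))
      have := this hp
      simp only [mem_ofPred_eq] at this
      linarith
    · refine ⟨c, fun p hp => ⟨?_, by linarith [(hlo p hp).2]⟩⟩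
      have : x.P ⊆ {p | c ≤ side 0 d p} :=
        hcl.trans (closure_minimal h (isClosed_le continuous_const (side_cont 0 d)))
      exact this hp

theorem width_mesh {𝒟 : Set α → Set α → Prop} (hG : GoodFam 𝒟) (hC : HasCuts 𝒟) {d : ℂ} (hd : d ≠ 0)
    {δ : ℝ} (hδ : 0 < δ) (n : ℕ) :
    ∀ (x : Piece α ℂ), CPiece 𝒟 x → ∀ lo w : ℝ,  w ≤ (4 / 3) ^ n * δ →
    (∀ p ∈ x.P, lo ≤ side 0 d p ∧ side 0 d p ≤ lo + w) →
    ∃ (ι : Type) (y : ι → Piece α ℂ), IsRep 𝒟 x y ∧ (∀ i, CPiece 𝒟 (y i)) ∧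
      ∀ i, ∃ lo', ∀ p ∈ (y i).P, lo' ≤ side 0 d p ∧ side 0 d p ≤ lo' + δ := by
  induction n with
  | zero =>
    intro x hx lo w hw h
    refine ⟨Unit, fun _ => x, IsRep.self (hG _ _ hx.mem).2.2 hx.valid, fun _ => hx, fun _ => ⟨lo, ?_⟩⟩
    intro p hp
    have := h p hp
    simp at hw
    exact ⟨this.1, by linarith⟩
  | succ n ih =>
    intro x hx lo w hw h
    obtain ⟨ι, y, hy, hy1, hy2⟩ := width_step hG hC hd hx (lo := lo) (w := (4 / 3) ^ (n+1) * δ)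
      (by positivity) (fun p hp => ⟨(h p hp).1, by linarith [(h p hp).2]⟩)
    have : ∀ i, ∃ (κ : Type) (z : κ → Piece α ℂ), IsRep 𝒟 (y i) z ∧ (∀ i, CPiece 𝒟 (z i)) ∧
      ∀ i, ∃ lo', ∀ p ∈ (z i).P, lo' ≤ side 0 d p ∧ side 0 d p ≤ lo' + δ := by
      intro i
      obtain ⟨lo', hlo'⟩ := hy2 i
      refine ih (y i) (hy1 i) lo' _ (le_of_eq ?_) hlo'
      rw [pow_succ]; ring
    choose κ z hz1 hz2 hz3 using this
    exact ⟨_, _, hy.comp hz1, fun s => hz2 s.1 s.2, fun s => hz3 s.1 s.2⟩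

theorem width_mesh' {𝒟 : Set α → Set α → Prop} (hG : GoodFam 𝒟) (hC : HasCuts 𝒟) {d : ℂ} (hd : d ≠ 0)
    {δ : ℝ} (hδ : 0 < δ) (x : Piece α ℂ) (hx : CPiece 𝒟 x) :
    ∃ (ι : Type) (y : ι → Piece α ℂ), IsRep 𝒟 x y ∧ (∀ i, CPiece 𝒟 (y i)) ∧
      ∀ i, ∃ lo', ∀ p ∈ (y i).P, lo' ≤ side 0 d p ∧ side 0 d p ≤ lo' + δ := by
  obtain ⟨m, hm⟩ := (hx.body.comp.image (side_cont 0 d)).bddBelow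
  obtain ⟨M, hM⟩ := (hx.body.comp.image (side_cont 0 d)).bddAbove
  obtain ⟨n, hn⟩ := pow_unbounded_of_one_lt ((M - m) / δ) (show (1:ℝ) < 4 / 3 by norm_num)
  rw [div_lt_iff₀ hδ] at hn
  refine width_mesh hG hC hd hδ n x hx m (M - m) hn.le ?_
  intro p hp
  have h1 : m ≤ side 0 d p := hm ⟨p, hp, rfl⟩
  have h2 : side 0 d p ≤ M := hM ⟨p, hp, rfl⟩
  exact ⟨h1, by linarith⟩

theorem model_mesh {𝒟 : Set α → Set α → Prop} (hG : GoodFam 𝒟) (hC : HasCuts 𝒟)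
    {δ : ℝ} (hδ : 0 < δ) (x : Piece α ℂ) (hx : CPiece 𝒟 x) :
    ∃ (ι : Type) (y : ι → Piece α ℂ), IsRep 𝒟 x y ∧
      ∀ i, ∀ p ∈ (y i).P, ∀ q ∈ (y i).P, dist p q ≤ δ := by
  obtain ⟨ι, y, hy, hy1, hy2⟩ := width_mesh' hG hC one_ne_zero (half_pos hδ) x hx
  have := fun i => width_mesh' hG hC Complex.I_ne_zero (half_pos hδ) (y i) (hy1 i)
  choose κ z hz1 hz2 hz3 using this
  refine ⟨_, _, hy.comp hz1, ?_⟩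
  rintro ⟨i, k⟩ p hp q hq
  obtain ⟨lo, h⟩ := hy2 i
  obtain ⟨lo', h'⟩ := hz3 i k
  have a1 := h p ((hz1 i).subP k hp)
  have a2 := h q ((hz1 i).subP k hq)
  have b1 := h' p hp
  have b2 := h' q hq
  simp [side] at a1 a2 b1 b2
  rw [dist_eq_norm]
  refine (Complex.norm_le_abs_re_add_abs_im _).trans ?_
  simp only [Complex.sub_re, Complex.sub_im]
  have c1 : |p.re - q.re| ≤ δ / 2 := abs_le.2 ⟨by linarith, by linarith⟩
  have c2 : |p.im - q.im| ≤ δ / 2 := abs_le.2 ⟨by linarith, by linarith⟩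
  linarith

theorem mesh {𝒟 : Set α → Set α → Prop} (hG : GoodFam 𝒟) (hC : HasCuts 𝒟)
    (hK : ∀ D J, 𝒟 D J → ∀ ε > 0, Cuttable 𝒟 ε D J)
    {ε : ℝ} (hε : 0 < ε) (x : Piece α β) (hx : Valid 𝒟 x) :
    ∃ (ι : Type) (y : ι → Piece α β), IsRep 𝒟 x y ∧
      (∀ i, ∀ p ∈ (y i).P, ∀ q ∈ (y i).P, dist p q ≤ ε) ∧
      (∀ i, ∀ p ∈ (y i).D, ∀ q ∈ (y i).D, dist p q ≤ ε) := by
  obtain ⟨g, ψ, hcp, hψ, hmap⟩ := hx.round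
  obtain ⟨δ, hδ, hu⟩ := Metric.uniformContinuousOn_iff.1
    ((isCompact_closedBall (0:ℂ) 1).uniformContinuousOn_of_continuous hψ) ε hε
  obtain ⟨ι, y, hy, hy1⟩ := model_mesh hG hC (half_pos hδ) _ hcp
  have hy' := hmap hy
  have := fun i => real_mesh hG (hK _ _ (hy'.valid i).mem ε hε) _ rfl rfl (hy'.valid i)
  choose κ z hz1 hz2 using this
  refine ⟨_, _, hy'.comp hz1, ?_, fun s => hz2 s.1 s.2⟩
  rintro ⟨i, k⟩ p hp q hq
  obtain ⟨p, hp', rfl⟩ := (hz1 i).subP k hp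
  obtain ⟨q, hq', rfl⟩ := (hz1 i).subP k hq
  exact (hu p (hy.subP i hp') q (hy.subP i hq') ((hy1 i p hp' q hq').trans_lt (by linarith))).le

end ABCT
end

section
open Set Metric Filter Topology

namespace ABCT

variable {α β : Type*} [MetricSpace α] [MetricSpace β]

def relOf {ι : Type} (y : ι → Piece α β) : Set (α × β) := ⋃ i, (y i).D ×ˢ (y i).P

theorem mem_relOf {ι : Type} {y : ι → Piece α β} {p : α} {q : β} :
    (p, q) ∈ relOf y ↔ ∃ i, p ∈ (y i).D ∧ q ∈ (y i).P := by simp [relOf]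

theorem homeo_of_rep {𝒟 : Set α → Set α → Prop} (hG : GoodFam 𝒟) (hC : HasCuts 𝒟)
    (hK : ∀ D J, 𝒟 D J → ∀ ε > 0, Cuttable 𝒟 ε D J) (x : Piece α β)
    (hX : IsCompact x.D) (hY : IsCompact x.P) {ι : Type} {y : ι → Piece α β} (hy : IsRep 𝒟 x y) :
    Nonempty (x.D ≃ₜ x.P) := by
  let St := {s : Σ κ : Type, (κ → Piece α β) // IsRep 𝒟 x s.2}
  have step : ∀ (s : St) (k : ℕ), ∃ s' : St, relOf s'.1.2 ⊆ relOf s.1.2 ∧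
      (∀ i, ∀ p ∈ (s'.1.2 i).P, ∀ q ∈ (s'.1.2 i).P, dist p q ≤ 1 / ((k:ℝ) + 1)) ∧
      (∀ i, ∀ p ∈ (s'.1.2 i).D, ∀ q ∈ (s'.1.2 i).D, dist p q ≤ 1 / ((k:ℝ) + 1)) := by
    rintro ⟨⟨κ, z⟩, hz⟩ k
    have := fun i => mesh hG hC hK (show (0:ℝ) < 1 / ((k:ℝ) + 1) by positivity) (z i) (hz.valid i)
    choose μ t h1 h2 h3 using this
    refine ⟨⟨⟨_, _⟩, hz.comp h1⟩, ?_, fun s => h2 s.1 s.2, fun s => h3 s.1 s.2⟩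
    rintro ⟨p, q⟩ hpq
    rw [mem_relOf] at hpq ⊢
    obtain ⟨⟨i, j⟩, hp, hq⟩ := hpq
    exact ⟨i, (h1 i).subD j hp, (h1 i).subP j hq⟩
  choose nxt n1 n2 n3 using step
  let seq : ℕ → St := fun n => Nat.rec ⟨⟨ι, y⟩, hy⟩ (fun k s => nxt s k) n
  have hseq : ∀ k, seq (k+1) = nxt (seq k) k := fun k => rfl
  have tend : ∀ ε > (0:ℝ), ∃ k : ℕ, 2 * (1 / ((k:ℝ) + 1)) ≤ ε := by
    intro ε hε
    obtain ⟨k, hk⟩ := exists_nat_one_div_lt (half_pos hε)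
    exact ⟨k, by linarith⟩
  refine homeo_of_relations hX hY (fun k => relOf (seq k).1.2) ?_ ?_ ?_ ?_ ?_ ?_ ?_
  · intro k
    have := (seq k).2.fin
    apply isClosed_iUnion_of_finite
    intro i
    exact (hG _ _ ((seq k).2.valid i).mem).1.isClosed.prod ((seq k).2.valid i).disc.isCompact.isClosed
  · intro k
    exact n1 _ _
  · rintro k ⟨p, q⟩ h
    obtain ⟨i, h1, h2⟩ := mem_relOf.1 h
    exact ⟨(seq k).2.subD i h1, (seq k).2.subP i h2⟩
  · intro k p hp
    rw [← (seq k).2.unionD, mem_iUnion] at hp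
    obtain ⟨i, hi⟩ := hp
    obtain ⟨q, hq⟩ := ((seq k).2.valid i).disc.nonempty
    exact ⟨q, mem_relOf.2 ⟨i, hi, ((seq k).2.valid i).disc.subset hq⟩⟩
  · intro k q hq
    rw [← (seq k).2.unionP, mem_iUnion] at hq
    obtain ⟨i, hi⟩ := hq
    obtain ⟨_, p, hp, -⟩ := ((seq k).2.valid i).disc.nonempty
    exact ⟨p, mem_relOf.2 ⟨i, (hG _ _ ((seq k).2.valid i).mem).2.2 hp, hi⟩⟩
  · intro ε hε
    obtain ⟨k, hk⟩ := tend ε hε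
    refine ⟨k+1, ?_⟩
    intro p q q' h h'
    have hr := (seq (k+1)).2
    obtain ⟨i, hp, hq⟩ := mem_relOf.1 h
    obtain ⟨j, hp', hq'⟩ := mem_relOf.1 h'
    have pos : (0:ℝ) < 1 / ((k:ℝ) + 1) := by positivity
    by_cases hij : i = j
    · subst hij
      exact (n2 _ k i q hq q' hq').trans (by linarith)
    · have hJ := hr.interD i j hij ⟨hp, hp'⟩
      have e := hr.interf i j hij p ⟨hp, hp'⟩
      have a1 := n2 _ k i q hq _ ((hr.valid i).disc.subset ⟨p, hJ.1, rfl⟩)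
      have a2 := n2 _ k j _ ((hr.valid j).disc.subset ⟨p, hJ.2, rfl⟩) q' hq'
      refine (dist_triangle _ _ _).trans (le_trans (add_le_add a1 (?_ : _ ≤ 1 / ((k:ℝ) + 1))) (by linarith))
      have e' : ((nxt (seq k) k).1.2 i).f p = ((nxt (seq k) k).1.2 j).f p := e
      rw [e']; exact a2
  · intro ε hε
    obtain ⟨k, hk⟩ := tend ε hε
    refine ⟨k+1, ?_⟩
    intro p p' q h h'
    have hr := (seq (k+1)).2
    obtain ⟨i, hp, hq⟩ := mem_relOf.1 h
    obtain ⟨j, hp', hq'⟩ := mem_relOf.1 h'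
    have pos : (0:ℝ) < 1 / ((k:ℝ) + 1) := by positivity
    by_cases hij : i = j
    · subst hij
      exact (n3 _ k i p hp p' hp').trans (by linarith)
    · obtain ⟨r, ⟨h1, h2⟩, -⟩ := hr.interP i j hij ⟨hq, hq'⟩
      have a1 := n3 _ k i p hp r h1
      have a2 := n3 _ k j r h2 p' hp'
      exact (dist_triangle _ _ _).trans (by linarith)

noncomputable def hemi (s : ℝ) (z : ℂ) : EuclideanSpace ℝ (Fin 3) :=
  !₂[z.re, z.im, s * √(1 - (z.re^2 + z.im^2))]

theorem hemi_cont (s : ℝ) : Continuous (hemi s) := by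
  unfold hemi
  apply (PiLp.continuous_toLp 2 _).comp
  apply continuous_pi
  intro i
  fin_cases i <;> simp <;> fun_prop

theorem hemi_inj (s : ℝ) : Function.Injective (hemi s) := by
  intro z w h
  have h0 := congrArg (fun v : EuclideanSpace ℝ (Fin 3) => v 0) h
  have h1 := congrArg (fun v : EuclideanSpace ℝ (Fin 3) => v 1) h
  simp [hemi] at h0 h1
  exact Complex.ext h0 h1

theorem mem_cball {z : ℂ} : z ∈ closedBall (0:ℂ) 1 ↔ z.re^2 + z.im^2 ≤ 1 := by
  rw [mem_closedBall_zero_iff, ← sq_le_one_iff₀ (norm_nonneg _), ← Complex.normSq_eq_norm_sq,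
    Complex.normSq_apply]
  constructor <;> intro h <;> nlinarith

theorem mem_csphere {z : ℂ} : z ∈ sphere (0:ℂ) 1 ↔ z.re^2 + z.im^2 = 1 := by
  rw [mem_sphere_zero_iff_norm, ← pow_eq_one_iff_of_nonneg (norm_nonneg _) two_ne_zero, ← Complex.normSq_eq_norm_sq,
    Complex.normSq_apply]
  constructor <;> intro h <;> nlinarith

theorem mem_S2 {v : EuclideanSpace ℝ (Fin 3)} :
    v ∈ sphere (0:EuclideanSpace ℝ (Fin 3)) 1 ↔ v 0 ^ 2 + v 1 ^ 2 + v 2 ^ 2 = 1 := by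
  rw [mem_sphere_zero_iff_norm, EuclideanSpace.norm_eq, Real.sqrt_eq_one, Fin.sum_univ_three]
  simp

theorem hemi_mem {s : ℝ} (hs : s ^ 2 = 1) {z : ℂ} (hz : z ∈ closedBall (0:ℂ) 1) :
    hemi s z ∈ sphere (0:EuclideanSpace ℝ (Fin 3)) 1 := by
  rw [mem_S2]
  rw [mem_cball] at hz
  simp [hemi, mul_pow, hs]
  rw [Real.sq_sqrt (by linarith)]; ring

theorem sphere_of_family {𝒟 : Set α → Set α → Prop} (hG : GoodFam 𝒟) (hC : HasCuts 𝒟)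
    (hK : ∀ D J, 𝒟 D J → ∀ ε > 0, Cuttable 𝒟 ε D J) {D1 D2 J : Set α} (h12 : D1 ∩ D2 = J)
    (h1 : 𝒟 D1 J) (h2 : 𝒟 D2 J) (f : α → ℂ) (fc : ContinuousOn f J) (fi : InjOn f J)
    (fim : f '' J = sphere 0 1) :
    Nonempty ((D1 ∪ D2 : Set α) ≃ₜ sphere (0 : EuclideanSpace ℝ (Fin 3)) 1) := by
  have hcl : ∀ s : ℝ, hemi s '' sphere 0 1 = (fun p => hemi s (f p)) '' J := by
    intro s; rw [← fim, image_image]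
  have val : ∀ (s : ℝ) (D : Set α), 𝒟 D J → Valid 𝒟 (⟨D, J, hemi s '' closedBall 0 1, fun p => hemi s (f p)⟩ :
      Piece α (EuclideanSpace ℝ (Fin 3))) := by
    intro s D hD
    refine ⟨hD, ⟨hemi s, (hemi_cont s).continuousOn, (hemi_inj s).injOn, rfl, hcl s⟩,
      (hemi_cont s).comp_continuousOn fc, ?_⟩
    intro p hp q hq e
    exact fi hp hq (hemi_inj s e)
  have eqv : ∀ s t : ℝ, ∀ p ∈ J, hemi s (f p) = hemi t (f p) := by
    intro s t p hp
    have : f p ∈ sphere (0:ℂ) 1 := by rw [← fim]; exact ⟨p, hp, rfl⟩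
    rw [mem_csphere] at this
    unfold hemi
    rw [this]; simp
  have inP : ∀ s t : ℝ, s * t = -1 → hemi s '' closedBall 0 1 ∩ hemi t '' closedBall 0 1 ⊆
      (fun p => hemi s (f p)) '' J := by
    rintro s t hst _ ⟨⟨z, hz, rfl⟩, w, hw, e⟩
    have h0 := congrArg (fun v : EuclideanSpace ℝ (Fin 3) => v 0) e
    have h1 := congrArg (fun v : EuclideanSpace ℝ (Fin 3) => v 1) e
    have h2 := congrArg (fun v : EuclideanSpace ℝ (Fin 3) => v 2) e
    simp [hemi] at h0 h1 h2
    have : w = z := Complex.ext h0 h1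
    subst this
    rw [← hcl]
    refine ⟨w, ?_, rfl⟩
    rw [mem_csphere]
    have h3 : (t - s) * √(1 - (w.re ^ 2 + w.im ^ 2)) = 0 := by linarith
    rcases mul_eq_zero.1 h3 with h2 | h2
    · have : t = s := by linarith
      rw [this] at hst; nlinarith
    · rw [Real.sqrt_eq_zero'] at h2
      rw [mem_cball] at hz
      linarith
  refine homeo_of_rep hG hC hK (⟨D1 ∪ D2, ∅, sphere 0 1, fun _ => 0⟩ : Piece α (EuclideanSpace ℝ (Fin 3)))
    ((hG _ _ h1).1.union (hG _ _ h2).1) (isCompact_sphere _ _)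
    (y := fun i : Bool => if i then ⟨D1, J, hemi 1 '' closedBall 0 1, fun p => hemi 1 (f p)⟩ else
      ⟨D2, J, hemi (-1) '' closedBall 0 1, fun p => hemi (-1) (f p)⟩) ?_
  constructor
  · infer_instance
  · rw [ABCT.iUnion_bool]; simp [union_comm]
  · rw [ABCT.iUnion_bool]
    simp only [if_true, Bool.false_eq_true, if_false]
    apply Subset.antisymm
    · rintro _ (⟨z, hz, rfl⟩ | ⟨z, hz, rfl⟩)
      · exact hemi_mem (by norm_num) hz
      · exact hemi_mem (by norm_num) hz
    · intro v hv
      rw [mem_S2] at hv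
      have hb : (⟨v 0, v 1⟩ : ℂ) ∈ closedBall (0:ℂ) 1 := by
        rw [mem_cball]; simp only; nlinarith [sq_nonneg (v 2)]
      have hs : 1 - ((v 0)^2 + (v 1)^2) = (v 2)^2 := by linarith
      rcases le_total 0 (v 2) with h | h
      · right
        refine ⟨⟨v 0, v 1⟩, hb, ?_⟩
        ext i
        fin_cases i <;> simp [hemi, hs, Real.sqrt_sq h]
      · left
        refine ⟨⟨v 0, v 1⟩, hb, ?_⟩
        ext i
        fin_cases i <;> simp [hemi, hs, Real.sqrt_sq_eq_abs, abs_of_nonpos h]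
  · rintro (_ | _)
    · exact val _ _ h2
    · exact val _ _ h1
  · intro i; simp
  · intro i p hp; simp at hp
  · intro i; simp
  · rintro (_ | _) (_ | _) hij
    · exact absurd rfl hij
    · simp only [if_true, Bool.false_eq_true, if_false]; rw [inter_comm, h12, inter_self]
    · simp only [if_true, Bool.false_eq_true, if_false]; rw [h12, inter_self]
    · exact absurd rfl hij
  · rintro (_ | _) (_ | _) hij p hp
    · exact absurd rfl hij
    · simp only [if_true, Bool.false_eq_true, if_false] at hp ⊢
      rw [inter_comm, h12] at hp; exact eqv _ _ p hp
    · simp only [if_true, Bool.false_eq_true, if_false] at hp ⊢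
      rw [h12] at hp; exact eqv _ _ p hp
    · exact absurd rfl hij
  · rintro (_ | _) (_ | _) hij
    · exact absurd rfl hij
    · simp only [if_true, Bool.false_eq_true, if_false]
      rw [inter_comm D2, h12]; exact inP _ _ (by norm_num)
    · simp only [if_true, Bool.false_eq_true, if_false]
      rw [h12]; exact inP _ _ (by norm_num)
    · exact absurd rfl hij

end ABCT
end

section
open Set Metric Filter Topology

namespace ABCT

section arcs
variable {α : Type*} [MetricSpace α]

/-- one-dimensional cut trees -/
inductive ACut (𝒜 : Set α → α → α → Prop) (ε : ℝ) : Set α → α → α → Prop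
  | leaf (D : Set α) (s t : α) : (∀ p ∈ D, ∀ q ∈ D, dist p q ≤ ε) → ACut 𝒜 ε D s t
  | node (D D1 D2 : Set α) (s m t : α) : D1 ∪ D2 = D → D1 ∩ D2 = {m} → 𝒜 D1 s m → 𝒜 D2 m t →
      ACut 𝒜 ε D1 s m → ACut 𝒜 ε D2 m t → ACut 𝒜 ε D s t

def GoodArcs (𝒜 : Set α → α → α → Prop) : Prop :=
  ∀ D s t, 𝒜 D s t → IsCompact D ∧ s ∈ D ∧ t ∈ D ∧ s ≠ t

inductive Sh (𝒜 : Set α → α → α → Prop) : Set α → α → α → ℝ → ℝ → Set (α × ℝ) → Prop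
  | leaf (D : Set α) (s t : α) (lo hi : ℝ) : 𝒜 D s t → lo < hi → Sh 𝒜 D s t lo hi (D ×ˢ Icc lo hi)
  | node (D D1 D2 : Set α) (s m t : α) (lo mid hi : ℝ) (R1 R2 : Set (α × ℝ)) :
      𝒜 D s t → D1 ∪ D2 = D → D1 ∩ D2 = {m} →
      Sh 𝒜 D1 s m lo mid R1 → Sh 𝒜 D2 m t mid hi R2 → Sh 𝒜 D s t lo hi (R1 ∪ R2)

structure ShOK (D : Set α) (s t : α) (lo hi : ℝ) (R : Set (α × ℝ)) : Prop where
  lt : lo < hi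
  closed : IsClosed R
  sub : R ⊆ D ×ˢ Icc lo hi
  totX : ∀ x ∈ D, ∃ y, (x, y) ∈ R
  totY : ∀ y ∈ Icc lo hi, ∃ x, (x, y) ∈ R

structure ShG (ε : ℝ) (s t : α) (lo hi : ℝ) (R : Set (α × ℝ)) : Prop where
  s1 : ∀ y, (s, y) ∈ R → |y - lo| ≤ ε
  t1 : ∀ y, (t, y) ∈ R → |y - hi| ≤ ε
  s2 : ∀ x, (x, lo) ∈ R → dist x s ≤ ε
  t2 : ∀ x, (x, hi) ∈ R → dist x t ≤ ε
  h1 : ∀ x y y', (x, y) ∈ R → (x, y') ∈ R → |y - y'| ≤ 2 * ε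
  h2 : ∀ x x' y, (x, y) ∈ R → (x', y) ∈ R → dist x x' ≤ 2 * ε

theorem Sh.mem {𝒜 : Set α → α → α → Prop} {D s t lo hi R}
    (h : Sh 𝒜 D s t lo hi R) : 𝒜 D s t := by
  cases h <;> assumption

theorem Sh.ok {𝒜 : Set α → α → α → Prop} (hG : GoodArcs 𝒜) {D s t lo hi R}
    (h : Sh 𝒜 D s t lo hi R) : ShOK D s t lo hi R := by
  induction h with
  | leaf D s t lo hi hA hlt =>
    obtain ⟨hc, hs, -, -⟩ := hG _ _ _ hA
    exact ⟨hlt, hc.isClosed.prod isClosed_Icc, Subset.rfl, fun x hx => ⟨lo, hx, left_mem_Icc.2 hlt.le⟩,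
      fun y hy => ⟨s, hs, hy⟩⟩
  | node D D1 D2 s m t lo mid hi R1 R2 hA hu hi' h1 h2 i1 i2 =>
    refine ⟨i1.lt.trans i2.lt, i1.closed.union i2.closed, ?_, ?_, ?_⟩
    · rw [← hu]
      rintro ⟨x, y⟩ (h | h)
      · have := i1.sub h; exact ⟨Or.inl this.1, this.2.1, this.2.2.trans i2.lt.le⟩
      · have := i2.sub h; exact ⟨Or.inr this.1, i1.lt.le.trans this.2.1, this.2.2⟩
    · rw [← hu]
      rintro x (h | h)
      · obtain ⟨y, hy⟩ := i1.totX x h; exact ⟨y, Or.inl hy⟩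
      · obtain ⟨y, hy⟩ := i2.totX x h; exact ⟨y, Or.inr hy⟩
    · intro y hy
      rcases le_total y mid with h | h
      · obtain ⟨x, hx⟩ := i1.totY y ⟨hy.1, h⟩; exact ⟨x, Or.inl hx⟩
      · obtain ⟨x, hx⟩ := i2.totY y ⟨h, hy.2⟩; exact ⟨x, Or.inr hx⟩

theorem ShG.glue {𝒜 : Set α → α → α → Prop} (hG : GoodArcs 𝒜) {ε : ℝ}
    {D1 D2 : Set α} {s m t : α} {lo mid hi : ℝ}
    {R1 R2 : Set (α × ℝ)} (hD : D1 ∩ D2 = {m})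
    (h1 : Sh 𝒜 D1 s m lo mid R1) (h2 : Sh 𝒜 D2 m t mid hi R2)
    (g1 : ShG ε s m lo mid R1) (g2 : ShG ε m t mid hi R2) : ShG ε s t lo hi (R1 ∪ R2) := by
  have o1 := h1.ok hG
  have o2 := h2.ok hG
  obtain ⟨-, a1, -, a2⟩ := hG _ _ _ h1.mem
  obtain ⟨-, -, b1, b2⟩ := hG _ _ _ h2.mem
  have key : ∀ x, x ∈ D1 → x ∈ D2 → x = m := fun x p q => by
    have : x ∈ D1 ∩ D2 := ⟨p, q⟩
    rwa [hD] at this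
  have l1 := o1.lt
  have l2 := o2.lt
  have cr1 : ∀ x y y', (x, y) ∈ R1 → (x, y') ∈ R2 → |y - y'| ≤ 2 * ε := by
    intro x y y' h h'
    have := key x (o1.sub h).1 (o2.sub h').1
    subst this
    have e1 := g1.t1 y h
    have e2 := g2.s1 y' h'
    rw [abs_le] at *
    constructor <;> linarith [e1.1, e1.2, e2.1, e2.2]
  have cr2 : ∀ x x' y, (x, y) ∈ R1 → (x', y) ∈ R2 → dist x x' ≤ 2 * ε := by
    intro x x' y h h'
    have : y = mid := le_antisymm (o1.sub h).2.2 (o2.sub h').2.1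
    subst this
    have := dist_triangle_right x x' m
    linarith [g1.t2 x h, g2.s2 x' h']
  constructor
  · rintro y (h | h)
    · exact g1.s1 y h
    · exact absurd (key s a1 (o2.sub h).1) a2
  · rintro y (h | h)
    · exact absurd (key t (o1.sub h).1 b1).symm b2
    · exact g2.t1 y h
  · rintro y (h | h)
    · exact g1.s2 y h
    · have := (o2.sub h).2.1
      simp only at this; linarith
  · rintro y (h | h)
    · have := (o1.sub h).2.2
      simp only at this; linarith
    · exact g2.t2 y h
  · rintro x y y' (h | h) (h' | h')
    · exact g1.h1 x y y' h h'
    · exact cr1 x y y' h h'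
    · rw [abs_sub_comm]; exact cr1 x y' y h' h
    · exact g2.h1 x y y' h h'
  · rintro x x' y (h | h) (h' | h')
    · exact g1.h2 x x' y h h'
    · exact cr2 x x' y h h'
    · rw [dist_comm]; exact cr2 x' x y h' h
    · exact g2.h2 x x' y h h'

theorem sh_real {𝒜 : Set α → α → α → Prop} (hG : GoodArcs 𝒜) {ε : ℝ} {D s t}
    (h : ACut 𝒜 ε D s t) : ∀ lo hi : ℝ, 𝒜 D s t → lo < hi → hi - lo ≤ ε →
    ∃ R, Sh 𝒜 D s t lo hi R ∧ R ⊆ D ×ˢ Icc lo hi ∧ ShG ε s t lo hi R := by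
  induction h with
  | leaf D s t hd =>
    intro lo hi hA hlt hε
    have hL := Sh.leaf D s t lo hi hA hlt
    obtain ⟨-, hs, ht, -⟩ := hG _ _ _ hA
    refine ⟨_, hL, Subset.rfl, ?_⟩
    have e0 : 0 ≤ ε := by linarith
    constructor
    · rintro y ⟨-, h1, h2⟩; simp only at h1 h2; rw [abs_le]; constructor <;> linarith
    · rintro y ⟨-, h1, h2⟩; simp only at h1 h2; rw [abs_le]; constructor <;> linarith
    · rintro x ⟨h, -⟩; exact hd x h s hs
    · rintro x ⟨h, -⟩; exact hd x h t ht
    · rintro x y y' ⟨-, h1, h2⟩ ⟨-, h3, h4⟩; simp only at h1 h2 h3 h4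
      rw [abs_le]; constructor <;> linarith
    · rintro x x' y ⟨h1, -⟩ ⟨h2, -⟩
      linarith [hd x h1 x' h2]
  | node D D1 D2 s m t hu hi' hA1 hA2 h1 h2 i1 i2 =>
    intro lo hi hA hlt hε
    obtain ⟨R1, a1, b1, c1⟩ := i1 lo ((lo + hi) / 2) hA1 (by linarith) (by linarith)
    obtain ⟨R2, a2, b2, c2⟩ := i2 ((lo + hi) / 2) hi hA2 (by linarith) (by linarith)
    have hN := Sh.node D D1 D2 s m t lo _ hi R1 R2 hA hu hi' a1 a2
    exact ⟨_, hN, (hN.ok hG).sub, ShG.glue hG hi' a1 a2 c1 c2⟩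

theorem sh_model {𝒜 : Set α → α → α → Prop} (hG : GoodArcs 𝒜)
    (hK : ∀ D s t, 𝒜 D s t → ∀ ε > 0, ACut 𝒜 ε D s t) {ε : ℝ} (hε : 0 < ε) (n : ℕ) :
    ∀ (D : Set α) (s t : α) (lo hi : ℝ), 𝒜 D s t → lo < hi → hi - lo ≤ 2 ^ n * ε →
    ∃ R, Sh 𝒜 D s t lo hi R ∧ R ⊆ D ×ˢ Icc lo hi ∧ ShG ε s t lo hi R := by
  induction n with
  | zero =>
    intro D s t lo hi hA hlt h
    exact sh_real hG (hK D s t hA ε hε) lo hi hA hlt (by simpa using h)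
  | succ n ih =>
    intro D s t lo hi hA hlt h
    obtain ⟨-, hs, ht, hne⟩ := hG _ _ _ hA
    have hd := dist_pos.2 hne
    have := hK D s t hA (dist s t / 2) (by linarith)
    cases this with
    | leaf _ _ _ hh => have := hh s hs t ht; linarith
    | node _ D1 D2 _ m _ hu hi' hA1 hA2 h1 h2 =>
      rw [pow_succ] at h
      obtain ⟨R1, a1, b1, c1⟩ := ih D1 s m lo ((lo + hi) / 2) hA1 (by linarith) (by linarith)
      obtain ⟨R2, a2, b2, c2⟩ := ih D2 m t ((lo + hi) / 2) hi hA2 (by linarith) (by linarith)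
      have hN := Sh.node D D1 D2 s m t lo _ hi R1 R2 hA hu hi' a1 a2
      exact ⟨_, hN, (hN.ok hG).sub, ShG.glue hG hi' a1 a2 c1 c2⟩

theorem sh_refine {𝒜 : Set α → α → α → Prop} (hG : GoodArcs 𝒜)
    (hK : ∀ D s t, 𝒜 D s t → ∀ ε > 0, ACut 𝒜 ε D s t) {ε : ℝ} (hε : 0 < ε)
    {D : Set α} {s t : α} {lo hi : ℝ} {R : Set (α × ℝ)} (h : Sh 𝒜 D s t lo hi R) :
    ∃ R', Sh 𝒜 D s t lo hi R' ∧ R' ⊆ R ∧ ShG ε s t lo hi R' := by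
  induction h with
  | leaf D s t lo hi hA hlt =>
    obtain ⟨n, hn⟩ := pow_unbounded_of_one_lt ((hi - lo) / ε) (one_lt_two)
    exact sh_model hG hK hε n D s t lo hi hA hlt (by rw [div_lt_iff₀ hε] at hn; exact hn.le)
  | node D D1 D2 s m t lo mid hi R1 R2 hA hu hi' h1 h2 i1 i2 =>
    obtain ⟨R1', a1, b1, c1⟩ := i1
    obtain ⟨R2', a2, b2, c2⟩ := i2
    exact ⟨_, Sh.node D D1 D2 s m t lo _ hi R1' R2' hA hu hi' a1 a2, union_subset_union b1 b2,
      ShG.glue hG hi' a1 a2 c1 c2⟩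

/-- The one-dimensional recognition theorem. -/
theorem isArc_of_family {𝒜 : Set α → α → α → Prop} (hG : GoodArcs 𝒜)
    (hK : ∀ D s t, 𝒜 D s t → ∀ ε > 0, ACut 𝒜 ε D s t) {D : Set α} {s t : α} (hA : 𝒜 D s t) :
    IsArc D s t := by
  obtain ⟨hDc, hs, ht, hne⟩ := hG _ _ _ hA
  let St := {R : Set (α × ℝ) // Sh 𝒜 D s t 0 1 R}
  have step : ∀ (r : St) (k : ℕ), ∃ r' : St, r'.1 ⊆ r.1 ∧ ShG (1 / ((k:ℝ) + 1)) s t 0 1 r'.1 := by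
    rintro ⟨R, hR⟩ k
    obtain ⟨R', a, b, c⟩ := sh_refine hG hK (show (0:ℝ) < 1 / ((k:ℝ) + 1) by positivity) hR
    exact ⟨⟨R', a⟩, b, c⟩
  choose nxt n1 n2 using step
  let seq : ℕ → St := fun n => Nat.rec ⟨_, Sh.leaf D s t 0 1 hA one_pos⟩ (fun k r => nxt r k) n
  have tend : ∀ ε > (0:ℝ), ∃ k : ℕ, 2 * (1 / ((k:ℝ) + 1)) ≤ ε := by
    intro ε hε
    obtain ⟨k, hk⟩ := exists_nat_one_div_lt (half_pos hε)
    exact ⟨k, by linarith⟩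
  have ok := fun k => (seq k).2.ok hG
  have g : ∀ k : ℕ, ShG (1 / ((k:ℝ) + 1)) s t 0 1 (seq (k+1)).1 := fun k => n2 _ _
  obtain ⟨e, he⟩ := homeo_of_relations_mem hDc (isCompact_Icc (a := (0:ℝ)) (b := 1))
    (fun k => (seq k).1) (fun k => (ok k).closed) (fun k => n1 _ _) (fun k => (ok k).sub)
    (fun k => (ok k).totX) (fun k => (ok k).totY)
    (fun ε hε => by
      obtain ⟨k, hk⟩ := tend ε hε
      exact ⟨k+1, fun x y y' h h' => ((g k).h1 x y y' h h').trans hk⟩)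
    (fun ε hε => by
      obtain ⟨k, hk⟩ := tend ε hε
      exact ⟨k+1, fun x y y' h h' => ((g k).h2 x y y' h h').trans hk⟩)
  have z : ∀ r : ℝ, (∀ k : ℕ, |r| ≤ 1 / ((k:ℝ) + 1)) → r = 0 := by
    intro r hr
    rw [← abs_eq_zero]
    apply le_antisymm _ (abs_nonneg _)
    apply le_of_forall_pos_le_add
    intro ε hε
    obtain ⟨k, hk⟩ := tend ε hε
    have := hr k
    have : 0 < 1 / ((k:ℝ) + 1) := by positivity
    linarith
  have e0 : (e ⟨s, hs⟩ : ℝ) = 0 := z _ fun k => by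
    have := (g k).s1 _ (he ⟨s, hs⟩ (k+1)); simpa using this
  have e1 : (e ⟨t, ht⟩ : ℝ) = 1 := by
    have := z ((e ⟨t, ht⟩ : ℝ) - 1) fun k => by
      have := (g k).t1 _ (he ⟨t, ht⟩ (k+1)); simpa using this
    linarith
  refine ⟨fun r => e.symm (projIcc 0 1 zero_le_one r), ?_, ?_, ?_, ?_, ?_⟩
  · apply Continuous.continuousOn
    exact continuous_subtype_val.comp (e.symm.continuous.comp continuous_projIcc)
  · intro x hx y hy h
    have := e.symm.injective (Subtype.val_injective h)
    rw [projIcc_of_mem _ hx, projIcc_of_mem _ hy] at this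
    exact congrArg Subtype.val this
  · have : projIcc (0:ℝ) 1 zero_le_one 0 = e ⟨s, hs⟩ := by
      apply Subtype.ext; rw [e0]; simp
    simp only; rw [this, e.symm_apply_apply]
  · have : projIcc (0:ℝ) 1 zero_le_one 1 = e ⟨t, ht⟩ := by
      apply Subtype.ext; rw [e1]; simp
    simp only; rw [this, e.symm_apply_apply]
  · apply Subset.antisymm
    · rintro _ ⟨r, -, rfl⟩; exact (e.symm _).2
    · intro x hx
      refine ⟨e ⟨x, hx⟩, (e ⟨x, hx⟩).2, ?_⟩
      simp

theorem IsArc.preconn {γ : Set α} {a b : α} (h : IsArc γ a b) : IsPreconnected (γ \ {a, b}) := by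
  obtain ⟨p, hc, hi, rfl, rfl, rfl⟩ := h
  have : p '' Icc 0 1 \ {p 0, p 1} = p '' Ioo 0 1 := by
    apply Subset.antisymm
    · rintro _ ⟨⟨r, hr, rfl⟩, h⟩
      simp only [mem_insert_iff, mem_singleton_iff, not_or] at h
      refine ⟨r, ⟨lt_of_le_of_ne hr.1 ?_, lt_of_le_of_ne hr.2 ?_⟩, rfl⟩
      · rintro rfl; exact h.1 rfl
      · rintro rfl; exact h.2 rfl
    · rintro _ ⟨r, hr, rfl⟩
      refine ⟨⟨r, Ioo_subset_Icc_self hr, rfl⟩, ?_⟩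
      simp only [mem_insert_iff, mem_singleton_iff, not_or]
      constructor
      · intro h; have := hi (Ioo_subset_Icc_self hr) (by simp) h; linarith [hr.1]
      · intro h; have := hi (Ioo_subset_Icc_self hr) (by simp) h; linarith [hr.2]
  rw [this]
  exact isPreconnected_Ioo.image _ (hc.mono Ioo_subset_Icc_self)

theorem circle_of_arcs {J1 J2 : Set α} {a b : α} (h1 : IsArc J1 a b) (h2 : IsArc J2 a b)
    (h12 : J1 ∩ J2 = {a, b}) :
    ∃ f : α → ℂ, ContinuousOn f (J1 ∪ J2) ∧ InjOn f (J1 ∪ J2) ∧ f '' (J1 ∪ J2) = sphere 0 1 := by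
  classical
  obtain ⟨p, pc, pi, p0, p1, rfl⟩ := h1
  obtain ⟨r, rc, ri, r0, r1, rfl⟩ := h2
  obtain ⟨g, gc, hg⟩ := exists_cont_inv isCompact_Icc pc pi
  obtain ⟨k, kc, hk⟩ := exists_cont_inv isCompact_Icc rc ri
  let u : ℝ → ℂ := fun x => Complex.exp ((Real.pi * x : ℝ) * Complex.I)
  have ure : ∀ x, (u x).re = Real.cos (Real.pi * x) := fun x => Complex.exp_ofReal_mul_I_re _
  have uim : ∀ x, (u x).im = Real.sin (Real.pi * x) := fun x => Complex.exp_ofReal_mul_I_im _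
  have uc : Continuous u := by fun_prop
  have cosinj : ∀ x ∈ Icc (0:ℝ) 1, ∀ y ∈ Icc (0:ℝ) 1, Real.cos (Real.pi * x) = Real.cos (Real.pi * y) → x = y := by
    intro x hx y hy h
    have pp := Real.pi_pos
    have := Real.injOn_cos (⟨by nlinarith [hx.1], by nlinarith [hx.2]⟩ : Real.pi * x ∈ Icc 0 Real.pi)
      (⟨by nlinarith [hy.1], by nlinarith [hy.2]⟩ : Real.pi * y ∈ Icc 0 Real.pi) h
    exact mul_left_cancel₀ pp.ne' this
  have sinn : ∀ x ∈ Icc (0:ℝ) 1, 0 ≤ Real.sin (Real.pi * x) := by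
    intro x hx
    have pp := Real.pi_pos
    exact Real.sin_nonneg_of_mem_Icc ⟨by nlinarith [hx.1], by nlinarith [hx.2]⟩
  have I0 : (0:ℝ) ∈ Icc (0:ℝ) 1 := by simp
  have I1 : (1:ℝ) ∈ Icc (0:ℝ) 1 := by simp
  let f : α → ℂ := fun x => if x ∈ p '' Icc 0 1 then u (g x) else u (-(k x))
  have f1 : ∀ x ∈ Icc (0:ℝ) 1, f (p x) = u x := by
    intro x hx
    simp only [f]; rw [if_pos ⟨x, hx, rfl⟩, hg x hx]
  have f2 : ∀ x ∈ Icc (0:ℝ) 1, f (r x) = u (-x) := by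
    intro x hx
    by_cases h : r x ∈ p '' Icc 0 1
    · have : r x ∈ p '' Icc 0 1 ∩ r '' Icc 0 1 := ⟨h, x, hx, rfl⟩
      rw [h12] at this
      rcases this with h | h
      · have e : r x = r 0 := by rw [h, r0]
        have e' := ri hx I0 e
        subst e'
        rw [r0, ← p0, f1 0 I0]; simp
      · have h : r x = b := h
        have e : r x = r 1 := by rw [h, r1]
        have e' := ri hx I1 e
        subst e'
        rw [r1, ← p1, f1 1 I1]
        apply Complex.ext
        · rw [ure, ure]; simp
        · rw [uim, uim]; simp
    · simp only [f]; rw [if_neg h, hk x hx]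
  have c1 : IsClosed (p '' Icc 0 1) := (isCompact_Icc.image_of_continuousOn pc).isClosed
  have c2 : IsClosed (r '' Icc 0 1) := (isCompact_Icc.image_of_continuousOn rc).isClosed
  refine ⟨f, ?_, ?_, ?_⟩
  · apply ContinuousOn.union_of_isClosed _ _ c1 c2
    · apply (uc.comp_continuousOn gc).congr
      rintro _ ⟨x, hx, rfl⟩
      simp only [Function.comp]
      rw [f1 x hx, hg x hx]
    · apply (uc.comp_continuousOn kc.neg).congr
      rintro _ ⟨x, hx, rfl⟩
      simp only [Function.comp, Pi.neg_apply]
      rw [f2 x hx, hk x hx]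
  · have cr : ∀ x ∈ Icc (0:ℝ) 1, ∀ y ∈ Icc (0:ℝ) 1, u x = u (-y) → p x = r y := by
      intro x hx y hy h
      have e1 := congrArg Complex.re h
      have e2 := congrArg Complex.im h
      rw [ure, ure, mul_neg, Real.cos_neg] at e1
      rw [uim, uim, mul_neg, Real.sin_neg] at e2
      have := cosinj x hx y hy e1
      subst this
      have s0 : Real.sin (Real.pi * x) = 0 := by linarith [sinn x hx]
      by_cases hx0 : x = 0
      · rw [hx0, p0, r0]
      by_cases hx1 : x = 1
      · rw [hx1, p1, r1]
      exfalso
      have pp := Real.pi_pos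
      have a0 : 0 < x := lt_of_le_of_ne hx.1 (Ne.symm hx0)
      have a1 : x < 1 := lt_of_le_of_ne hx.2 hx1
      have := Real.sin_pos_of_mem_Ioo (⟨by nlinarith, by nlinarith⟩ : Real.pi * x ∈ Ioo 0 Real.pi)
      linarith
    rintro _ (⟨x, hx, rfl⟩ | ⟨x, hx, rfl⟩) _ (⟨y, hy, rfl⟩ | ⟨y, hy, rfl⟩) h
    · rw [f1 x hx, f1 y hy] at h
      have e1 := congrArg Complex.re h
      rw [ure, ure] at e1
      rw [cosinj x hx y hy e1]
    · rw [f1 x hx, f2 y hy] at h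
      exact cr x hx y hy h
    · rw [f2 x hx, f1 y hy] at h
      exact (cr y hy x hx h.symm).symm
    · rw [f2 x hx, f2 y hy] at h
      have e1 := congrArg Complex.re h
      rw [ure, ure, mul_neg, Real.cos_neg, mul_neg, Real.cos_neg] at e1
      rw [cosinj x hx y hy e1]
  · apply Subset.antisymm
    · rintro _ ⟨_, (⟨x, hx, rfl⟩ | ⟨x, hx, rfl⟩), rfl⟩
      · rw [f1 x hx]; simp only [mem_sphere_zero_iff_norm]; exact Complex.norm_exp_ofReal_mul_I _
      · rw [f2 x hx]; simp only [mem_sphere_zero_iff_norm]; exact Complex.norm_exp_ofReal_mul_I _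
    · intro z hz
      have hz' := mem_csphere.1 hz
      have pp := Real.pi_pos
      set x := Real.arccos z.re / Real.pi with hx
      have hxI : x ∈ Icc (0:ℝ) 1 := by
        refine ⟨div_nonneg (Real.arccos_nonneg _) pp.le, ?_⟩
        rw [hx, div_le_one pp]; exact Real.arccos_le_pi _
      have hpx : Real.pi * x = Real.arccos z.re := by rw [hx]; field_simp
      have hc : Real.cos (Real.pi * x) = z.re := by
        rw [hpx, Real.cos_arccos] <;> nlinarith [sq_nonneg z.im]
      have hs : Real.sin (Real.pi * x) ^ 2 = z.im ^ 2 := by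
        have := Real.sin_sq_add_cos_sq (Real.pi * x)
        rw [hc] at this; linarith
      have hsn := sinn x hxI
      rcases le_total 0 z.im with h | h
      · refine ⟨p x, Or.inl ⟨x, hxI, rfl⟩, ?_⟩
        rw [f1 x hxI]
        apply Complex.ext
        · rw [ure, hc]
        · rw [uim]; nlinarith
      · refine ⟨r x, Or.inr ⟨x, hxI, rfl⟩, ?_⟩
        rw [f2 x hxI]
        apply Complex.ext
        · rw [ure, mul_neg, Real.cos_neg, hc]
        · rw [uim, mul_neg, Real.sin_neg]; nlinarith

end arcs
end ABCT
end

section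
open Set Metric Filter Topology

namespace ABCT

section graph
set_option linter.unusedSectionVars false
set_option linter.unusedVariables false
variable {L : Type*} [DecidableEq L]

/-- parity of the number of members of `s` contained in `t` -/
def par (s : Finset (Finset L)) (t : Finset L) : ZMod 2 := ∑ e ∈ s, if e ⊆ t then 1 else 0

theorem z2 (a : ZMod 2) : a = 0 ∨ a = 1 := by revert a; decide
theorem z2_add (a : ZMod 2) : a + a = 0 := by revert a; decide
theorem z2_ne {a : ZMod 2} (h : a ≠ 0) : a = 1 := (z2 a).resolve_left h
theorem z2_10 : (1 : ZMod 2) ≠ 0 := by decide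

theorem par_union {s t : Finset (Finset L)} (h : Disjoint s t) (x : Finset L) :
    par (s ∪ t) x = par s x + par t x := Finset.sum_union h

theorem par_sdiff {s t : Finset (Finset L)} (h : t ⊆ s) (x : Finset L) :
    par (s \ t) x = par s x + par t x := by
  have := par_union (Finset.sdiff_disjoint (s := t) (t := s)) x
  rw [Finset.sdiff_union_of_subset h] at this
  rw [this, add_assoc, z2_add, add_zero]

theorem par_zero {s : Finset (Finset L)} {x : Finset L} (h : ∀ e ∈ s, ¬ e ⊆ x) : par s x = 0 :=
  Finset.sum_eq_zero fun e he => if_neg (h e he)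

@[simp] theorem par_empty (x : Finset L) : par ∅ x = 0 := rfl

theorem par_single (e x : Finset L) : par {e} x = if e ⊆ x then 1 else 0 :=
  Finset.sum_singleton _ _

theorem exists_of_par {s : Finset (Finset L)} {x : Finset L} (h : par s x ≠ 0) : ∃ e ∈ s, e ⊆ x := by
  by_contra hc
  push Not at hc
  exact h (par_zero hc)

theorem par_inter_sdiff (s t : Finset (Finset L)) (x : Finset L) :
    par s x = par (s ∩ t) x + par (s \ t) x := by
  rw [← par_union, Finset.union_comm, Finset.sdiff_union_inter]
  exact Finset.disjoint_sdiff.mono_left Finset.inter_subset_right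

structure Graph (E V : Finset (Finset L)) : Prop where
  two : ∀ e ∈ E, ∃ u ∈ V, ∃ v ∈ V, u ≠ v ∧ ∀ w ∈ V, e ⊆ w ↔ w = u ∨ w = v

def Touch (z : Finset (Finset L)) (w : Finset L) : Prop := ∃ e ∈ z, e ⊆ w

def Even' (V z : Finset (Finset L)) : Prop := ∀ w ∈ V, par z w = 0

def Bd (V z : Finset (Finset L)) (u v : Finset L) : Prop :=
  ∀ w ∈ V, par z w = (if w = u then 1 else 0) + (if w = v then 1 else 0)

structure Arc (E V z : Finset (Finset L)) (u v : Finset L) : Prop where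
  sub : z ⊆ E
  hu : u ∈ V
  hv : v ∈ V
  ne : u ≠ v
  bd : Bd V z u v
  ac : ∀ y ⊆ z, Even' V y → y = ∅

structure Cyc (E V c : Finset (Finset L)) : Prop where
  sub : c ⊆ E
  ne : c.Nonempty
  ev : Even' V c
  min : ∀ y ⊆ c, Even' V y → y = ∅ ∨ y = c

variable {E V : Finset (Finset L)}

theorem Touch.mono {z z' : Finset (Finset L)} {w : Finset L} (h : Touch z w) (hz : z ⊆ z') : Touch z' w := by
  obtain ⟨e, he, h⟩ := h; exact ⟨e, hz he, h⟩

theorem touch_of_par {z : Finset (Finset L)} {w : Finset L} (h : par z w ≠ 0) : Touch z w := exists_of_par h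

theorem par_of_not_touch {z : Finset (Finset L)} {w : Finset L} (h : ¬ Touch z w) : par z w = 0 := by
  by_contra hc; exact h (touch_of_par hc)

theorem touch_union {z z' : Finset (Finset L)} {w : Finset L} : Touch (z ∪ z') w ↔ Touch z w ∨ Touch z' w := by
  constructor
  · rintro ⟨e, he, h⟩
    rcases Finset.mem_union.1 he with h' | h'
    · exact Or.inl ⟨e, h', h⟩
    · exact Or.inr ⟨e, h', h⟩
  · rintro (h | h)
    · exact h.mono Finset.subset_union_left
    · exact h.mono Finset.subset_union_right

theorem Bd.symm {z : Finset (Finset L)} {u v : Finset L} (h : Bd V z u v) : Bd V z v u := by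
  intro w hw; rw [h w hw, add_comm]

theorem Bd.self_even {z : Finset (Finset L)} {u : Finset L} (h : Bd V z u u) : Even' V z := by
  intro w hw; rw [h w hw, z2_add]

theorem Bd.left {z : Finset (Finset L)} {u v : Finset L} (h : Bd V z u v) (hu : u ∈ V) (hne : u ≠ v) :
    par z u = 1 := by
  rw [h u hu, if_pos rfl, if_neg hne, add_zero]

theorem Bd.touch_left {z : Finset (Finset L)} {u v : Finset L} (h : Bd V z u v) (hu : u ∈ V) (hne : u ≠ v) :
    Touch z u := touch_of_par (by rw [h.left hu hne]; exact z2_10)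

theorem Bd.touch_right {z : Finset (Finset L)} {u v : Finset L} (h : Bd V z u v) (hv : v ∈ V) (hne : u ≠ v) :
    Touch z v := h.symm.touch_left hv hne.symm

theorem Bd.trans {z z' : Finset (Finset L)} {u v w : Finset L} (h : Bd V z u v) (h' : Bd V z' v w)
    (hd : Disjoint z z') : Bd V (z ∪ z') u w := by
  intro x hx
  rw [par_union hd, h x hx, h' x hx]
  generalize (if x = u then (1 : ZMod 2) else 0) = a
  generalize (if x = v then (1 : ZMod 2) else 0) = b
  generalize (if x = w then (1 : ZMod 2) else 0) = c
  revert a b c; decide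

theorem Bd.sdiff {z z' : Finset (Finset L)} {u v w : Finset L} (h : Bd V z u v) (h' : Bd V z' u w)
    (hd : z' ⊆ z) : Bd V (z \ z') w v := by
  intro x hx
  rw [par_sdiff hd, h x hx, h' x hx]
  generalize (if x = u then (1 : ZMod 2) else 0) = a
  generalize (if x = v then (1 : ZMod 2) else 0) = b
  generalize (if x = w then (1 : ZMod 2) else 0) = c
  revert a b c; decide

theorem Bd.sdiff_even {z z' : Finset (Finset L)} {u v : Finset L} (h : Bd V z u v) (h' : Even' V z')
    (hd : z' ⊆ z) : Bd V (z \ z') u v := by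
  intro x hx
  rw [par_sdiff hd, h x hx, h' x hx, add_zero]

theorem Even'.sdiff {z z' : Finset (Finset L)} {u v : Finset L} (h : Even' V z) (h' : Bd V z' u v)
    (hd : z' ⊆ z) : Bd V (z \ z') u v := by
  intro x hx
  rw [par_sdiff hd, h x hx, h' x hx, zero_add]

theorem Bd.even_union {z z' : Finset (Finset L)} {u v : Finset L} (h : Bd V z u v) (h' : Bd V z' u v)
    (hd : Disjoint z z') : Even' V (z ∪ z') := (h.trans h'.symm hd).self_even

theorem Even'.union {z z' : Finset (Finset L)} (h : Even' V z) (h' : Even' V z')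
    (hd : Disjoint z z') : Even' V (z ∪ z') := by
  intro w hw; rw [par_union hd, h w hw, h' w hw, add_zero]

theorem Graph.other (hG : Graph E V) {e x : Finset L} (he : e ∈ E) (hx : x ∈ V) (hex : e ⊆ x) :
    ∃ y ∈ V, y ≠ x ∧ (∀ w ∈ V, e ⊆ w ↔ w = x ∨ w = y) ∧ Bd V {e} x y := by
  obtain ⟨u, hu, v, hv, hne, h⟩ := hG.two e he
  have key : ∃ y ∈ V, y ≠ x ∧ (∀ w ∈ V, e ⊆ w ↔ w = x ∨ w = y) := by
    rcases (h x hx).1 hex with rfl | rfl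
    · exact ⟨v, hv, hne.symm, h⟩
    · exact ⟨u, hu, hne, fun w hw => by rw [h w hw, or_comm]⟩
  obtain ⟨y, hy, hyx, h'⟩ := key
  refine ⟨y, hy, hyx, h', ?_⟩
  intro w hw
  rw [par_single]
  by_cases h1 : w = x
  · subst h1
    rw [if_pos hex, if_pos rfl, if_neg hyx.symm, add_zero]
  · by_cases h2 : w = y
    · subst h2
      rw [if_pos ((h' w hw).2 (Or.inr rfl)), if_pos rfl, if_neg h1, zero_add]
    · rw [if_neg, if_neg h1, if_neg h2, add_zero]
      rw [h' w hw]; tauto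

theorem Graph.peel (hG : Graph E V) : ∀ (n : ℕ) (h : Finset (Finset L)), h.card ≤ n → h ⊆ E → ∀ x ∈ V,
    par h x = 1 → ∃ y ∈ V, y ≠ x ∧ par h y = 1 ∧ ∃ z ⊆ h, Bd V z x y := by
  intro n
  induction n with
  | zero =>
    intro h hc _ x _ hp
    have : h = ∅ := Finset.card_eq_zero.1 (Nat.le_zero.1 hc)
    subst this
    exact absurd hp.symm (by simp)
  | succ n ih =>
    intro h hc hE x hx hp
    obtain ⟨e, he, hex⟩ := exists_of_par (s := h) (x := x) (by rw [hp]; exact z2_10)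
    obtain ⟨w, hw, hwx, hinc, hbd⟩ := hG.other (hE he) hx hex
    by_cases hpw : par h w = 1
    · exact ⟨w, hw, hwx, hpw, {e}, by simpa using he, hbd⟩
    have hpw0 : par h w = 0 := (z2 _).resolve_right hpw
    have hse : ({e} : Finset (Finset L)) ⊆ h := by simpa using he
    have hp' : ∀ y ∈ V, par (h \ {e}) y = par h y + ((if y = x then 1 else 0) + (if y = w then 1 else 0)) := by
      intro y hy; rw [par_sdiff hse, hbd y hy]
    have hcard : (h \ {e}).card ≤ n := by
      have := Finset.card_sdiff_add_card_eq_card hse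
      simp at this; omega
    obtain ⟨y, hy, hyw, hpy, z, hz, hbz⟩ := ih (h \ {e}) hcard (Finset.sdiff_subset.trans hE) w hw
      (by rw [hp' w hw, hpw0, if_neg hwx, if_pos rfl]; decide)
    have hyx : y ≠ x := by
      rintro rfl
      rw [hp' y hy, hp, if_pos rfl, if_neg hwx.symm] at hpy
      revert hpy; decide
    refine ⟨y, hy, hyx, ?_, {e} ∪ z, ?_, ?_⟩
    · rw [hp' y hy, if_neg hyx, if_neg hyw] at hpy
      simpa using hpy
    · exact Finset.union_subset hse (hz.trans Finset.sdiff_subset)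
    · apply hbd.trans hbz
      exact Finset.disjoint_sdiff.mono_right hz

theorem Graph.handshake (hG : Graph E V) {z : Finset (Finset L)} (hz : z ⊆ E) : ∑ w ∈ V, par z w = 0 := by
  unfold par
  rw [Finset.sum_comm]
  apply Finset.sum_eq_zero
  intro e he
  obtain ⟨u, hu, v, hv, hne, h⟩ := hG.two e (hz he)
  have : ∀ w ∈ V, (if e ⊆ w then (1:ZMod 2) else 0) = (if w = u then 1 else 0) + (if w = v then 1 else 0) := by
    intro w hw
    by_cases h1 : w = u
    · subst h1
      rw [if_pos ((h w hw).2 (Or.inl rfl)), if_pos rfl, if_neg hne, add_zero]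
    · by_cases h2 : w = v
      · subst h2
        rw [if_pos ((h w hw).2 (Or.inr rfl)), if_pos rfl, if_neg h1, zero_add]
      · rw [if_neg, if_neg h1, if_neg h2, add_zero]
        rw [h w hw]; tauto
  rw [Finset.sum_congr rfl this, Finset.sum_add_distrib, Finset.sum_ite_eq_of_mem' _ _ _ hu,
    Finset.sum_ite_eq_of_mem' _ _ _ hv]
  decide

/-- pairing lemma: from a set `P` with odd total parity one can leave `P` -/
theorem Graph.leave (hG : Graph E V) (P : Finset (Finset L)) (hP : P ⊆ V) : ∀ (n : ℕ) (h : Finset (Finset L)),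
    h.card ≤ n → h ⊆ E → ∑ w ∈ P, par h w = 1 →
    ∃ x ∈ P, ∃ y ∈ V, y ∉ P ∧ par h y = 1 ∧ ∃ z ⊆ h, Bd V z x y := by
  intro n
  induction n with
  | zero =>
    intro h hc _ hs
    have : h = ∅ := Finset.card_eq_zero.1 (Nat.le_zero.1 hc)
    subst this
    simp at hs
  | succ n ih =>
    intro h hc hE hs
    obtain ⟨x, hx, hpx⟩ := Finset.exists_ne_zero_of_sum_ne_zero (by rw [hs]; exact z2_10)
    have hpx := z2_ne hpx
    obtain ⟨y, hy, hyx, hpy, z, hz, hbz⟩ := hG.peel _ h le_rfl hE x (hP hx) hpx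
    by_cases hyP : y ∈ P
    · have hzne : z.Nonempty := by
        obtain ⟨e, he, -⟩ := hbz.touch_left (hP hx) hyx.symm
        exact ⟨e, he⟩
      have hcard : (h \ z).card ≤ n := by
        have := Finset.card_sdiff_add_card_eq_card hz
        have := hzne.card_pos
        omega
      have hp' : ∀ w ∈ V, par (h \ z) w = par h w + ((if w = x then 1 else 0) + (if w = y then 1 else 0)) := by
        intro w hw; rw [par_sdiff hz, hbz w hw]
      have hs' : ∑ w ∈ P, par (h \ z) w = 1 := by
        rw [Finset.sum_congr rfl (fun w hw => hp' w (hP hw)), Finset.sum_add_distrib, hs,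
          Finset.sum_add_distrib, Finset.sum_ite_eq_of_mem' _ _ _ hx, Finset.sum_ite_eq_of_mem' _ _ _ hyP]
        decide
      obtain ⟨x', hx', y', hy', hyP', hpy', z', hz', hb'⟩ := ih _ hcard (Finset.sdiff_subset.trans hE) hs'
      refine ⟨x', hx', y', hy', hyP', ?_, z', hz'.trans Finset.sdiff_subset, hb'⟩
      rw [hp' y' hy', if_neg, if_neg] at hpy'
      · simpa using hpy'
      · rintro rfl; exact hyP' hyP
      · rintro rfl; exact hyP' hx
    · exact ⟨x, hx, y, hy, hyP, hpy, z, hz, hbz⟩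

theorem Arc.symm {z : Finset (Finset L)} {u v : Finset L} (h : Arc E V z u v) : Arc E V z v u :=
  ⟨h.sub, h.hv, h.hu, h.ne.symm, h.bd.symm, h.ac⟩

theorem Arc.tu {z : Finset (Finset L)} {u v : Finset L} (h : Arc E V z u v) : Touch z u :=
  h.bd.touch_left h.hu h.ne

theorem Arc.tv {z : Finset (Finset L)} {u v : Finset L} (h : Arc E V z u v) : Touch z v :=
  h.bd.touch_right h.hv h.ne

theorem Arc.nonempty {z : Finset (Finset L)} {u v : Finset L} (h : Arc E V z u v) : z.Nonempty := by
  obtain ⟨e, he, -⟩ := h.tu; exact ⟨e, he⟩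

theorem Arc.of_sub {z z' : Finset (Finset L)} {u v x y : Finset L} (h : Arc E V z u v) (hz : z' ⊆ z)
    (hx : x ∈ V) (hy : y ∈ V) (hne : x ≠ y) (hb : Bd V z' x y) : Arc E V z' x y :=
  ⟨hz.trans h.sub, hx, hy, hne, hb, fun w hw => h.ac w (hw.trans hz)⟩

/-- a vertex of an arc is joined to the first end inside the arc -/
theorem Arc.reach (hG : Graph E V) {z : Finset (Finset L)} {u v m : Finset L} (h : Arc E V z u v)
    (hm : m ∈ V) (ht : Touch z m) : ∃ y ⊆ z, Bd V y u m := by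
  by_cases hmv : m = v
  · subst hmv; exact ⟨z, Finset.Subset.rfl, h.bd⟩
  by_cases hmu : m = u
  · subst hmu
    refine ⟨∅, by simp, ?_⟩
    intro w hw; rw [z2_add, par_empty]
  obtain ⟨e, he, hem⟩ := ht
  obtain ⟨w, hw, hwm, hinc, hbe⟩ := hG.other (h.sub he) hm hem
  have hse : ({e} : Finset (Finset L)) ⊆ z := by simpa using he
  have hp' : ∀ y ∈ V, par (z \ {e}) y = ((if y = u then 1 else 0) + (if y = v then 1 else 0)) +
      ((if y = m then 1 else 0) + (if y = w then 1 else 0)) := by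
    intro y hy; rw [par_sdiff hse, hbe y hy, h.bd y hy]
  obtain ⟨y, hy, hym, hpy, z', hz', hb'⟩ := hG.peel _ (z \ {e}) le_rfl (Finset.sdiff_subset.trans h.sub) m hm
    (by rw [hp' m hm, if_neg hmu, if_neg hmv, if_pos rfl, if_neg hwm.symm]; decide)
  by_cases hyw : y = w
  · exfalso
    subst hyw
    have := h.ac ({e} ∪ z') (Finset.union_subset hse (hz'.trans Finset.sdiff_subset))
      (hbe.even_union hb' (Finset.disjoint_sdiff.mono_right hz'))
    have he' : e ∈ ({e} ∪ z' : Finset (Finset L)) := by simp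
    rw [this] at he'; simp at he'
  by_cases hyu : y = u
  · subst hyu
    exact ⟨z', hz'.trans Finset.sdiff_subset, hb'.symm⟩
  by_cases hyv : y = v
  · subst hyv
    exact ⟨z \ z', Finset.sdiff_subset, (h.bd.symm.sdiff hb'.symm (hz'.trans Finset.sdiff_subset)).symm⟩
  · exfalso
    rw [hp' y hy, if_neg hyu, if_neg hyv, if_neg hym, if_neg hyw] at hpy
    revert hpy; decide

theorem Arc.split (hG : Graph E V) {z : Finset (Finset L)} {u v m : Finset L} (h : Arc E V z u v)
    (hm : m ∈ V) (ht : Touch z m) (hmu : m ≠ u) (hmv : m ≠ v) :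
    ∃ z1 z2, z1 ∪ z2 = z ∧ Disjoint z1 z2 ∧ Arc E V z1 u m ∧ Arc E V z2 m v ∧
      ∀ w ∈ V, Touch z1 w → Touch z2 w → w = m := by
  obtain ⟨z1, hz1, hb1⟩ := h.reach hG hm ht
  have hb2 : Bd V (z \ z1) m v := h.bd.sdiff hb1 hz1
  have a1 := h.of_sub hz1 h.hu hm hmu.symm hb1
  have a2 := h.of_sub Finset.sdiff_subset hm h.hv hmv hb2
  refine ⟨z1, z \ z1, Finset.union_sdiff_of_subset hz1, Finset.disjoint_sdiff, a1, a2, ?_⟩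
  intro w hw t1 t2
  by_contra hwm
  obtain ⟨y1, hy1, hc1⟩ := a1.symm.reach hG hw t1
  obtain ⟨y2, hy2, hc2⟩ := a2.reach hG hw t2
  have := h.ac (y1 ∪ y2) (Finset.union_subset (hy1.trans hz1) (hy2.trans Finset.sdiff_subset))
    (hc1.even_union hc2 (Finset.disjoint_sdiff.mono hy1 hy2))
  obtain ⟨e, he, -⟩ := hc1.touch_left hm (Ne.symm hwm)
  have : e ∈ y1 ∪ y2 := Finset.mem_union_left _ he
  simp_all

theorem arc_single (hG : Graph E V) {e : Finset L} (he : e ∈ E) {x y : Finset L} (hx : x ∈ V) (hy : y ∈ V)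
    (hne : x ≠ y) (hb : Bd V {e} x y) : Arc E V {e} x y := by
  refine ⟨by simpa using he, hx, hy, hne, hb, ?_⟩
  intro w hw hev
  rcases Finset.subset_singleton_iff.1 hw with h | h
  · exact h
  · subst h
    have := hb.left hx hne
    rw [hev x hx] at this
    exact absurd this.symm z2_10

/-- an arc is a single edge or has an interior vertex -/
theorem Arc.cases (hG : Graph E V) {z : Finset (Finset L)} {u v : Finset L} (h : Arc E V z u v) :
    (∃ e ∈ E, z = {e}) ∨ ∃ m ∈ V, Touch z m ∧ m ≠ u ∧ m ≠ v := by
  obtain ⟨e, he, heu⟩ := h.tu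
  obtain ⟨w, hw, hwu, hinc, hbe⟩ := hG.other (h.sub he) h.hu heu
  by_cases hwv : w = v
  · subst hwv
    left
    refine ⟨e, h.sub he, ?_⟩
    have hse : ({e} : Finset (Finset L)) ⊆ z := by simpa using he
    have := h.ac (z \ {e}) Finset.sdiff_subset (h.bd.sdiff hbe hse).self_even
    exact Finset.Subset.antisymm (Finset.sdiff_eq_empty_iff_subset.1 this) hse
  · right
    exact ⟨w, hw, ⟨e, he, (hinc w hw).2 (Or.inr rfl)⟩, hwu, hwv⟩

theorem Cyc.split (hG : Graph E V) {c : Finset (Finset L)} (h : Cyc E V c) {u v : Finset L} (hu : u ∈ V)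
    (hv : v ∈ V) (hne : u ≠ v) (tu : Touch c u) (tv : Touch c v) :
    ∃ q1 q2, q1 ∪ q2 = c ∧ Disjoint q1 q2 ∧ Arc E V q1 u v ∧ Arc E V q2 u v ∧
      ∀ w ∈ V, Touch q1 w → Touch q2 w → w = u ∨ w = v := by
  obtain ⟨e, he, heu⟩ := tu
  obtain ⟨w, hw, hwu, hinc, hbe⟩ := hG.other (h.sub he) hu heu
  have hse : ({e} : Finset (Finset L)) ⊆ c := by simpa using he
  have hh : Arc E V (c \ {e}) u w := by
    refine ⟨Finset.sdiff_subset.trans h.sub, hu, hw, hwu.symm, h.ev.sdiff hbe hse, ?_⟩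
    intro y hy hev
    rcases h.min y (hy.trans Finset.sdiff_subset) hev with h' | h'
    · exact h'
    · subst h'
      have := hy he
      simp at this
  have he1 := arc_single hG (h.sub he) hu hw hwu.symm hbe
  have key : ∃ q1 q2, q1 ∪ q2 = c ∧ Disjoint q1 q2 ∧ Arc E V q1 u v ∧ Bd V q2 u v := by
    by_cases hvw : v = w
    · subst hvw
      exact ⟨c \ {e}, {e}, Finset.sdiff_union_of_subset hse, Finset.sdiff_disjoint, hh, hbe⟩
    · have tv' : Touch (c \ {e}) v := by
        obtain ⟨e', he', hev'⟩ := tv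
        refine ⟨e', ?_, hev'⟩
        rw [Finset.mem_sdiff]
        refine ⟨he', ?_⟩
        intro hee
        rw [Finset.mem_singleton] at hee
        subst hee
        rcases (hinc v hv).1 hev' with h1 | h1
        · exact hne h1.symm
        · exact hvw h1
      obtain ⟨z1, z2, hz, hd, a1, a2, -⟩ := hh.split hG hv tv' hne.symm hvw
      have hd1 : Disjoint z1 {e} := by
        have : z1 ⊆ c \ {e} := by rw [← hz]; exact Finset.subset_union_left
        exact Finset.sdiff_disjoint.mono_left this
      have hd2 : Disjoint z2 {e} := by
        have : z2 ⊆ c \ {e} := by rw [← hz]; exact Finset.subset_union_right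
        exact Finset.sdiff_disjoint.mono_left this
      refine ⟨z1, z2 ∪ {e}, ?_, ?_, a1, ?_⟩
      · rw [← Finset.union_assoc, hz, Finset.sdiff_union_of_subset hse]
      · rw [Finset.disjoint_union_right]; exact ⟨hd, hd1⟩
      · exact (a2.bd.trans hbe.symm hd2).symm
  obtain ⟨q1, q2, hq, hd, a1, b2⟩ := key
  have s1 : q1 ⊆ c := by rw [← hq]; exact Finset.subset_union_left
  have s2 : q2 ⊆ c := by rw [← hq]; exact Finset.subset_union_right
  have a2 : Arc E V q2 u v := by
    refine ⟨s2.trans h.sub, hu, hv, hne, b2, ?_⟩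
    intro y hy hev
    rcases h.min y (hy.trans s2) hev with h' | h'
    · exact h'
    · exfalso
      obtain ⟨e', he'⟩ := a1.nonempty
      have : e' ∈ q2 := hy (by rw [h']; exact s1 he')
      exact Finset.disjoint_left.1 hd he' this
  refine ⟨q1, q2, hq, hd, a1, a2, ?_⟩
  intro x hx t1 t2
  by_contra hc
  push Not at hc
  obtain ⟨y1, hy1, hc1⟩ := a1.reach hG hx t1
  obtain ⟨y2, hy2, hc2⟩ := a2.reach hG hx t2
  have hev := hc1.even_union hc2 (hd.mono hy1 hy2)
  rcases h.min (y1 ∪ y2) (Finset.union_subset (hy1.trans s1) (hy2.trans s2)) hev with h' | h'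
  · obtain ⟨e', he', -⟩ := hc1.touch_left hu (Ne.symm hc.1)
    have : e' ∈ y1 ∪ y2 := Finset.mem_union_left _ he'
    rw [h'] at this; simp at this
  · have : y1 = q1 := by
      apply Finset.Subset.antisymm hy1
      intro e' he'
      have : e' ∈ y1 ∪ y2 := by rw [h']; exact s1 he'
      rcases Finset.mem_union.1 this with h1 | h1
      · exact h1
      · exact absurd (hy2 h1) (Finset.disjoint_left.1 hd he')
    subst this
    have e1 := hc1 v hv
    rw [a1.bd.symm.left hv hne.symm, if_neg hne.symm, if_neg (Ne.symm hc.2)] at e1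
    revert e1; decide

theorem cyc_of_arcs (hG : Graph E V) {q1 q2 : Finset (Finset L)} {u v : Finset L} (a1 : Arc E V q1 u v)
    (a2 : Arc E V q2 u v) (hd : Disjoint q1 q2)
    (hsh : ∀ w ∈ V, Touch q1 w → Touch q2 w → w = u ∨ w = v) : Cyc E V (q1 ∪ q2) := by
  refine ⟨Finset.union_subset a1.sub a2.sub, ?_, a1.bd.even_union a2.bd hd, ?_⟩
  · obtain ⟨e, he⟩ := a1.nonempty; exact ⟨e, Finset.mem_union_left _ he⟩
  intro y hy hev
  have hyy : (y ∩ q1) ∪ (y ∩ q2) = y := by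
    rw [← Finset.inter_union_distrib_left, Finset.inter_eq_left]; exact hy
  have hdy : Disjoint (y ∩ q1) (y ∩ q2) := hd.mono Finset.inter_subset_right Finset.inter_subset_right
  have hsum : ∀ w ∈ V, par (y ∩ q1) w + par (y ∩ q2) w = 0 := by
    intro w hw; rw [← par_union hdy, hyy]; exact hev w hw
  have hz1 : ∀ w ∈ V, w ≠ u → w ≠ v → par (y ∩ q1) w = 0 := by
    intro w hw h1 h2
    by_contra hc
    have t1 := touch_of_par hc
    have : par (y ∩ q2) w ≠ 0 := by
      intro h0
      have := hsum w hw
      rw [h0, add_zero] at this; exact hc this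
    have t2 := touch_of_par this
    rcases hsh w hw (t1.mono Finset.inter_subset_right) (t2.mono Finset.inter_subset_right) with h | h
    · exact h1 h
    · exact h2 h
  have huv : par (y ∩ q1) u = par (y ∩ q1) v := by
    have := hG.handshake (z := y ∩ q1) (Finset.inter_subset_right.trans a1.sub)
    rw [← Finset.sum_subset (s₁ := {u, v}) (by
      intro x hx
      rcases Finset.mem_insert.1 hx with h | h
      · rw [h]; exact a1.hu
      · rw [Finset.mem_singleton.1 h]; exact a1.hv) (by
      intro x hx hx'
      simp only [Finset.mem_insert, Finset.mem_singleton, not_or] at hx'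
      exact hz1 x hx hx'.1 hx'.2), Finset.sum_pair a1.ne] at this
    revert this
    generalize par (y ∩ q1) u = a
    generalize par (y ∩ q1) v = b
    revert a b; decide
  rcases z2 (par (y ∩ q1) u) with h0 | h0
  · have e1 : y ∩ q1 = ∅ := a1.ac _ Finset.inter_subset_right (by
      intro w hw
      by_cases h1 : w = u
      · rw [h1]; exact h0
      by_cases h2 : w = v
      · rw [h2, ← huv]; exact h0
      exact hz1 w hw h1 h2)
    have e2 : y ∩ q2 = ∅ := a2.ac _ Finset.inter_subset_right (by
      intro w hw
      have := hsum w hw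
      rwa [e1, par_empty, zero_add] at this)
    left
    rw [← hyy, e1, e2]; rfl
  · have hb : Bd V (y ∩ q1) u v := by
      intro w hw
      by_cases h1 : w = u
      · rw [h1, h0, if_pos rfl, if_neg a1.ne, add_zero]
      by_cases h2 : w = v
      · rw [h2, ← huv, h0, if_pos rfl, if_neg a1.ne.symm, zero_add]
      rw [hz1 w hw h1 h2, if_neg h1, if_neg h2, add_zero]
    have hb2 : Bd V (y ∩ q2) u v := by
      intro w hw
      rw [← hb w hw]
      have := hsum w hw
      revert this
      generalize par (y ∩ q1) w = a
      generalize par (y ∩ q2) w = b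
      revert a b; decide
    have e1 := a1.ac (q1 \ (y ∩ q1)) Finset.sdiff_subset (a1.bd.sdiff hb Finset.inter_subset_right).self_even
    have e2 := a2.ac (q2 \ (y ∩ q2)) Finset.sdiff_subset (a2.bd.sdiff hb2 Finset.inter_subset_right).self_even
    right
    rw [Finset.sdiff_eq_empty_iff_subset] at e1 e2
    apply Finset.Subset.antisymm hy
    exact Finset.union_subset (e1.trans Finset.inter_subset_left) (e2.trans Finset.inter_subset_left)

/-- minimal connecting sets are arcs; `P`,`Q` describe allowed ends and `B` the forbidden interior vertices -/
theorem Graph.min_arc (hG : Graph E V) (h : Finset (Finset L)) (hE : h ⊆ E) (Rel : Finset L → Finset L → Prop)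
    (hr : ∀ x y, Rel x y → x ≠ y) (Bad : Finset L → Prop)
    (hBad : ∀ x y m, Rel x y → Bad m → Touch h m → m ≠ x → m ≠ y → Rel x m ∨ Rel m y)
    (hex : ∃ x ∈ V, ∃ y ∈ V, Rel x y ∧ ∃ z ⊆ h, Bd V z x y) :
    ∃ x y z, Rel x y ∧ z ⊆ h ∧ Arc E V z x y ∧ ∀ m ∈ V, Touch z m → Bad m → m = x ∨ m = y := by
  classical
  have hex' : ∃ n : ℕ, ∃ x ∈ V, ∃ y ∈ V, Rel x y ∧ ∃ z ⊆ h, Bd V z x y ∧ z.card = n := by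
    obtain ⟨x, hx, y, hy, hR, z, hz, hb⟩ := hex
    exact ⟨_, x, hx, y, hy, hR, z, hz, hb, rfl⟩
  obtain ⟨x, hx, y, hy, hR, z, hz, hb, hn⟩ := Nat.find_spec hex'
  have hmin := fun m hm => Nat.find_min (m := m) hex' hm
  rw [← hn] at hmin
  have harc : Arc E V z x y := by
    refine ⟨hz.trans hE, hx, hy, hr _ _ hR, hb, ?_⟩
    intro w hw hev
    by_contra hne
    have hpos := Finset.card_pos.2 (Finset.nonempty_iff_ne_empty.2 hne)
    have hc := Finset.card_sdiff_add_card_eq_card hw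
    exact hmin (z \ w).card (by omega) ⟨x, hx, y, hy, hR, z \ w, Finset.sdiff_subset.trans hz,
      hb.sdiff_even hev hw, rfl⟩
  refine ⟨x, y, z, hR, hz, harc, ?_⟩
  intro m hm ht hB
  by_contra hc
  push Not at hc
  obtain ⟨z1, z2, hzz, hd, a1, a2, -⟩ := harc.split hG hm ht hc.1 hc.2
  have hcard : z1.card + z2.card = z.card := by rw [← hzz, Finset.card_union_of_disjoint hd]
  have p1 := a1.nonempty.card_pos
  have p2 := a2.nonempty.card_pos
  have s1 : z1 ⊆ z := by rw [← hzz]; exact Finset.subset_union_left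
  have s2 : z2 ⊆ z := by rw [← hzz]; exact Finset.subset_union_right
  rcases hBad x y m hR hB (ht.mono hz) hc.1 hc.2 with h1 | h1
  · exact hmin z1.card (by omega) ⟨x, hx, m, hm, h1, z1, s1.trans hz, a1.bd, rfl⟩
  · exact hmin z2.card (by omega) ⟨m, hm, y, hy, h1, z2, s2.trans hz, a2.bd, rfl⟩

end graph
end ABCT
end

section
open Set Metric Filter Topology

namespace ABCT

section surf
set_option linter.unusedSectionVars false
set_option linter.unusedVariables false
variable {L : Type*} [DecidableEq L]

structure Surf (L : Type*) [DecidableEq L] where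
  F : Finset (Finset L)
  E : Finset (Finset L)
  V : Finset (Finset L)
  cF : ∀ f ∈ F, f.card = 2
  cE : ∀ f ∈ E, f.card = 3
  cV : ∀ f ∈ V, f.card = 4
  S1 : Graph E V
  S2 : ∀ e ∈ E, ∃ f ∈ F, ∃ g ∈ F, f ≠ g ∧ ∀ h ∈ F, h ⊆ e ↔ h = f ∨ h = g
  S3 : ∀ f ∈ F, ∀ v ∈ V, f ⊆ v → ∃ e ∈ E, ∃ e' ∈ E, e ≠ e' ∧ ∀ d ∈ E, (f ⊆ d ∧ d ⊆ v) ↔ d = e ∨ d = e'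
  S4 : ∀ 𝓖 ⊆ F, ∀ v ∈ V, (∀ e ∈ E, e ⊆ v → par 𝓖 e = 0) →
    (∀ f ∈ F, f ⊆ v → f ∈ 𝓖) ∨ (∀ f ∈ F, f ⊆ v → f ∉ 𝓖)
  S5 : ∀ z ⊆ E, Even' V z → ∃ 𝓖 ⊆ F, ∀ e ∈ E, par 𝓖 e = if e ∈ z then 1 else 0
  S6 : ∀ 𝓖 ⊆ F, (∀ e ∈ E, par 𝓖 e = 0) → 𝓖 = ∅ ∨ 𝓖 = F
  S7 : ∀ f ∈ F, ∀ z ⊆ E, (∀ e ∈ z, f ⊆ e) → Even' V z → z = ∅ ∨ (∀ e ∈ E, f ⊆ e → e ∈ z)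
  S8 : ∀ f ∈ F, ∃ e ∈ E, f ⊆ e

structure Disc (S : Surf L) (𝓕 c : Finset (Finset L)) : Prop where
  sub : 𝓕 ⊆ S.F
  cyc : Cyc S.E S.V c
  dl : ∀ e ∈ S.E, par 𝓕 e = if e ∈ c then 1 else 0

variable {S : Surf L}

theorem sum_two {T : Finset (Finset L)} {P : Finset L → Prop} [DecidablePred P] {a b : Finset L}
    (ha : a ∈ T) (hb : b ∈ T) (hne : a ≠ b) (h : ∀ d ∈ T, P d ↔ d = a ∨ d = b) (g : Finset L → ZMod 2) :
    ∑ d ∈ T, (if P d then g d else 0) = g a + g b := by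
  rw [← Finset.sum_filter]
  have : T.filter P = {a, b} := by
    ext d
    rw [Finset.mem_filter, Finset.mem_insert, Finset.mem_singleton]
    constructor
    · rintro ⟨h1, h2⟩; exact (h d h1).1 h2
    · rintro (rfl | rfl)
      · exact ⟨ha, (h _ ha).2 (Or.inl rfl)⟩
      · exact ⟨hb, (h _ hb).2 (Or.inr rfl)⟩
  rw [this, Finset.sum_pair hne]

theorem Surf.dd (S : Surf L) (𝓖 : Finset (Finset L)) (h𝓖 : 𝓖 ⊆ S.F) :
    Even' S.V (S.E.filter fun e => par 𝓖 e = 1) := by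
  intro v hv
  have e1 : par (S.E.filter fun e => par 𝓖 e = 1) v = ∑ e ∈ S.E, (if e ⊆ v then par 𝓖 e else 0) := by
    unfold par
    rw [Finset.sum_filter]
    apply Finset.sum_congr rfl
    intro e he
    rcases z2 (par 𝓖 e) with h | h
    · unfold par at h; rw [h]; simp
    · unfold par at h; rw [h]; simp
  have e2 : ∀ e ∈ S.E, (if e ⊆ v then par 𝓖 e else 0) = ∑ f ∈ 𝓖, if f ⊆ e ∧ e ⊆ v then (1:ZMod 2) else 0 := by
    intro e he
    by_cases h : e ⊆ v
    · simp only [h, if_true, and_true]; rfl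
    · simp [h]
  rw [e1, Finset.sum_congr rfl e2, Finset.sum_comm]
  apply Finset.sum_eq_zero
  intro f hf
  by_cases hfv : f ⊆ v
  · obtain ⟨e, he, e', he', hne, h⟩ := S.S3 f (h𝓖 hf) v hv hfv
    rw [sum_two he he' hne h (fun _ => 1)]; decide
  · apply Finset.sum_eq_zero
    intro e _
    rw [if_neg]
    rintro ⟨h1, h2⟩; exact hfv (h1.trans h2)

theorem Surf.par_two (S : Surf L) {e : Finset L} (he : e ∈ S.E) : ∃ f ∈ S.F, ∃ g ∈ S.F, f ≠ g ∧
    (∀ h ∈ S.F, h ⊆ e ↔ h = f ∨ h = g) ∧ ∀ 𝓖 ⊆ S.F, par 𝓖 e = (if f ∈ 𝓖 then 1 else 0) + (if g ∈ 𝓖 then 1 else 0) := by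
  obtain ⟨f, hf, g, hg, hne, h⟩ := S.S2 e he
  refine ⟨f, hf, g, hg, hne, h, ?_⟩
  intro 𝓖 h𝓖
  have : par 𝓖 e = ∑ d ∈ S.F, if d ⊆ e then (if d ∈ 𝓖 then 1 else 0) else 0 := by
    unfold par
    rw [← Finset.sum_subset h𝓖]
    · apply Finset.sum_congr rfl
      intro d hd; rw [if_pos hd]
    · intro d _ hd; rw [if_neg hd]; simp
  rw [this, sum_two hf hg hne h]

theorem Surf.par_F (S : Surf L) {e : Finset L} (he : e ∈ S.E) : par S.F e = 0 := by
  obtain ⟨f, hf, g, hg, -, -, h⟩ := S.par_two he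
  rw [h _ Finset.Subset.rfl, if_pos hf, if_pos hg]; decide

theorem Surf.eq_union (S : Surf L) {e f g : Finset L} (he : e ∈ S.E) (hf : f ∈ S.F) (hg : g ∈ S.F)
    (hne : f ≠ g) (hfe : f ⊆ e) (hge : g ⊆ e) : f ∪ g = e := by
  apply Finset.eq_of_subset_of_card_le (Finset.union_subset hfe hge)
  rw [S.cE e he]
  by_contra hc
  push Not at hc
  have h1 : f = f ∪ g := Finset.eq_of_subset_of_card_le Finset.subset_union_left (by rw [S.cF f hf]; omega)
  have h2 : g = f ∪ g := Finset.eq_of_subset_of_card_le Finset.subset_union_right (by rw [S.cF g hg]; omega)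
  exact hne (h1.trans h2.symm)

theorem Surf.unique_dl (S : Surf L) {𝓖 𝓗 : Finset (Finset L)} (h1 : 𝓖 ⊆ S.F) (h2 : 𝓗 ⊆ S.F)
    (h : ∀ e ∈ S.E, par 𝓖 e = par 𝓗 e) : 𝓖 = 𝓗 ∨ 𝓖 = S.F \ 𝓗 := by
  have hd : Disjoint (𝓖 \ 𝓗) (𝓗 \ 𝓖) := Finset.disjoint_left.2 (by
    intro x hx hx'; rw [Finset.mem_sdiff] at hx hx'; exact hx.2 hx'.1)
  have hpar : ∀ e ∈ S.E, par (𝓖 \ 𝓗 ∪ 𝓗 \ 𝓖) e = 0 := by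
    intro e he
    rw [par_union hd]
    have a1 := par_inter_sdiff 𝓖 𝓗 e
    have a2 := par_inter_sdiff 𝓗 𝓖 e
    rw [Finset.inter_comm] at a2
    rw [h e he] at a1
    rw [a1] at a2
    have := add_left_cancel a2
    rw [this, z2_add]
  rcases S.S6 _ (Finset.union_subset (Finset.sdiff_subset.trans h1) (Finset.sdiff_subset.trans h2)) hpar with h | h
  · left
    rw [Finset.union_eq_empty, Finset.sdiff_eq_empty_iff_subset, Finset.sdiff_eq_empty_iff_subset] at h
    exact Finset.Subset.antisymm h.1 h.2
  · right
    ext x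
    have hx : x ∈ (𝓖 \ 𝓗 ∪ 𝓗 \ 𝓖) ↔ x ∈ S.F := by rw [h]
    simp only [Finset.mem_union, Finset.mem_sdiff] at hx ⊢
    have := @h1 x
    have := @h2 x
    tauto

/-- combinatorial cut -/
theorem Disc.cut {𝓕 c p : Finset (Finset L)} {a b : Finset L} (hD : Disc S 𝓕 c) (hp : Arc S.E S.V p a b)
    (ta : Touch c a) (tb : Touch c b) (hpc : ∀ e ∈ p, e ∉ c) (hin : ∀ e ∈ p, ∃ f ∈ 𝓕, f ⊆ e)
    (hintr : ∀ m ∈ S.V, Touch p m → Touch c m → m = a ∨ m = b) :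
    ∃ q1 q2 𝓖1 𝓖2, q1 ∪ q2 = c ∧ Disjoint q1 q2 ∧ Arc S.E S.V q1 a b ∧ Arc S.E S.V q2 a b ∧
      (∀ w ∈ S.V, Touch q1 w → Touch q2 w → w = a ∨ w = b) ∧
      𝓖1 ∪ 𝓖2 = 𝓕 ∧ Disjoint 𝓖1 𝓖2 ∧ Disc S 𝓖1 (p ∪ q1) ∧ Disc S 𝓖2 (p ∪ q2) := by
  obtain ⟨q1, q2, hq, hd, a1, a2, hsh⟩ := hD.cyc.split S.S1 hp.hu hp.hv hp.ne ta tb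
  have s1 : q1 ⊆ c := by rw [← hq]; exact Finset.subset_union_left
  have s2 : q2 ⊆ c := by rw [← hq]; exact Finset.subset_union_right
  have dp1 : Disjoint p q1 := Finset.disjoint_left.2 fun e h h' => hpc e h (s1 h')
  have dp2 : Disjoint p q2 := Finset.disjoint_left.2 fun e h h' => hpc e h (s2 h')
  have cy1 := cyc_of_arcs S.S1 hp a1 dp1 (fun w hw t t' => hintr w hw t (t'.mono s1))
  have cy2 := cyc_of_arcs S.S1 hp a2 dp2 (fun w hw t t' => hintr w hw t (t'.mono s2))
  have hFne : 𝓕.Nonempty := by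
    obtain ⟨e, he⟩ := hD.cyc.ne
    have := hD.dl e (hD.cyc.sub he)
    rw [if_pos he] at this
    obtain ⟨f, hf, -⟩ := exists_of_par (s := 𝓕) (x := e) (by rw [this]; exact z2_10)
    exact ⟨f, hf⟩
  have key : ∃ 𝓖 ⊆ 𝓕, ∀ e ∈ S.E, par 𝓖 e = if e ∈ p ∪ q1 then 1 else 0 := by
    obtain ⟨𝓖, h𝓖, hdl⟩ := S.S5 _ cy1.sub cy1.ev
    set 𝓗 := 𝓖 \ 𝓕 with h𝓗
    have h𝓗F : 𝓗 ⊆ S.F := Finset.sdiff_subset.trans h𝓖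
    have hsubc : ∀ e ∈ S.E, e ∉ c → par 𝓗 e = 0 := by
      intro e he hec
      obtain ⟨f, hf, g, hg, hfg, hinc, hpar⟩ := S.par_two he
      have h1 := hD.dl e he
      rw [if_neg hec, hpar _ hD.sub] at h1
      have h2 := hdl e he
      rw [hpar _ h𝓖] at h2
      rw [hpar _ h𝓗F]
      by_cases hfF : f ∈ 𝓕
      · have hgF : g ∈ 𝓕 := by
          by_contra hg'
          rw [if_pos hfF, if_neg hg'] at h1
          revert h1; decide
        simp [h𝓗, hfF, hgF]
      · have hgF : g ∉ 𝓕 := by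
          intro hg'
          rw [if_neg hfF, if_pos hg'] at h1
          revert h1; decide
        have hepq : e ∉ p ∪ q1 := by
          intro h
          rcases Finset.mem_union.1 h with h | h
          · obtain ⟨f', hf', hfe⟩ := hin e h
            rcases (hinc f' (hD.sub hf')).1 hfe with rfl | rfl
            · exact hfF hf'
            · exact hgF hf'
          · exact hec (s1 h)
        rw [if_neg hepq] at h2
        simpa [h𝓗, hfF, hgF] using h2
    have hev := S.dd 𝓗 h𝓗F
    have hss : (S.E.filter fun e => par 𝓗 e = 1) ⊆ c := by
      intro e he
      rw [Finset.mem_filter] at he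
      by_contra hc
      have := hsubc e he.1 hc
      rw [this] at he
      exact z2_10 he.2.symm
    rcases hD.cyc.min _ hss hev with h0 | h0
    · have hz : ∀ e ∈ S.E, par 𝓗 e = 0 := by
        intro e he
        by_contra hc
        have : e ∈ (S.E.filter fun e => par 𝓗 e = 1) := Finset.mem_filter.2 ⟨he, z2_ne hc⟩
        rw [h0] at this; simp at this
      rcases S.S6 _ h𝓗F hz with h1 | h1
      · exact ⟨𝓖, Finset.sdiff_eq_empty_iff_subset.1 h1, hdl⟩
      · exfalso
        obtain ⟨f, hf⟩ := hFne
        have : f ∈ 𝓗 := by rw [h1]; exact hD.sub hf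
        rw [h𝓗, Finset.mem_sdiff] at this
        exact this.2 hf
    · have hz : ∀ e ∈ S.E, par 𝓗 e = par 𝓕 e := by
        intro e he
        rw [hD.dl e he]
        by_cases hec : e ∈ c
        · rw [if_pos hec]
          rw [← h0, Finset.mem_filter] at hec
          exact hec.2
        · rw [if_neg hec]; exact hsubc e he hec
      have hFc : 𝓗 = S.F \ 𝓕 := by
        rcases S.unique_dl h𝓗F hD.sub hz with h1 | h1
        · exfalso
          obtain ⟨f, hf⟩ := hFne
          have : f ∈ 𝓗 := by rw [h1]; exact hf
          rw [h𝓗, Finset.mem_sdiff] at this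
          exact this.2 hf
        · exact h1
      refine ⟨S.F \ 𝓖, ?_, ?_⟩
      · intro f hf
        rw [Finset.mem_sdiff] at hf
        by_contra hc
        have : f ∈ 𝓗 := by rw [hFc]; exact Finset.mem_sdiff.2 ⟨hf.1, hc⟩
        rw [h𝓗, Finset.mem_sdiff] at this
        exact hf.2 this.1
      · intro e he
        rw [par_sdiff h𝓖, S.par_F he, zero_add, hdl e he]
  obtain ⟨𝓖, h𝓖, hdl⟩ := key
  refine ⟨q1, q2, 𝓖, 𝓕 \ 𝓖, hq, hd, a1, a2, hsh, Finset.union_sdiff_of_subset h𝓖, Finset.disjoint_sdiff,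
    ⟨h𝓖.trans hD.sub, cy1, hdl⟩, ⟨Finset.sdiff_subset.trans hD.sub, cy2, ?_⟩⟩
  intro e he
  rw [par_sdiff h𝓖, hD.dl e he, hdl e he]
  by_cases hp' : e ∈ p
  · simp [hp', hpc e hp']
  · by_cases h1 : e ∈ q1
    · have h2 : e ∉ q2 := Finset.disjoint_left.1 hd h1
      simp [hp', h1, h2, s1 h1]; decide
    · by_cases h2 : e ∈ q2
      · simp [hp', h1, h2, s2 h2]
      · have : e ∉ c := by rw [← hq]; simp [h1, h2]
        simp [hp', h1, h2, this]

section real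
variable {α : Type*} [MetricSpace α]

structure Rz (S : Surf L) (X : Finset L → Set α) : Prop where
  cpt : ∀ s, s.Nonempty → IsCompact (X s)
  R1 : ∀ s t, X s ∩ X t = X (s ∪ t)
  R2 : ∀ f ∈ S.F, ∀ s, f ⊆ s → (X s).Nonempty → s ∈ S.F ∨ s ∈ S.E ∨ s ∈ S.V
  R3 : ∀ v ∈ S.V, ∃ p, X v = {p}

def re (X : Finset L → Set α) (z : Finset (Finset L)) : Set α := ⋃ e ∈ z, X e

theorem mem_re {X : Finset L → Set α} {z : Finset (Finset L)} {x : α} : x ∈ re X z ↔ ∃ e ∈ z, x ∈ X e := by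
  simp [re]

theorem re_union (X : Finset L → Set α) (z z' : Finset (Finset L)) : re X (z ∪ z') = re X z ∪ re X z' := by
  ext x
  simp only [mem_re, Finset.mem_union, mem_union]
  constructor
  · rintro ⟨e, h | h, hx⟩
    · exact Or.inl ⟨e, h, hx⟩
    · exact Or.inr ⟨e, h, hx⟩
  · rintro (⟨e, h, hx⟩ | ⟨e, h, hx⟩)
    · exact ⟨e, Or.inl h, hx⟩
    · exact ⟨e, Or.inr h, hx⟩

theorem re_mono (X : Finset L → Set α) {z z' : Finset (Finset L)} (h : z ⊆ z') : re X z ⊆ re X z' := by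
  intro x hx
  obtain ⟨e, he, hx⟩ := mem_re.1 hx
  exact mem_re.2 ⟨e, h he, hx⟩

variable {X : Finset L → Set α}

theorem Rz.mono (h : Rz S X) {s t : Finset L} (hst : s ⊆ t) : X t ⊆ X s := by
  have := h.R1 s t
  rw [Finset.union_eq_right.2 hst] at this
  rw [← this]; exact inter_subset_left

theorem Rz.touch_mem (h : Rz S X) {z : Finset (Finset L)} {w : Finset L} (ht : Touch z w) : X w ⊆ re X z := by
  obtain ⟨e, he, hew⟩ := ht
  intro x hx
  exact mem_re.2 ⟨e, he, h.mono hew hx⟩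

theorem Rz.v_ne (h : Rz S X) {v : Finset L} (hv : v ∈ S.V) : (X v).Nonempty := by
  obtain ⟨p, hp⟩ := h.R3 v hv; rw [hp]; exact singleton_nonempty p

theorem Rz.face_of_edge (S : Surf L) {e : Finset L} (he : e ∈ S.E) : ∃ f ∈ S.F, f ⊆ e := by
  obtain ⟨f, hf, g, hg, -, h⟩ := S.S2 e he
  exact ⟨f, hf, (h f hf).2 (Or.inl rfl)⟩

theorem Rz.ee (h : Rz S X) {e e' : Finset L} (he : e ∈ S.E) (he' : e' ∈ S.E) (hne : e ≠ e') {x : α}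
    (hx : x ∈ X e) (hx' : x ∈ X e') : e ∪ e' ∈ S.V ∧ x ∈ X (e ∪ e') := by
  have hu : x ∈ X (e ∪ e') := by rw [← h.R1]; exact ⟨hx, hx'⟩
  refine ⟨?_, hu⟩
  obtain ⟨f, hf, hfe⟩ := Rz.face_of_edge S he
  have hc : 3 < (e ∪ e').card := by
    by_contra hc
    push Not at hc
    have h1 : e = e ∪ e' := Finset.eq_of_subset_of_card_le Finset.subset_union_left (by rw [S.cE e he]; omega)
    have h2 : e' = e ∪ e' := Finset.eq_of_subset_of_card_le Finset.subset_union_right (by rw [S.cE e' he']; omega)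
    exact hne (h1.trans h2.symm)
  rcases h.R2 f hf _ (hfe.trans Finset.subset_union_left) ⟨x, hu⟩ with h1 | h1 | h1
  · rw [S.cF _ h1] at hc; omega
  · rw [S.cE _ h1] at hc; omega
  · exact h1

theorem Rz.fe (h : Rz S X) {f e : Finset L} (hf : f ∈ S.F) (he : e ∈ S.E) (hne : ¬ f ⊆ e) {x : α}
    (hx : x ∈ X f) (hx' : x ∈ X e) : f ∪ e ∈ S.V ∧ x ∈ X (f ∪ e) := by
  have hu : x ∈ X (f ∪ e) := by rw [← h.R1]; exact ⟨hx, hx'⟩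
  refine ⟨?_, hu⟩
  have hc : 3 < (f ∪ e).card := by
    by_contra hc
    push Not at hc
    have h1 : e = f ∪ e := Finset.eq_of_subset_of_card_le Finset.subset_union_right (by rw [S.cE e he]; omega)
    apply hne
    conv_rhs => rw [h1]
    exact Finset.subset_union_left
  rcases h.R2 f hf _ Finset.subset_union_left ⟨x, hu⟩ with h1 | h1 | h1
  · rw [S.cF _ h1] at hc; omega
  · rw [S.cE _ h1] at hc; omega
  · exact h1

theorem Rz.ff (h : Rz S X) {f g : Finset L} (hf : f ∈ S.F) (hg : g ∈ S.F) (hne : f ≠ g) {x : α}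
    (hx : x ∈ X f) (hx' : x ∈ X g) : (f ∪ g ∈ S.E ∨ f ∪ g ∈ S.V) ∧ x ∈ X (f ∪ g) := by
  have hu : x ∈ X (f ∪ g) := by rw [← h.R1]; exact ⟨hx, hx'⟩
  refine ⟨?_, hu⟩
  have hc : 2 < (f ∪ g).card := by
    by_contra hc
    push Not at hc
    have h1 : f = f ∪ g := Finset.eq_of_subset_of_card_le Finset.subset_union_left (by rw [S.cF f hf]; omega)
    have h2 : g = f ∪ g := Finset.eq_of_subset_of_card_le Finset.subset_union_right (by rw [S.cF g hg]; omega)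
    exact hne (h1.trans h2.symm)
  rcases h.R2 f hf _ Finset.subset_union_left ⟨x, hu⟩ with h1 | h1 | h1
  · rw [S.cF _ h1] at hc; omega
  · exact Or.inl h1
  · exact Or.inr h1

theorem Rz.edge_of_v (S : Surf L) {v f : Finset L} (hv : v ∈ S.V) (hf : f ∈ S.F) (hfv : f ⊆ v) :
    ∃ e ∈ S.E, f ⊆ e ∧ e ⊆ v := by
  obtain ⟨e, he, e', he', -, h⟩ := S.S3 f hf v hv hfv
  exact ⟨e, he, (h e he).2 (Or.inl rfl)⟩

theorem Rz.vinj (h : Rz S X) {v w f : Finset L} (hv : v ∈ S.V) (hw : w ∈ S.V) (hf : f ∈ S.F) (hfv : f ⊆ v) {x : α}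
    (hx : x ∈ X v) (hx' : x ∈ X w) : v = w := by
  have hu : x ∈ X (v ∪ w) := by rw [← h.R1]; exact ⟨hx, hx'⟩
  have hc : (v ∪ w).card ≤ 4 := by
    rcases h.R2 f hf _ (hfv.trans Finset.subset_union_left) ⟨x, hu⟩ with h1 | h1 | h1
    · rw [S.cF _ h1]; omega
    · rw [S.cE _ h1]; omega
    · rw [S.cV _ h1]
  have h1 : v = v ∪ w := Finset.eq_of_subset_of_card_le Finset.subset_union_left (by rw [S.cV v hv]; omega)
  have h2 : w = v ∪ w := Finset.eq_of_subset_of_card_le Finset.subset_union_right (by rw [S.cV w hw]; omega)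
  exact h1.trans h2.symm

theorem Rz.touch_face (S : Surf L) {z : Finset (Finset L)} (hz : z ⊆ S.E) {v : Finset L} (ht : Touch z v) :
    ∃ f ∈ S.F, f ⊆ v := by
  obtain ⟨e, he, hev⟩ := ht
  obtain ⟨f, hf, hfe⟩ := Rz.face_of_edge S (hz he)
  exact ⟨f, hf, hfe.trans hev⟩

theorem Rz.re_inter (h : Rz S X) {z z' : Finset (Finset L)} (hz : z ⊆ S.E) (hz' : z' ⊆ S.E) (hd : Disjoint z z')
    {x : α} (hx : x ∈ re X z) (hx' : x ∈ re X z') : ∃ v ∈ S.V, x ∈ X v ∧ Touch z v ∧ Touch z' v := by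
  obtain ⟨e, he, hx⟩ := mem_re.1 hx
  obtain ⟨e', he', hx'⟩ := mem_re.1 hx'
  have hne : e ≠ e' := by rintro rfl; exact Finset.disjoint_left.1 hd he he'
  obtain ⟨hv, hxv⟩ := h.ee (hz he) (hz' he') hne hx hx'
  exact ⟨_, hv, hxv, ⟨e, he, Finset.subset_union_left⟩, ⟨e', he', Finset.subset_union_right⟩⟩

theorem Rz.re_compact (h : Rz S X) {z : Finset (Finset L)} (hz : ∀ e ∈ z, e.Nonempty) : IsCompact (re X z) :=
  z.isCompact_biUnion fun e he => h.cpt e (hz e he)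

theorem Surf.F_ne (S : Surf L) {f : Finset L} (h : f ∈ S.F) : f.Nonempty := by
  rw [← Finset.card_pos, S.cF f h]; omega
theorem Surf.E_ne (S : Surf L) {f : Finset L} (h : f ∈ S.E) : f.Nonempty := by
  rw [← Finset.card_pos, S.cE f h]; omega

/-- geometric cut, given that the arcs of the boundary and the cutting arc are topological arcs -/
theorem Rz.cut (h : Rz S X) {𝓕 c p q1 q2 𝓖1 𝓖2 : Finset (Finset L)} {a b : Finset L} {pa pb : α}
    (hD : Disc S 𝓕 c) (hp : Arc S.E S.V p a b)
    (hpc : ∀ e ∈ p, e ∉ c)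
    (hintr : ∀ m ∈ S.V, Touch p m → Touch c m → m = a ∨ m = b)
    (hq : q1 ∪ q2 = c) (hd : Disjoint q1 q2) (a1 : Arc S.E S.V q1 a b) (a2 : Arc S.E S.V q2 a b)
    (hsh : ∀ w ∈ S.V, Touch q1 w → Touch q2 w → w = a ∨ w = b)
    (hFF : 𝓖1 ∪ 𝓖2 = 𝓕) (hdF : Disjoint 𝓖1 𝓖2) (D1 : Disc S 𝓖1 (p ∪ q1)) (D2 : Disc S 𝓖2 (p ∪ q2))
    (ha : X a = {pa}) (hb : X b = {pb}) (hγ : IsArc (re X p) pa pb) (hq1 : IsArc (re X q1) pa pb)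
    (hq2 : IsArc (re X q2) pa pb) :
    IsCut (re X 𝓕) (re X c) (re X p) pa pb (re X 𝓖1) (re X (p ∪ q1)) (re X 𝓖2) (re X (p ∪ q2)) := by
  have s1 : q1 ⊆ c := by rw [← hq]; exact Finset.subset_union_left
  have s2 : q2 ⊆ c := by rw [← hq]; exact Finset.subset_union_right
  have ext : ∀ {𝓖 k : Finset (Finset L)}, Disc S 𝓖 k → re X k ⊆ re X 𝓖 := by
    intro 𝓖 k hDk x hx
    obtain ⟨e, he, hx⟩ := mem_re.1 hx
    have := hDk.dl e (hDk.cyc.sub he)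
    rw [if_pos he] at this
    obtain ⟨f, hf, hfe⟩ := exists_of_par (s := 𝓖) (x := e) (by rw [this]; exact z2_10)
    exact mem_re.2 ⟨f, hf, h.mono hfe hx⟩
  have hpa : pa ∈ X a := by rw [ha]; rfl
  have hpb : pb ∈ X b := by rw [hb]; rfl
  have sides : ∀ {q q' 𝓖 𝓖' : Finset (Finset L)}, q ∪ q' = c → Disjoint q q' → Disc S 𝓖 (p ∪ q) → 𝓖 ⊆ 𝓕 →
      Arc S.E S.V q a b → re X c ∩ re X 𝓖 = re X q := by
    intro q q' 𝓖 𝓖' hqq hdq hDq h𝓖 aq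
    have sq : q ⊆ c := by rw [← hqq]; exact Finset.subset_union_left
    apply Subset.antisymm
    · rintro x ⟨hx1, hx2⟩
      obtain ⟨e, he, hxe⟩ := mem_re.1 hx1
      obtain ⟨f, hf, hxf⟩ := mem_re.1 hx2
      by_cases heq : e ∈ q
      · exact mem_re.2 ⟨e, heq, hxe⟩
      have heE := hD.cyc.sub he
      have hepq : e ∉ p ∪ q := by
        rw [Finset.mem_union]
        rintro (h' | h')
        · exact hpc e h' he
        · exact heq h'
      obtain ⟨f0, hf0, g0, hg0, hfg, hinc, hpar⟩ := S.par_two heE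
      -- not all faces of e lie in 𝓖
      have nall : ¬ (f0 ∈ 𝓖 ∧ g0 ∈ 𝓖) := by
        rintro ⟨h1, h2⟩
        have h3 := hD.dl e heE
        rw [if_pos he, hpar _ hD.sub, if_pos (h𝓖 h1), if_pos (h𝓖 h2)] at h3
        revert h3; decide
      by_cases hfe : f ⊆ e
      · exfalso
        have h3 := hDq.dl e heE
        rw [if_neg hepq, hpar _ hDq.sub] at h3
        rcases (hinc f (hDq.sub hf)).1 hfe with rfl | rfl
        · rw [if_pos hf] at h3
          apply nall
          refine ⟨hf, ?_⟩
          by_contra hg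
          rw [if_neg hg] at h3; revert h3; decide
        · rw [if_pos hf] at h3
          apply nall
          refine ⟨?_, hf⟩
          by_contra hg
          rw [if_neg hg] at h3; revert h3; decide
      · obtain ⟨hv, hxv⟩ := h.fe (hDq.sub hf) heE hfe hxf hxe
        by_cases tq : Touch q (f ∪ e)
        · exact h.touch_mem tq hxv
        exfalso
        have tc : Touch c (f ∪ e) := ⟨e, he, Finset.subset_union_right⟩
        have tp : ¬ Touch p (f ∪ e) := by
          intro tp
          rcases hintr _ hv tp tc with h' | h'
          · rw [h'] at tq; exact tq aq.tu
          · rw [h'] at tq; exact tq aq.tv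
        rcases S.S4 𝓖 hDq.sub (f ∪ e) hv (by
          intro e' he' hev'
          rw [hDq.dl e' he', if_neg]
          rw [Finset.mem_union]
          rintro (h' | h')
          · exact tp ⟨e', h', hev'⟩
          · exact tq ⟨e', h', hev'⟩) with hall | hnone
        · apply nall
          exact ⟨hall f0 hf0 (((hinc f0 hf0).2 (Or.inl rfl)).trans Finset.subset_union_right),
            hall g0 hg0 (((hinc g0 hg0).2 (Or.inr rfl)).trans Finset.subset_union_right)⟩
        · exact hnone f (hDq.sub hf) Finset.subset_union_left hf
    · intro x hx
      exact ⟨re_mono X sq hx, ext hDq (re_mono X Finset.subset_union_right hx)⟩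
  have sub1 : 𝓖1 ⊆ 𝓕 := by rw [← hFF]; exact Finset.subset_union_left
  have sub2 : 𝓖2 ⊆ 𝓕 := by rw [← hFF]; exact Finset.subset_union_right
  have e1 := sides (𝓖' := 𝓖2) hq hd D1 sub1 a1
  have e2 := sides (𝓖' := 𝓖1) (by rw [Finset.union_comm]; exact hq) hd.symm D2 sub2 a2
  refine ⟨?_, ?_, ?_, hγ, ?_, ?_, ?_, ?_, ?_⟩
  · intro hab
    rw [← hab] at hpb
    obtain ⟨f, hf, hfa⟩ := Rz.touch_face S hp.sub hp.tu
    exact hp.ne (h.vinj hp.hu hp.hv hf hfa hpa hpb)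
  · rw [← re_union, hFF]
  · apply Subset.antisymm
    · rintro x ⟨hx1, hx2⟩
      obtain ⟨f1, hf1, hxf1⟩ := mem_re.1 hx1
      obtain ⟨f2, hf2, hxf2⟩ := mem_re.1 hx2
      have hne : f1 ≠ f2 := by rintro rfl; exact Finset.disjoint_left.1 hdF hf1 hf2
      obtain ⟨hev, hxu⟩ := h.ff (D1.sub hf1) (D2.sub hf2) hne hxf1 hxf2
      rcases hev with he | hv
      · have he1 : f1 ∪ f2 ∈ p ∪ q1 ∧ f1 ∪ f2 ∈ p ∪ q2 := by
          obtain ⟨f0, hf0, g0, hg0, hfg, hinc, hpar⟩ := S.par_two he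
          have n1 : f1 ∉ 𝓖2 := Finset.disjoint_left.1 hdF hf1
          have n2 : f2 ∉ 𝓖1 := Finset.disjoint_right.1 hdF hf2
          have h1 := D1.dl _ he
          have h2 := D2.dl _ he
          rw [hpar _ D1.sub] at h1
          rw [hpar _ D2.sub] at h2
          rcases (hinc f1 (D1.sub hf1)).1 Finset.subset_union_left with r1 | r1 <;>
          rcases (hinc f2 (D2.sub hf2)).1 Finset.subset_union_right with r2 | r2
          · exact absurd (r1.trans r2.symm) hne
          · rw [← r1, ← r2, if_pos hf1, if_neg n2] at h1
            rw [← r1, ← r2, if_pos hf2, if_neg n1] at h2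
            constructor
            · by_contra hc; rw [if_neg hc] at h1; revert h1; decide
            · by_contra hc; rw [if_neg hc] at h2; revert h2; decide
          · rw [← r1, ← r2, if_pos hf1, if_neg n2] at h1
            rw [← r1, ← r2, if_pos hf2, if_neg n1] at h2
            constructor
            · by_contra hc; rw [if_neg hc] at h1; revert h1; decide
            · by_contra hc; rw [if_neg hc] at h2; revert h2; decide
          · exact absurd (r1.trans r2.symm) hne
        refine mem_re.2 ⟨_, ?_, hxu⟩
        rcases Finset.mem_union.1 he1.1 with h' | h'
        · exact h'
        · rcases Finset.mem_union.1 he1.2 with h'' | h''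
          · exact h''
          · exact absurd h'' (Finset.disjoint_left.1 hd h')
      · by_cases tp : Touch p (f1 ∪ f2)
        · exact h.touch_mem tp hxu
        exfalso
        by_cases t1 : Touch q1 (f1 ∪ f2)
        · have t2 : ¬ Touch q2 (f1 ∪ f2) := by
            intro t2
            rcases hsh _ hv t1 t2 with h' | h'
            · rw [h'] at tp; exact tp hp.tu
            · rw [h'] at tp; exact tp hp.tv
          rcases S.S4 𝓖2 D2.sub (f1 ∪ f2) hv (by
            intro e' he' hev'
            rw [D2.dl e' he', if_neg]
            rw [Finset.mem_union]
            rintro (h' | h')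
            · exact tp ⟨e', h', hev'⟩
            · exact t2 ⟨e', h', hev'⟩) with hall | hnone
          · exact Finset.disjoint_left.1 hdF hf1 (hall f1 (D1.sub hf1) Finset.subset_union_left)
          · exact hnone f2 (D2.sub hf2) Finset.subset_union_right hf2
        · rcases S.S4 𝓖1 D1.sub (f1 ∪ f2) hv (by
            intro e' he' hev'
            rw [D1.dl e' he', if_neg]
            rw [Finset.mem_union]
            rintro (h' | h')
            · exact tp ⟨e', h', hev'⟩
            · exact t1 ⟨e', h', hev'⟩) with hall | hnone
          · exact Finset.disjoint_right.1 hdF hf2 (hall f2 (D2.sub hf2) Finset.subset_union_right)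
          · exact hnone f1 (D1.sub hf1) Finset.subset_union_left hf1
    · exact subset_inter ((re_mono X Finset.subset_union_left).trans (ext D1))
        ((re_mono X Finset.subset_union_left).trans (ext D2))
  · apply Subset.antisymm
    · rintro x ⟨hx1, hx2⟩
      obtain ⟨v, hv, hxv, t1, t2⟩ := h.re_inter hp.sub hD.cyc.sub (Finset.disjoint_left.2 hpc) hx1 hx2
      rcases hintr v hv t1 t2 with rfl | rfl
      · left; rw [ha] at hxv; exact hxv
      · right; rw [hb] at hxv; exact hxv
    · rintro x (rfl | hx)
      · exact ⟨h.touch_mem hp.tu hpa, h.touch_mem (a1.tu.mono s1) hpa⟩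
      · have hx : x = pb := hx
        subst hx
        exact ⟨h.touch_mem hp.tv hpb, h.touch_mem (a1.tv.mono s1) hpb⟩
  · rw [re_union, e1, union_comm]
  · rw [re_union, e2, union_comm]
  · rw [e1]; exact hq1.preconn
  · rw [e2]; exact hq2.preconn

end real
end surf
end ABCT
end

section
open Set Metric Filter Topology

namespace ABCT

section tower
set_option linter.unusedSectionVars false
set_option linter.unusedVariables false
variable {L : Type*} [DecidableEq L] {α : Type*} [MetricSpace α]

def lift (q : L → L) (E' z : Finset (Finset L)) : Finset (Finset L) := E'.filter fun t => t.image q ∈ z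

theorem mem_lift {q : L → L} {E' z : Finset (Finset L)} {t : Finset L} : t ∈ lift q E' z ↔ t ∈ E' ∧ t.image q ∈ z :=
  Finset.mem_filter

theorem lift_union (q : L → L) (E' z1 z2 : Finset (Finset L)) :
    lift q E' (z1 ∪ z2) = lift q E' z1 ∪ lift q E' z2 := by
  ext t; simp only [mem_lift, Finset.mem_union]; tauto

theorem lift_mono (q : L → L) (E' : Finset (Finset L)) {z1 z2 : Finset (Finset L)} (h : z1 ⊆ z2) :
    lift q E' z1 ⊆ lift q E' z2 := by
  intro t ht; rw [mem_lift] at ht ⊢; exact ⟨ht.1, h ht.2⟩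

theorem lift_disj (q : L → L) (E' : Finset (Finset L)) {z1 z2 : Finset (Finset L)} (h : Disjoint z1 z2) :
    Disjoint (lift q E' z1) (lift q E' z2) := by
  rw [Finset.disjoint_left] at h ⊢
  intro t ht ht'; rw [mem_lift] at ht ht'; exact h ht.2 ht'.2

structure Ref (S S' : Surf L) (X X' : Finset L → Set α) (q : L → L) : Prop where
  Q1 : ∀ t, X' t ⊆ X (t.image q)
  QF : ∀ s ∈ S.F, ∀ x ∈ X s, ∃ t ∈ S'.F, t.image q = s ∧ x ∈ X' t
  QE : ∀ s ∈ S.E, ∀ x ∈ X s, ∃ t ∈ S'.E, t.image q = s ∧ x ∈ X' t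
  QV : ∀ s ∈ S.V, ∀ x ∈ X s, ∃ t ∈ S'.V, t.image q = s ∧ x ∈ X' t
  Q2 : ∀ 𝓖 ⊆ S.F, ∀ t ∈ S'.E, par (lift q S'.F 𝓖) t = if t.image q ∈ S.E then par 𝓖 (t.image q) else 0
  Q3 : ∀ z ⊆ S.E, ∀ t ∈ S'.V, par (lift q S'.E z) t = if t.image q ∈ S.V then par z (t.image q) else 0
  Q4 : ∀ e ∈ S.E, ∀ y ⊆ lift q S'.E {e}, (∀ t ∈ S'.V, t.image q = e → par y t = 0) → y = ∅ ∨ y = lift q S'.E {e}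

variable {S S' : Surf L} {X X' : Finset L → Set α} {q : L → L}

theorem Ref.reE (h : Ref S S' X X' q) {z : Finset (Finset L)} (hz : z ⊆ S.E) :
    re X' (lift q S'.E z) = re X z := by
  ext x
  simp only [mem_re, mem_lift]
  constructor
  · rintro ⟨t, ⟨ht, ht'⟩, hx⟩; exact ⟨_, ht', h.Q1 t hx⟩
  · rintro ⟨e, he, hx⟩
    obtain ⟨t, ht, rfl, hx'⟩ := h.QE e (hz he) x hx
    exact ⟨t, ⟨ht, he⟩, hx'⟩

theorem Ref.reF (h : Ref S S' X X' q) {z : Finset (Finset L)} (hz : z ⊆ S.F) :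
    re X' (lift q S'.F z) = re X z := by
  ext x
  simp only [mem_re, mem_lift]
  constructor
  · rintro ⟨t, ⟨ht, ht'⟩, hx⟩; exact ⟨_, ht', h.Q1 t hx⟩
  · rintro ⟨e, he, hx⟩
    obtain ⟨t, ht, rfl, hx'⟩ := h.QF e (hz he) x hx
    exact ⟨t, ⟨ht, he⟩, hx'⟩

theorem Ref.upV (h : Ref S S' X X' q) (hR : Rz S X) (hR' : Rz S' X') {e v : Finset L} (he : e ∈ S.E) (hv : v ∈ S.V)
    (hev : e ⊆ v) : ∃ v' ∈ S'.V, v'.image q = v ∧ (∀ w ∈ S'.V, w.image q = v → w = v') ∧ X' v' = X v := by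
  obtain ⟨p, hp⟩ := hR.R3 v hv
  have key : ∀ w ∈ S'.V, w.image q = v → X' w = X v := by
    intro w hw hwv
    obtain ⟨p', hp'⟩ := hR'.R3 w hw
    have := h.Q1 w
    rw [hwv, hp, hp', singleton_subset_singleton] at this
    rw [hp, hp', this]
  obtain ⟨v', hv', hvv, hpx⟩ := h.QV v hv p (by rw [hp]; rfl)
  refine ⟨v', hv', hvv, ?_, key v' hv' hvv⟩
  intro w hw hwv
  have h3 := h.Q3 {e} (by simpa using he) v' hv'
  rw [hvv, if_pos hv, par_single, if_pos hev] at h3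
  obtain ⟨t, ht, htv⟩ := exists_of_par (by rw [h3]; exact z2_10)
  obtain ⟨f, hf, hft⟩ := Rz.face_of_edge S' (mem_lift.1 ht).1
  exact (hR'.vinj hv' hw hf (hft.trans htv) hpx (by rw [key w hw hwv, hp]; rfl)).symm

theorem Ref.even (h : Ref S S' X X' q) {z : Finset (Finset L)} (hz : z ⊆ S.E) (he : Even' S.V z) :
    Even' S'.V (lift q S'.E z) := by
  intro w hw
  rw [h.Q3 z hz w hw]
  split_ifs with h1
  · exact he _ h1
  · rfl

theorem Ref.bd (h : Ref S S' X X' q) {z : Finset (Finset L)} (hz : z ⊆ S.E) {u v u' v' : Finset L}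
    (hu : u ∈ S.V) (hv : v ∈ S.V)
    (hb : Bd S.V z u v) (hu1 : u'.image q = u) (hu2 : ∀ w ∈ S'.V, w.image q = u → w = u')
    (hv1 : v'.image q = v) (hv2 : ∀ w ∈ S'.V, w.image q = v → w = v') : Bd S'.V (lift q S'.E z) u' v' := by
  intro w hw
  rw [h.Q3 z hz w hw]
  have e1 : w = u' ↔ w.image q = u := ⟨fun h => by rw [h, hu1], hu2 w hw⟩
  have e2 : w = v' ↔ w.image q = v := ⟨fun h => by rw [h, hv1], hv2 w hw⟩
  simp only [e1, e2]
  by_cases h1 : w.image q ∈ S.V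
  · rw [if_pos h1]; exact hb _ h1
  · rw [if_neg h1, if_neg, if_neg, add_zero]
    · intro h2; exact h1 (h2 ▸ hv)
    · intro h2; exact h1 (h2 ▸ hu)

theorem Ref.lift_ne (h : Ref S S' X X' q) (hR : Rz S X) {e : Finset L} (he : e ∈ S.E) : (lift q S'.E {e}).Nonempty := by
  obtain ⟨u, hu, v, hv, hne, hi⟩ := S.S1.two e he
  obtain ⟨x, hx⟩ := hR.v_ne hu
  obtain ⟨t, ht, hte, -⟩ := h.QE e he x (hR.mono ((hi u hu).2 (Or.inl rfl)) hx)
  exact ⟨t, mem_lift.2 ⟨ht, by simp [hte]⟩⟩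

theorem Ref.descend (h : Ref S S' X X' q) (hR : Rz S X) (hR' : Rz S' X') {z y : Finset (Finset L)} (hz : z ⊆ S.E)
    (hy : y ⊆ lift q S'.E z) (hev : Even' S'.V y) : ∃ y' ⊆ z, y = lift q S'.E y' ∧ Even' S.V y' := by
  classical
  have one : ∀ e ∈ z, y ∩ lift q S'.E {e} = ∅ ∨ y ∩ lift q S'.E {e} = lift q S'.E {e} := by
    intro e he
    apply h.Q4 e (hz he) _ Finset.inter_subset_right
    intro t ht hte
    rw [← hev t ht]
    unfold par
    apply Finset.sum_subset Finset.inter_subset_left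
    intro d hd hd'
    rw [if_neg]
    intro hdt
    apply hd'
    have h1 := mem_lift.1 (hy hd)
    refine Finset.mem_inter.2 ⟨hd, mem_lift.2 ⟨h1.1, ?_⟩⟩
    rw [Finset.mem_singleton]
    apply Finset.eq_of_subset_of_card_le
    · rw [← hte]; exact Finset.image_subset_image hdt
    · rw [S.cE e (hz he), S.cE _ (hz h1.2)]
  refine ⟨z.filter fun e => lift q S'.E {e} ⊆ y, Finset.filter_subset _ _, ?_, ?_⟩
  · ext t
    rw [mem_lift, Finset.mem_filter]
    constructor
    · intro ht
      have h1 := mem_lift.1 (hy ht)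
      refine ⟨h1.1, h1.2, ?_⟩
      rcases one _ h1.2 with h2 | h2
      · exfalso
        have : t ∈ y ∩ lift q S'.E {t.image q} := Finset.mem_inter.2 ⟨ht, mem_lift.2 ⟨h1.1, by simp⟩⟩
        rw [h2] at this; simp at this
      · exact Finset.inter_eq_right.1 h2
    · rintro ⟨h1, h2, h3⟩
      exact h3 (mem_lift.2 ⟨h1, by simp⟩)
  · have hyl : y = lift q S'.E (z.filter fun e => lift q S'.E {e} ⊆ y) := by
      ext t
      rw [mem_lift, Finset.mem_filter]
      constructor
      · intro ht
        have h1 := mem_lift.1 (hy ht)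
        refine ⟨h1.1, h1.2, ?_⟩
        rcases one _ h1.2 with h2 | h2
        · exfalso
          have : t ∈ y ∩ lift q S'.E {t.image q} := Finset.mem_inter.2 ⟨ht, mem_lift.2 ⟨h1.1, by simp⟩⟩
          rw [h2] at this; simp at this
        · exact Finset.inter_eq_right.1 h2
      · rintro ⟨h1, h2, h3⟩
        exact h3 (mem_lift.2 ⟨h1, by simp⟩)
    intro v hv
    by_contra hc
    obtain ⟨e, he, hev'⟩ := exists_of_par hc
    have hsub : (z.filter fun e => lift q S'.E {e} ⊆ y) ⊆ S.E := (Finset.filter_subset _ _).trans hz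
    obtain ⟨v', hv', hvv, -, -⟩ := h.upV hR hR' (hsub he) hv hev'
    have h3 := h.Q3 _ hsub v' hv'
    rw [← hyl, hev v' hv', hvv, if_pos hv] at h3
    exact hc h3.symm

theorem Ref.arc (h : Ref S S' X X' q) (hR : Rz S X) (hR' : Rz S' X') {z : Finset (Finset L)} {u v : Finset L}
    (ha : Arc S.E S.V z u v) : ∃ u' v', Arc S'.E S'.V (lift q S'.E z) u' v' ∧ X' u' = X u ∧ X' v' = X v := by
  obtain ⟨e, he, heu⟩ := ha.tu
  obtain ⟨d, hd, hdv⟩ := ha.tv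
  obtain ⟨u', hu', hu1, hu2, hu3⟩ := h.upV hR hR' (ha.sub he) ha.hu heu
  obtain ⟨v', hv', hv1, hv2, hv3⟩ := h.upV hR hR' (ha.sub hd) ha.hv hdv
  refine ⟨u', v', ⟨Finset.filter_subset _ _, hu', hv', ?_, h.bd ha.sub ha.hu ha.hv ha.bd hu1 hu2 hv1 hv2, ?_⟩, hu3, hv3⟩
  · rintro rfl; exact ha.ne (hu1.symm.trans hv1)
  · intro y hy hev
    obtain ⟨y', hy', rfl, hev'⟩ := h.descend hR hR' ha.sub hy hev
    rw [ha.ac y' hy' hev']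
    simp [lift]

theorem Ref.cyc (h : Ref S S' X X' q) (hR : Rz S X) (hR' : Rz S' X') {c : Finset (Finset L)}
    (hc : Cyc S.E S.V c) : Cyc S'.E S'.V (lift q S'.E c) := by
  refine ⟨Finset.filter_subset _ _, ?_, h.even hc.sub hc.ev, ?_⟩
  · obtain ⟨e, he⟩ := hc.ne
    obtain ⟨t, ht⟩ := h.lift_ne hR (hc.sub he)
    exact ⟨t, lift_mono q _ (by simpa using he) ht⟩
  · intro y hy hev
    obtain ⟨y', hy', rfl, hev'⟩ := h.descend hR hR' hc.sub hy hev
    rcases hc.min y' hy' hev' with rfl | rfl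
    · left; simp [lift]
    · right; rfl

theorem Ref.disc (h : Ref S S' X X' q) (hR : Rz S X) (hR' : Rz S' X') {𝓕 c : Finset (Finset L)}
    (hD : Disc S 𝓕 c) : Disc S' (lift q S'.F 𝓕) (lift q S'.E c) := by
  refine ⟨Finset.filter_subset _ _, h.cyc hR hR' hD.cyc, ?_⟩
  intro t ht
  rw [h.Q2 𝓕 hD.sub t ht]
  by_cases h1 : t.image q ∈ S.E
  · rw [if_pos h1, hD.dl _ h1]
    congr 1
    simp [mem_lift, ht]
  · rw [if_neg h1, if_neg]
    intro h2
    exact h1 (hD.cyc.sub (mem_lift.1 h2).2)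

structure Tower (L : Type*) [DecidableEq L] (α : Type*) [MetricSpace α] where
  S : ℕ → Surf L
  X : ℕ → Finset L → Set α
  q : L → L
  rz : ∀ n, Rz (S n) (X n)
  rf : ∀ n, Ref (S n) (S (n+1)) (X n) (X (n+1)) q
  mesh : ∀ ε > 0, ∃ N, ∀ n ≥ N, ∀ f ∈ (S n).F, ∀ x ∈ X n f, ∀ y ∈ X n f, dist x y ≤ ε

variable (W : Tower L α)

theorem Tower.arc_up {n m : ℕ} (hnm : n ≤ m) {z : Finset (Finset L)} {u v : Finset L}
    (ha : Arc (W.S n).E (W.S n).V z u v) : ∃ z' u' v', Arc (W.S m).E (W.S m).V z' u' v' ∧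
      re (W.X m) z' = re (W.X n) z ∧ W.X m u' = W.X n u ∧ W.X m v' = W.X n v := by
  induction m, hnm using Nat.le_induction with
  | base => exact ⟨z, u, v, ha, rfl, rfl, rfl⟩
  | succ m hm ih =>
    obtain ⟨z', u', v', ha', h1, h2, h3⟩ := ih
    obtain ⟨u2, v2, h4, h5, h6⟩ := (W.rf m).arc (W.rz m) (W.rz (m+1)) ha'
    exact ⟨_, u2, v2, h4, ((W.rf m).reE ha'.sub).trans h1, h5.trans h2, h6.trans h3⟩

theorem Tower.disc_up {n m : ℕ} (hnm : n ≤ m) {𝓕 c : Finset (Finset L)}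
    (hD : Disc (W.S n) 𝓕 c) : ∃ 𝓕' c', Disc (W.S m) 𝓕' c' ∧
      re (W.X m) 𝓕' = re (W.X n) 𝓕 ∧ re (W.X m) c' = re (W.X n) c := by
  induction m, hnm using Nat.le_induction with
  | base => exact ⟨𝓕, c, hD, rfl, rfl⟩
  | succ m hm ih =>
    obtain ⟨𝓕', c', ha', h1, h2⟩ := ih
    exact ⟨_, _, (W.rf m).disc (W.rz m) (W.rz (m+1)) ha', ((W.rf m).reF ha'.sub).trans h1,
      ((W.rf m).reE ha'.cyc.sub).trans h2⟩

def Tower.AA (D : Set α) (s t : α) : Prop := ∃ n z u v, Arc (W.S n).E (W.S n).V z u v ∧ D = re (W.X n) z ∧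
  W.X n u = {s} ∧ W.X n v = {t}

def Tower.DD (D J : Set α) : Prop := ∃ n 𝓕 c, Disc (W.S n) 𝓕 c ∧ D = re (W.X n) 𝓕 ∧ J = re (W.X n) c

theorem Tower.goodArcs : GoodArcs W.AA := by
  rintro D s t ⟨n, z, u, v, ha, rfl, hs, ht⟩
  have hR := W.rz n
  refine ⟨hR.re_compact fun e he => Surf.E_ne _ (ha.sub he), ?_, ?_, ?_⟩
  · apply hR.touch_mem ha.tu; rw [hs]; rfl
  · apply hR.touch_mem ha.tv; rw [ht]; rfl
  · rintro rfl
    obtain ⟨f, hf, hfu⟩ := Rz.touch_face (W.S n) ha.sub ha.tu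
    exact ha.ne (hR.vinj ha.hu ha.hv hf hfu (by rw [hs]; rfl) (x := s) (by rw [ht]; rfl))

theorem Tower.acut_aux (n : ℕ) (ε : ℝ) (hm : ∀ f ∈ (W.S n).F, ∀ x ∈ W.X n f, ∀ y ∈ W.X n f, dist x y ≤ ε) (k : ℕ) :
    ∀ z u v s t, Arc (W.S n).E (W.S n).V z u v → z.card ≤ k → W.X n u = {s} → W.X n v = {t} →
      ACut W.AA ε (re (W.X n) z) s t := by
  induction k with
  | zero =>
    intro z u v s t ha hk
    have := Finset.card_pos.2 ha.nonempty
    omega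
  | succ k ih =>
    intro z u v s t ha hk hs ht
    have hR := W.rz n
    rcases ha.cases (W.S n).S1 with ⟨e, he, rfl⟩ | ⟨m, hmV, htm, hmu, hmv⟩
    · apply ACut.leaf
      intro x hx y hy
      simp only [re, Finset.mem_singleton, iUnion_iUnion_eq_left] at hx hy
      obtain ⟨f, hf, hfe⟩ := Rz.face_of_edge (W.S n) he
      exact hm f hf x (hR.mono hfe hx) y (hR.mono hfe hy)
    · obtain ⟨z1, z2, hu, hd, a1, a2, hsh⟩ := ha.split (W.S n).S1 hmV htm hmu hmv
      obtain ⟨p, hp⟩ := hR.R3 m hmV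
      have hcard : z1.card + z2.card = z.card := by rw [← hu, Finset.card_union_of_disjoint hd]
      have c1 := Finset.card_pos.2 a1.nonempty
      have c2 := Finset.card_pos.2 a2.nonempty
      refine ACut.node _ (re (W.X n) z1) (re (W.X n) z2) s p t ?_ ?_ ⟨n, z1, u, m, a1, rfl, hs, hp⟩
        ⟨n, z2, m, v, a2, rfl, hp, ht⟩ (ih z1 u m s p a1 (by omega) hs hp) (ih z2 m v p t a2 (by omega) hp ht)
      · rw [← re_union, hu]
      · apply Subset.antisymm
        · rintro x ⟨hx, hx'⟩
          obtain ⟨w, hw, hxw, t1, t2⟩ := hR.re_inter a1.sub a2.sub hd hx hx'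
          rw [hsh w hw t1 t2, hp] at hxw
          exact hxw
        · rintro x rfl
          exact ⟨hR.touch_mem a1.tv (by rw [hp]; rfl), hR.touch_mem a2.tu (by rw [hp]; rfl)⟩

theorem Tower.isArc {n : ℕ} {z : Finset (Finset L)} {u v : Finset L} {s t : α}
    (ha : Arc (W.S n).E (W.S n).V z u v) (hs : W.X n u = {s}) (ht : W.X n v = {t}) : IsArc (re (W.X n) z) s t := by
  refine isArc_of_family W.goodArcs ?_ ⟨n, z, u, v, ha, rfl, hs, ht⟩
  rintro D s t ⟨n, z, u, v, ha, rfl, hs, ht⟩ ε hε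
  obtain ⟨N, hN⟩ := W.mesh ε hε
  obtain ⟨z', u', v', ha', h1, h2, h3⟩ := W.arc_up (le_max_left n N) ha
  rw [← h1]
  exact W.acut_aux _ ε (hN _ (le_max_right n N)) _ z' u' v' s t ha' le_rfl (h2.trans hs) (h3.trans ht)

theorem Tower.goodFam : GoodFam W.DD := by
  rintro D J ⟨n, 𝓕, c, hD, rfl, rfl⟩
  have hR := W.rz n
  refine ⟨hR.re_compact fun e he => Surf.F_ne _ (hD.sub he), hR.re_compact fun e he => Surf.E_ne _ (hD.cyc.sub he), ?_⟩
  intro x hx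
  obtain ⟨e, he, hx⟩ := mem_re.1 hx
  have := hD.dl e (hD.cyc.sub he)
  rw [if_pos he] at this
  obtain ⟨f, hf, hfe⟩ := exists_of_par (s := 𝓕) (x := e) (by rw [this]; exact z2_10)
  exact mem_re.2 ⟨f, hf, hR.mono hfe hx⟩

/-- a combinatorial chord gives a geometric cut -/
theorem Tower.cut {n : ℕ} {𝓕 c p : Finset (Finset L)} {a b : Finset L} (hD : Disc (W.S n) 𝓕 c)
    (hp : Arc (W.S n).E (W.S n).V p a b)
    (ta : Touch c a) (tb : Touch c b) (hpc : ∀ e ∈ p, e ∉ c) (hin : ∀ e ∈ p, ∃ f ∈ 𝓕, f ⊆ e)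
    (hintr : ∀ m ∈ (W.S n).V, Touch p m → Touch c m → m = a ∨ m = b) :
    ∃ pa pb 𝓖1 𝓖2 c1 c2, W.X n a = {pa} ∧ W.X n b = {pb} ∧ 𝓖1 ∪ 𝓖2 = 𝓕 ∧ Disjoint 𝓖1 𝓖2 ∧
      Disc (W.S n) 𝓖1 c1 ∧ Disc (W.S n) 𝓖2 c2 ∧
      IsCut (re (W.X n) 𝓕) (re (W.X n) c) (re (W.X n) p) pa pb (re (W.X n) 𝓖1) (re (W.X n) c1)
        (re (W.X n) 𝓖2) (re (W.X n) c2) := by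
  obtain ⟨q1, q2, 𝓖1, 𝓖2, hq, hd, a1, a2, hsh, hFF, hdF, D1, D2⟩ := hD.cut hp ta tb hpc hin hintr
  obtain ⟨pa, ha⟩ := (W.rz n).R3 a hp.hu
  obtain ⟨pb, hb⟩ := (W.rz n).R3 b hp.hv
  exact ⟨pa, pb, 𝓖1, 𝓖2, _, _, ha, hb, hFF, hdF, D1, D2, (W.rz n).cut hD hp hpc hintr hq hd a1 a2 hsh hFF hdF D1 D2
    ha hb (W.isArc hp ha hb) (W.isArc a1 ha hb) (W.isArc a2 ha hb)⟩

theorem Disc.face_ne {S : Surf L} {𝓕 c : Finset (Finset L)} (hD : Disc S 𝓕 c) : ∃ e ∈ c, ∃ f ∈ 𝓕, f ⊆ e := by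
  obtain ⟨e, he⟩ := hD.cyc.ne
  have := hD.dl e (hD.cyc.sub he)
  rw [if_pos he] at this
  obtain ⟨f, hf, hfe⟩ := exists_of_par (s := 𝓕) (x := e) (by rw [this]; exact z2_10)
  exact ⟨e, he, f, hf, hfe⟩

end tower
end ABCT
end

section
open Set Metric Filter Topology

namespace ABCT

section tower2
set_option linter.unusedSectionVars false
set_option linter.unusedVariables false
variable {L : Type*} [DecidableEq L] {α : Type*} [MetricSpace α]

def Surf.bf (S : Surf L) (f : Finset L) : Finset (Finset L) := S.E.filter fun e => f ⊆ e

theorem Surf.bf_cyc (S : Surf L) {f : Finset L} (hf : f ∈ S.F) : Cyc S.E S.V (S.bf f) := by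
  refine ⟨Finset.filter_subset _ _, ?_, ?_, ?_⟩
  · obtain ⟨e, he, hfe⟩ := S.S8 f hf
    exact ⟨e, Finset.mem_filter.2 ⟨he, hfe⟩⟩
  · intro v hv
    by_cases hfv : f ⊆ v
    · obtain ⟨e, he, e', he', hne, h⟩ := S.S3 f hf v hv hfv
      have : par (S.bf f) v = ∑ d ∈ S.E, if f ⊆ d ∧ d ⊆ v then (1 : ZMod 2) else 0 := by
        unfold par Surf.bf
        rw [Finset.sum_filter]
        apply Finset.sum_congr rfl
        intro d _
        by_cases h1 : f ⊆ d <;> simp [h1]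
      rw [this, sum_two he he' hne h (fun _ => 1)]; decide
    · apply par_zero
      intro e he hev
      exact hfv ((Finset.mem_filter.1 he).2.trans hev)
  · intro y hy hev
    rcases S.S7 f hf y (hy.trans (Finset.filter_subset _ _)) (fun e he => (Finset.mem_filter.1 (hy he)).2) hev with h | h
    · exact Or.inl h
    · right
      apply Finset.Subset.antisymm hy
      intro e he
      rw [Surf.bf, Finset.mem_filter] at he
      exact h e he.1 he.2

theorem Surf.bf_disc (S : Surf L) {f : Finset L} (hf : f ∈ S.F) : Disc S {f} (S.bf f) := by
  refine ⟨by simpa using hf, S.bf_cyc hf, ?_⟩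
  intro e he
  rw [par_single]
  congr 1
  simp [Surf.bf, he]

theorem Surf.bf_disc' (S : Surf L) {f : Finset L} (hf : f ∈ S.F) : Disc S (S.F \ {f}) (S.bf f) := by
  refine ⟨Finset.sdiff_subset, S.bf_cyc hf, ?_⟩
  intro e he
  rw [par_sdiff (by simpa using hf), S.par_F he, zero_add, (S.bf_disc hf).dl e he]

variable (W : Tower L α)

theorem Tower.cuttable_aux (n : ℕ) (ε : ℝ) (hm : ∀ f ∈ (W.S n).F, ∀ x ∈ W.X n f, ∀ y ∈ W.X n f, dist x y ≤ ε) (k : ℕ) :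
    ∀ 𝓕 c, Disc (W.S n) 𝓕 c → 𝓕.card ≤ k → Cuttable W.DD ε (re (W.X n) 𝓕) (re (W.X n) c) := by
  induction k with
  | zero =>
    intro 𝓕 c hD hk
    obtain ⟨e, he, f, hf, hfe⟩ := hD.face_ne
    have := Finset.card_pos.2 ⟨f, hf⟩
    omega
  | succ k ih =>
    intro 𝓕 c hD hk
    set S := W.S n with hS
    have hR := W.rz n
    obtain ⟨e0, he0, f, hf, hfe⟩ := hD.face_ne
    have hfF := hD.sub hf
    have hB := S.bf_cyc hfF
    by_cases hBc : S.bf f ⊆ c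
    · have hBc' : S.bf f = c := by
        rcases hD.cyc.min _ hBc hB.ev with h | h
        · have := hB.ne; rw [h] at this; simp at this
        · exact h
      have h1 : 𝓕 = {f} := by
        rcases S.unique_dl hD.sub (𝓗 := {f}) (by simpa using hfF) (fun e he => by
          rw [hD.dl e he, (S.bf_disc hfF).dl e he, hBc']) with h | h
        · exact h
        · rw [h] at hf; simp at hf
      apply Cuttable.leaf
      rw [h1]
      intro x hx y hy
      simp only [re, Finset.mem_singleton, iUnion_iUnion_eq_left] at hx hy
      exact hm f hfF x hx y hy
    · set h := S.bf f \ c with hh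
      have hhE : h ⊆ S.E := Finset.sdiff_subset.trans hB.sub
      have hhB : h ⊆ S.bf f := Finset.sdiff_subset
      have e0B : e0 ∈ S.bf f := Finset.mem_filter.2 ⟨hD.cyc.sub he0, hfe⟩
      have hnev : ¬ Even' S.V h := by
        intro hev
        rcases hB.min h hhB hev with h1 | h1
        · exact hBc (Finset.sdiff_eq_empty_iff_subset.1 h1)
        · rw [← h1, hh, Finset.mem_sdiff] at e0B
          exact e0B.2 he0
      have tc : ∀ x ∈ S.V, par h x = 1 → Touch c x := by
        intro x hx h1
        have h2 := par_inter_sdiff (S.bf f) c x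
        rw [hB.ev x hx, ← hh, h1] at h2
        have h3 : par (S.bf f ∩ c) x ≠ 0 := by
          intro h4; rw [h4] at h2; revert h2; decide
        exact (touch_of_par h3).mono Finset.inter_subset_right
      unfold Even' at hnev
      push Not at hnev
      obtain ⟨x, hx, hpx⟩ := hnev
      obtain ⟨y, hy, hyx, hpy, z, hz, hbz⟩ := S.S1.peel _ h le_rfl hhE x hx (z2_ne hpx)
      obtain ⟨a, b, p, ⟨hab, ta, tb⟩, hph, hp, hpm⟩ := S.S1.min_arc h hhE (fun x y => x ≠ y ∧ Touch c x ∧ Touch c y)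
        (fun x y h => h.1) (fun m => Touch c m) (by
          rintro x y m ⟨h1, h2, h3⟩ h4 _ h5 h6
          exact Or.inl ⟨h5.symm, h2, h4⟩)
        ⟨x, hx, y, hy, ⟨hyx.symm, tc x hx (z2_ne hpx), tc y hy hpy⟩, z, hz, hbz⟩
      obtain ⟨pa, pb, 𝓖1, 𝓖2, c1, c2, -, -, hFF, hdF, D1, D2, hcut⟩ := W.cut hD hp ta tb
        (fun e he => (Finset.mem_sdiff.1 (hph he)).2)
        (fun e he => ⟨f, hf, (Finset.mem_filter.1 (hhB (hph he))).2⟩) hpm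
      have hcard : 𝓖1.card + 𝓖2.card = 𝓕.card := by rw [← hFF, Finset.card_union_of_disjoint hdF]
      obtain ⟨_, -, g1, hg1, -⟩ := D1.face_ne
      obtain ⟨_, -, g2, hg2, -⟩ := D2.face_ne
      have n1 := Finset.card_pos.2 ⟨g1, hg1⟩
      have n2 := Finset.card_pos.2 ⟨g2, hg2⟩
      exact Cuttable.node _ _ _ _ _ _ _ _ _ hcut ⟨n, 𝓖1, c1, D1, rfl, rfl⟩ ⟨n, 𝓖2, c2, D2, rfl, rfl⟩
        (ih 𝓖1 c1 D1 (by omega)) (ih 𝓖2 c2 D2 (by omega))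

theorem Tower.cuttable (D J : Set α) (h : W.DD D J) (ε : ℝ) (hε : 0 < ε) : Cuttable W.DD ε D J := by
  obtain ⟨n, 𝓕, c, hD, rfl, rfl⟩ := h
  obtain ⟨N, hN⟩ := W.mesh ε hε
  obtain ⟨𝓕', c', hD', h1, h2⟩ := W.disc_up (le_max_left n N) hD
  rw [← h1, ← h2]
  exact W.cuttable_aux _ ε (hN _ (le_max_right n N)) _ 𝓕' c' hD' le_rfl

/-- the boundary cycle is a circle -/
theorem Tower.circle {n : ℕ} {c : Finset (Finset L)} (hc : Cyc (W.S n).E (W.S n).V c) :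
    ∃ f : α → ℂ, ContinuousOn f (re (W.X n) c) ∧ InjOn f (re (W.X n) c) ∧ f '' (re (W.X n) c) = sphere 0 1 := by
  have hR := W.rz n
  obtain ⟨e, he⟩ := hc.ne
  obtain ⟨u, hu, v, hv, hne, hi⟩ := (W.S n).S1.two e (hc.sub he)
  obtain ⟨q1, q2, hq, hd, a1, a2, hsh⟩ := hc.split (W.S n).S1 hu hv hne ⟨e, he, (hi u hu).2 (Or.inl rfl)⟩
    ⟨e, he, (hi v hv).2 (Or.inr rfl)⟩
  obtain ⟨s, hs⟩ := hR.R3 u hu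
  obtain ⟨t, ht⟩ := hR.R3 v hv
  rw [← hq, re_union]
  apply circle_of_arcs (W.isArc a1 hs ht) (W.isArc a2 hs ht)
  apply Subset.antisymm
  · rintro x ⟨hx, hx'⟩
    obtain ⟨w, hw, hxw, t1, t2⟩ := hR.re_inter a1.sub a2.sub hd hx hx'
    rcases hsh w hw t1 t2 with rfl | rfl
    · rw [hs] at hxw; exact Or.inl hxw
    · rw [ht] at hxw; exact Or.inr hxw
  · rintro x (rfl | rfl)
    · exact ⟨hR.touch_mem a1.tu (by rw [hs]; rfl), hR.touch_mem a2.tu (by rw [hs]; rfl)⟩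
    · exact ⟨hR.touch_mem a1.tv (by rw [ht]; rfl), hR.touch_mem a2.tv (by rw [ht]; rfl)⟩

theorem Tower.inter {n : ℕ} {f : Finset L} (hf : f ∈ (W.S n).F) :
    re (W.X n) {f} ∩ re (W.X n) ((W.S n).F \ {f}) = re (W.X n) ((W.S n).bf f) := by
  have hR := W.rz n
  ext x
  simp only [mem_inter_iff, mem_re, Finset.mem_singleton, exists_eq_left, Finset.mem_sdiff]
  constructor
  · rintro ⟨hx, g, ⟨hg, hgf⟩, hxg⟩
    obtain ⟨h1, h2⟩ := hR.ff hf hg (Ne.symm hgf) hx hxg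
    rcases h1 with h1 | h1
    · exact ⟨_, Finset.mem_filter.2 ⟨h1, Finset.subset_union_left⟩, h2⟩
    · obtain ⟨e, he, hfe, hev⟩ := Rz.edge_of_v (W.S n) h1 hf Finset.subset_union_left
      exact ⟨e, Finset.mem_filter.2 ⟨he, hfe⟩, hR.mono hev h2⟩
  · rintro ⟨e, he, hx⟩
    obtain ⟨he, hfe⟩ := Finset.mem_filter.1 he
    refine ⟨hR.mono hfe hx, ?_⟩
    obtain ⟨f1, hf1, g1, hg1, hne, hi⟩ := (W.S n).S2 e he
    by_cases h1 : f1 = f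
    · exact ⟨g1, ⟨hg1, fun h => hne (h1.trans h.symm)⟩, hR.mono ((hi g1 hg1).2 (Or.inr rfl)) hx⟩
    · exact ⟨f1, ⟨hf1, h1⟩, hR.mono ((hi f1 hf1).2 (Or.inl rfl)) hx⟩

end tower2
end ABCT
end

section
open Set Metric Filter Topology

namespace ABCT

section tower3
set_option linter.unusedSectionVars false
set_option linter.unusedVariables false
variable {L : Type*} [DecidableEq L] {α : Type*} [MetricSpace α]
variable {E V : Finset (Finset L)}

theorem Arc.eq_single {z : Finset (Finset L)} {u v e : Finset L} (h : Arc E V z u v) (he : e ∈ z)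
    (hb : Bd V {e} u v) : z = {e} := by
  have h1 : ({e} : Finset (Finset L)) ⊆ z := by simpa using he
  have h2 : z \ {e} = ∅ := h.ac _ Finset.sdiff_subset (by
    intro w hw; rw [par_sdiff h1, h.bd w hw, hb w hw, z2_add])
  exact Finset.Subset.antisymm (Finset.sdiff_eq_empty_iff_subset.1 h2) h1

/-- a cycle minus two vertex disjoint edges -/
theorem Cyc.two_edges (hG : Graph E V) {c : Finset (Finset L)} (hc : Cyc E V c) {ea eb : Finset L} (ha : ea ∈ c)
    (hb : eb ∈ c) (hab : ∀ w ∈ V, ea ⊆ w → ¬ eb ⊆ w) :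
    ∃ al be a1 b1, c = al ∪ be ∪ {ea} ∪ {eb} ∧ Disjoint al {ea} ∧ Disjoint al {eb} ∧ a1 ∈ V ∧ b1 ∈ V ∧
      Bd V al a1 b1 ∧ ea ⊆ a1 ∧ eb ⊆ b1 ∧ Disjoint al be ∧ ∀ w ∈ V, Touch al w → ¬ Touch be w := by
  obtain ⟨x1, hx1, x2, hx2, hx, hxi⟩ := hG.two ea (hc.sub ha)
  obtain ⟨y1, hy1, y2, hy2, hy, hyi⟩ := hG.two eb (hc.sub hb)
  have bda : ∀ {x1 x2 ea : Finset L}, x1 ≠ x2 → (∀ w ∈ V, ea ⊆ w ↔ w = x1 ∨ w = x2) → Bd V {ea} x1 x2 := by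
    intro x1 x2 ea hx hxi w hw
    rw [par_single]
    by_cases h1 : w = x1
    · rw [if_pos ((hxi w hw).2 (Or.inl h1)), if_pos h1, if_neg (h1 ▸ hx), add_zero]
    · by_cases h2 : w = x2
      · rw [if_pos ((hxi w hw).2 (Or.inr h2)), if_neg h1, if_pos h2, zero_add]
      · rw [if_neg (by rw [hxi w hw]; tauto), if_neg h1, if_neg h2, zero_add]
  have hx1a := (hxi x1 hx1).2 (Or.inl rfl)
  have hx2a := (hxi x2 hx2).2 (Or.inr rfl)
  have hy1b := (hyi y1 hy1).2 (Or.inl rfl)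
  have hy2b := (hyi y2 hy2).2 (Or.inr rfl)
  have hne : ea ≠ eb := by rintro rfl; exact hab x1 hx1 hx1a hx1a
  -- the complement of ea
  have key1 : ∃ q, c = {ea} ∪ q ∧ ea ∉ q ∧ Arc E V q x1 x2 := by
    obtain ⟨q1, q2, hq, hd, a1, a2, -⟩ := hc.split hG hx1 hx2 hx ⟨ea, ha, hx1a⟩ ⟨ea, ha, hx2a⟩
    rw [← hq, Finset.mem_union] at ha
    rcases ha with h | h
    · rw [a1.eq_single h (bda hx hxi)] at hq hd
      exact ⟨q2, hq.symm, by simpa using hd, a2⟩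
    · rw [a2.eq_single h (bda hx hxi)] at hq hd
      exact ⟨q1, by rw [← hq, Finset.union_comm], by simpa using hd.symm, a1⟩
  obtain ⟨qq, hcq, heaq, aq⟩ := key1
  have hbq : eb ∈ qq := by
    rw [hcq, Finset.mem_union, Finset.mem_singleton] at hb
    exact hb.resolve_left (Ne.symm hne)
  have y1x : ∀ x ∈ V, ea ⊆ x → y1 ≠ x := by rintro x hx hxa rfl; exact hab _ hx hxa hy1b
  have y2x : ∀ x ∈ V, ea ⊆ x → y2 ≠ x := by rintro x hx hxa rfl; exact hab _ hx hxa hy2b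
  -- main case
  have key2 : ∀ x x' z1 z2, ea ⊆ x → ea ⊆ x' → z1 ∪ z2 = qq → Disjoint z1 z2 → Arc E V z1 x y1 → Arc E V z2 y1 x' →
      (∀ w ∈ V, Touch z1 w → Touch z2 w → w = y1) → eb ∈ z2 →
      ∃ al be a1 b1, c = al ∪ be ∪ {ea} ∪ {eb} ∧ Disjoint al {ea} ∧ Disjoint al {eb} ∧ a1 ∈ V ∧ b1 ∈ V ∧
      Bd V al a1 b1 ∧ ea ⊆ a1 ∧ eb ⊆ b1 ∧ Disjoint al be ∧ ∀ w ∈ V, Touch al w → ¬ Touch be w := by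
    intro x x' z1 z2 hxa hxa' hz hd A1 A2 hsh hbz
    obtain ⟨w1, w2, hw, hdw, B1, B2, hshw⟩ := A2.split hG hy2 ⟨eb, hbz, hy2b⟩ hy.symm (y2x x' A2.hv hxa')
    have hb1 : eb ∈ w1 := by
      rw [← hw, Finset.mem_union] at hbz
      rcases hbz with h | h
      · exact h
      · exact absurd (hshw y1 hy1 B1.tu ⟨eb, h, hy1b⟩) hy
    have hw1 := B1.eq_single hb1 (bda hy hyi)
    subst hw1
    refine ⟨z1, w2, x, y1, ?_, ?_, ?_, A1.hu, hy1, A1.bd, hxa, hy1b, ?_, ?_⟩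
    · rw [hcq, ← hz, ← hw]
      ext t; simp only [Finset.mem_union, Finset.mem_singleton]; tauto
    · rw [Finset.disjoint_singleton_right]
      intro h; exact heaq (by rw [← hz]; exact Finset.mem_union_left _ h)
    · exact hd.mono_right (by rw [← hw]; exact Finset.subset_union_left)
    · exact hd.mono_right (by rw [← hw]; exact Finset.subset_union_right)
    · intro w hwV t1 t2
      have := hsh w hwV t1 (t2.mono (by rw [← hw]; exact Finset.subset_union_right))
      subst this
      exact hy (hshw w hwV B1.tu t2)
  obtain ⟨z1, z2, hz, hd, A1, A2, hsh⟩ := aq.split hG hy1 ⟨eb, hbq, hy1b⟩ (y1x _ hx1 hx1a) (y1x _ hx2 hx2a)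
  have hbq' := hbq
  rw [← hz, Finset.mem_union] at hbq'
  rcases hbq' with h | h
  · exact key2 x2 x1 z2 z1 hx2a hx1a (by rw [Finset.union_comm]; exact hz) hd.symm A2.symm A1.symm
      (fun w hw t1 t2 => hsh w hw t2 t1) h
  · exact key2 x1 x2 z1 z2 hx1a hx2a hz hd A1 A2 hsh h

/-- configuration for the chord construction -/
structure Conf (S : Surf L) (X : Finset L → Set α) (𝓕 c al be Ia Ib : Finset (Finset L)) (a1 b1 : Finset L) : Prop where
  disc : Disc S 𝓕 c
  un : c = al ∪ be ∪ Ia ∪ Ib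
  d1 : Disjoint al Ia
  d2 : Disjoint al Ib
  d3 : Disjoint Ia Ib
  ha : a1 ∈ S.V
  hb : b1 ∈ S.V
  bd : Bd S.V al a1 b1
  ta : Touch Ia a1
  tb : Touch Ib b1

theorem Conf.suba {S : Surf L} {X : Finset L → Set α} {𝓕 c al be Ia Ib : Finset (Finset L)} {a1 b1 : Finset L}
    (h : Conf S X 𝓕 c al be Ia Ib a1 b1) : al ⊆ S.E ∧ be ⊆ S.E ∧ Ia ⊆ S.E ∧ Ib ⊆ S.E := by
  have := h.disc.cyc.sub
  rw [h.un] at this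
  simp only [Finset.union_subset_iff] at this
  exact ⟨this.1.1.1, this.1.1.2, this.1.2, this.2⟩

theorem Ref.touch {S S' : Surf L} {X X' : Finset L → Set α} {q : L → L} (h : Ref S S' X X' q)
    {z : Finset (Finset L)} (hz : z ⊆ S.E) {v v' : Finset L} (hv : v ∈ S.V) (ht : Touch z v)
    (hv' : v' ∈ S'.V) (h1 : v'.image q = v) : Touch (lift q S'.E z) v' := by
  obtain ⟨e, he, hev⟩ := ht
  have h3 := h.Q3 {e} (by simpa using hz he) v' hv'
  rw [h1, if_pos hv, par_single, if_pos hev] at h3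
  exact (touch_of_par (by rw [h3]; exact z2_10)).mono (lift_mono q _ (by simpa using he))

variable (W : Tower L α)

theorem Tower.conf_up {n m : ℕ} (hnm : n ≤ m) {𝓕 c al be Ia Ib : Finset (Finset L)} {a1 b1 : Finset L}
    (h : Conf (W.S n) (W.X n) 𝓕 c al be Ia Ib a1 b1) :
    ∃ 𝓕' c' al' be' Ia' Ib' a1' b1', Conf (W.S m) (W.X m) 𝓕' c' al' be' Ia' Ib' a1' b1' ∧
      re (W.X m) 𝓕' = re (W.X n) 𝓕 ∧ re (W.X m) c' = re (W.X n) c ∧ re (W.X m) al' = re (W.X n) al ∧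
      re (W.X m) be' = re (W.X n) be ∧ re (W.X m) Ia' = re (W.X n) Ia ∧ re (W.X m) Ib' = re (W.X n) Ib := by
  induction m, hnm using Nat.le_induction with
  | base => exact ⟨_, _, _, _, _, _, _, _, h, rfl, rfl, rfl, rfl, rfl, rfl⟩
  | succ m hm ih =>
    obtain ⟨𝓕', c', al', be', Ia', Ib', a1', b1', hC, e1, e2, e3, e4, e5, e6⟩ := ih
    obtain ⟨s1, s2, s3, s4⟩ := hC.suba
    have hr := W.rf m
    obtain ⟨ea, hea, heaa⟩ := hC.ta
    obtain ⟨eb, heb, hebb⟩ := hC.tb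
    obtain ⟨a2, ha2, ha3, ha4, -⟩ := hr.upV (W.rz m) (W.rz (m+1)) (s3 hea) hC.ha heaa
    obtain ⟨b2, hb2, hb3, hb4, -⟩ := hr.upV (W.rz m) (W.rz (m+1)) (s4 heb) hC.hb hebb
    refine ⟨_, _, _, _, _, _, a2, b2, ⟨hr.disc (W.rz m) (W.rz (m+1)) hC.disc, ?_, lift_disj _ _ hC.d1, lift_disj _ _ hC.d2,
      lift_disj _ _ hC.d3, ha2, hb2, hr.bd s1 hC.ha hC.hb hC.bd ha3 ha4 hb3 hb4,
      hr.touch s3 hC.ha hC.ta ha2 ha3, hr.touch s4 hC.hb hC.tb hb2 hb3⟩, (hr.reF hC.disc.sub).trans e1,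
      (hr.reE hC.disc.cyc.sub).trans e2, (hr.reE s1).trans e3, (hr.reE s2).trans e4, (hr.reE s3).trans e5,
      (hr.reE s4).trans e6⟩
    rw [← lift_union, ← lift_union, ← lift_union, ← hC.un]

/-- the chord -/
theorem Conf.chord {S : Surf L} {X : Finset L → Set α} {𝓕 c al be Ia Ib : Finset (Finset L)} {a1 b1 : Finset L}
    (h : Conf S X 𝓕 c al be Ia Ib a1 b1)
    (hI : ∀ w ∈ S.V, Touch Ia w → ¬ Touch Ib w)
    (hfar : ∀ f ∈ 𝓕, ∀ v ∈ S.V, ∀ w ∈ S.V, f ⊆ v → f ⊆ w → Touch al v → ¬ Touch be w) :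
    ∃ x y p, Touch Ia x ∧ Touch Ib y ∧ Arc S.E S.V p x y ∧ (∀ e ∈ p, e ∉ c) ∧ (∀ e ∈ p, ∃ f ∈ 𝓕, f ⊆ e) ∧
      ∀ m ∈ S.V, Touch p m → Touch c m → m = x ∨ m = y := by
  classical
  obtain ⟨s1, s2, s3, s4⟩ := h.suba
  set N := 𝓕.filter fun f => ∃ v ∈ S.V, f ⊆ v ∧ Touch al v with hN
  have hNF : N ⊆ 𝓕 := Finset.filter_subset _ _
  have hNS : N ⊆ S.F := hNF.trans h.disc.sub
  set d := S.E.filter fun e => par N e = 1 with hd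
  have dE : d ⊆ S.E := Finset.filter_subset _ _
  have dev : Even' S.V d := S.dd N hNS
  -- near al the set N agrees with all of 𝓕
  have near : ∀ e ∈ S.E, ∀ w ∈ S.V, e ⊆ w → Touch al w → (e ∈ d ↔ e ∈ c) := by
    intro e he w hw hew ht
    have : par N e = par 𝓕 e := by
      unfold par
      apply Finset.sum_subset hNF
      intro f hf hfN
      rw [if_neg]
      intro hfe
      exact hfN (Finset.mem_filter.2 ⟨hf, w, hw, hfe.trans hew, ht⟩)
    rw [hd, Finset.mem_filter, this, h.disc.dl e he]
    by_cases hec : e ∈ c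
    · simp [hec, he]
    · simp [hec]
  have far : ∀ e ∈ S.E, ∀ w ∈ S.V, e ⊆ w → Touch be w → e ∉ d := by
    intro e he w hw hew ht hed
    rw [hd, Finset.mem_filter] at hed
    obtain ⟨f, hf, hfe⟩ := exists_of_par (s := N) (x := e) (by rw [hed.2]; exact z2_10)
    obtain ⟨hf𝓕, v, hv, hfv, tv⟩ := Finset.mem_filter.1 hf
    exact hfar f hf𝓕 v hv w hw hfv (hfe.trans hew) tv ht
  set hh := d \ c with hhd
  have hhE : hh ⊆ S.E := Finset.sdiff_subset.trans dE
  have navoid : ∀ w ∈ S.V, Touch hh w → Touch c w → Touch Ia w ∨ Touch Ib w := by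
    rintro w hw ⟨e, he, hew⟩ tc
    obtain ⟨hed, hec⟩ := Finset.mem_sdiff.1 he
    rw [h.un, touch_union, touch_union, touch_union] at tc
    rcases tc with ((tc | tc) | tc) | tc
    · exact absurd ((near e (dE hed) w hw hew tc).1 hed) hec
    · exact absurd hed (far e (dE hed) w hw hew tc)
    · exact Or.inl tc
    · exact Or.inr tc
  have hpar : ∀ w ∈ S.V, par hh w = par (d ∩ c) w := by
    intro w hw
    have h1 := par_inter_sdiff d c w
    rw [dev w hw, ← hhd] at h1
    generalize par hh w = x at *
    generalize par (d ∩ c) w = y at *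
    revert h1 x y; decide
  have dal : al ⊆ d := by
    intro e he
    have heE := s1 he
    obtain ⟨u, hu, v, hv, -, hi⟩ := S.S1.two e heE
    have heu := (hi u hu).2 (Or.inl rfl)
    exact (near e heE u hu heu ⟨e, he, heu⟩).2 (by
      rw [h.un]; simp only [Finset.mem_union]; tauto)
  have dbe : ∀ e ∈ be, e ∉ d := by
    intro e he
    have heE := s2 he
    obtain ⟨u, hu, v, hv, -, hi⟩ := S.S1.two e heE
    have heu := (hi u hu).2 (Or.inl rfl)
    exact far e heE u hu heu ⟨e, he, heu⟩
  have ddec : d ∩ c = (al ∪ (d ∩ Ia)) ∪ (d ∩ Ib) := by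
    ext e
    rw [h.un]
    have h1 := @dal e
    have h2 := dbe e
    simp only [Finset.mem_inter, Finset.mem_union]
    tauto
  have dj1 : Disjoint al (d ∩ Ia) := h.d1.mono_right Finset.inter_subset_right
  have dj2 : Disjoint (al ∪ (d ∩ Ia)) (d ∩ Ib) := by
    rw [Finset.disjoint_union_left]
    exact ⟨h.d2.mono_right Finset.inter_subset_right, h.d3.mono Finset.inter_subset_right Finset.inter_subset_right⟩
  set P := S.V.filter fun w => Touch Ia w with hP
  have hPV : P ⊆ S.V := Finset.filter_subset _ _
  have sum1 : ∑ w ∈ P, par hh w = 1 := by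
    have e1 : ∀ w ∈ P, par hh w = par al w + par (d ∩ Ia) w := by
      intro w hw
      obtain ⟨hwV, hwI⟩ := Finset.mem_filter.1 hw
      rw [hpar w hwV, ddec, par_union dj2, par_union dj1]
      have : par (d ∩ Ib) w = 0 := par_of_not_touch fun t => hI w hwV hwI (t.mono Finset.inter_subset_right)
      rw [this, add_zero]
    rw [Finset.sum_congr rfl e1, Finset.sum_add_distrib]
    have e2 : ∑ w ∈ P, par (d ∩ Ia) w = 0 := by
      rw [← S.S1.handshake (z := d ∩ Ia) (Finset.inter_subset_right.trans s3)]
      apply Finset.sum_subset hPV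
      intro w hw hwP
      apply par_of_not_touch
      intro t
      exact hwP (Finset.mem_filter.2 ⟨hw, t.mono Finset.inter_subset_right⟩)
    have e3 : ∑ w ∈ P, par al w = 1 := by
      have : ∀ w ∈ P, par al w = if w = a1 then 1 else 0 := by
        intro w hw
        obtain ⟨hwV, hwI⟩ := Finset.mem_filter.1 hw
        rw [h.bd w hwV, if_neg (c := w = b1), add_zero]
        rintro rfl
        exact hI w hwV hwI h.tb
      rw [Finset.sum_congr rfl this, Finset.sum_ite_eq', if_pos (Finset.mem_filter.2 ⟨h.ha, h.ta⟩)]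
    rw [e2, e3, add_zero]
  obtain ⟨x, hx, y, hy, hyP, hpy, z, hz, hbz⟩ := S.S1.leave P hPV _ hh le_rfl hhE sum1
  obtain ⟨hxV, hxI⟩ := Finset.mem_filter.1 hx
  have hyI : Touch Ib y := by
    have ty : Touch hh y := touch_of_par (by rw [hpy]; exact z2_10)
    have tyc : Touch c y := (touch_of_par (by rw [← hpar y hy, hpy]; exact z2_10)).mono Finset.inter_subset_right
    rcases navoid y hy ty tyc with h1 | h1
    · exact absurd (Finset.mem_filter.2 ⟨hy, h1⟩) hyP
    · exact h1
  obtain ⟨x', y', p, ⟨-, -, h1, h2⟩, hph, hp, hpm⟩ := S.S1.min_arc hh hhE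
    (fun x y => x ∈ S.V ∧ y ∈ S.V ∧ Touch Ia x ∧ Touch Ib y)
    (by rintro x y ⟨h0, h0', h1, h2⟩ rfl; exact hI x h0 h1 h2) (fun m => m ∈ S.V ∧ Touch c m) (by
      rintro x y m ⟨h0, h0', h1, h2⟩ ⟨hm, hmc⟩ tm - -
      rcases navoid m hm tm hmc with h3 | h3
      · exact Or.inr ⟨hm, h0', h3, h2⟩
      · exact Or.inl ⟨h0, hm, h1, h3⟩) ⟨x, hxV, y, hy, ⟨hxV, hy, hxI, hyI⟩, z, hz, hbz⟩
  refine ⟨x', y', p, h1, h2, hp, fun e he => (Finset.mem_sdiff.1 (hph he)).2, ?_, fun m hm t tc => hpm m hm t ⟨hm, tc⟩⟩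
  intro e he
  have := (Finset.mem_filter.1 (Finset.mem_sdiff.1 (hph he)).1).2
  obtain ⟨f, hf, hfe⟩ := exists_of_par (s := N) (x := e) (by rw [this]; exact z2_10)
  exact ⟨f, hNF hf, hfe⟩

theorem Tower.hasCuts : HasCuts W.DD := by
  rintro D J ⟨n0, 𝓕0, c0, hD0, rfl, rfl⟩ a ha b hb hab r hr
  have hdab := dist_pos.2 hab
  set ε := min (r/2) (dist a b / 3) with hε
  have hε0 : 0 < ε := by positivity
  have hεr : ε < r := lt_of_le_of_lt (min_le_left _ _) (by linarith)
  have hεd : ε + ε < dist a b := by have := min_le_right (r/2) (dist a b / 3); rw [← hε] at this; linarith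
  obtain ⟨N, hN⟩ := W.mesh ε hε0
  obtain ⟨𝓕, c, hD, h1, h2⟩ := W.disc_up (le_max_left n0 N) hD0
  have hN := hN _ (le_max_right n0 N)
  set n := max n0 N
  rw [← h1, ← h2]
  rw [← h2] at ha hb
  clear h1 h2 hD0
  have hR := W.rz n
  obtain ⟨ea, hea, hxa⟩ := mem_re.1 ha
  obtain ⟨eb, heb, hxb⟩ := mem_re.1 hb
  have meshE : ∀ e ∈ (W.S n).E, ∀ x ∈ W.X n e, ∀ y ∈ W.X n e, dist x y ≤ ε := by
    intro e he x hx y hy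
    obtain ⟨f, hf, hfe⟩ := Rz.face_of_edge (W.S n) he
    exact hN f hf x (hR.mono hfe hx) y (hR.mono hfe hy)
  have hdisj : ∀ x, x ∈ W.X n ea → x ∉ W.X n eb := by
    intro x h1 h2
    have := meshE ea (hD.cyc.sub hea) a hxa x h1
    have := meshE eb (hD.cyc.sub heb) x h2 b hxb
    have := dist_triangle a x b
    linarith
  obtain ⟨al, be, a1, b1, hun, d1, d2, ha1, hb1, hbd, haa, hbb, dab, htt⟩ := hD.cyc.two_edges (W.S n).S1 hea heb (by
    intro w hw h1 h2
    obtain ⟨x, hx⟩ := hR.v_ne hw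
    exact hdisj x (hR.mono h1 hx) (hR.mono h2 hx))
  have hne : ea ≠ eb := by rintro rfl; exact hdisj a hxa hxa
  have hC : Conf (W.S n) (W.X n) 𝓕 c al be {ea} {eb} a1 b1 :=
    ⟨hD, hun, d1, d2, by simpa using hne, ha1, hb1, hbd, ⟨ea, by simp, haa⟩, ⟨eb, by simp, hbb⟩⟩
  obtain ⟨s1, s2, s3, s4⟩ := hC.suba
  have hdj : Disjoint (re (W.X n) al) (re (W.X n) be) := by
    rw [Set.disjoint_left]
    intro x hx hx'
    obtain ⟨w, hw, -, t1, t2⟩ := hR.re_inter s1 s2 dab hx hx'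
    exact htt w hw t1 t2
  obtain ⟨ρ, hρ, hρd⟩ := Metric.exists_pos_forall_lt_edist (hR.re_compact fun e he => Surf.E_ne _ (s1 he))
    (hR.re_compact fun e he => Surf.E_ne _ (s2 he)).isClosed hdj
  obtain ⟨N2, hN2⟩ := W.mesh ρ (by exact_mod_cast hρ)
  obtain ⟨𝓕', c', al', be', Ia, Ib, a2, b2, hC', e1, e2, e3, e4, e5, e6⟩ := W.conf_up (le_max_left n N2) hC
  have hN2 := hN2 _ (le_max_right n N2)
  set m := max n N2
  have hR' := W.rz m
  have e5' : re (W.X m) Ia = W.X n ea := by rw [e5]; simp [re]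
  have e6' : re (W.X m) Ib = W.X n eb := by rw [e6]; simp [re]
  obtain ⟨x, y, p, hx, hy, hp, h1, h2, h3⟩ := hC'.chord (by
      intro w hw t1 t2
      obtain ⟨x, hx⟩ := hR'.v_ne hw
      exact hdisj x (e5' ▸ hR'.touch_mem t1 hx) (e6' ▸ hR'.touch_mem t2 hx))
    (by
      intro f hf v hv w hw hfv hfw t1 t2
      obtain ⟨x, hx⟩ := hR'.v_ne hv
      obtain ⟨y, hy⟩ := hR'.v_ne hw
      have h1 := hN2 f (hC'.disc.sub hf) x (hR'.mono hfv hx) y (hR'.mono hfw hy)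
      have h2 := hρd x (e3 ▸ hR'.touch_mem t1 hx) y (e4 ▸ hR'.touch_mem t2 hy)
      rw [edist_dist] at h2
      have h3 : ENNReal.ofReal (dist x y) ≤ (ρ : ENNReal) := by
        rw [← ENNReal.ofReal_coe_nnreal]; exact ENNReal.ofReal_le_ofReal h1
      exact absurd h2 (not_lt.2 h3))
  have tIa : Ia ⊆ c' := by rw [hC'.un]; intro e he; simp [he]
  have tIb : Ib ⊆ c' := by rw [hC'.un]; intro e he; simp [he]
  obtain ⟨pa, pb, 𝓖1, 𝓖2, c1, c2, hpa, hpb, hFF, hdF, D1, D2, hcut⟩ := W.cut hC'.disc hp (hx.mono tIa) (hy.mono tIb) h1 h2 h3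
  rw [e1, e2] at hcut
  refine ⟨_, pa, pb, _, _, _, _, hcut, ?_, ?_, ⟨m, 𝓖1, c1, D1, rfl, rfl⟩, ⟨m, 𝓖2, c2, D2, rfl, rfl⟩⟩
  · refine lt_of_le_of_lt (meshE ea (hD.cyc.sub hea) pa ?_ a hxa) hεr
    rw [← e5']
    exact hR'.touch_mem hx (by rw [hpa]; rfl)
  · refine lt_of_le_of_lt (meshE eb (hD.cyc.sub heb) pb ?_ b hxb) hεr
    rw [← e6']
    exact hR'.touch_mem hy (by rw [hpb]; rfl)

theorem Tower.sphere {f : Finset L} (hf : f ∈ (W.S 0).F) :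
    Nonempty (re (W.X 0) (W.S 0).F ≃ₜ sphere (0 : EuclideanSpace ℝ (Fin 3)) 1) := by
  obtain ⟨g, gc, gi, gim⟩ := W.circle ((W.S 0).bf_cyc hf)
  have := sphere_of_family W.goodFam W.hasCuts W.cuttable (W.inter hf)
    ⟨0, _, _, (W.S 0).bf_disc hf, rfl, rfl⟩ ⟨0, _, _, (W.S 0).bf_disc' hf, rfl, rfl⟩ g gc gi gim
  rw [← re_union, Finset.union_sdiff_of_subset (by simpa using hf)] at this
  exact this

end tower3
end ABCT
end

section
open Set Metric Filter Topology

namespace ABCT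

section cells
set_option linter.unusedSectionVars false
set_option linter.unusedVariables false

abbrev LL := ℤ × ℤ × ℤ

def RR (a b : LL) : Prop := (b.1 = a.1 ∨ b.1 = a.1 + 1) ∧ (b.2.1 = a.2.1 ∨ b.2.1 = a.2.1 + 1) ∧
  (b.2.2 = a.2.2 ∨ b.2.2 = a.2.2 + 1)

instance (a b : LL) : Decidable (RR a b) := by unfold RR; infer_instance

def Adj (a b : LL) : Prop := a ≠ b ∧ (RR a b ∨ RR b a)

instance (a b : LL) : Decidable (Adj a b) := by unfold Adj; infer_instance

theorem Adj.symm {a b : LL} (h : Adj a b) : Adj b a := ⟨h.1.symm, h.2.symm⟩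

theorem Adj.ne {a b : LL} (h : Adj a b) : a ≠ b := h.1

def Nb : Finset LL := {(1,0,0), (0,1,0), (0,0,1), (1,1,0), (1,0,1), (0,1,1), (1,1,1),
  (-1,0,0), (0,-1,0), (0,0,-1), (-1,-1,0), (-1,0,-1), (0,-1,-1), (-1,-1,-1)}

theorem adj_zero {p : LL} : Adj 0 p ↔ p ∈ Nb := by
  obtain ⟨x, y, z⟩ := p
  constructor
  · rintro ⟨h1, ⟨h2, h3, h4⟩ | ⟨h2, h3, h4⟩⟩
    · simp only [Prod.fst_zero, Prod.snd_zero, zero_add] at h2 h3 h4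
      rcases h2 with rfl | rfl <;> rcases h3 with rfl | rfl <;> rcases h4 with rfl | rfl <;>
        first | exact absurd rfl h1 | decide
    · simp only [Prod.fst_zero, Prod.snd_zero] at h2 h3 h4
      have h2 : x = 0 ∨ x = -1 := by omega
      have h3 : y = 0 ∨ y = -1 := by omega
      have h4 : z = 0 ∨ z = -1 := by omega
      rcases h2 with rfl | rfl <;> rcases h3 with rfl | rfl <;> rcases h4 with rfl | rfl <;>
        first | exact absurd rfl h1 | decide
  · have : ∀ p ∈ Nb, Adj 0 p := by decide
    exact this _

theorem adj_sub {a b : LL} (x : LL) : Adj (a - x) (b - x) ↔ Adj a b := by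
  obtain ⟨a1, a2, a3⟩ := a
  obtain ⟨b1, b2, b3⟩ := b
  obtain ⟨x1, x2, x3⟩ := x
  simp only [Adj, RR, Prod.mk_sub_mk, ne_eq, Prod.mk.injEq]
  omega

theorem adj_iff {a b : LL} : Adj a b ↔ b - a ∈ Nb := by
  rw [← adj_sub a, sub_self, adj_zero]

theorem fc1 : ∀ p ∈ Nb, ∀ p' ∈ Nb, Adj p p' → (Nb.filter fun w => Adj w p ∧ Adj w p').card = 2 := by
  decide +kernel

def Near (p c d : LL) : Prop := Adj d p ∧ (c = d ∨ Adj c d)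

instance (p c d : LL) : Decidable (Near p c d) := by unfold Near; infer_instance

theorem fc2 : ∀ p ∈ Nb, ∀ c ∈ Nb, ∀ c' ∈ Nb, Adj c p → Adj c' p → ∃ d1 ∈ Nb, ∃ d2 ∈ Nb,
    Near p c d1 ∧ Near p d1 d2 ∧ (d2 = c' ∨ Adj d2 c') := by
  decide +kernel

theorem fc3 : ∀ p ∈ Nb, ∃ c ∈ Nb, Adj c p := by decide +kernel

def Clique (s : Finset LL) : Prop := ∀ a ∈ s, ∀ b ∈ s, a ≠ b → Adj a b

def Bi (U s : Finset LL) : Prop := (∃ a ∈ s, a ∈ U) ∧ ∃ b ∈ s, b ∉ U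

theorem Clique.mono {s t : Finset LL} (h : Clique t) (hst : s ⊆ t) : Clique s :=
  fun a ha b hb => h a (hst ha) b (hst hb)

theorem Bi.mono {U s t : Finset LL} (h : Bi U s) (hst : s ⊆ t) : Bi U t := by
  obtain ⟨⟨a, ha, h1⟩, b, hb, h2⟩ := h
  exact ⟨⟨a, hst ha, h1⟩, b, hst hb, h2⟩

theorem Clique.card_le {s : Finset LL} (h : Clique s) : s.card ≤ 4 := by
  rcases s.eq_empty_or_nonempty with rfl | hne
  · simp
  obtain ⟨a, ha, hmin⟩ := s.exists_min_image (fun a => a.1 + a.2.1 + a.2.2) hne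
  have : s.card ≤ (Finset.Icc (a.1 + a.2.1 + a.2.2) (a.1 + a.2.1 + a.2.2 + 3)).card := by
    apply Finset.card_le_card_of_injOn (fun a => a.1 + a.2.1 + a.2.2)
    · intro b hb
      have h1 := hmin b hb
      simp only [Finset.coe_Icc, Set.mem_Icc]
      refine ⟨h1, ?_⟩
      by_cases hab : a = b
      · rw [hab]; omega
      · obtain ⟨-, ⟨h2, h3, h4⟩ | ⟨h2, h3, h4⟩⟩ := h a ha b hb hab <;> omega
    · intro b hb c hc hbc
      by_contra hne
      have hbc : b.1 + b.2.1 + b.2.2 = c.1 + c.2.1 + c.2.2 := hbc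
      obtain ⟨-, ⟨h2, h3, h4⟩ | ⟨h2, h3, h4⟩⟩ := h b hb c hc hne <;>
      · apply hne
        refine Prod.ext ?_ (Prod.ext ?_ ?_) <;> omega
  refine this.trans ?_
  rw [Int.card_Icc]; omega

def nbhd (U : Finset LL) : Finset LL := U ∪ U.biUnion fun a => Nb.image fun p => a + p

open Classical in
noncomputable def cells (U : Finset LL) (k : ℕ) : Finset (Finset LL) :=
  ((nbhd U).powersetCard k).filter fun s => Clique s ∧ Bi U s

theorem mem_cells {U s : Finset LL} {k : ℕ} : s ∈ cells U k ↔ s.card = k ∧ Clique s ∧ Bi U s := by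
  classical
  unfold cells
  rw [Finset.mem_filter, Finset.mem_powersetCard]
  constructor
  · rintro ⟨⟨h1, h2⟩, h3, h4⟩; exact ⟨h2, h3, h4⟩
  · rintro ⟨h2, h3, h4⟩
    refine ⟨⟨?_, h2⟩, h3, h4⟩
    obtain ⟨⟨a, ha, haU⟩, -⟩ := h4
    intro b hb
    unfold nbhd
    by_cases hab : a = b
    · subst hab; exact Finset.mem_union_left _ haU
    · apply Finset.mem_union_right
      rw [Finset.mem_biUnion]
      refine ⟨a, haU, Finset.mem_image.2 ⟨b - a, adj_iff.1 (h3 a ha b hb hab), by abel⟩⟩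

variable {U : Finset LL}

theorem clique_insert {s : Finset LL} {d : LL} (h : Clique s) (hd : ∀ a ∈ s, Adj d a) : Clique (insert d s) := by
  intro a ha b hb hab
  rw [Finset.mem_insert] at ha hb
  rcases ha with rfl | ha <;> rcases hb with rfl | hb
  · exact absurd rfl hab
  · exact hd b hb
  · exact (hd a ha).symm
  · exact h a ha b hb hab

theorem insert_cell {s : Finset LL} {d : LL} {k : ℕ} (h : s ∈ cells U k) (hd : ∀ a ∈ s, Adj d a) :
    d ∉ s ∧ insert d s ∈ cells U (k+1) := by
  obtain ⟨h1, h2, h3⟩ := mem_cells.1 h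
  have hds : d ∉ s := fun h' => (hd d h').1 rfl
  exact ⟨hds, mem_cells.2 ⟨by rw [Finset.card_insert_of_notMem hds, h1], clique_insert h2 hd,
    h3.mono (Finset.subset_insert _ _)⟩⟩

theorem cell_up {s t : Finset LL} {k : ℕ} (hs : s ∈ cells U k) (ht : t ∈ cells U (k+1)) (hst : s ⊆ t) :
    ∃ d, d ∉ s ∧ t = insert d s ∧ ∀ a ∈ s, Adj d a := by
  obtain ⟨h1, h2, h3⟩ := mem_cells.1 hs
  obtain ⟨h4, h5, h6⟩ := mem_cells.1 ht
  obtain ⟨d, hd⟩ : ∃ d, d ∈ t \ s := by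
    rw [← Finset.Nonempty, ← Finset.card_pos, Finset.card_sdiff_of_subset hst]; omega
  obtain ⟨hdt, hds⟩ := Finset.mem_sdiff.1 hd
  refine ⟨d, hds, ?_, ?_⟩
  · symm
    apply Finset.eq_of_subset_of_card_le
    · exact Finset.insert_subset hdt hst
    · rw [Finset.card_insert_of_notMem hds, h1, h4]
  · intro a ha
    exact h5 d hdt a (hst ha) (by rintro rfl; exact hds ha)

theorem cells_S1 (U : Finset LL) : Graph (cells U 3) (cells U 4) := by
  constructor
  intro e he
  obtain ⟨h1, h2, h3⟩ := mem_cells.1 he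
  obtain ⟨x, y, w, hxy, hxw, hyw, rfl⟩ := Finset.card_eq_three.1 h1
  have a1 := h2 x (by simp) y (by simp) hxy
  have a2 := h2 x (by simp) w (by simp) hxw
  have a3 := h2 y (by simp) w (by simp) hyw
  have hc := fc1 (y - x) (adj_iff.1 a1) (w - x) (adj_iff.1 a2) ((adj_sub x).2 a3)
  obtain ⟨d1, d2, hd, hs⟩ := Finset.card_eq_two.1 hc
  have key : ∀ d, (∀ a ∈ ({x, y, w} : Finset LL), Adj d a) ↔ d = x + d1 ∨ d = x + d2 := by
    intro d
    have : d - x ∈ (Nb.filter fun w' => Adj w' (y - x) ∧ Adj w' (w - x)) ↔ d = x + d1 ∨ d = x + d2 := by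
      rw [hs, Finset.mem_insert, Finset.mem_singleton, sub_eq_iff_eq_add', sub_eq_iff_eq_add']
    rw [← this, Finset.mem_filter, adj_sub, adj_sub, ← adj_iff]
    constructor
    · intro h; exact ⟨(h x (by simp)).symm, h y (by simp), h w (by simp)⟩
    · rintro ⟨h1, h2, h3⟩ a ha
      simp only [Finset.mem_insert, Finset.mem_singleton] at ha
      rcases ha with rfl | rfl | rfl
      · exact h1.symm
      · exact h2
      · exact h3
  obtain ⟨n1, c1⟩ := insert_cell he ((key _).2 (Or.inl rfl))
  obtain ⟨n2, c2⟩ := insert_cell he ((key _).2 (Or.inr rfl))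
  refine ⟨_, c1, _, c2, ?_, ?_⟩
  · intro h
    have : x + d1 ∈ insert (x + d2) ({x, y, w} : Finset LL) := by rw [← h]; exact Finset.mem_insert_self _ _
    rcases Finset.mem_insert.1 this with h' | h'
    · exact hd (add_left_cancel h')
    · exact n1 h'
  · intro v hv
    constructor
    · intro hev
      obtain ⟨d, hde, rfl, hda⟩ := cell_up he hv hev
      rcases (key d).1 hda with rfl | rfl
      · exact Or.inl rfl
      · exact Or.inr rfl
    · rintro (rfl | rfl) <;> exact Finset.subset_insert _ _

theorem pair_cell {a b : LL} (hab : Adj a b) (h : (a ∈ U ∧ b ∉ U) ∨ (a ∉ U ∧ b ∈ U)) : {a, b} ∈ cells U 2 := by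
  refine mem_cells.2 ⟨Finset.card_pair hab.1, ?_, ?_⟩
  · intro x hx y hy hxy
    simp only [Finset.mem_insert, Finset.mem_singleton] at hx hy
    rcases hx with rfl | rfl <;> rcases hy with rfl | rfl
    · exact absurd rfl hxy
    · exact hab
    · exact hab.symm
    · exact absurd rfl hxy
  · rcases h with ⟨h1, h2⟩ | ⟨h1, h2⟩
    · exact ⟨⟨a, by simp, h1⟩, b, by simp, h2⟩
    · exact ⟨⟨b, by simp, h2⟩, a, by simp, h1⟩

theorem cell_two {f : Finset LL} (hf : f ∈ cells U 2) : ∃ a b, a ∈ U ∧ b ∉ U ∧ Adj a b ∧ f = {a, b} := by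
  obtain ⟨h1, h2, ⟨a, ha, haU⟩, b, hb, hbU⟩ := mem_cells.1 hf
  have hab : a ≠ b := by rintro rfl; exact hbU haU
  refine ⟨a, b, haU, hbU, h2 a ha b hb hab, ?_⟩
  symm
  apply Finset.eq_of_subset_of_card_le
  · intro x hx
    simp only [Finset.mem_insert, Finset.mem_singleton] at hx
    rcases hx with rfl | rfl
    · exact ha
    · exact hb
  · rw [h1, Finset.card_pair hab]

theorem cells_S2 : ∀ e ∈ cells U 3, ∃ f ∈ cells U 2, ∃ g ∈ cells U 2, f ≠ g ∧
    ∀ h ∈ cells U 2, h ⊆ e ↔ h = f ∨ h = g := by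
  intro e he
  obtain ⟨h1, h2, ⟨a, ha, haU⟩, b, hb, hbU⟩ := mem_cells.1 he
  have hab : a ≠ b := by rintro rfl; exact hbU haU
  obtain ⟨c, hc⟩ : ∃ c, c ∈ e \ {a, b} := by
    rw [← Finset.Nonempty, ← Finset.card_pos]
    have := Finset.le_card_sdiff {a, b} e
    rw [Finset.card_pair hab] at this; omega
  simp only [Finset.mem_sdiff, Finset.mem_insert, Finset.mem_singleton, not_or] at hc
  obtain ⟨hce, hca, hcb⟩ := hc
  have hee : e = {a, b, c} := by
    symm
    apply Finset.eq_of_subset_of_card_le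
    · intro x hx
      simp only [Finset.mem_insert, Finset.mem_singleton] at hx
      rcases hx with rfl | rfl | rfl <;> assumption
    · rw [h1, Finset.card_eq_three.2 ⟨a, b, c, hab, Ne.symm hca, Ne.symm hcb, rfl⟩]
  have A1 := h2 a ha b hb hab
  have A2 := h2 a ha c hce (Ne.symm hca)
  have A3 := h2 b hb c hce (Ne.symm hcb)
  by_cases hcU : c ∈ U
  · refine ⟨{a, b}, pair_cell A1 (Or.inl ⟨haU, hbU⟩), {c, b}, pair_cell A3.symm (Or.inl ⟨hcU, hbU⟩), ?_, ?_⟩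
    · intro h
      have : c ∈ ({a, b} : Finset LL) := by rw [h]; simp
      simp only [Finset.mem_insert, Finset.mem_singleton] at this; tauto
    · intro h hh
      obtain ⟨x, y, hx, hy, -, rfl⟩ := cell_two hh
      rw [hee]
      constructor
      · intro hs
        have m1 := hs (show x ∈ ({x, y} : Finset LL) by simp)
        have m2 := hs (show y ∈ ({x, y} : Finset LL) by simp)
        simp only [Finset.mem_insert, Finset.mem_singleton] at m1 m2
        rcases m2 with rfl | rfl | rfl
        · exact absurd haU hy
        · rcases m1 with rfl | rfl | rfl
          · exact Or.inl rfl
          · exact absurd hx hy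
          · exact Or.inr rfl
        · exact absurd hcU hy
      · rintro (h | h) <;> rw [h] <;> intro x hx <;> simp at hx ⊢ <;> tauto
  · refine ⟨{a, b}, pair_cell A1 (Or.inl ⟨haU, hbU⟩), {a, c}, pair_cell A2 (Or.inl ⟨haU, hcU⟩), ?_, ?_⟩
    · intro h
      have : c ∈ ({a, b} : Finset LL) := by rw [h]; simp
      simp only [Finset.mem_insert, Finset.mem_singleton] at this; tauto
    · intro h hh
      obtain ⟨x, y, hx, hy, -, rfl⟩ := cell_two hh
      rw [hee]
      constructor
      · intro hs
        have m1 := hs (show x ∈ ({x, y} : Finset LL) by simp)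
        have m2 := hs (show y ∈ ({x, y} : Finset LL) by simp)
        simp only [Finset.mem_insert, Finset.mem_singleton] at m1 m2
        rcases m1 with rfl | rfl | rfl
        · rcases m2 with rfl | rfl | rfl
          · exact absurd hx hy
          · exact Or.inl rfl
          · exact Or.inr rfl
        · exact absurd hx hbU
        · exact absurd hx hcU
      · rintro (h | h) <;> rw [h] <;> intro x hx <;> simp at hx ⊢ <;> tauto

theorem cells_S3 : ∀ f ∈ cells U 2, ∀ v ∈ cells U 4, f ⊆ v → ∃ e ∈ cells U 3, ∃ e' ∈ cells U 3, e ≠ e' ∧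
    ∀ d ∈ cells U 3, (f ⊆ d ∧ d ⊆ v) ↔ d = e ∨ d = e' := by
  intro f hf v hv hfv
  obtain ⟨h1, h2, h3⟩ := mem_cells.1 hf
  obtain ⟨h4, h5, h6⟩ := mem_cells.1 hv
  have hcard : (v \ f).card = 2 := by rw [Finset.card_sdiff_of_subset hfv]; omega
  obtain ⟨c, d, hcd, hs⟩ := Finset.card_eq_two.1 hcard
  have hmem : ∀ x, x ∈ v ∧ x ∉ f ↔ x = c ∨ x = d := by
    intro x; rw [← Finset.mem_sdiff, hs]; simp
  obtain ⟨cv, cf⟩ := (hmem c).2 (Or.inl rfl)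
  obtain ⟨dv, df⟩ := (hmem d).2 (Or.inr rfl)
  have mk : ∀ x, x ∈ v → x ∉ f → insert x f ∈ cells U 3 := by
    intro x hx hxf
    exact (insert_cell hf fun a ha => h5 x hx a (hfv ha) (by rintro rfl; exact hxf ha)).2
  refine ⟨_, mk c cv cf, _, mk d dv df, ?_, ?_⟩
  · intro h
    have : c ∈ insert d f := by rw [← h]; exact Finset.mem_insert_self _ _
    rcases Finset.mem_insert.1 this with h' | h'
    · exact hcd h'
    · exact cf h'
  · intro t ht
    constructor
    · rintro ⟨hft, htv⟩
      obtain ⟨x, hx, rfl, -⟩ := cell_up hf ht hft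
      rcases (hmem x).1 ⟨htv (Finset.mem_insert_self _ _), hx⟩ with rfl | rfl
      · exact Or.inl rfl
      · exact Or.inr rfl
    · rintro (rfl | rfl)
      · exact ⟨Finset.subset_insert _ _, Finset.insert_subset cv hfv⟩
      · exact ⟨Finset.subset_insert _ _, Finset.insert_subset dv hfv⟩

/-- two faces of an edge on which 𝓖 is even are both in or both out -/
theorem par_edge {𝓖 : Finset (Finset LL)} (h𝓖 : 𝓖 ⊆ cells U 2) {e f g : Finset LL} (he : e ∈ cells U 3)
    (hf : f ∈ cells U 2) (hg : g ∈ cells U 2) (hfe : f ⊆ e) (hge : g ⊆ e) (hp : par 𝓖 e = 0) : f ∈ 𝓖 ↔ g ∈ 𝓖 := by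
  obtain ⟨f1, hf1, g1, hg1, hne, hi⟩ := cells_S2 e he
  have key : par 𝓖 e = (if f1 ∈ 𝓖 then 1 else 0) + (if g1 ∈ 𝓖 then 1 else 0) := by
    have : par 𝓖 e = ∑ d ∈ cells U 2, if d ⊆ e then (if d ∈ 𝓖 then 1 else 0) else 0 := by
      unfold par
      rw [← Finset.sum_subset h𝓖]
      · apply Finset.sum_congr rfl
        intro d hd; rw [if_pos hd]
      · intro d _ hd; rw [if_neg hd]; simp
    rw [this, sum_two hf1 hg1 hne hi]
  have h12 : f1 ∈ 𝓖 ↔ g1 ∈ 𝓖 := by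
    rw [hp] at key
    by_cases h1 : f1 ∈ 𝓖 <;> by_cases h2 : g1 ∈ 𝓖
    · simp [h1, h2]
    · exfalso; rw [if_pos h1, if_neg h2] at key; revert key; decide
    · exfalso; rw [if_neg h1, if_pos h2] at key; revert key; decide
    · simp [h1, h2]
  rcases (hi f hf).1 hfe with rfl | rfl <;> rcases (hi g hg).1 hge with rfl | rfl
  · rfl
  · exact h12
  · exact h12.symm
  · rfl

theorem tri_cell {a b c : LL} (h1 : Adj a b) (h2 : Adj a c) (h3 : Adj b c) (h : Bi U {a, b, c}) : {a, b, c} ∈ cells U 3 := by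
  refine mem_cells.2 ⟨Finset.card_eq_three.2 ⟨a, b, c, h1.1, h2.1, h3.1, rfl⟩, ?_, h⟩
  have hbc : Clique {b, c} := by
    apply clique_insert
    · intro x hx y hy hxy; simp only [Finset.mem_singleton] at hx hy; exact absurd (hx.trans hy.symm) hxy
    · intro x hx; rw [Finset.mem_singleton] at hx; rw [hx]; exact h3
  apply clique_insert hbc
  intro x hx
  simp only [Finset.mem_insert, Finset.mem_singleton] at hx
  rcases hx with rfl | rfl <;> assumption

theorem cells_S4 : ∀ 𝓖 ⊆ cells U 2, ∀ v ∈ cells U 4, (∀ e ∈ cells U 3, e ⊆ v → par 𝓖 e = 0) →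
    (∀ f ∈ cells U 2, f ⊆ v → f ∈ 𝓖) ∨ (∀ f ∈ cells U 2, f ⊆ v → f ∉ 𝓖) := by
  intro 𝓖 h𝓖 v hv hp
  obtain ⟨-, hc, -⟩ := mem_cells.1 hv
  -- changing one end
  have step1 : ∀ a ∈ v, ∀ b ∈ v, ∀ c ∈ v, a ∈ U → b ∉ U → c ∉ U → (({a, b} : Finset LL) ∈ 𝓖 ↔ {a, c} ∈ 𝓖) := by
    intro a ha b hb c hcv haU hbU hcU
    by_cases hbc : b = c
    · rw [hbc]
    have hab : a ≠ b := by rintro rfl; exact hbU haU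
    have hac : a ≠ c := by rintro rfl; exact hcU haU
    have A1 := hc a ha b hb hab
    have A2 := hc a ha c hcv hac
    have A3 := hc b hb c hcv hbc
    have ht : {a, b, c} ∈ cells U 3 := tri_cell A1 A2 A3 ⟨⟨a, by simp, haU⟩, b, by simp, hbU⟩
    refine par_edge h𝓖 ht (pair_cell A1 (Or.inl ⟨haU, hbU⟩)) (pair_cell A2 (Or.inl ⟨haU, hcU⟩)) ?_ ?_ (hp _ ht ?_)
    · intro x hx; simp at hx ⊢; tauto
    · intro x hx; simp at hx ⊢; tauto
    · intro x hx; simp only [Finset.mem_insert, Finset.mem_singleton] at hx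
      rcases hx with rfl | rfl | rfl <;> assumption
  have step2 : ∀ a ∈ v, ∀ b ∈ v, ∀ c ∈ v, a ∈ U → b ∈ U → c ∉ U → (({a, c} : Finset LL) ∈ 𝓖 ↔ {b, c} ∈ 𝓖) := by
    intro a ha b hb c hcv haU hbU hcU
    by_cases hbc : a = b
    · rw [hbc]
    have hac : a ≠ c := by rintro rfl; exact hcU haU
    have hbc' : b ≠ c := by rintro rfl; exact hcU hbU
    have A1 := hc a ha b hb hbc
    have A2 := hc a ha c hcv hac
    have A3 := hc b hb c hcv hbc'
    have ht : {a, b, c} ∈ cells U 3 := tri_cell A1 A2 A3 ⟨⟨a, by simp, haU⟩, c, by simp, hcU⟩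
    refine par_edge h𝓖 ht (pair_cell A2 (Or.inl ⟨haU, hcU⟩)) (pair_cell A3 (Or.inl ⟨hbU, hcU⟩)) ?_ ?_ (hp _ ht ?_)
    · intro x hx; simp at hx ⊢; tauto
    · intro x hx; simp at hx ⊢; tauto
    · intro x hx; simp only [Finset.mem_insert, Finset.mem_singleton] at hx
      rcases hx with rfl | rfl | rfl <;> assumption
  by_contra hcon
  push Not at hcon
  obtain ⟨⟨f, hf, hfv, hfG⟩, g, hg, hgv, hgG⟩ := hcon
  obtain ⟨a, b, haU, hbU, -, rfl⟩ := cell_two hf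
  obtain ⟨c, d, hcU, hdU, -, rfl⟩ := cell_two hg
  have ha := hfv (show a ∈ ({a, b} : Finset LL) by simp)
  have hb := hfv (show b ∈ ({a, b} : Finset LL) by simp)
  have hcv := hgv (show c ∈ ({c, d} : Finset LL) by simp)
  have hd := hgv (show d ∈ ({c, d} : Finset LL) by simp)
  exact hfG ((step1 a ha b hb d hd haU hbU hdU).2 ((step2 a ha c hcv d hd haU hcU hdU).2 hgG))

theorem cells_S8 : ∀ f ∈ cells U 2, ∃ e ∈ cells U 3, f ⊆ e := by
  intro f hf
  obtain ⟨a, b, haU, hbU, hab, rfl⟩ := cell_two hf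
  obtain ⟨c, hc, hcb⟩ := fc3 (b - a) (adj_iff.1 hab)
  have h1 : Adj a (a + c) := adj_iff.2 (by simpa using hc)
  have h2 : Adj (a + c) b := (adj_sub a).1 (by simpa using hcb)
  refine ⟨_, (insert_cell (d := a + c) hf ?_).2, Finset.subset_insert _ _⟩
  intro x hx
  simp only [Finset.mem_insert, Finset.mem_singleton] at hx
  rcases hx with rfl | rfl
  · exact h1.symm
  · exact h2

theorem cells_S7 : ∀ f ∈ cells U 2, ∀ z ⊆ cells U 3, (∀ e ∈ z, f ⊆ e) → Even' (cells U 4) z →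
    z = ∅ ∨ (∀ e ∈ cells U 3, f ⊆ e → e ∈ z) := by
  intro f hf z hz hfz hev
  obtain ⟨a, b, haU, hbU, hab, hfe⟩ := cell_two hf
  -- adjacent common neighbours
  have step : ∀ c d, (∀ x ∈ f, Adj c x) → (∀ x ∈ f, Adj d x) → Adj c d → (insert c f ∈ z ↔ insert d f ∈ z) := by
    intro c d hc hd hcd
    obtain ⟨n1, c1⟩ := insert_cell hf hc
    obtain ⟨n2, c2⟩ := insert_cell hf hd
    obtain ⟨n3, c3⟩ := insert_cell (d := c) c2 (by
      intro x hx
      rcases Finset.mem_insert.1 hx with rfl | hx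
      · exact hcd
      · exact hc x hx)
    obtain ⟨e, he, e', he', hne, hi⟩ := cells_S3 f hf _ c3 ((Finset.subset_insert _ _).trans (Finset.subset_insert _ _))
    have hpar : par z (insert c (insert d f)) = (if e ∈ z then 1 else 0) + (if e' ∈ z then 1 else 0) := by
      have : par z (insert c (insert d f)) = ∑ t ∈ cells U 3, if f ⊆ t ∧ t ⊆ insert c (insert d f) then (if t ∈ z then 1 else 0) else 0 := by
        unfold par
        rw [← Finset.sum_subset hz]
        · apply Finset.sum_congr rfl
          intro t ht; simp [ht, hfz t ht]
        · intro t _ ht; simp [ht]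
      rw [this, sum_two he he' hne hi]
    rw [hev _ c3] at hpar
    have h12 : e ∈ z ↔ e' ∈ z := by
      by_cases h1 : e ∈ z <;> by_cases h2 : e' ∈ z
      · simp [h1, h2]
      · exfalso; rw [if_pos h1, if_neg h2] at hpar; revert hpar; decide
      · exfalso; rw [if_neg h1, if_pos h2] at hpar; revert hpar; decide
      · simp [h1, h2]
    have i1 := (hi _ c1).1 ⟨Finset.subset_insert _ _, Finset.insert_subset_insert _ (Finset.subset_insert _ _)⟩
    have i2 := (hi _ c2).1 ⟨Finset.subset_insert _ _, Finset.subset_insert _ _⟩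
    rcases i1 with h1 | h1 <;> rcases i2 with h2 | h2 <;> rw [h1, h2]
    · exact h12
    · exact h12.symm
  have step' : ∀ c d, (∀ x ∈ f, Adj c x) → (∀ x ∈ f, Adj d x) → (c = d ∨ Adj c d) → (insert c f ∈ z ↔ insert d f ∈ z) := by
    rintro c d hc hd (rfl | h)
    · rfl
    · exact step c d hc hd h
  by_contra hcon
  push Not at hcon
  obtain ⟨hne, e, he, hfe', hez⟩ := hcon
  obtain ⟨e1, he1⟩ := hne
  obtain ⟨c, -, rfl, hc⟩ := cell_up hf (hz he1) (hfz _ he1)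
  obtain ⟨d, -, rfl, hd⟩ := cell_up hf he hfe'
  have tr : ∀ c, (∀ x ∈ f, Adj c x) → c - a ∈ Nb ∧ Adj (c - a) (b - a) := by
    intro c hc
    refine ⟨adj_iff.1 (hc a (by rw [hfe]; simp)).symm, (adj_sub a).2 (hc b (by rw [hfe]; simp))⟩
  have tr' : ∀ c, c ∈ Nb → Adj c (b - a) → (∀ x ∈ f, Adj (a + c) x) := by
    intro c h1 h2 x hx
    rw [hfe] at hx
    simp only [Finset.mem_insert, Finset.mem_singleton] at hx
    rcases hx with rfl | rfl
    · exact (adj_iff.2 (by simpa using h1)).symm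
    · exact (adj_sub a).1 (by simpa using h2)
  obtain ⟨d1, h1, d2, h2, ⟨k1, k3⟩, ⟨k2, k4⟩, k5⟩ := fc2 (b - a) (adj_iff.1 hab) (c - a) (tr c hc).1 (d - a) (tr d hd).1
    (tr c hc).2 (tr d hd).2
  have eqv : ∀ x y : LL, (x - a = y ∨ Adj (x - a) y) → (x = a + y ∨ Adj x (a + y)) := by
    rintro x y (h | h)
    · left; rw [← h]; abel
    · right; exact (adj_sub a).1 (by simpa using h)
  apply hez
  rw [← step' (a + d2) d (tr' d2 h2 k2) hd, ← step' (a + d1) (a + d2) (tr' d1 h1 k1) (tr' d2 h2 k2),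
    ← step' c (a + d1) hc (tr' d1 h1 k1)]
  · exact he1
  · exact eqv _ _ k3
  · apply eqv; simpa using k4
  · have := eqv d d2 (by rcases k5 with h | h
                         · exact Or.inl h.symm
                         · exact Or.inr h.symm)
    rcases this with h | h
    · exact Or.inl h.symm
    · exact Or.inr h.symm

/-- connectivity properties which will be proved by induction on the level -/
structure Conn (U : Finset LL) : Prop where
  S5 : ∀ z ⊆ cells U 3, Even' (cells U 4) z → ∃ 𝓖 ⊆ cells U 2, ∀ e ∈ cells U 3, par 𝓖 e = if e ∈ z then 1 else 0
  S6 : ∀ 𝓖 ⊆ cells U 2, (∀ e ∈ cells U 3, par 𝓖 e = 0) → 𝓖 = ∅ ∨ 𝓖 = cells U 2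

noncomputable def mkSurf (U : Finset LL) (h : Conn U) : Surf LL where
  F := cells U 2
  E := cells U 3
  V := cells U 4
  cF := fun f hf => (mem_cells.1 hf).1
  cE := fun f hf => (mem_cells.1 hf).1
  cV := fun f hf => (mem_cells.1 hf).1
  S1 := cells_S1 U
  S2 := cells_S2
  S3 := cells_S3
  S4 := cells_S4
  S5 := h.S5
  S6 := h.S6
  S7 := cells_S7
  S8 := cells_S8

end cells
end ABCT
end

section
open Set Metric Filter Topology

namespace ABCT

section refine_lattice
set_option linter.unusedSectionVars false
set_option linter.unusedVariables false

structure PS where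
  s1 : ℤ
  s2 : ℤ
  s3 : ℤ
  h1 : 0 ≤ s1
  h2 : 0 ≤ s2
  h3 : 0 < s3

namespace PS
variable (P : PS)

def C : ℤ := P.s1 + P.s2 + P.s3 + 1

def kk (a : LL) : ℤ := -((a.1 + P.s1 * a.2.1 + P.s2 * a.2.2) / P.C)

def q (a : LL) : LL := (a.2.1 + P.kk a, a.2.2 + P.kk a, P.kk a)

def u (a : LL) : ℤ := a.1 + P.kk a

def s (a : LL) : ℤ := P.s1 * a.1 + P.s2 * a.2.1 + P.s3 * a.2.2

def ch (a : LL) (u : ℤ) : LL := (u - a.2.2, a.1 - a.2.2, a.2.1 - a.2.2)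

theorem C_pos : 0 < P.C := by have := P.h1; have := P.h2; have := P.h3; unfold C; omega

theorem ch_q_u (a : LL) : ch (P.q a) (P.u a) = a := by
  obtain ⟨x, y, z⟩ := a
  simp only [ch, q, u]
  refine Prod.ext ?_ (Prod.ext ?_ ?_) <;> simp

theorem qu_inj {a b : LL} (h1 : P.q a = P.q b) (h2 : P.u a = P.u b) : a = b := by
  rw [← P.ch_q_u a, ← P.ch_q_u b, h1, h2]

theorem u_s (a : LL) : P.u a + P.s (P.q a) = (a.1 + P.s1 * a.2.1 + P.s2 * a.2.2) % P.C := by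
  rw [Int.emod_def]
  simp only [u, s, q, kk, C]
  ring

theorem u_lo (a : LL) : - P.s (P.q a) ≤ P.u a := by
  have := P.u_s a
  have := Int.emod_nonneg (a.1 + P.s1 * a.2.1 + P.s2 * a.2.2) P.C_pos.ne'
  omega

theorem u_hi (a : LL) : P.u a ≤ P.C - 1 - P.s (P.q a) := by
  have := P.u_s a
  have := Int.emod_lt_of_pos (a.1 + P.s1 * a.2.1 + P.s2 * a.2.2) P.C_pos
  omega

theorem kk_ch {α : LL} {u : ℤ} (h1 : - P.s α ≤ u) (h2 : u ≤ P.C - 1 - P.s α) : P.kk (ch α u) = α.2.2 := by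
  unfold kk ch
  have : u - α.2.2 + P.s1 * (α.1 - α.2.2) + P.s2 * (α.2.1 - α.2.2) = (u + P.s α) + (- α.2.2) * P.C := by
    simp only [s, C]; ring
  simp only [this]
  rw [Int.add_mul_ediv_right _ _ P.C_pos.ne', Int.ediv_eq_zero_of_lt (by omega) (by omega)]
  ring

theorem q_ch {α : LL} {u : ℤ} (h1 : - P.s α ≤ u) (h2 : u ≤ P.C - 1 - P.s α) : P.q (ch α u) = α := by
  unfold q
  rw [P.kk_ch h1 h2]
  simp [ch]

theorem u_ch {α : LL} {u : ℤ} (h1 : - P.s α ≤ u) (h2 : u ≤ P.C - 1 - P.s α) : P.u (ch α u) = u := by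
  unfold PS.u
  rw [P.kk_ch h1 h2]
  simp [ch]

theorem s_mono {α β : LL} (h : RR α β) : P.s α ≤ P.s β ∧ P.s β ≤ P.s α + P.C - 1 := by
  obtain ⟨h1, h2, h3⟩ := h
  have := P.h1; have := P.h2; have := P.h3
  unfold s C
  rcases h1 with h1 | h1 <;> rcases h2 with h2 | h2 <;> rcases h3 with h3 | h3 <;> rw [h1, h2, h3] <;>
    constructor <;> nlinarith

/-- the relation on pairs (parent, parameter) -/
def QR (a b : LL) : Prop := RR (P.q a) (P.q b) ∧ P.u a ≤ P.u b ∧ P.u b ≤ P.u a + 1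

theorem rr_qr {a b : LL} (h : RR a b) : P.QR a b ∨ P.QR b a := by
  obtain ⟨h1, h2, h3⟩ := h
  have := P.h1; have := P.h2; have := P.h3
  have hC := P.C_pos
  have key : (b.1 + P.s1 * b.2.1 + P.s2 * b.2.2) - (a.1 + P.s1 * a.2.1 + P.s2 * a.2.2) ≥ 0 ∧
      (b.1 + P.s1 * b.2.1 + P.s2 * b.2.2) - (a.1 + P.s1 * a.2.1 + P.s2 * a.2.2) < P.C := by
    unfold C
    rcases h1 with h1 | h1 <;> rcases h2 with h2 | h2 <;> rcases h3 with h3 | h3 <;> rw [h1, h2, h3] <;>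
      constructor <;> nlinarith
  have hk : P.kk b = P.kk a ∨ P.kk b = P.kk a - 1 := by
    unfold kk
    set m := a.1 + P.s1 * a.2.1 + P.s2 * a.2.2
    set n := b.1 + P.s1 * b.2.1 + P.s2 * b.2.2
    have e1 : m / P.C ≤ n / P.C := Int.ediv_le_ediv hC (by omega)
    have e2 : n / P.C ≤ m / P.C + 1 := by
      have : n / P.C ≤ (m + 1 * P.C) / P.C := Int.ediv_le_ediv hC (by omega)
      rwa [Int.add_mul_ediv_right _ _ hC.ne'] at this
    omega
  simp only [QR, RR, q, u]
  rcases hk with hk | hk <;> rw [hk] <;> omega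

theorem qr_rr {a b : LL} (h : P.QR a b) : RR a b ∨ RR b a := by
  rw [← P.ch_q_u a, ← P.ch_q_u b]
  obtain ⟨⟨h1, h2, h3⟩, h4, h5⟩ := h
  simp only [ch, RR]
  omega

theorem adj_qr {a b : LL} : Adj a b ↔ a ≠ b ∧ (P.QR a b ∨ P.QR b a) := by
  unfold Adj
  constructor
  · rintro ⟨h, h1 | h1⟩
    · exact ⟨h, P.rr_qr h1⟩
    · exact ⟨h, (P.rr_qr h1).symm⟩
  · rintro ⟨h, h1 | h1⟩
    · exact ⟨h, P.qr_rr h1⟩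
    · exact ⟨h, (P.qr_rr h1).symm⟩

theorem adj_q {a b : LL} (h : Adj a b) (hne : P.q a ≠ P.q b) : Adj (P.q a) (P.q b) := by
  obtain ⟨-, h | h⟩ := P.adj_qr.1 h
  · exact ⟨hne, Or.inl h.1⟩
  · exact ⟨hne, Or.inr h.1⟩

end PS

theorem RR.refl (a : LL) : RR a a := ⟨Or.inl rfl, Or.inl rfl, Or.inl rfl⟩

theorem RR.antisymm {a b : LL} (h : RR a b) (h' : RR b a) : a = b := by
  obtain ⟨h1, h2, h3⟩ := h
  obtain ⟨h4, h5, h6⟩ := h'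
  refine Prod.ext ?_ (Prod.ext ?_ ?_) <;> omega

variable (P : PS)

theorem PS.clique_image {t : Finset LL} (h : Clique t) : Clique (t.image P.q) := by
  intro a ha b hb hab
  obtain ⟨x, hx, rfl⟩ := Finset.mem_image.1 ha
  obtain ⟨y, hy, rfl⟩ := Finset.mem_image.1 hb
  exact P.adj_q (h x hx y hy (by rintro rfl; exact hab rfl)) hab

/-- children of a set -/
noncomputable def PS.kids (U : Finset LL) : Finset LL :=
  U.biUnion fun α => (Finset.Icc (- P.s α) (P.C - 1 - P.s α)).image fun u => PS.ch α u

theorem PS.mem_kids {U : Finset LL} {a : LL} : a ∈ P.kids U ↔ P.q a ∈ U := by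
  unfold PS.kids
  simp only [Finset.mem_biUnion, Finset.mem_image, Finset.mem_Icc]
  constructor
  · rintro ⟨α, hα, u, ⟨h1, h2⟩, rfl⟩
    rwa [P.q_ch h1 h2]
  · intro h
    exact ⟨_, h, _, ⟨P.u_lo a, P.u_hi a⟩, P.ch_q_u a⟩

theorem PS.bi_kids {U t : Finset LL} : Bi (P.kids U) t ↔ Bi U (t.image P.q) := by
  unfold Bi
  simp only [P.mem_kids, Finset.mem_image, exists_exists_and_eq_and]

theorem Bi.two {U t : Finset LL} (h : Bi U t) : 2 ≤ t.card := by
  obtain ⟨⟨a, ha, haU⟩, b, hb, hbU⟩ := h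
  exact Finset.one_lt_card.2 ⟨a, ha, b, hb, by rintro rfl; exact hbU haU⟩

variable {U : Finset LL}

theorem PS.image_cell {t : Finset LL} {k : ℕ} (ht : t ∈ cells (P.kids U) k) :
    t.image P.q ∈ cells U (t.image P.q).card ∧ 2 ≤ (t.image P.q).card ∧ (t.image P.q).card ≤ k := by
  obtain ⟨h1, h2, h3⟩ := mem_cells.1 ht
  have h4 := P.bi_kids.1 h3
  exact ⟨mem_cells.2 ⟨rfl, P.clique_image h2, h4⟩, h4.two, h1 ▸ Finset.card_image_le⟩

theorem par_erase {𝓖 : Finset (Finset LL)} {k : ℕ} (h : ∀ g ∈ 𝓖, g.card = k) {s : Finset LL} (hs : s.card = k + 1) :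
    par 𝓖 s = ∑ a ∈ s, if s.erase a ∈ 𝓖 then 1 else 0 := by
  unfold par
  rw [← Finset.sum_filter, ← Finset.sum_filter]
  symm
  apply Finset.sum_bij (fun a _ => s.erase a)
  · intro a ha
    rw [Finset.mem_filter] at ha ⊢
    exact ⟨ha.2, Finset.erase_subset _ _⟩
  · intro a ha b hb hab
    by_contra hne
    have : b ∈ s.erase a := Finset.mem_erase.2 ⟨Ne.symm hne, (Finset.mem_filter.1 hb).1⟩
    rw [hab] at this
    exact (Finset.notMem_erase b s) this
  · intro g hg
    rw [Finset.mem_filter] at hg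
    have hc : (s \ g).card = 1 := by rw [Finset.card_sdiff_of_subset hg.2, hs, h g hg.1]; omega
    obtain ⟨a, ha⟩ := Finset.card_eq_one.1 hc
    have has : a ∈ s \ g := by rw [ha]; simp
    have e : s.erase a = g := by
      rw [Finset.erase_eq, ← ha, Finset.sdiff_sdiff_eq_self hg.2]
    refine ⟨a, Finset.mem_filter.2 ⟨(Finset.mem_sdiff.1 has).1, by rw [e]; exact hg.1⟩, e⟩
  · intro a _; rfl

/-- only two facets of a rung map onto a set of full size -/
theorem PS.erase_inj {t : Finset LL} {k : ℕ} (ht : t.card = k + 1) {a b c : LL} (ha : a ∈ t) (hb : b ∈ t)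
    (hab : a ≠ b) (hq : P.q a = P.q b) (hc : c ∈ t) (hcard : ((t.erase c).image P.q).card = k) : c = a ∨ c = b := by
  by_contra hcon
  push Not at hcon
  have : (t.erase c).card = k := by rw [Finset.card_erase_of_mem hc, ht]; rfl
  have hinj := Finset.card_image_iff.1 (hcard.trans this.symm)
  exact hab (hinj (by simp [hcon.1.symm, ha]) (by simp [hcon.2.symm, hb]) hq)

theorem sum_pair_only {t : Finset LL} {a b : LL} (ha : a ∈ t) (hb : b ∈ t) (hab : a ≠ b) (F : LL → ZMod 2)
    (h : ∀ c ∈ t, c ≠ a → c ≠ b → F c = 0) : ∑ c ∈ t, F c = F a + F b := by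
  rw [← Finset.sum_pair hab]
  symm
  apply Finset.sum_subset
  · intro x hx
    simp only [Finset.mem_insert, Finset.mem_singleton] at hx
    rcases hx with rfl | rfl <;> assumption
  · intro c hc hc'
    simp only [Finset.mem_insert, Finset.mem_singleton, not_or] at hc'
    exact h c hc hc'.1 hc'.2

theorem PS.Q23 {k : ℕ} {𝓖 : Finset (Finset LL)} (h𝓖 : 𝓖 ⊆ cells U k) {t : Finset LL}
    (ht : t ∈ cells (P.kids U) (k+1)) : par (lift P.q (cells (P.kids U) k) 𝓖) t =
      if t.image P.q ∈ cells U (k+1) then par 𝓖 (t.image P.q) else 0 := by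
  obtain ⟨h1, h2, h3⟩ := mem_cells.1 ht
  rw [par_erase (k := k) (fun g hg => (mem_cells.1 (mem_lift.1 hg).1).1) h1]
  have e1 : ∀ a ∈ t, (if t.erase a ∈ lift P.q (cells (P.kids U) k) 𝓖 then (1 : ZMod 2) else 0) =
      if (t.erase a).image P.q ∈ 𝓖 then 1 else 0 := by
    intro a ha
    congr 1
    rw [mem_lift, eq_iff_iff, and_iff_right_iff_imp]
    intro h
    obtain ⟨-, -, h5⟩ := mem_cells.1 (h𝓖 h)
    refine mem_cells.2 ⟨by rw [Finset.card_erase_of_mem ha, h1]; rfl, h2.mono (Finset.erase_subset _ _), P.bi_kids.2 h5⟩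
  rw [Finset.sum_congr rfl e1]
  split_ifs with hi
  · have hc := (mem_cells.1 hi).1
    have hinj := Finset.card_image_iff.1 (hc.trans h1.symm)
    rw [par_erase (k := k) (fun g hg => (mem_cells.1 (h𝓖 hg)).1) hc, Finset.sum_image hinj]
    apply Finset.sum_congr rfl
    intro a ha
    have : (t.erase a).image P.q = (t.image P.q).erase (P.q a) := by
      ext x
      simp only [Finset.mem_image, Finset.mem_erase]
      constructor
      · rintro ⟨y, ⟨hya, hy⟩, rfl⟩
        exact ⟨fun h => hya (hinj hy ha h), y, hy, rfl⟩
      · rintro ⟨hx, y, hy, rfl⟩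
        exact ⟨y, ⟨by rintro rfl; exact hx rfl, hy⟩, rfl⟩
    rw [this]
  · have hc : (t.image P.q).card ≠ k + 1 := by
      intro h; exact hi (mem_cells.2 ⟨h, P.clique_image h2, P.bi_kids.1 h3⟩)
    have hni : ¬ Set.InjOn P.q t := fun h => hc ((Finset.card_image_iff.2 h).trans h1)
    unfold Set.InjOn at hni
    push Not at hni
    obtain ⟨a, ha, b, hb, hq, hab⟩ := hni
    rw [sum_pair_only ha hb hab]
    · have : (t.erase a).image P.q = (t.erase b).image P.q := by
        have key : ∀ a b, a ∈ t → b ∈ t → P.q a = P.q b → a ≠ b → (t.erase a).image P.q ⊆ (t.erase b).image P.q := by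
          intro a b ha hb hq hab x hx
          obtain ⟨y, hy, rfl⟩ := Finset.mem_image.1 hx
          by_cases hyb : y = b
          · rw [hyb, ← hq]; exact Finset.mem_image_of_mem _ (Finset.mem_erase.2 ⟨hab, ha⟩)
          · exact Finset.mem_image_of_mem _ (Finset.mem_erase.2 ⟨hyb, (Finset.mem_erase.1 hy).2⟩)
        exact (key a b ha hb hq hab).antisymm (key b a hb ha hq.symm hab.symm)
      rw [this, z2_add]
    · intro c hc hca hcb
      rw [if_neg]
      intro h
      rcases P.erase_inj h1 ha hb hab hq hc (mem_cells.1 (h𝓖 h)).1 with h | h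
      · exact hca h
      · exact hcb h

/-- every cell has a child cell of the same size -/
theorem PS.exists_child {s : Finset LL} {k : ℕ} (hs : s ∈ cells U k) :
    ∃ t ∈ cells (P.kids U) k, t.image P.q = s := by
  obtain ⟨h1, h2, h3⟩ := mem_cells.1 hs
  obtain ⟨a, ha, -⟩ := h3.1
  obtain ⟨m, hm, hmin⟩ := s.exists_min_image P.s ⟨a, ha⟩
  have hw : ∀ α ∈ s, - P.s α ≤ - P.s m ∧ - P.s m ≤ P.C - 1 - P.s α := by
    intro α hα
    have := hmin α hα
    refine ⟨by omega, ?_⟩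
    by_cases hne : m = α
    · have := P.C_pos; rw [hne]; omega
    · obtain ⟨-, h | h⟩ := h2 m hm α hα hne
      · have := P.s_mono h; omega
      · have := P.s_mono h; have := P.C_pos; omega
  have hq : ∀ α ∈ s, P.q (PS.ch α (- P.s m)) = α := fun α hα => P.q_ch (hw α hα).1 (hw α hα).2
  have himg : (s.image fun α => PS.ch α (- P.s m)).image P.q = s := by
    rw [Finset.image_image]
    ext x
    simp only [Finset.mem_image, Function.comp]
    constructor
    · rintro ⟨y, hy, rfl⟩; rwa [hq y hy]
    · intro hx; exact ⟨x, hx, hq x hx⟩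
  refine ⟨s.image fun α => PS.ch α (- P.s m), mem_cells.2 ⟨?_, ?_, ?_⟩, himg⟩
  · rw [Finset.card_image_of_injOn, h1]
    intro x hx y hy hxy
    rw [← hq x hx, ← hq y hy]; exact congrArg _ hxy
  · intro x hx y hy hxy
    obtain ⟨α, hα, rfl⟩ := Finset.mem_image.1 hx
    obtain ⟨β, hβ, rfl⟩ := Finset.mem_image.1 hy
    have hab : α ≠ β := by rintro rfl; exact hxy rfl
    rw [P.adj_qr]
    refine ⟨hxy, ?_⟩
    unfold PS.QR
    rw [hq α hα, hq β hβ, P.u_ch (hw α hα).1 (hw α hα).2, P.u_ch (hw β hβ).1 (hw β hβ).2]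
    obtain ⟨-, h | h⟩ := h2 α hα β hβ hab
    · left; exact ⟨h, le_refl _, by omega⟩
    · right; exact ⟨h, le_refl _, by omega⟩
  · rw [P.bi_kids, himg]; exact h3

/-- a 4-cell has a unique child 4-cell -/
theorem PS.child_unique {t t' : Finset LL} (ht : Clique t) (ht' : Clique t') (h4 : t.card = 4) (h4' : t'.card = 4)
    (h : t.image P.q = t'.image P.q) (hc : (t.image P.q).card = 4) : t = t' := by
  set v := t.image P.q with hv
  have hcl : Clique v := P.clique_image ht
  -- extreme elements
  let w : LL → ℤ := fun a => a.1 + a.2.1 + a.2.2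
  obtain ⟨m, hm, hmin⟩ := v.exists_min_image w (Finset.card_pos.1 (by omega))
  have hrr : ∀ β ∈ v, RR m β := by
    intro β hβ
    by_cases hne : m = β
    · rw [hne]; exact RR.refl _
    · obtain ⟨-, h | h⟩ := hcl m hm β hβ hne
      · exact h
      · have := hmin β hβ
        obtain ⟨h1, h2, h3⟩ := h
        exfalso; apply hne
        simp only [w] at this
        refine Prod.ext ?_ (Prod.ext ?_ ?_) <;> omega
  obtain ⟨M, hM, hmax⟩ : ∃ M ∈ v, P.s M = P.s m + P.C - 1 ∧ ∀ β ∈ v, RR β M := by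
    have hinj : Set.InjOn w v := by
      intro b hb c hc hbc
      by_contra hne
      have hbc : b.1 + b.2.1 + b.2.2 = c.1 + c.2.1 + c.2.2 := hbc
      obtain ⟨-, ⟨h2, h3, h4⟩ | ⟨h2, h3, h4⟩⟩ := hcl b hb c hc hne <;>
      · apply hne
        refine Prod.ext ?_ (Prod.ext ?_ ?_) <;> omega
    have himg : v.image w = Finset.Icc (w m) (w m + 3) := by
      apply Finset.eq_of_subset_of_card_le
      · intro x hx
        obtain ⟨β, hβ, rfl⟩ := Finset.mem_image.1 hx
        obtain ⟨h1, h2, h3⟩ := hrr β hβ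
        rw [Finset.mem_Icc]
        simp only [w]; omega
      · rw [Finset.card_image_of_injOn hinj, hc, Int.card_Icc]; omega
    have : w m + 3 ∈ v.image w := by rw [himg, Finset.mem_Icc]; omega
    obtain ⟨M, hM, hMw⟩ := Finset.mem_image.1 this
    obtain ⟨h1, h2, h3⟩ := hrr M hM
    simp only [w] at hMw
    have e1 : M.1 = m.1 + 1 := by omega
    have e2 : M.2.1 = m.2.1 + 1 := by omega
    have e3 : M.2.2 = m.2.2 + 1 := by omega
    refine ⟨M, hM, by unfold PS.s PS.C; rw [e1, e2, e3]; ring, ?_⟩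
    intro β hβ
    obtain ⟨k1, k2, k3⟩ := hrr β hβ
    unfold RR
    omega
  have key : ∀ t : Finset LL, Clique t → t.card = 4 → t.image P.q = v → ∀ a ∈ t, P.u a = - P.s m := by
    intro t ht h4 hv a ha
    have hinj := Finset.card_image_iff.1 ((congrArg Finset.card hv).trans (hc.trans h4.symm))
    have mono : ∀ a ∈ t, ∀ b ∈ t, RR (P.q a) (P.q b) → P.u a ≤ P.u b := by
      intro a ha b hb hab
      by_cases hne : a = b
      · rw [hne]
      · obtain ⟨-, h | h⟩ := P.adj_qr.1 (ht a ha b hb hne)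
        · exact h.2.1
        · exact absurd (hinj ha hb (hab.antisymm h.1)) hne
    rw [← hv] at hm hM
    obtain ⟨x, hx, hxm⟩ := Finset.mem_image.1 hm
    obtain ⟨y, hy, hyM⟩ := Finset.mem_image.1 hM
    have haq : P.q a ∈ v := hv ▸ Finset.mem_image_of_mem _ ha
    have i1 := mono x hx a ha (hxm ▸ hrr _ haq)
    have i2 := mono a ha y hy (hyM ▸ hmax.2 _ haq)
    have i3 := P.u_lo x
    have i4 := P.u_hi y
    rw [hxm] at i3
    rw [hyM, hmax.1] at i4
    omega
  have sub : ∀ t t' : Finset LL, Clique t → t.card = 4 → t.image P.q = v → Clique t' → t'.card = 4 → t'.image P.q = v → t ⊆ t' := by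
    intro t t' h1 h2 h3 h4 h5 h6 a ha
    have : P.q a ∈ t'.image P.q := by rw [h6, ← h3]; exact Finset.mem_image_of_mem _ ha
    obtain ⟨b, hb, hba⟩ := Finset.mem_image.1 this
    rwa [P.qu_inj hba.symm ((key t h1 h2 h3 a ha).trans (key t' h4 h5 h6 b hb).symm)]
  exact (sub t t' ht h4 rfl ht' h4' h.symm).antisymm (sub t' t ht' h4' h.symm ht h4 rfl)

end refine_lattice
end ABCT
end

section
open Set Metric Filter Topology

namespace ABCT

section chains
set_option linter.unusedSectionVars false
set_option linter.unusedVariables false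

structure Chain (k : ℕ) (α : ℕ → LL) : Prop where
  hk : k = 2 ∨ k = 3
  rr : ∀ i j, i ≤ j → j < k → RR (α i) (α j)
  inj : ∀ i j, i < k → j < k → α i = α j → i = j

theorem exists_chain {s : Finset LL} {k : ℕ} (hk : k = 2 ∨ k = 3) (hc : s.card = k) (h : Clique s) :
    ∃ α, Chain k α ∧ (Finset.range k).image α = s := by
  rcases hk with rfl | rfl
  · have main : ∀ a b, s = {a, b} → a ≠ b → RR a b → ∃ α, Chain 2 α ∧ (Finset.range 2).image α = s := by
      intro a b hs hab hr
      refine ⟨fun j => if j = 0 then a else b, ⟨Or.inl rfl, ?_, ?_⟩, ?_⟩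
      · intro i j hij hj
        interval_cases j <;> interval_cases i <;> first | exact RR.refl _ | exact hr
      · intro i j hi hj e
        interval_cases j <;> interval_cases i <;> simp_all
      · rw [hs]; ext x; simp [Finset.range_add_one]; tauto
    obtain ⟨a, b, hab, rfl⟩ := Finset.card_eq_two.1 hc
    obtain ⟨-, hr | hr⟩ := h a (by simp) b (by simp) hab
    · exact main a b rfl hab hr
    · exact main b a (Finset.pair_comm _ _) hab.symm hr
  · have main : ∀ a b c, s = {a, b, c} → a ≠ b → a ≠ c → b ≠ c → RR a b → RR b c → RR a c →
        ∃ α, Chain 3 α ∧ (Finset.range 3).image α = s := by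
      intro a b c hs hab hac hbc h1 h2 h3
      refine ⟨fun j => if j = 0 then a else if j = 1 then b else c, ⟨Or.inr rfl, ?_, ?_⟩, ?_⟩
      · intro i j hij hj
        interval_cases j <;> interval_cases i <;> first | exact RR.refl _ | assumption
      · intro i j hi hj e
        interval_cases j <;> interval_cases i <;> simp_all
      · rw [hs]; ext x; simp [Finset.range_add_one]; tauto
    obtain ⟨a, b, c, hab, hac, hbc, hs⟩ := Finset.card_eq_three.1 hc
    have e1 : s = {a, c, b} := by rw [hs]; ext x; simp; tauto
    have e2 : s = {b, a, c} := by rw [hs]; ext x; simp; tauto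
    have e3 : s = {b, c, a} := by rw [hs]; ext x; simp; tauto
    have e4 : s = {c, a, b} := by rw [hs]; ext x; simp; tauto
    have e5 : s = {c, b, a} := by rw [hs]; ext x; simp; tauto
    have cyc : ∀ a b c : LL, a ≠ b → RR a b → RR b c → RR c a → False := by
      rintro a b c hab ⟨h1, h2, h3⟩ ⟨h4, h5, h6⟩ ⟨h7, h8, h9⟩
      apply hab
      refine Prod.ext ?_ (Prod.ext ?_ ?_) <;> omega
    obtain ⟨-, h1⟩ := h a (by simp [hs]) b (by simp [hs]) hab
    obtain ⟨-, h2⟩ := h a (by simp [hs]) c (by simp [hs]) hac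
    obtain ⟨-, h3⟩ := h b (by simp [hs]) c (by simp [hs]) hbc
    rcases h1 with h1 | h1 <;> rcases h2 with h2 | h2 <;> rcases h3 with h3 | h3
    · exact main a b c hs hab hac hbc h1 h3 h2
    · exact main a c b e1 hac hab hbc.symm h2 h3 h1
    · exact (cyc a b c hab h1 h3 h2).elim
    · exact main c a b e4 hac.symm hbc.symm hab h2 h1 h3
    · exact main b a c e2 hab.symm hbc hac h1 h2 h3
    · exact (cyc b a c hab.symm h1 h2 h3).elim
    · exact main b c a e3 hbc hab.symm hac.symm h3 h2 h1
    · exact main c b a e5 hbc.symm hac.symm hab.symm h3 h1 h2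

variable (P : PS)

def PS.phi (k : ℕ) (α : ℕ → LL) (T : ℤ) : Finset LL :=
  (Finset.range k).image fun j : ℕ => PS.ch (α j) ((T + j) / (k : ℤ))

def PS.Rg (k : ℕ) (α : ℕ → LL) (T : ℤ) : Prop :=
  k * (- P.s (α 0)) ≤ T ∧ T ≤ k * (P.C - 1 - P.s (α (k-1)))

variable {P} {k : ℕ} {α : ℕ → LL}

theorem Chain.win (h : Chain k α) {T : ℤ} (hT : P.Rg k α T) {j : ℕ} (hj : j < k) :
    - P.s (α j) ≤ (T + j) / (k : ℤ) ∧ (T + j) / (k : ℤ) ≤ P.C - 1 - P.s (α j) := by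
  have m1 := (P.s_mono (h.rr 0 j (by omega) hj)).1
  have m2 := (P.s_mono (h.rr j (k-1) (by omega) (by omega))).1
  obtain ⟨h1, h2⟩ := hT
  rcases h.hk with rfl | rfl
  · push_cast at *
    have m2 : P.s (α j) ≤ P.s (α 1) := m2
    have h2 : T ≤ 2 * (P.C - 1 - P.s (α 1)) := h2
    omega
  · push_cast at *
    have m2 : P.s (α j) ≤ P.s (α 2) := m2
    have h2 : T ≤ 3 * (P.C - 1 - P.s (α 2)) := h2
    omega

theorem Chain.mem_phi (h : Chain k α) {T : ℤ} (hT : P.Rg k α T) {a : LL} :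
    a ∈ PS.phi k α T ↔ ∃ j < k, P.q a = α j ∧ P.u a = (T + j) / (k : ℤ) := by
  unfold PS.phi
  rw [Finset.mem_image]
  constructor
  · rintro ⟨j, hj, rfl⟩
    rw [Finset.mem_range] at hj
    have := h.win hT hj
    exact ⟨j, hj, P.q_ch this.1 this.2, P.u_ch this.1 this.2⟩
  · rintro ⟨j, hj, h1, h2⟩
    exact ⟨j, Finset.mem_range.2 hj, by rw [← h1, ← h2, P.ch_q_u]⟩

theorem Chain.phi_at (h : Chain k α) {T : ℤ} (hT : P.Rg k α T) {j : ℕ} (hj : j < k) :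
    ∃ a ∈ PS.phi k α T, P.q a = α j ∧ P.u a = (T + j) / (k : ℤ) := by
  have := h.win hT hj
  refine ⟨PS.ch (α j) ((T + j) / (k : ℤ)), ?_, P.q_ch this.1 this.2, P.u_ch this.1 this.2⟩
  exact (h.mem_phi hT).2 ⟨j, hj, P.q_ch this.1 this.2, P.u_ch this.1 this.2⟩

theorem Chain.u_of_mem (h : Chain k α) {T : ℤ} (hT : P.Rg k α T) {a : LL} (ha : a ∈ PS.phi k α T) {j : ℕ} (hj : j < k)
    (hq : P.q a = α j) : P.u a = (T + j) / (k : ℤ) := by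
  obtain ⟨i, hi, h1, h2⟩ := (h.mem_phi hT).1 ha
  rw [h.inj j i hj hi (hq.symm.trans h1)]; exact h2

theorem Chain.phi_card (h : Chain k α) {T : ℤ} (hT : P.Rg k α T) : (PS.phi k α T).card = k := by
  unfold PS.phi
  rw [Finset.card_image_of_injOn, Finset.card_range]
  intro i hi j hj hij
  simp only [Finset.coe_range, Set.mem_Iio] at hi hj
  have w1 := h.win hT hi
  have w2 := h.win hT hj
  apply h.inj i j hi hj
  rw [← P.q_ch w1.1 w1.2, ← P.q_ch w2.1 w2.2]
  exact congrArg _ hij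

theorem Chain.phi_image (h : Chain k α) {T : ℤ} (hT : P.Rg k α T) :
    (PS.phi k α T).image P.q = (Finset.range k).image α := by
  ext x
  simp only [Finset.mem_image, Finset.mem_range]
  constructor
  · rintro ⟨a, ha, rfl⟩
    obtain ⟨j, hj, h1, -⟩ := (h.mem_phi hT).1 ha
    exact ⟨j, hj, h1.symm⟩
  · rintro ⟨j, hj, rfl⟩
    obtain ⟨a, ha, h1, -⟩ := h.phi_at hT hj
    exact ⟨a, ha, h1⟩

theorem Chain.union_clique (h : Chain k α) {T : ℤ} (hT : P.Rg k α T) (hT' : P.Rg k α (T+1)) :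
    Clique (PS.phi k α T ∪ PS.phi k α (T+1)) := by
  have key : ∀ a ∈ PS.phi k α T ∪ PS.phi k α (T+1), ∃ j < k, P.q a = α j ∧
      (P.u a = (T + j) / (k : ℤ) ∨ P.u a = (T + 1 + j) / (k : ℤ)) := by
    intro a ha
    rcases Finset.mem_union.1 ha with h' | h'
    · obtain ⟨j, hj, h1, h2⟩ := (h.mem_phi hT).1 h'
      exact ⟨j, hj, h1, Or.inl h2⟩
    · obtain ⟨j, hj, h1, h2⟩ := (h.mem_phi hT').1 h'
      exact ⟨j, hj, h1, Or.inr h2⟩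
  have main : ∀ a b : LL, a ≠ b → ∀ i j, i ≤ j → j < k → P.q a = α i → P.q b = α j →
      (P.u a = (T + i) / (k : ℤ) ∨ P.u a = (T + 1 + i) / (k : ℤ)) → (P.u b = (T + j) / (k : ℤ) ∨ P.u b = (T + 1 + j) / (k : ℤ)) →
      Adj a b := by
    intro a b hab i j hij hj h1 h2 h3 h4
    rw [P.adj_qr]
    refine ⟨hab, ?_⟩
    unfold PS.QR
    rw [h1, h2]
    have r1 := h.rr i j hij hj
    rcases hij.lt_or_eq with hlt | rfl
    · left
      refine ⟨r1, ?_⟩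
      rcases h.hk with rfl | rfl <;> push_cast at * <;> omega
    · have r2 : RR (α i) (α i) := RR.refl _
      have : (P.u a ≤ P.u b ∧ P.u b ≤ P.u a + 1) ∨ (P.u b ≤ P.u a ∧ P.u a ≤ P.u b + 1) := by
        rcases h.hk with rfl | rfl <;> push_cast at * <;> omega
      tauto
  intro a ha b hb hab
  obtain ⟨i, hi, h1, h2⟩ := key a ha
  obtain ⟨j, hj, h3, h4⟩ := key b hb
  rcases le_total i j with hij | hij
  · exact main a b hab i j hij hj h1 h3 h2 h4
  · exact (main b a hab.symm j i hij hi h3 h1 h4 h2).symm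

theorem Chain.phi_clique (h : Chain k α) {T : ℤ} (hT : P.Rg k α T) : Clique (PS.phi k α T) := by
  intro a ha b hb hab
  obtain ⟨i, hi, h1, h2⟩ := (h.mem_phi hT).1 ha
  obtain ⟨j, hj, h3, h4⟩ := (h.mem_phi hT).1 hb
  have main : ∀ a b : LL, a ≠ b → ∀ i j, i ≤ j → j < k → P.q a = α i → P.q b = α j →
      P.u a = (T + i) / (k : ℤ) → P.u b = (T + j) / (k : ℤ) → Adj a b := by
    intro a b hab i j hij hj h1 h2 h3 h4
    rw [P.adj_qr]
    refine ⟨hab, Or.inl ?_⟩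
    unfold PS.QR
    rw [h1, h2]
    refine ⟨h.rr i j hij hj, ?_⟩
    rcases h.hk with rfl | rfl <;> push_cast at * <;> omega
  rcases le_total i j with hij | hij
  · exact main a b hab i j hij hj h1 h3 h2 h4
  · exact (main b a hab.symm j i hij hi h3 h1 h4 h2).symm

theorem arith_T (hk : k = 2 ∨ k = 3) (W : ℕ → ℤ) (hW : ∀ i j, i ≤ j → j < k → W i ≤ W j ∧ W j ≤ W i + 1) :
    ∃ T : ℤ, ∀ j < k, (T + j) / (k : ℤ) = W j := by
  rcases hk with rfl | rfl
  · have := hW 0 1 (by norm_num) (by norm_num)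
    refine ⟨W 0 + W 1, fun j hj => ?_⟩
    interval_cases j <;> push_cast <;> omega
  · have := hW 0 1 (by norm_num) (by norm_num)
    have := hW 1 2 (by norm_num) (by norm_num)
    have := hW 0 2 (by norm_num) (by norm_num)
    refine ⟨W 0 + W 1 + W 2, fun j hj => ?_⟩
    interval_cases j <;> push_cast <;> omega

theorem Chain.exists_phi (h : Chain k α) {t : Finset LL} (hc : t.card = k) (ht : Clique t)
    (hi : t.image P.q = (Finset.range k).image α) : ∃ T, P.Rg k α T ∧ t = PS.phi k α T := by
  have hex : ∀ j, ∃ a, j < k → a ∈ t ∧ P.q a = α j := by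
    intro j
    by_cases hj : j < k
    · have : α j ∈ t.image P.q := by rw [hi]; exact Finset.mem_image_of_mem _ (Finset.mem_range.2 hj)
      obtain ⟨a, ha, h1⟩ := Finset.mem_image.1 this
      exact ⟨a, fun _ => ⟨ha, h1⟩⟩
    · exact ⟨0, fun h => absurd h hj⟩
  choose f hf using hex
  have hW : ∀ i j, i ≤ j → j < k → P.u (f i) ≤ P.u (f j) ∧ P.u (f j) ≤ P.u (f i) + 1 := by
    intro i j hij hj
    rcases hij.lt_or_eq with hlt | rfl
    · have hne : α i ≠ α j := fun e => hlt.ne (h.inj i j (by omega) hj e)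
      have hfi := hf i (by omega)
      have hfj := hf j hj
      have hne' : f i ≠ f j := by intro e; rw [e] at hfi; exact hne (hfi.2.symm.trans hfj.2)
      obtain ⟨-, h' | h'⟩ := P.adj_qr.1 (ht _ hfi.1 _ hfj.1 hne')
      · exact h'.2
      · exfalso; apply hne; rw [← hfi.2, ← hfj.2]
        refine RR.antisymm ?_ h'.1
        rw [hfi.2, hfj.2]; exact h.rr i j hij hj
    · omega
  obtain ⟨T, hT⟩ := arith_T h.hk (fun j => P.u (f j)) hW
  have hR : P.Rg k α T := by
    have k0 : 0 < k := by rcases h.hk with rfl | rfl <;> norm_num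
    have a1 := P.u_lo (f 0)
    have a2 := P.u_hi (f (k-1))
    rw [(hf 0 k0).2] at a1
    rw [(hf (k-1) (by omega)).2] at a2
    have b1 := hT 0 k0
    have b2 := hT (k-1) (by omega)
    beta_reduce at b1 b2
    rw [← b1] at a1
    rw [← b2] at a2
    unfold PS.Rg
    rcases h.hk with rfl | rfl
    · change _ ∧ T ≤ ((2 : ℕ) : ℤ) * (P.C - 1 - P.s (α 1))
      have a2 : (T + ((1 : ℕ) : ℤ)) / ((2 : ℕ) : ℤ) ≤ P.C - 1 - P.s (α 1) := a2
      push_cast at *; omega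
    · change _ ∧ T ≤ ((3 : ℕ) : ℤ) * (P.C - 1 - P.s (α 2))
      have a2 : (T + ((2 : ℕ) : ℤ)) / ((3 : ℕ) : ℤ) ≤ P.C - 1 - P.s (α 2) := a2
      push_cast at *; omega
  refine ⟨T, hR, ?_⟩
  symm
  apply Finset.eq_of_subset_of_card_le
  · intro a ha
    obtain ⟨j, hj, h1, h2⟩ := (h.mem_phi hR).1 ha
    have : a = f j := P.qu_inj (h1.trans (hf j hj).2.symm) (h2.trans (hT j hj))
    rw [this]; exact (hf j hj).1
  · rw [h.phi_card hR, hc]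

theorem Chain.phi_inj (h : Chain k α) {T T' : ℤ} (hT : P.Rg k α T) (hT' : P.Rg k α T')
    (he : PS.phi k α T = PS.phi k α T') : T = T' := by
  have key : ∀ j < k, (T + j) / (k : ℤ) = (T' + j) / (k : ℤ) := by
    intro j hj
    obtain ⟨a, ha, h1, h2⟩ := h.phi_at hT hj
    rw [← h2, h.u_of_mem hT' (he ▸ ha) hj h1]
  rcases h.hk with rfl | rfl
  · have := key 0 (by norm_num); have := key 1 (by norm_num)
    push_cast at *; omega
  · have := key 0 (by norm_num); have := key 1 (by norm_num); have := key 2 (by norm_num)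
    push_cast at *; omega

/-- structure of a rung -/
theorem Chain.rung (h : Chain k α) {T : ℤ} (hT : P.Rg k α T) (hT' : P.Rg k α (T+1)) :
    ∃ a b, a ∈ PS.phi k α T ∧ b ∉ PS.phi k α T ∧ P.q a = P.q b ∧ a ≠ b ∧
      PS.phi k α T ∪ PS.phi k α (T+1) = insert b (PS.phi k α T) ∧
      (insert b (PS.phi k α T)).erase a = PS.phi k α (T+1) := by
  obtain ⟨j, hj, hj1, hj2⟩ : ∃ j < k, (T + 1 + j) / (k : ℤ) = (T + j) / (k : ℤ) + 1 ∧
      ∀ i < k, i ≠ j → (T + 1 + i) / (k : ℤ) = (T + i) / (k : ℤ) := by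
    rcases h.hk with rfl | rfl
    · rcases Int.emod_two_eq_zero_or_one T with h0 | h0
      · refine ⟨1, by norm_num, by push_cast; omega, fun i hi hne => ?_⟩
        push_cast; omega
      · refine ⟨0, by norm_num, by push_cast; omega, fun i hi hne => ?_⟩
        push_cast; omega
    · have : T % 3 = 0 ∨ T % 3 = 1 ∨ T % 3 = 2 := by omega
      rcases this with h0 | h0 | h0
      · refine ⟨2, by norm_num, by push_cast; omega, fun i hi hne => ?_⟩
        push_cast; omega
      · refine ⟨1, by norm_num, by push_cast; omega, fun i hi hne => ?_⟩
        push_cast; omega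
      · refine ⟨0, by norm_num, by push_cast; omega, fun i hi hne => ?_⟩
        push_cast; omega
  obtain ⟨a, ha, a1, a2⟩ := h.phi_at hT hj
  obtain ⟨b, hb, b1, b2⟩ := h.phi_at hT' hj
  have hbn : b ∉ PS.phi k α T := by
    intro hb'
    have := h.u_of_mem hT hb' hj b1
    omega
  have han : a ∉ PS.phi k α (T+1) := by
    intro hb'
    have := h.u_of_mem hT' hb' hj a1
    omega
  have hsub : ∀ x ∈ PS.phi k α (T+1), x = b ∨ x ∈ PS.phi k α T := by
    intro x hx
    obtain ⟨i, hi, h1, h2⟩ := (h.mem_phi hT').1 hx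
    by_cases hij : i = j
    · subst hij; left; exact P.qu_inj (h1.trans b1.symm) (h2.trans b2.symm)
    · right; exact (h.mem_phi hT).2 ⟨i, hi, h1, by rw [h2, hj2 i hi hij]⟩
  refine ⟨a, b, ha, hbn, a1.trans b1.symm, by rintro rfl; exact hbn ha, ?_, ?_⟩
  · ext x
    simp only [Finset.mem_union, Finset.mem_insert]
    constructor
    · rintro (h' | h')
      · exact Or.inr h'
      · exact hsub x h'
    · rintro (rfl | h')
      · exact Or.inr hb
      · exact Or.inl h'
  · symm
    apply Finset.eq_of_subset_of_card_le
    · intro x hx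
      rw [Finset.mem_erase, Finset.mem_insert]
      exact ⟨by rintro rfl; exact han hx, hsub x hx⟩
    · rw [h.phi_card hT', Finset.card_erase_of_mem (Finset.mem_insert_of_mem ha), Finset.card_insert_of_notMem hbn,
        h.phi_card hT]; rfl

theorem Chain.rung_card (h : Chain k α) {T : ℤ} (hT : P.Rg k α T) (hT' : P.Rg k α (T+1)) :
    (PS.phi k α T ∪ PS.phi k α (T+1)).card = k + 1 := by
  obtain ⟨a, b, -, hb, -, -, he, -⟩ := h.rung hT hT'
  rw [he, Finset.card_insert_of_notMem hb, h.phi_card hT]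

theorem Chain.rung_image (h : Chain k α) {T : ℤ} (hT : P.Rg k α T) (hT' : P.Rg k α (T+1)) :
    (PS.phi k α T ∪ PS.phi k α (T+1)).image P.q = (Finset.range k).image α := by
  rw [Finset.image_union, h.phi_image hT, h.phi_image hT', Finset.union_idempotent]

theorem Chain.rung_par (h : Chain k α) {T : ℤ} (hT : P.Rg k α T) (hT' : P.Rg k α (T+1)) {y : Finset (Finset LL)}
    (hy : ∀ t ∈ y, t.card = k ∧ t.image P.q = (Finset.range k).image α) :
    par y (PS.phi k α T ∪ PS.phi k α (T+1)) =
      (if PS.phi k α T ∈ y then 1 else 0) + (if PS.phi k α (T+1) ∈ y then 1 else 0) := by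
  have hc := h.rung_card hT hT'
  rw [par_erase (fun g hg => (hy g hg).1) hc]
  obtain ⟨a, b, ha, hb, hq, hab, he, he'⟩ := h.rung hT hT'
  rw [he] at hc ⊢
  rw [sum_pair_only (Finset.mem_insert_of_mem ha) (Finset.mem_insert_self _ _) hab, he', Finset.erase_insert hb, add_comm]
  intro c hc' hca hcb
  rw [if_neg]
  intro hm
  have h2 := (hy _ hm).2
  have h3 : (((insert b (PS.phi k α T)).erase c).image P.q).card = k := by
    rw [h2, ← h.phi_image hT, Finset.card_image_of_injOn, h.phi_card hT]
    apply Finset.card_image_iff.1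
    rw [h.phi_image hT, h.phi_card hT, Finset.card_image_of_injOn, Finset.card_range]
    intro i hi j hj hij
    exact h.inj i j (by simpa using hi) (by simpa using hj) hij
  rcases P.erase_inj hc (Finset.mem_insert_of_mem ha) (Finset.mem_insert_self _ _) hab hq hc' h3 with h' | h'
  · exact hca h'
  · exact hcb h'

theorem Chain.exists_rung (h : Chain k α) {v : Finset LL} (hc : v.card = k + 1) (hv : Clique v)
    (hi : v.image P.q = (Finset.range k).image α) :
    ∃ T, P.Rg k α T ∧ P.Rg k α (T+1) ∧ v = PS.phi k α T ∪ PS.phi k α (T+1) := by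
  have hni : ¬ Set.InjOn P.q v := by
    intro hinj
    have := Finset.card_image_of_injOn hinj
    rw [hi, hc] at this
    have := (Finset.card_image_le (s := Finset.range k) (f := α))
    rw [Finset.card_range] at this
    omega
  unfold Set.InjOn at hni
  push Not at hni
  obtain ⟨a, ha, b, hb, hq, hab⟩ := hni
  have main : ∀ a ∈ v, ∀ b ∈ v, P.q a = P.q b → a ≠ b → P.u b = P.u a + 1 →
      ∃ T, P.Rg k α T ∧ P.Rg k α (T+1) ∧ v = PS.phi k α T ∪ PS.phi k α (T+1) := by
    intro a ha b hb hq hab hu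
    have er : ∀ a ∈ v, ∀ b ∈ v, P.q a = P.q b → a ≠ b → ∃ T, P.Rg k α T ∧ v.erase b = PS.phi k α T := by
      intro a ha b hb hq hab
      apply h.exists_phi
      · rw [Finset.card_erase_of_mem hb, hc]; rfl
      · exact hv.mono (Finset.erase_subset _ _)
      · rw [← hi]
        apply Finset.Subset.antisymm (Finset.image_subset_image (Finset.erase_subset _ _))
        intro x hx
        obtain ⟨c, hc', rfl⟩ := Finset.mem_image.1 hx
        by_cases hcb : c = b
        · rw [hcb, ← hq]; exact Finset.mem_image_of_mem _ (Finset.mem_erase.2 ⟨hab, ha⟩)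
        · exact Finset.mem_image_of_mem _ (Finset.mem_erase.2 ⟨hcb, hc'⟩)
    obtain ⟨T, hT, e1⟩ := er a ha b hb hq hab
    obtain ⟨T', hT', e2⟩ := er b hb a ha hq.symm hab.symm
    have haT : a ∈ PS.phi k α T := by rw [← e1]; exact Finset.mem_erase.2 ⟨hab, ha⟩
    have hbT : b ∈ PS.phi k α T' := by rw [← e2]; exact Finset.mem_erase.2 ⟨hab.symm, hb⟩
    obtain ⟨j, hj, j1, j2⟩ := (h.mem_phi hT).1 haT
    have j3 := h.u_of_mem hT' hbT hj (hq ▸ j1)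
    have j4 : ∀ i < k, i ≠ j → (T + i) / (k : ℤ) = (T' + i) / (k : ℤ) := by
      intro i hi' hij
      obtain ⟨x, hx, x1, x2⟩ := h.phi_at hT hi'
      rw [← x2]
      apply h.u_of_mem hT' _ hi' x1
      rw [← e1, Finset.mem_erase] at hx
      rw [← e2, Finset.mem_erase]
      refine ⟨?_, hx.2⟩
      rintro rfl
      exact hij (h.inj i j hi' hj (x1.symm.trans j1))
    have hTT : T' = T + 1 := by
      rcases h.hk with rfl | rfl
      · have := j4 0; have := j4 1
        interval_cases j <;> push_cast at * <;> simp at * <;> omega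
      · have := j4 0; have := j4 1; have := j4 2
        interval_cases j <;> push_cast at * <;> simp at * <;> omega
    subst hTT
    refine ⟨T, hT, hT', ?_⟩
    rw [← e1, ← e2]
    ext x
    simp only [Finset.mem_union, Finset.mem_erase]
    constructor
    · intro hx
      by_cases hxb : x = b
      · right; exact ⟨by rw [hxb]; exact hab.symm, hx⟩
      · left; exact ⟨hxb, hx⟩
    · rintro (h' | h') <;> exact h'.2
  obtain ⟨-, h' | h'⟩ := P.adj_qr.1 (hv a ha b hb hab)
  · refine main a ha b hb hq hab ?_
    have : P.u a ≠ P.u b := fun e => hab (P.qu_inj hq e)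
    have := h'.2; omega
  · refine main b hb a ha hq.symm hab.symm ?_
    have : P.u a ≠ P.u b := fun e => hab (P.qu_inj hq e)
    have := h'.2; omega

variable {U : Finset LL}

theorem PS.mem_fiber {s t : Finset LL} (hs : s ∈ cells U k) : t ∈ lift P.q (cells (P.kids U) k) {s} ↔
    t.card = k ∧ Clique t ∧ t.image P.q = s := by
  rw [mem_lift, mem_cells, Finset.mem_singleton]
  constructor
  · rintro ⟨⟨h1, h2, -⟩, h3⟩; exact ⟨h1, h2, h3⟩
  · rintro ⟨h1, h2, h3⟩; exact ⟨⟨h1, h2, P.bi_kids.2 (h3 ▸ (mem_cells.1 hs).2.2)⟩, h3⟩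

theorem PS.fiber_const {s : Finset LL} (hk : k = 2 ∨ k = 3) (hs : s ∈ cells U k) {y : Finset (Finset LL)}
    (hy : y ⊆ lift P.q (cells (P.kids U) k) {s})
    (hev : ∀ t ∈ cells (P.kids U) (k+1), t.image P.q = s → par y t = 0) :
    y = ∅ ∨ y = lift P.q (cells (P.kids U) k) {s} := by
  obtain ⟨h1, h2, h3⟩ := mem_cells.1 hs
  obtain ⟨α, h, hα⟩ := exists_chain hk h1 h2
  have step : ∀ T, P.Rg k α T → P.Rg k α (T+1) → (PS.phi k α T ∈ y ↔ PS.phi k α (T+1) ∈ y) := by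
    intro T hT hT'
    have := h.rung_par hT hT' (y := y) (fun t ht => by
      obtain ⟨a, b, c⟩ := (PS.mem_fiber hs).1 (hy ht)
      exact ⟨a, c.trans hα.symm⟩)
    have hi := (h.rung_image hT hT').trans hα
    rw [hev _ (mem_cells.2 ⟨h.rung_card hT hT', h.union_clique hT hT', P.bi_kids.2 (hi ▸ h3)⟩) hi] at this
    by_cases c1 : PS.phi k α T ∈ y <;> by_cases c2 : PS.phi k α (T+1) ∈ y
    · simp [c1, c2]
    · exfalso; rw [if_pos c1, if_neg c2] at this; revert this; decide
    · exfalso; rw [if_neg c1, if_pos c2] at this; revert this; decide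
    · simp [c1, c2]
  have steps : ∀ n : ℕ, ∀ T, P.Rg k α T → P.Rg k α (T+n) → (PS.phi k α T ∈ y ↔ PS.phi k α (T+n) ∈ y) := by
    intro n
    induction n with
    | zero => intro T _ _; simp
    | succ n ih =>
      intro T hT hT'
      have hm : P.Rg k α (T + n) := by unfold PS.Rg at *; push_cast at hT'; omega
      rw [ih T hT hm]
      have := step (T + n) hm (by push_cast at hT'; rwa [add_assoc])
      rw [this]; push_cast; rw [add_assoc]
  rcases y.eq_empty_or_nonempty with he | ⟨t, ht⟩
  · exact Or.inl he
  right
  apply hy.antisymm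
  intro t' ht'
  obtain ⟨a1, a2, a3⟩ := (PS.mem_fiber hs).1 (hy ht)
  obtain ⟨b1, b2, b3⟩ := (PS.mem_fiber hs).1 ht'
  obtain ⟨T, hT, rfl⟩ := h.exists_phi a1 a2 (a3.trans hα.symm)
  obtain ⟨T', hT', rfl⟩ := h.exists_phi b1 b2 (b3.trans hα.symm)
  rcases le_total T T' with hle | hle
  · obtain ⟨n, rfl⟩ := Int.le.dest hle
    exact (steps n T hT hT').1 ht
  · obtain ⟨n, rfl⟩ := Int.le.dest hle
    exact (steps n T' hT' hT).2 ht

theorem PS.fiber_solve {s : Finset LL} (hk : k = 2 ∨ k = 3) (hs : s ∈ cells U k) (Y : Finset (Finset LL)) :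
    ∃ y ⊆ lift P.q (cells (P.kids U) k) {s},
    ∀ t ∈ cells (P.kids U) (k+1), t.image P.q = s → par y t = if t ∈ Y then 1 else 0 := by
  classical
  obtain ⟨h1, h2, h3⟩ := mem_cells.1 hs
  obtain ⟨α, h, hα⟩ := exists_chain hk h1 h2
  set l : ℤ := k * (- P.s (α 0)) with hl
  let g : ℤ → ZMod 2 := fun T => ∑ T' ∈ Finset.Ico l T, if PS.phi k α T' ∪ PS.phi k α (T'+1) ∈ Y then 1 else 0
  refine ⟨(lift P.q (cells (P.kids U) k) {s}).filter fun t => ∃ T, P.Rg k α T ∧ t = PS.phi k α T ∧ g T = 1,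
    Finset.filter_subset _ _, ?_⟩
  intro t ht hts
  obtain ⟨t1, t2, t3⟩ := mem_cells.1 ht
  obtain ⟨T, hT, hT', rfl⟩ := h.exists_rung t1 t2 (hts.trans hα.symm)
  rw [h.rung_par hT hT']
  · have val : ∀ T, P.Rg k α T → (if PS.phi k α T ∈ (lift P.q (cells (P.kids U) k) {s}).filter
        (fun t => ∃ T, P.Rg k α T ∧ t = PS.phi k α T ∧ g T = 1) then (1 : ZMod 2) else 0) = g T := by
      intro T hT
      rcases z2 (g T) with hg | hg
      · rw [hg, if_neg]
        intro hm
        obtain ⟨T', hT', e, hg'⟩ := (Finset.mem_filter.1 hm).2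
        rw [← h.phi_inj hT hT' e, hg] at hg'
        revert hg'; decide
      · rw [hg, if_pos]
        refine Finset.mem_filter.2 ⟨(PS.mem_fiber hs).2 ⟨h.phi_card hT, h.phi_clique hT, (h.phi_image hT).trans hα⟩, T, hT, rfl, hg⟩
    rw [val T hT, val (T+1) hT']
    have : g (T+1) = g T + if PS.phi k α T ∪ PS.phi k α (T+1) ∈ Y then 1 else 0 := by
      simp only [g]
      have e : Finset.Ico l (T+1) = insert T (Finset.Ico l T) := by
        ext x
        have := hT.1
        simp only [Finset.mem_Ico, Finset.mem_insert]; omega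
      rw [e, Finset.sum_insert (by simp), add_comm]
    rw [this, ← add_assoc, z2_add, zero_add]
  · intro t ht
    obtain ⟨a, b, c⟩ := (PS.mem_fiber hs).1 (Finset.mem_filter.1 ht).1
    exact ⟨a, c.trans hα.symm⟩

end chains
end ABCT
end

section
open Set Metric Filter Topology

namespace ABCT

section conn
set_option linter.unusedSectionVars false
set_option linter.unusedVariables false

variable {P : PS} {U : Finset LL}

theorem par_symm (s t : Finset (Finset LL)) (x : Finset LL) : par (symmDiff s t) x = par s x + par t x := by
  rw [symmDiff_def, Finset.sup_eq_union, par_union, par_inter_sdiff s t, par_inter_sdiff t s x, Finset.inter_comm t s]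
  · generalize par (s ∩ t) x = a
    generalize par (s \ t) x = b
    generalize par (t \ s) x = c
    revert a b c; decide
  · rw [Finset.disjoint_left]
    intro y hy hy'
    exact (Finset.mem_sdiff.1 hy).2 (Finset.mem_sdiff.1 hy').1

theorem cells_dd (𝓖 : Finset (Finset LL)) (h𝓖 : 𝓖 ⊆ cells U 2) :
    Even' (cells U 4) ((cells U 3).filter fun e => par 𝓖 e = 1) := by
  intro v hv
  have e1 : par ((cells U 3).filter fun e => par 𝓖 e = 1) v = ∑ e ∈ cells U 3, (if e ⊆ v then par 𝓖 e else 0) := by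
    unfold par
    rw [Finset.sum_filter]
    apply Finset.sum_congr rfl
    intro e he
    rcases z2 (par 𝓖 e) with h | h
    · unfold par at h; rw [h]; simp
    · unfold par at h; rw [h]; simp
  have e2 : ∀ e ∈ cells U 3, (if e ⊆ v then par 𝓖 e else 0) = ∑ f ∈ 𝓖, if f ⊆ e ∧ e ⊆ v then (1:ZMod 2) else 0 := by
    intro e he
    by_cases h : e ⊆ v
    · simp only [h, if_true, and_true]; rfl
    · simp [h]
  rw [e1, Finset.sum_congr rfl e2, Finset.sum_comm]
  apply Finset.sum_eq_zero
  intro f hf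
  by_cases hfv : f ⊆ v
  · obtain ⟨e, he, e', he', hne, h⟩ := cells_S3 f (h𝓖 hf) v hv hfv
    rw [sum_two he he' hne h (fun _ => 1)]; decide
  · apply Finset.sum_eq_zero
    intro e _
    rw [if_neg]
    rintro ⟨h1, h2⟩; exact hfv (h1.trans h2)

/-- restricting to the part over a cell does not change parity over that cell -/
theorem PS.par_fiber {k : ℕ} {z : Finset (Finset LL)} (hz : ∀ t ∈ z, t.image P.q ∈ cells U k) {s t : Finset LL}
    (hs : s ∈ cells U k) (ht : t.image P.q = s) : par (z.filter fun d => d.image P.q = s) t = par z t := by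
  unfold par
  rw [Finset.sum_filter]
  apply Finset.sum_congr rfl
  intro d hd
  by_cases hdt : d ⊆ t
  · rw [if_pos]
    have h1 : d.image P.q ⊆ s := ht ▸ Finset.image_subset_image hdt
    apply Finset.eq_of_subset_of_card_le h1
    rw [(mem_cells.1 hs).1, (mem_cells.1 (hz d hd)).1]
  · simp [hdt]

theorem PS.image_two {t : Finset LL} (ht : t ∈ cells (P.kids U) 2) : t.image P.q ∈ cells U 2 := by
  obtain ⟨h1, h2, h3⟩ := P.image_cell ht
  rwa [show (t.image P.q).card = 2 by omega] at h1

theorem PS.image_three {t : Finset LL} (ht : t ∈ cells (P.kids U) 3) : t.image P.q ∈ cells U 2 ∨ t.image P.q ∈ cells U 3 := by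
  obtain ⟨h1, h2, h3⟩ := P.image_cell ht
  rcases (show (t.image P.q).card = 2 ∨ (t.image P.q).card = 3 by omega) with h | h
  · left; rwa [h] at h1
  · right; rwa [h] at h1

theorem cells_ne {s : Finset LL} (h2 : s ∈ cells U 2) (h3 : s ∈ cells U 3) : False := by
  have := (mem_cells.1 h2).1; have := (mem_cells.1 h3).1; omega

/-- a family which is locally a full or empty fiber is a lift -/
theorem PS.is_lift {k : ℕ} {z : Finset (Finset LL)} (hzc : z ⊆ cells (P.kids U) k) (hz : ∀ t ∈ z, t.image P.q ∈ cells U k)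
    (h : ∀ s ∈ cells U k, (z.filter fun d => d.image P.q = s) = ∅ ∨
      (z.filter fun d => d.image P.q = s) = lift P.q (cells (P.kids U) k) {s}) :
    ∃ z' ⊆ cells U k, z = lift P.q (cells (P.kids U) k) z' := by
  refine ⟨z.image fun t => t.image P.q, ?_, ?_⟩
  · intro s hs
    obtain ⟨t, ht, rfl⟩ := Finset.mem_image.1 hs
    exact hz t ht
  · ext t
    rw [mem_lift, Finset.mem_image]
    constructor
    · intro ht; exact ⟨hzc ht, t, ht, rfl⟩
    · rintro ⟨ht, d, hd, hdt⟩
      rcases h _ (hz d hd) with h' | h'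
      · have : d ∈ z.filter fun d' => d'.image P.q = d.image P.q := Finset.mem_filter.2 ⟨hd, rfl⟩
        rw [h'] at this; simp at this
      · have : t ∈ lift P.q (cells (P.kids U) k) {d.image P.q} := by
          rw [mem_lift]; exact ⟨ht, by simp [hdt]⟩
        rw [← h'] at this
        exact (Finset.mem_filter.1 this).1

theorem filter_sub_lift {k : ℕ} {z : Finset (Finset LL)} (hzc : z ⊆ cells (P.kids U) k) (s : Finset LL) :
    (z.filter fun d => d.image P.q = s) ⊆ lift P.q (cells (P.kids U) k) {s} := by
  intro t ht
  rw [Finset.mem_filter] at ht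
  rw [mem_lift]; exact ⟨hzc ht.1, by simp [ht.2]⟩

theorem Conn.step (h : Conn U) : Conn (P.kids U) := by
  constructor
  · intro z hz hev
    have hsol := fun f : {f // f ∈ cells U 2} => PS.fiber_solve (P := P) (Or.inl rfl) f.2 z
    choose G hG1 hG2 using hsol
    set 𝓖0 := (cells U 2).attach.biUnion G with h𝓖0
    have h0sub : 𝓖0 ⊆ cells (P.kids U) 2 := by
      intro t ht
      obtain ⟨f, -, hf⟩ := Finset.mem_biUnion.1 ht
      exact (mem_lift.1 (hG1 f hf)).1
    have h0par : ∀ t ∈ cells (P.kids U) 3, t.image P.q ∈ cells U 2 → par 𝓖0 t = if t ∈ z then 1 else 0 := by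
      intro t ht htf
      rw [← hG2 ⟨_, htf⟩ t ht rfl, ← PS.par_fiber (P := P) (fun d hd => PS.image_two (h0sub hd)) htf rfl]
      congr 1
      ext d
      rw [Finset.mem_filter, h𝓖0, Finset.mem_biUnion]
      constructor
      · rintro ⟨⟨f, -, hf⟩, hd⟩
        have h3 := (mem_lift.1 (hG1 f hf)).2
        rw [Finset.mem_singleton] at h3
        have : f = ⟨_, htf⟩ := Subtype.ext (h3.symm.trans hd)
        rwa [← this]
      · intro hd
        refine ⟨⟨_, Finset.mem_attach _ _, hd⟩, ?_⟩
        have h3 := (mem_lift.1 (hG1 _ hd)).2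
        simpa using h3
    set δ := (cells (P.kids U) 3).filter fun e => par 𝓖0 e = 1 with hδ
    set z1 := symmDiff z δ with hz1
    have hz1sub : z1 ⊆ cells (P.kids U) 3 := by
      intro t ht
      rcases Finset.mem_symmDiff.1 ht with h' | h'
      · exact hz h'.1
      · exact (Finset.mem_filter.1 h'.1).1
    have hz1ev : Even' (cells (P.kids U) 4) z1 := by
      intro v hv
      rw [hz1, par_symm, hev v hv, hδ, cells_dd 𝓖0 h0sub v hv, add_zero]
    have hz1im : ∀ t ∈ z1, t.image P.q ∈ cells U 3 := by
      intro t ht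
      rcases PS.image_three (hz1sub ht) with h' | h'
      · exfalso
        have e := h0par t (hz1sub ht) h'
        rcases Finset.mem_symmDiff.1 ht with ⟨a, b⟩ | ⟨a, b⟩
        · rw [if_pos a] at e; exact b (Finset.mem_filter.2 ⟨hz a, e⟩)
        · rw [if_neg b, (Finset.mem_filter.1 a).2] at e; revert e; decide
      · exact h'
    obtain ⟨z', hz', hzz⟩ := PS.is_lift (P := P) hz1sub hz1im (by
      intro s hs
      apply PS.fiber_const (P := P) (Or.inr rfl) hs (filter_sub_lift hz1sub s)
      intro t ht hts
      rw [PS.par_fiber hz1im hs hts]; exact hz1ev t ht)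
    have hz'ev : Even' (cells U 4) z' := by
      intro v hv
      obtain ⟨t, ht, hti⟩ := P.exists_child hv
      have := P.Q23 hz' ht
      rw [hti, if_pos hv, ← hzz, hz1ev t ht] at this
      exact this.symm
    obtain ⟨𝓖', h𝓖', hp⟩ := h.S5 z' hz' hz'ev
    refine ⟨symmDiff 𝓖0 (lift P.q (cells (P.kids U) 2) 𝓖'), ?_, ?_⟩
    · intro t ht
      rcases Finset.mem_symmDiff.1 ht with h' | h'
      · exact h0sub h'.1
      · exact (mem_lift.1 h'.1).1
    · intro t ht
      rw [par_symm, P.Q23 h𝓖' ht]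
      have e1 : par 𝓖0 t = if t ∈ δ then 1 else 0 := by
        rcases z2 (par 𝓖0 t) with h' | h'
        · rw [h', if_neg]; intro hm; rw [(Finset.mem_filter.1 hm).2] at h'; revert h'; decide
        · rw [h', if_pos]; exact Finset.mem_filter.2 ⟨ht, h'⟩
      have e2 : (if t.image P.q ∈ cells U (2+1) then par 𝓖' (t.image P.q) else 0) = if t ∈ z1 then 1 else 0 := by
        by_cases hi : t.image P.q ∈ cells U (2+1)
        · rw [if_pos hi, hp _ hi]
          congr 1
          rw [hzz, mem_lift]; simp [ht]
        · rw [if_neg hi, if_neg]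
          intro hm; exact hi (hz1im t hm)
      rw [e1, e2]
      by_cases c1 : t ∈ z <;> by_cases c2 : t ∈ δ <;> simp [hz1, Finset.mem_symmDiff, c1, c2]
      decide
  · intro 𝓖 h𝓖 hev
    obtain ⟨𝓗, h𝓗, hh⟩ := PS.is_lift (P := P) h𝓖 (fun t ht => PS.image_two (h𝓖 ht)) (by
      intro s hs
      apply PS.fiber_const (P := P) (Or.inl rfl) hs (filter_sub_lift h𝓖 s)
      intro t ht hts
      rw [PS.par_fiber (fun t ht => PS.image_two (h𝓖 ht)) hs hts]; exact hev t ht)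
    have := h.S6 𝓗 h𝓗 (by
      intro e he
      obtain ⟨t, ht, hti⟩ := P.exists_child he
      have := P.Q23 h𝓗 ht
      rw [hti, if_pos he, ← hh, hev t ht] at this
      exact this.symm)
    rcases this with rfl | rfl
    · left; rw [hh]; ext t; simp [mem_lift]
    · right; rw [hh]; ext t; rw [mem_lift]
      constructor
      · exact fun h => h.1
      · exact fun h => ⟨h, PS.image_two h⟩

/-- the link of the origin has trivial first cohomology -/
theorem base_link (Z : LL → LL → ZMod 2) (hs : ∀ p p', Z p p' = Z p' p)
    (hc : ∀ p ∈ Nb, ∀ p' ∈ Nb, ∀ p'' ∈ Nb, Adj p p' → Adj p p'' → Adj p' p'' → Z p p' + Z p p'' + Z p' p'' = 0) :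
    ∃ g : LL → ZMod 2, ∀ p ∈ Nb, ∀ p' ∈ Nb, Adj p p' → g p + g p' = Z p p' := by
  let O : LL := (1,1,1)
  let N : LL := (-1,-1,-1)
  let Po : Finset LL := {(1,0,0), (0,1,0), (0,0,1), (1,1,0), (1,0,1), (0,1,1)}
  let Ne : Finset LL := {(-1,0,0), (0,-1,0), (0,0,-1), (-1,-1,0), (-1,0,-1), (0,-1,-1)}
  have hsplit : ∀ p ∈ Nb, p = O ∨ p ∈ Po ∨ p = N ∨ p ∈ Ne := by decide
  have hPo : ∀ p ∈ Po, p ∈ Nb ∧ Adj O p := by decide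
  have hNe : ∀ p ∈ Ne, p ∈ Nb ∧ Adj N p := by decide
  have hO : O ∈ Nb := by decide
  have hN : N ∈ Nb := by decide
  have hPne : ∀ p ∈ Po, p ≠ O := by decide
  have hNne : ∀ p ∈ Ne, p ≠ O ∧ p ∉ Po ∧ p ≠ N := by decide
  have hON : ¬ Adj O N := by decide
  have hON' : N ≠ O ∧ N ∉ Po := by decide
  have hONe : ∀ p ∈ Ne, ¬ Adj O p := by decide
  have hNPo : ∀ p ∈ Po, ¬ Adj N p := by decide
  let h : LL → LL → ZMod 2 := fun s t => Z s t + Z O s + Z N t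
  have arith : ∀ a b c d e f : ZMod 2, a + b + c = 0 → c + d + e = 0 → d + a + f = e + b + f := by decide
  have arith2 : ∀ a b c d e f : ZMod 2, a + b + c = 0 → c + d + e = 0 → d + f + a = e + f + b := by decide
  have st1 : ∀ s ∈ Po, ∀ s' ∈ Po, ∀ t ∈ Ne, Adj s s' → Adj s t → Adj s' t → h s t = h s' t := by
    intro s hs1 s' hs2 t ht a1 a2 a3
    have c1 := hc O hO s (hPo s hs1).1 s' (hPo s' hs2).1 (hPo s hs1).2 (hPo s' hs2).2 a1
    have c2 := hc s (hPo s hs1).1 s' (hPo s' hs2).1 t (hNe t ht).1 a1 a2 a3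
    exact arith _ _ _ _ _ _ c1 c2
  have st2 : ∀ s ∈ Po, ∀ t ∈ Ne, ∀ t' ∈ Ne, Adj t t' → Adj s t → Adj s t' → h s t = h s t' := by
    intro s hs1 t ht t' ht' a1 a2 a3
    have c1 := hc N hN t (hNe t ht).1 t' (hNe t' ht').1 (hNe t ht).2 (hNe t' ht').2 a1
    have c2 := hc t (hNe t ht).1 t' (hNe t' ht').1 s (hPo s hs1).1 a1 a2.symm a3.symm
    rw [hs t s, hs t' s] at c2
    exact arith2 _ _ _ _ _ _ c1 c2
  let c := h (1,0,0) (0,-1,0)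
  have m1 : h (1,0,0) (0,-1,-1) = c := (st2 _ (by decide) _ (by decide) _ (by decide) (by decide) (by decide) (by decide)).symm
  have m2 : h (1,0,0) (0,0,-1) = c := (st2 _ (by decide) _ (by decide) _ (by decide) (by decide) (by decide) (by decide)).symm.trans m1
  have m3 : h (1,1,0) (0,0,-1) = c := (st1 _ (by decide) _ (by decide) _ (by decide) (by decide) (by decide) (by decide)).symm.trans m2
  have m4 : h (0,1,0) (0,0,-1) = c := (st1 _ (by decide) _ (by decide) _ (by decide) (by decide) (by decide) (by decide)).symm.trans m3
  have m5 : h (0,1,0) (-1,0,-1) = c := (st2 _ (by decide) _ (by decide) _ (by decide) (by decide) (by decide) (by decide)).symm.trans m4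
  have m6 : h (0,1,0) (-1,0,0) = c := (st2 _ (by decide) _ (by decide) _ (by decide) (by decide) (by decide) (by decide)).symm.trans m5
  have m7 : h (0,1,1) (-1,0,0) = c := (st1 _ (by decide) _ (by decide) _ (by decide) (by decide) (by decide) (by decide)).symm.trans m6
  have m8 : h (0,0,1) (-1,0,0) = c := (st1 _ (by decide) _ (by decide) _ (by decide) (by decide) (by decide) (by decide)).symm.trans m7
  have m9 : h (0,0,1) (-1,-1,0) = c := (st2 _ (by decide) _ (by decide) _ (by decide) (by decide) (by decide) (by decide)).symm.trans m8
  have m10 : h (0,0,1) (0,-1,0) = c := (st2 _ (by decide) _ (by decide) _ (by decide) (by decide) (by decide) (by decide)).symm.trans m9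
  have m11 : h (1,0,1) (0,-1,0) = c := (st1 _ (by decide) _ (by decide) _ (by decide) (by decide) (by decide) (by decide)).symm.trans m10
  have hconst : ∀ s ∈ Po, ∀ t ∈ Ne, Adj s t → h s t = c := by
    intro s hs1 t ht hst
    have key : ∀ s ∈ Po, ∀ t ∈ Ne, Adj s t → (s, t) ∈ ([((1,0,0),(0,-1,0)), ((1,0,0),(0,-1,-1)), ((1,0,0),(0,0,-1)),
      ((1,1,0),(0,0,-1)), ((0,1,0),(0,0,-1)), ((0,1,0),(-1,0,-1)), ((0,1,0),(-1,0,0)), ((0,1,1),(-1,0,0)),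
      ((0,0,1),(-1,0,0)), ((0,0,1),(-1,-1,0)), ((0,0,1),(0,-1,0)), ((1,0,1),(0,-1,0))] : List (LL × LL)) := by decide
    have := key s hs1 t ht hst
    simp only [List.mem_cons, List.not_mem_nil, or_false, Prod.mk.injEq] at this
    rcases this with ⟨rfl, rfl⟩ | ⟨rfl, rfl⟩ | ⟨rfl, rfl⟩ | ⟨rfl, rfl⟩ | ⟨rfl, rfl⟩ | ⟨rfl, rfl⟩ | ⟨rfl, rfl⟩ |
      ⟨rfl, rfl⟩ | ⟨rfl, rfl⟩ | ⟨rfl, rfl⟩ | ⟨rfl, rfl⟩ | ⟨rfl, rfl⟩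
    · rfl
    all_goals assumption
  let g : LL → ZMod 2 := fun p => if p = O then 0 else if p ∈ Po then Z O p else if p = N then c else c + Z N p
  have gO : g O = 0 := if_pos rfl
  have gP : ∀ p ∈ Po, g p = Z O p := fun p hp => by simp only [g]; rw [if_neg (hPne p hp), if_pos hp]
  have gN : g N = c := by simp only [g]; rw [if_neg hON'.1, if_neg hON'.2]; simp
  have gNe : ∀ p ∈ Ne, g p = c + Z N p := fun p hp => by
    simp only [g]; rw [if_neg (hNne p hp).1, if_neg (hNne p hp).2.1, if_neg (hNne p hp).2.2]
  have a3 : ∀ a b c : ZMod 2, a + b + c = 0 → a + b = c := by decide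
  have a4 : ∀ a b c d : ZMod 2, a + b + c = 0 → (d + a) + (d + b) = c := by decide
  have a5 : ∀ a b c d : ZMod 2, a + b + c = d → b + (d + c) = a := by decide
  have mix : ∀ s ∈ Po, ∀ t ∈ Ne, Adj s t → g s + g t = Z s t := by
    intro s hs1 t ht hst
    rw [gP s hs1, gNe t ht]
    exact a5 _ _ _ _ (hconst s hs1 t ht hst)
  refine ⟨g, fun p hp p' hp' ha => ?_⟩
  rcases hsplit p hp with rfl | h1 | rfl | h1 <;> rcases hsplit p' hp' with rfl | h2 | rfl | h2
  · exact absurd rfl ha.1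
  · rw [gO, gP _ h2, zero_add]
  · exact absurd ha hON
  · exact absurd ha (hONe _ h2)
  · rw [gO, gP _ h1, add_zero, hs]
  · rw [gP _ h1, gP _ h2]; exact a3 _ _ _ (hc O hO _ hp _ hp' (hPo _ h1).2 (hPo _ h2).2 ha)
  · exact absurd ha.symm (hNPo _ h1)
  · exact mix _ h1 _ h2 ha
  · exact absurd ha.symm hON
  · exact absurd ha (hNPo _ h2)
  · exact absurd rfl ha.1
  · rw [gN, gNe _ h2, ← add_assoc, z2_add, zero_add]
  · exact absurd ha.symm (hONe _ h1)
  · rw [hs, add_comm]; exact mix _ h2 _ h1 ha.symm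
  · rw [gN, gNe _ h1, add_comm, ← add_assoc, z2_add, zero_add, hs]
  · rw [gNe _ h1, gNe _ h2]; exact a4 _ _ _ _ (hc N hN _ hp _ hp' (hNe _ h1).2 (hNe _ h2).2 ha)

theorem zero_pair {p : LL} (hp : p ∈ Nb) : ({0, p} : Finset LL) ∈ cells {0} 2 := by
  have h := adj_zero.2 hp
  exact pair_cell h (Or.inl ⟨by simp, by simpa using h.1.symm⟩)

theorem zero_tri {p p' : LL} (hp : p ∈ Nb) (hp' : p' ∈ Nb) (h : Adj p p') : ({0, p, p'} : Finset LL) ∈ cells {0} 3 := by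
  have h1 := adj_zero.2 hp
  have h2 := adj_zero.2 hp'
  exact tri_cell h1 h2 h ⟨⟨0, by simp⟩, p, by simp, by simpa using h1.1.symm⟩

theorem zero_two {f : Finset LL} (hf : f ∈ cells {0} 2) : ∃ p ∈ Nb, f = {0, p} := by
  obtain ⟨a, b, ha, hb, hab, rfl⟩ := cell_two hf
  rw [Finset.mem_singleton] at ha
  subst ha
  exact ⟨b, adj_zero.1 hab, rfl⟩

theorem zero_three {e : Finset LL} (he : e ∈ cells {0} 3) : ∃ p ∈ Nb, ∃ p' ∈ Nb, Adj p p' ∧ e = {0, p, p'} := by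
  obtain ⟨f, hf, g, hg, hne, hi⟩ := cells_S2 e he
  obtain ⟨p, hp, rfl⟩ := zero_two hf
  obtain ⟨d, hd, rfl, hda⟩ := cell_up hf he ((hi _ hf).2 (Or.inl rfl))
  refine ⟨p, hp, d, adj_zero.1 (hda 0 (by simp)).symm, (hda p (by simp)).symm, ?_⟩
  ext x; simp; tauto

theorem pair_zero_inj {p p' : LL} (hp : p ∈ Nb) (hp' : p' ∈ Nb) : ({0, p} : Finset LL) = {0, p'} ↔ p = p' := by
  constructor
  · intro h
    have : p ∈ ({0, p'} : Finset LL) := by rw [← h]; simp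
    simp only [Finset.mem_insert, Finset.mem_singleton] at this
    rcases this with h' | h'
    · exact absurd h' (adj_zero.2 hp).1.symm
    · exact h'
  · rintro rfl; rfl

theorem zero_par {𝓖 : Finset (Finset LL)} (h𝓖 : 𝓖 ⊆ cells {0} 2) {p p' : LL} (hp : p ∈ Nb) (hp' : p' ∈ Nb)
    (h : Adj p p') : par 𝓖 {0, p, p'} = (if {0, p} ∈ 𝓖 then 1 else 0) + (if {0, p'} ∈ 𝓖 then 1 else 0) := by
  have hi : ∀ d ∈ cells {0} 2, d ⊆ ({0, p, p'} : Finset LL) ↔ d = {0, p} ∨ d = {0, p'} := by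
    intro d hd
    obtain ⟨x, hx, rfl⟩ := zero_two hd
    rw [pair_zero_inj hx hp, pair_zero_inj hx hp']
    constructor
    · intro hs
      have := hs (show x ∈ ({0, x} : Finset LL) by simp)
      simp only [Finset.mem_insert, Finset.mem_singleton] at this
      rcases this with h' | h'
      · exact absurd h' (adj_zero.2 hx).1.symm
      · exact h'
    · rintro (rfl | rfl) <;> intro y hy <;> simp at hy ⊢ <;> tauto
  have : par 𝓖 {0, p, p'} = ∑ d ∈ cells {0} 2, if d ⊆ ({0, p, p'} : Finset LL) then (if d ∈ 𝓖 then 1 else 0) else 0 := by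
    unfold par
    rw [← Finset.sum_subset h𝓖]
    · apply Finset.sum_congr rfl
      intro d hd; rw [if_pos hd]
    · intro d _ hd; rw [if_neg hd]; simp
  rw [this, sum_two (zero_pair hp) (zero_pair hp') (by rw [Ne, pair_zero_inj hp hp']; exact h.1) hi]

theorem conn_zero : Conn {0} := by
  classical
  constructor
  · intro z hz hev
    obtain ⟨g, hg⟩ := base_link (fun p p' => if ({0, p, p'} : Finset LL) ∈ z then 1 else 0)
      (by intro p p'; rw [Finset.pair_comm])
      (by
        intro a ha b hb c hc hab hac hbc
        have A0 := adj_zero.2 ha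
        have B0 := adj_zero.2 hb
        have C0 := adj_zero.2 hc
        have h4 := (insert_cell (d := c) (zero_tri ha hb hab) (by
          intro x hx
          simp only [Finset.mem_insert, Finset.mem_singleton] at hx
          rcases hx with rfl | rfl | rfl
          · exact C0.symm
          · exact hac.symm
          · exact hbc.symm)).2
        have hp := hev _ h4
        have hv : insert c ({0, a, b} : Finset LL) = {0, a, b, c} := by ext x; simp; tauto
        rw [hv, par_erase (k := 3) (fun e he => (mem_cells.1 (hz he)).1) (by rw [← hv]; exact (mem_cells.1 h4).1)] at hp
        rw [Finset.sum_insert, Finset.sum_insert, Finset.sum_insert, Finset.sum_singleton] at hp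
        · have e0 : ({0, a, b, c} : Finset LL).erase 0 ∉ z := by
            intro hm
            obtain ⟨-, -, ⟨x, hx, hx'⟩, -⟩ := mem_cells.1 (hz hm)
            rw [Finset.mem_singleton] at hx'
            exact (Finset.mem_erase.1 hx).1 hx'
          have e1 : ({0, a, b, c} : Finset LL).erase a = {0, b, c} := by
            ext x; simp only [Finset.mem_erase, Finset.mem_insert, Finset.mem_singleton]
            have := A0.1; have := hab.1; have := hac.1
            constructor
            · tauto
            · rintro (rfl | rfl | rfl) <;> simp_all [eq_comm]
          have e2 : ({0, a, b, c} : Finset LL).erase b = {0, a, c} := by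
            ext x; simp only [Finset.mem_erase, Finset.mem_insert, Finset.mem_singleton]
            have := B0.1; have := hab.1; have := hbc.1
            constructor
            · tauto
            · rintro (rfl | rfl | rfl) <;> simp_all [eq_comm]
          have e3 : ({0, a, b, c} : Finset LL).erase c = {0, a, b} := by
            ext x; simp only [Finset.mem_erase, Finset.mem_insert, Finset.mem_singleton]
            have := C0.1; have := hac.1; have := hbc.1
            constructor
            · tauto
            · rintro (rfl | rfl | rfl) <;> simp_all [eq_comm]
          rw [if_neg e0, e1, e2, e3, zero_add] at hp
          have ar : ∀ x y w : ZMod 2, x + (y + w) = 0 → w + y + x = 0 := by decide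
          exact ar _ _ _ hp
        · simpa using hbc.1
        · simp only [Finset.mem_insert, Finset.mem_singleton, not_or]; exact ⟨hab.1, hac.1⟩
        · simp only [Finset.mem_insert, Finset.mem_singleton, not_or]; exact ⟨A0.1, B0.1, C0.1⟩)
    refine ⟨(Nb.filter fun p => g p = 1).image fun p => {0, p}, ?_, ?_⟩
    · intro f hf
      obtain ⟨p, hp, rfl⟩ := Finset.mem_image.1 hf
      exact zero_pair (Finset.mem_filter.1 hp).1
    · intro e he
      obtain ⟨p, hp, p', hp', hpp, rfl⟩ := zero_three he
      rw [zero_par _ hp hp' hpp, ← hg p hp p' hp' hpp]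
      · have key : ∀ p ∈ Nb, (if ({0, p} : Finset LL) ∈ (Nb.filter fun p => g p = 1).image (fun p => ({0, p} : Finset LL)) then (1 : ZMod 2) else 0) = g p := by
          intro p hp
          have : ({0, p} : Finset LL) ∈ (Nb.filter fun p => g p = 1).image (fun p => ({0, p} : Finset LL)) ↔ g p = 1 := by
            rw [Finset.mem_image]
            constructor
            · rintro ⟨x, hx, e⟩
              rw [Finset.mem_filter] at hx
              rw [← (pair_zero_inj hx.1 hp).1 e]; exact hx.2
            · intro h; exact ⟨p, Finset.mem_filter.2 ⟨hp, h⟩, rfl⟩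
          rcases z2 (g p) with h | h
          · rw [h, if_neg]; rw [this, h]; decide
          · rw [h, if_pos]; rw [this, h]
        rw [key p hp, key p' hp']
      · intro f hf
        obtain ⟨p, hp, rfl⟩ := Finset.mem_image.1 hf
        exact zero_pair (Finset.mem_filter.1 hp).1
  · intro 𝓖 h𝓖 hev
    have step : ∀ p ∈ Nb, ∀ p' ∈ Nb, Adj p p' → (({0, p} : Finset LL) ∈ 𝓖 ↔ {0, p'} ∈ 𝓖) := by
      intro p hp p' hp' h
      have := zero_par h𝓖 hp hp' h
      rw [hev _ (zero_tri hp hp' h)] at this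
      by_cases c1 : ({0, p} : Finset LL) ∈ 𝓖 <;> by_cases c2 : ({0, p'} : Finset LL) ∈ 𝓖
      · simp [c1, c2]
      · exfalso; rw [if_pos c1, if_neg c2] at this; revert this; decide
      · exfalso; rw [if_neg c1, if_pos c2] at this; revert this; decide
      · simp [c1, c2]
    have hall : ∀ p ∈ Nb, (({0, p} : Finset LL) ∈ 𝓖 ↔ {0, (1,1,1)} ∈ 𝓖) := by
      intro p hp
      have hs : ∀ p ∈ Nb, p = (1,1,1) ∨ Adj p (1,1,1) ∨ p = (-1,-1,-1) ∨ Adj p (-1,-1,-1) := by decide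
      have l1 := step (1,0,0) (by decide) (1,1,1) (by decide) (by decide)
      have l2 := step (0,-1,0) (by decide) (1,0,0) (by decide) (by decide)
      have l3 := step (-1,-1,-1) (by decide) (0,-1,0) (by decide) (by decide)
      have l4 := l3.trans (l2.trans l1)
      rcases hs p hp with rfl | h | rfl | h
      · rfl
      · exact step p hp _ (by decide) h
      · exact l4
      · exact (step p hp _ (by decide) h).trans l4
    by_cases h0 : ({0, (1,1,1)} : Finset LL) ∈ 𝓖
    · right
      apply h𝓖.antisymm
      intro f hf
      obtain ⟨p, hp, rfl⟩ := zero_two hf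
      exact (hall p hp).2 h0
    · left
      rw [Finset.eq_empty_iff_forall_notMem]
      intro f hf
      obtain ⟨p, hp, rfl⟩ := zero_two (h𝓖 hf)
      exact h0 ((hall p hp).1 hf)

variable (P)

noncomputable def PS.UU : ℕ → Finset LL
  | 0 => {0}
  | n+1 => P.kids (PS.UU n)

theorem PS.conn (n : ℕ) : Conn (P.UU n) := by
  induction n with
  | zero => exact conn_zero
  | succ n ih => exact ih.step

noncomputable def PS.SS (n : ℕ) : Surf LL := mkSurf (P.UU n) (P.conn n)

end conn
end ABCT
end

section
open Set Metric Filter Topology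

namespace ABCT

section rec
set_option linter.unusedSectionVars false
set_option linter.unusedVariables false

/-! Sequences with the recurrence `c f (k+3) + b f (k+2) + a f (k+1) + f k = 0` tend to zero. -/

structure Rec (a b c : ℝ) (f : ℕ → ℝ) : Prop where
  ha : 1 ≤ a
  hab : a ≤ b
  hbc : b + 1 ≤ c
  r : ∀ k, c * f (k+3) + b * f (k+2) + a * f (k+1) + f k = 0

variable {a b c : ℝ} {f : ℕ → ℝ}

theorem Rec.neg (h : Rec a b c f) : Rec a b c (fun k => - f k) := by
  refine ⟨h.ha, h.hab, h.hbc, fun k => ?_⟩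
  have := h.r k
  linarith

theorem Rec.four (h : Rec a b c f) (k : ℕ) :
    c * f (k+4) = (c - b) * f (k+3) + (b - a) * f (k+2) + (a - 1) * f (k+1) + f k := by
  have h1 := h.r k
  have h2 := h.r (k+1)
  have e1 : k + 1 + 3 = k + 4 := rfl
  have e2 : k + 1 + 2 = k + 3 := rfl
  have e3 : k + 1 + 1 = k + 2 := rfl
  rw [e1, e2, e3] at h2
  linarith

theorem Rec.drop (h : Rec a b c f) (k : ℕ) {M η : ℝ} (h0 : f k ≤ M) (h1 : f (k+1) ≤ M) (h2 : f (k+2) ≤ M)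
    (h3 : f (k+3) ≤ M - η) (hη : 0 ≤ η) : f (k+4) ≤ M - (1/c) * η := by
  have ha := h.ha; have hab := h.hab; have hbc := h.hbc
  have hc : 0 < c := by linarith
  have h4 := h.four k
  have : c * f (k+4) ≤ c * (M - (1/c) * η) := by
    have e : c * (M - (1/c) * η) = c * M - η := by field_simp
    rw [e, h4]
    have i1 := mul_le_mul_of_nonneg_left h3 (by linarith : 0 ≤ c - b)
    have i2 := mul_le_mul_of_nonneg_left h2 (by linarith : 0 ≤ b - a)
    have i3 := mul_le_mul_of_nonneg_left h1 (by linarith : 0 ≤ a - 1)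
    nlinarith
  exact le_of_mul_le_mul_left this hc

theorem Rec.bound (h : Rec a b c f) (k : ℕ) {M : ℝ} (h0 : f k ≤ M) (h1 : f (k+1) ≤ M) (h2 : f (k+2) ≤ M)
    (h3 : f (k+3) ≤ M) (i : ℕ) (hi : k ≤ i) : f i ≤ M := by
  have key : ∀ j, f (k+j) ≤ M ∧ f (k+j+1) ≤ M ∧ f (k+j+2) ≤ M ∧ f (k+j+3) ≤ M := by
    intro j
    induction j with
    | zero => exact ⟨h0, h1, h2, h3⟩
    | succ j ih =>
      obtain ⟨i0, i1, i2, i3⟩ := ih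
      refine ⟨i1, i2, i3, ?_⟩
      have := h.drop (k+j) (η := 0) i0 i1 i2 (by linarith) le_rfl
      rw [mul_zero, sub_zero] at this
      exact this
  obtain ⟨j, rfl⟩ := Nat.exists_eq_add_of_le hi
  exact (key j).1

theorem Rec.shrink (h : Rec a b c f) (k : ℕ) {M : ℝ} (hM : 0 ≤ M) (hb : ∀ i ≥ k, f i ≤ M) :
    ∀ i ≥ k + 9, f i ≤ (1 - (1/c)^6) * M := by
  have ha := h.ha; have hab := h.hab; have hbc := h.hbc
  have hc : 0 < c := by linarith
  have d0 : 0 < 1/c := by positivity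
  have d1 : 1/c ≤ 1 := by rw [div_le_one hc]; linarith
  obtain ⟨j, hj3, hkj, hj⟩ : ∃ j, j ≤ k + 6 ∧ k + 3 ≤ j ∧ f j ≤ 0 := by
    by_contra! hcon
    have q0 := hcon (k+3) (by omega) (by omega)
    have q1 := hcon (k+3+1) (by omega) (by omega)
    have q2 := hcon (k+3+2) (by omega) (by omega)
    have q3 := hcon (k+3+3) (by omega) (by omega)
    have := h.r (k+3)
    have : 0 < c * f (k+3+3) + b * f (k+3+2) + a * f (k+3+1) + f (k+3) := by
      have := mul_pos hc q3
      have := mul_pos (by linarith : 0 < b) q2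
      have := mul_pos (by linarith : 0 < a) q1
      linarith
    linarith
  have key : ∀ i, f (j+i) ≤ M - (1/c)^i * M := by
    intro i
    induction i with
    | zero => simpa using hj
    | succ i ih =>
      have hp : 0 ≤ (1/c)^i * M := by positivity
      have h3 : k + 3 ≤ j + i := by omega
      obtain ⟨l, hl⟩ := Nat.exists_eq_add_of_le h3
      have := h.drop (k+l) (M := M) (η := (1/c)^i * M) (hb _ (by omega)) (hb _ (by omega)) (hb _ (by omega))
        (by have e : k + l + 3 = j + i := by omega
            rw [e]; exact ih) hp
      have e : k + l + 4 = j + (i+1) := by omega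
      rw [e] at this
      rw [pow_succ]
      linarith
  have key2 : ∀ i ≤ 6, f (j+i) ≤ (1 - (1/c)^6) * M := by
    intro i hi
    have h1 := key i
    have h2 : (1/c)^6 ≤ (1/c)^i := pow_le_pow_of_le_one d0.le d1 hi
    have := mul_le_mul_of_nonneg_right h2 hM
    linarith
  have w : ∀ i, k + 6 ≤ i → i ≤ k + 9 → f i ≤ (1 - (1/c)^6) * M := by
    intro i h1 h2
    have := key2 (i - j) (by omega)
    rwa [Nat.add_sub_cancel' (by omega)] at this
  intro i hi
  exact h.bound (k+6) (w _ (by omega) (by omega)) (w _ (by omega) (by omega)) (w _ (by omega) (by omega))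
    (w _ (by omega) (by omega)) i (by omega)

theorem Rec.decay (h : Rec a b c f) {M : ℝ} (hM : 0 ≤ M) (h0 : |f 0| ≤ M) (h1 : |f 1| ≤ M) (h2 : |f 2| ≤ M)
    (h3 : |f 3| ≤ M) (n : ℕ) : ∀ i ≥ 9 * n, |f i| ≤ (1 - (1/c)^6)^n * M := by
  have ha := h.ha; have hab := h.hab; have hbc := h.hbc
  have hc : 0 < c := by linarith
  have d1 : 1/c ≤ 1 := by rw [div_le_one hc]; linarith
  have hr : 0 ≤ 1 - (1/c)^6 := by
    have : (1/c)^6 ≤ 1 := pow_le_one₀ (by positivity) d1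
    linarith
  induction n with
  | zero =>
    intro i _
    rw [abs_le] at h0 h1 h2 h3 ⊢
    rw [pow_zero, one_mul]
    have u := h.bound 0 h0.2 h1.2 h2.2 h3.2 i (Nat.zero_le i)
    have l := h.neg.bound 0 (M := M) (by linarith) (by simp only [zero_add]; linarith) (by simp only [zero_add]; linarith)
      (by simp only [zero_add]; linarith) i (Nat.zero_le i)
    exact ⟨by linarith, u⟩
  | succ n ih =>
    have hM' : 0 ≤ (1 - (1/c)^6)^n * M := by positivity
    have u := h.shrink (9*n) hM' (fun i hi => (abs_le.1 (ih i hi)).2)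
    have l := h.neg.shrink (9*n) hM' (fun i hi => by have := (abs_le.1 (ih i hi)).1; linarith)
    intro i hi
    have u := u i (by omega)
    have l := l i (by omega)
    rw [pow_succ', mul_assoc, abs_le]
    exact ⟨by linarith, u⟩

end rec

section tilemap
set_option linter.unusedSectionVars false
set_option linter.unusedVariables false

abbrev E3 := Fin 3 → ℝ

variable (P : PS)

noncomputable def PS.ra : ℝ := P.s1 + 1
noncomputable def PS.rb : ℝ := P.s1 + P.s2 + 1
noncomputable def PS.rc : ℝ := P.C

theorem PS.rc_eq : P.rc = P.s1 + P.s2 + P.s3 + 1 := by unfold PS.rc PS.C; push_cast; ring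

theorem PS.rr : 1 ≤ P.ra ∧ P.ra ≤ P.rb ∧ P.rb + 1 ≤ P.rc := by
  have h1 : (0:ℝ) ≤ P.s1 := by exact_mod_cast P.h1
  have h2 : (0:ℝ) ≤ P.s2 := by exact_mod_cast P.h2
  have h3 : (1:ℝ) ≤ P.s3 := by exact_mod_cast P.h3
  rw [P.rc_eq]
  unfold PS.ra PS.rb
  refine ⟨by linarith, by linarith, by linarith⟩

theorem PS.rc_pos : 0 < P.rc := by obtain ⟨h1, h2, h3⟩ := P.rr; linarith

noncomputable def PS.mat : Matrix (Fin 3) (Fin 3) ℝ := !![0, 0, -P.rc; 1, 0, -P.rb; 0, 1, -P.ra]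

noncomputable def PS.m : E3 →ₗ[ℝ] E3 := Matrix.toLin' P.mat

noncomputable def PS.w (z : E3) : E3 := ![z 1 - P.rb * z 0 / P.rc, z 2 - P.ra * z 0 / P.rc, - z 0 / P.rc]

theorem PS.m_apply (x : E3) : P.m x = ![- P.rc * x 2, x 0 - P.rb * x 2, x 1 - P.ra * x 2] := by
  unfold PS.m PS.mat
  rw [Matrix.toLin'_apply]
  ext i
  fin_cases i <;> simp [Matrix.mulVec, dotProduct, Fin.sum_univ_three] <;> ring

theorem PS.m_w (z : E3) : P.m (P.w z) = z := by
  have := P.rc_pos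
  rw [P.m_apply]
  ext i
  fin_cases i <;> simp [PS.w] <;> field_simp <;> ring

theorem PS.w_m (z : E3) : P.w (P.m z) = z := by
  have := P.rc_pos
  rw [P.m_apply]
  ext i
  fin_cases i <;> simp [PS.w] <;> field_simp <;> ring

theorem PS.m_inj : Function.Injective P.m := Function.LeftInverse.injective P.w_m

theorem PS.det_m : LinearMap.det P.m = - P.rc := by
  unfold PS.m
  rw [LinearMap.det_toLin']
  simp [PS.mat, Matrix.det_fin_three]

theorem PS.w_rec (z : E3) (j : Fin 3) : Rec P.ra P.rb P.rc (fun k => (P.w^[k] z) j) := by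
  obtain ⟨h1, h2, h3⟩ := P.rr
  refine ⟨h1, h2, h3, fun k => ?_⟩
  have hc := P.rc_pos
  simp only [Function.iterate_succ_apply']
  generalize P.w^[k] z = y
  fin_cases j <;> simp [PS.w] <;> field_simp <;> ring

theorem PS.w_bound {z : E3} {R : ℝ} (hz : ∀ i, |z i| ≤ R) (i : Fin 3) : |P.w z i| ≤ 2 * R := by
  obtain ⟨h1, h2, h3⟩ := P.rr
  have hc := P.rc_pos
  have hR : 0 ≤ R := (abs_nonneg _).trans (hz 0)
  have k1 : ∀ t, 0 ≤ t → t ≤ P.rc → |t * z 0 / P.rc| ≤ R := by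
    intro t h0 h1
    rw [abs_div, abs_mul, abs_of_pos hc, abs_of_nonneg h0, div_le_iff₀ hc]
    have := hz 0
    nlinarith [abs_nonneg (z 0)]
  fin_cases i
  · have := abs_sub (z 1) (P.rb * z 0 / P.rc)
    have := k1 P.rb (by linarith) (by linarith)
    have := hz 1
    simp [PS.w]; linarith
  · have := abs_sub (z 2) (P.ra * z 0 / P.rc)
    have := k1 P.ra (by linarith) (by linarith)
    have := hz 2
    simp [PS.w]; linarith
  · have := k1 1 (by linarith) (by linarith)
    rw [one_mul] at this
    simp [PS.w, neg_div]; linarith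

theorem PS.w_decay (R : ℝ) (hR : 0 ≤ R) {ε : ℝ} (hε : 0 < ε) : ∃ N, ∀ n ≥ N, ∀ z : E3, ‖z‖ ≤ R → ‖P.w^[n] z‖ ≤ ε := by
  obtain ⟨h1, h2, h3⟩ := P.rr
  have hc := P.rc_pos
  have r0 : 0 ≤ 1 - (1/P.rc)^6 := by
    have : (1/P.rc)^6 ≤ 1 := pow_le_one₀ (by positivity) (by rw [div_le_one hc]; linarith)
    linarith
  have r1 : 1 - (1/P.rc)^6 < 1 := by
    have : 0 < (1/P.rc)^6 := by positivity
    linarith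
  have lim : Tendsto (fun n : ℕ => (1 - (1/P.rc)^6)^n * (8 * R)) atTop (𝓝 (0 * (8 * R))) :=
    (tendsto_pow_atTop_nhds_zero_of_lt_one r0 r1).mul_const _
  rw [zero_mul] at lim
  obtain ⟨n0, hn0⟩ := (lim.eventually (ge_mem_nhds hε)).exists
  refine ⟨9 * n0, fun n hn z hz => ?_⟩
  rw [pi_norm_le_iff_of_nonneg hε.le]
  intro j
  rw [Real.norm_eq_abs]
  have b0 : ∀ i, |z i| ≤ R := fun i => by
    rw [← Real.norm_eq_abs]; exact (norm_le_pi_norm z i).trans hz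
  have b1 := fun i => P.w_bound b0 i
  have b2 := fun i => P.w_bound b1 i
  have b3 := fun i => P.w_bound b2 i
  have := (P.w_rec z j).decay (M := 8 * R) (by linarith) ((b0 j).trans (by linarith)) ((b1 j).trans (by linarith))
    ((b2 j).trans (by linarith)) ((b3 j).trans (by linarith)) n0 n hn
  exact this.trans hn0

/-- expansion: if `m^n x` stays bounded then `x` is small -/
theorem PS.m_expand (R : ℝ) (hR : 0 ≤ R) {ε : ℝ} (hε : 0 < ε) :
    ∃ N, ∀ n ≥ N, ∀ x : E3, ‖P.m^[n] x‖ ≤ R → ‖x‖ ≤ ε := by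
  obtain ⟨N, hN⟩ := P.w_decay R hR hε
  refine ⟨N, fun n hn x hx => ?_⟩
  have := hN n hn _ hx
  have li : Function.LeftInverse P.w P.m := P.w_m
  rwa [li.iterate n x] at this

noncomputable def PS.e (a : LL) : E3 := ![a.1 + P.s1 * a.2.1 + P.s2 * a.2.2, a.2.1 + P.s1 * a.2.2, a.2.2]

theorem PS.e_add (a b : LL) : P.e (a + b) = P.e a + P.e b := by
  ext i
  fin_cases i <;> simp [PS.e] <;> ring

theorem PS.e_sub (a b : LL) : P.e (a - b) = P.e a - P.e b := by
  ext i
  fin_cases i <;> simp [PS.e] <;> ring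

theorem PS.e_zero : P.e 0 = 0 := by
  ext i
  fin_cases i <;> simp [PS.e]

def PS.dg (i : ℤ) : E3 := ![(i : ℝ), 0, 0]

theorem PS.e_ch (α : LL) (u : ℤ) : P.e (PS.ch α u) = P.m (P.e α) + PS.dg (u + P.s α) := by
  rw [P.m_apply]
  have := P.rc_eq
  ext i
  fin_cases i <;> simp [PS.e, PS.ch, PS.dg, PS.s, this, PS.ra, PS.rb] <;> ring

/-- integer coordinates -/
theorem PS.e_int (a : LL) : P.e a = fun i => ((![a.1 + P.s1 * a.2.1 + P.s2 * a.2.2, a.2.1 + P.s1 * a.2.2, a.2.2] : Fin 3 → ℤ) i : ℝ) := by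
  ext i
  fin_cases i <;> simp [PS.e]

theorem PS.e_surj (v : Fin 3 → ℤ) : ∃ a : LL, P.e a = fun i => (v i : ℝ) := by
  refine ⟨(v 0 - P.s1 * (v 1 - P.s1 * v 2) - P.s2 * v 2, v 1 - P.s1 * v 2, v 2), ?_⟩
  ext i
  fin_cases i <;> simp [PS.e] <;> ring

theorem PS.e_inj : Function.Injective P.e := by
  intro a b h
  have h0 := congrFun h 0
  have h1 := congrFun h 1
  have h2 := congrFun h 2
  simp [PS.e] at h0 h1 h2
  obtain ⟨a1, a2, a3⟩ := a
  obtain ⟨b1, b2, b3⟩ := b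
  simp at h0 h1 h2
  subst h2
  have : a2 = b2 := by simpa using h1
  subst this
  have : a1 = b1 := by simpa using h0
  subst this
  rfl

end tilemap
end ABCT
end

section
open Set Metric Filter Topology

namespace ABCT

section tiles
set_option linter.unusedSectionVars false
set_option linter.unusedVariables false

structure Tl (P : PS) (T : Set E3) : Prop where
  ne : T.Nonempty
  cpt : IsCompact T
  vol : 0 < MeasureTheory.volume T
  eq : ∀ y, (∃ x ∈ T, P.m x = y) ↔ ∃ i : ℤ, 0 ≤ i ∧ i < P.C ∧ y - PS.dg i ∈ T

def KK (P : PS) (T : Set E3) (a : LL) : Set E3 := (fun x => x - P.e a) ⁻¹' T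

variable {P : PS} {T : Set E3}

theorem mem_KK {a : LL} {x : E3} : x ∈ KK P T a ↔ x - P.e a ∈ T := Iff.rfl

theorem KK_zero : KK P T 0 = T := by
  ext x; rw [mem_KK, P.e_zero, sub_zero]

theorem Tl.cptK (h : Tl P T) (a : LL) : IsCompact (KK P T a) :=
  (Homeomorph.subRight (P.e a)).isCompact_preimage.2 h.cpt

theorem Tl.neK (h : Tl P T) (a : LL) : (KK P T a).Nonempty := by
  obtain ⟨x, hx⟩ := h.ne
  exact ⟨x + P.e a, by rw [mem_KK, add_sub_cancel_right]; exact hx⟩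

theorem Tl.child (h : Tl P T) {α : LL} {x : E3} : x ∈ KK P T α ↔ ∃ a, P.q a = α ∧ P.m x ∈ KK P T a := by
  constructor
  · intro hx
    obtain ⟨i, h0, h1, hi⟩ := (h.eq _).1 ⟨_, hx, rfl⟩
    refine ⟨PS.ch α (i - P.s α), P.q_ch (by omega) (by omega), ?_⟩
    rw [mem_KK, P.e_ch, sub_add_cancel, ← sub_sub, ← map_sub]
    exact hi
  · rintro ⟨a, rfl, ha⟩
    rw [mem_KK, ← P.ch_q_u a, P.e_ch, ← sub_sub, ← map_sub] at ha
    obtain ⟨y, hy, hyx⟩ := (h.eq _).2 ⟨_, by have := P.u_lo a; omega, by have := P.u_hi a; omega, ha⟩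
    rw [mem_KK, ← P.m_inj hyx]
    exact hy

theorem Tl.mesh (h : Tl P T) {ε : ℝ} (hε : 0 < ε) : ∃ N, ∀ n ≥ N, ∀ a b : LL, (a = b ∨ Adj a b) → ∀ x y,
    P.m^[n] x ∈ KK P T a → P.m^[n] y ∈ KK P T b → dist x y ≤ ε := by
  obtain ⟨R, hR0, hR⟩ := h.cpt.isBounded.exists_pos_norm_le
  obtain ⟨R', hR'⟩ : ∃ R' : ℝ, ∀ p ∈ Nb, ‖P.e p‖ ≤ R' :=
    ⟨∑ p ∈ Nb, ‖P.e p‖, fun p hp => Finset.single_le_sum (f := fun p => ‖P.e p‖) (fun _ _ => norm_nonneg _) hp⟩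
  have hR'0 : 0 ≤ R' := (norm_nonneg _).trans (hR' (1,0,0) (by decide))
  obtain ⟨N, hN⟩ := P.m_expand (R + R + R') (by positivity) hε
  refine ⟨N, fun n hn a b hab x y hx hy => ?_⟩
  rw [dist_eq_norm]
  apply hN n hn
  rw [iterate_map_sub]
  have e : P.m^[n] x - P.m^[n] y = (P.m^[n] x - P.e a) - (P.m^[n] y - P.e b) - P.e (b - a) := by
    rw [P.e_sub]; abel
  rw [e]
  have h1 := hR _ hx
  have h2 := hR _ hy
  have h3 : ‖P.e (b - a)‖ ≤ R' := by
    rcases hab with rfl | hab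
    · rw [sub_self, P.e_zero, norm_zero]; exact hR'0
    · exact hR' _ (adj_iff.1 hab)
  have := norm_sub_le (P.m^[n] x - P.e a - (P.m^[n] y - P.e b)) (P.e (b - a))
  have := norm_sub_le (P.m^[n] x - P.e a) (P.m^[n] y - P.e b)
  linarith

theorem Tl.thread_unique (h : Tl P T) {a b : ℕ → LL} (hab : ∀ k, a k = b k ∨ Adj (a k) (b k)) {x y : E3}
    (hx : ∀ k, P.m^[k] x ∈ KK P T (a k)) (hy : ∀ k, P.m^[k] y ∈ KK P T (b k)) : x = y := by
  apply dist_le_zero.1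
  apply le_of_forall_pos_le_add
  intro ε hε
  obtain ⟨N, hN⟩ := h.mesh hε
  rw [zero_add]
  exact hN N le_rfl _ _ (hab N) _ _ (hx N) (hy N)

theorem PS.m_cont : Continuous P.m := LinearMap.continuous_of_finiteDimensional _

theorem Tl.thread (h : Tl P T) {a : ℕ → LL} (ha : ∀ k, P.q (a (k+1)) = a k) :
    ∃ x, ∀ k, P.m^[k] x ∈ KK P T (a k) := by
  have cl : ∀ k, IsClosed ((P.m^[k]) ⁻¹' KK P T (a k)) := fun k =>
    (h.cptK _).isClosed.preimage (P.m_cont.iterate k)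
  have := IsCompact.nonempty_iInter_of_sequence_nonempty_isCompact_isClosed
    (fun k => (P.m^[k]) ⁻¹' KK P T (a k)) ?_ ?_ ?_ cl
  · obtain ⟨x, hx⟩ := this
    exact ⟨x, fun k => mem_iInter.1 hx k⟩
  · intro k x hx
    rw [mem_preimage, Function.iterate_succ_apply'] at hx
    exact h.child.2 ⟨_, ha k, hx⟩
  · intro k
    obtain ⟨z, hz⟩ := h.neK (a k)
    refine ⟨P.w^[k] z, ?_⟩
    have li : Function.LeftInverse P.m P.w := P.m_w
    rw [mem_preimage, li.iterate k z]
    exact hz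
  · exact h.cptK _

theorem PS.tower_cells {U s : Finset LL} {k : ℕ} (hs : s ∈ cells U k) :
    ∃ V : ℕ → Finset LL, V 0 = s ∧ ∀ j, Clique (V j) ∧ (V (j+1)).image P.q = V j := by
  have st : ∀ t : {t : Finset LL // ∃ U, t ∈ cells U k}, ∃ t' : {t : Finset LL // ∃ U, t ∈ cells U k},
      t'.1.image P.q = t.1 := by
    rintro ⟨t, U', ht⟩
    obtain ⟨t', h1, h2⟩ := P.exists_child ht
    exact ⟨⟨t', _, h1⟩, h2⟩
  choose g hg using st
  refine ⟨fun j => (g^[j] ⟨s, U, hs⟩).1, rfl, fun j => ⟨?_, ?_⟩⟩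
  · obtain ⟨U', h⟩ := (g^[j] ⟨s, U, hs⟩).2
    exact (mem_cells.1 h).2.1
  · beta_reduce
    rw [Function.iterate_succ_apply']
    exact hg _

theorem PS.chain {V : ℕ → Finset LL} (hV : ∀ j, (V (j+1)).image P.q = V j) {c : LL} (hc : c ∈ V 0) :
    ∃ a : ℕ → LL, a 0 = c ∧ (∀ j, a j ∈ V j) ∧ ∀ j, P.q (a (j+1)) = a j := by
  have st : ∀ j : ℕ, ∀ b : LL, ∃ b', b ∈ V j → b' ∈ V (j+1) ∧ P.q b' = b := by
    intro j b
    by_cases hb : b ∈ V j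
    · rw [← hV j] at hb
      obtain ⟨b', h1, h2⟩ := Finset.mem_image.1 hb
      exact ⟨b', fun _ => ⟨h1, h2⟩⟩
    · exact ⟨b, fun h => absurd h hb⟩
  choose g hg using st
  have hm : ∀ j, (Nat.rec c (fun j b => g j b) j : LL) ∈ V j := by
    intro j
    induction j with
    | zero => exact hc
    | succ j ih => exact (hg j _ ih).1
  exact ⟨fun j => Nat.rec c (fun j b => g j b) j, rfl, hm, fun j => (hg j _ (hm j)).2⟩

theorem Tl.cell_point (h : Tl P T) {U s : Finset LL} {k : ℕ} (hs : s ∈ cells U k) : ∃ x, ∀ c ∈ s, x ∈ KK P T c := by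
  obtain ⟨V, hV0, hV⟩ := PS.tower_cells (P := P) hs
  have pt : ∀ c ∈ s, ∃ a : ℕ → LL, ∃ x, a 0 = c ∧ (∀ j, a j ∈ V j) ∧ ∀ j, P.m^[j] x ∈ KK P T (a j) := by
    intro c hc
    obtain ⟨a, h1, h2, h3⟩ := PS.chain (P := P) (fun j => (hV j).2) (hV0 ▸ hc)
    obtain ⟨x, hx⟩ := h.thread h3
    exact ⟨a, x, h1, h2, hx⟩
  obtain ⟨-, -, ⟨c0, hc0, -⟩, -⟩ := mem_cells.1 hs
  obtain ⟨a, x, ha0, ha, hx⟩ := pt c0 hc0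
  refine ⟨x, fun c hc => ?_⟩
  obtain ⟨b, y, hb0, hb, hy⟩ := pt c hc
  have : x = y := by
    refine h.thread_unique (fun k => ?_) hx hy
    by_cases e : a k = b k
    · exact Or.inl e
    · exact Or.inr ((hV k).1 _ (ha k) _ (hb k) e)
  rw [this, ← hb0]
  exact hy 0

theorem Tl.adj_inter (h : Tl P T) {a b : LL} (hab : Adj a b) : (KK P T a ∩ KK P T b).Nonempty := by
  have : ({a, b} : Finset LL) ∈ cells {a} 2 := pair_cell hab (Or.inl ⟨Finset.mem_singleton_self _, by
    rw [Finset.mem_singleton]; exact hab.1.symm⟩)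
  obtain ⟨x, hx⟩ := h.cell_point this
  exact ⟨x, hx a (by simp), hx b (by simp)⟩

theorem KK_trans {a b : LL} (c : LL) : (KK P T (a + c) ∩ KK P T (b + c)).Nonempty ↔ (KK P T a ∩ KK P T b).Nonempty := by
  constructor
  · rintro ⟨x, h1, h2⟩
    refine ⟨x - P.e c, ?_, ?_⟩ <;> rw [mem_KK]
    · rw [mem_KK, P.e_add] at h1; convert h1 using 1; abel
    · rw [mem_KK, P.e_add] at h2; convert h2 using 1; abel
  · rintro ⟨x, h1, h2⟩
    refine ⟨x + P.e c, ?_, ?_⟩ <;> rw [mem_KK, P.e_add]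
    · rw [mem_KK] at h1; convert h1 using 1; abel
    · rw [mem_KK] at h2; convert h2 using 1; abel

/-- fourteen neighbors -/
def NL (P : PS) (T : Set E3) : Set LL := {p | p ≠ 0 ∧ (T ∩ KK P T p).Nonempty}

theorem Tl.nl_eq (h : Tl P T) (h14 : (NL P T).ncard = 14) : NL P T = (Nb : Set LL) := by
  symm
  apply Set.eq_of_subset_of_ncard_le
  · intro p hp
    have hp : Adj 0 p := adj_zero.2 hp
    refine ⟨hp.1.symm, ?_⟩
    have := h.adj_inter hp
    rwa [KK_zero] at this
  · rw [h14, Set.ncard_coe_finset]; decide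
  · exact Set.finite_of_ncard_ne_zero (by omega)

theorem Tl.meet (h : Tl P T) (h14 : (NL P T).ncard = 14) {a b : LL} {x : E3} (ha : x ∈ KK P T a) (hb : x ∈ KK P T b) :
    a = b ∨ Adj a b := by
  by_cases e : a = b
  · exact Or.inl e
  right
  have h1 : (KK P T (0 + a) ∩ KK P T (b - a + a)).Nonempty := by
    rw [zero_add, sub_add_cancel]; exact ⟨x, ha, hb⟩
  rw [KK_trans, KK_zero] at h1
  have : b - a ∈ NL P T := ⟨fun e' => e (sub_eq_zero.1 e').symm, h1⟩
  rw [h.nl_eq h14] at this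
  exact adj_iff.2 this

end tiles
end ABCT
end

section
open Set Metric Filter Topology

namespace ABCT

section tower
set_option linter.unusedSectionVars false
set_option linter.unusedVariables false

def XX (P : PS) (T : Set E3) (n : ℕ) (s : Finset LL) : Set E3 := {x | ∀ c ∈ s, P.m^[n] x ∈ KK P T c}

variable {P : PS} {T : Set E3}

theorem mem_XX {n : ℕ} {s : Finset LL} {x : E3} : x ∈ XX P T n s ↔ ∀ c ∈ s, P.m^[n] x ∈ KK P T c := Iff.rfl

theorem PS.w_cont : Continuous P.w := by
  unfold PS.w
  fun_prop

theorem Tl.clique (h : Tl P T) (h14 : (NL P T).ncard = 14) {n : ℕ} {s : Finset LL} {x : E3} (hx : x ∈ XX P T n s) :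
    Clique s := by
  intro a ha b hb hab
  exact (h.meet h14 (hx a ha) (hx b hb)).resolve_left hab

theorem Tl.rz (h : Tl P T) (h14 : (NL P T).ncard = 14) (n : ℕ) : Rz (P.SS n) (XX P T n) := by
  have li : Function.LeftInverse P.w P.m := P.w_m
  have ri : Function.LeftInverse P.m P.w := P.m_w
  refine ⟨?_, ?_, ?_, ?_⟩
  · rintro s ⟨c, hc⟩
    have h1 : IsCompact (P.w^[n] '' KK P T c) := (h.cptK c).image (PS.w_cont.iterate n)
    refine h1.of_isClosed_subset ?_ ?_
    · have : XX P T n s = ⋂ c ∈ s, P.m^[n] ⁻¹' KK P T c := by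
        ext x; simp [mem_XX]
      rw [this]
      exact isClosed_biInter fun c _ => (h.cptK c).isClosed.preimage (PS.m_cont.iterate n)
    · intro x hx
      exact ⟨_, hx c hc, li.iterate n x⟩
  · intro s t
    ext x
    simp only [mem_inter_iff, mem_XX, Finset.mem_union]
    constructor
    · rintro ⟨h1, h2⟩ c (hc | hc)
      · exact h1 c hc
      · exact h2 c hc
    · intro h'
      exact ⟨fun c hc => h' c (Or.inl hc), fun c hc => h' c (Or.inr hc)⟩
  · rintro f hf s hfs ⟨x, hx⟩
    have hf : f ∈ cells (P.UU n) 2 := hf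
    have hc := h.clique h14 hx
    have h4 := hc.card_le
    have hb := (mem_cells.1 hf).2.2.mono hfs
    have h2 := hb.two
    have : s.card = 2 ∨ s.card = 3 ∨ s.card = 4 := by omega
    rcases this with e | e | e
    · exact Or.inl (mem_cells.2 ⟨e, hc, hb⟩)
    · exact Or.inr (Or.inl (mem_cells.2 ⟨e, hc, hb⟩))
    · exact Or.inr (Or.inr (mem_cells.2 ⟨e, hc, hb⟩))
  · intro v hv
    have hv : v ∈ cells (P.UU n) 4 := hv
    obtain ⟨y, hy⟩ := h.cell_point hv
    have hp : P.w^[n] y ∈ XX P T n v := by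
      intro c hc; rw [ri.iterate n y]; exact hy c hc
    refine ⟨P.w^[n] y, Subset.antisymm ?_ (singleton_subset_iff.2 hp)⟩
    -- at every level the children agree
    intro x hx
    rw [mem_singleton_iff]
    generalize hz : P.w^[n] y = z at hp
    have key : ∀ k, ∃ t, t.Nonempty ∧ t.card = 4 ∧ x ∈ XX P T (n+k) t ∧ z ∈ XX P T (n+k) t := by
      intro k
      induction k with
      | zero => exact ⟨v, by rw [← Finset.card_pos, (mem_cells.1 hv).1]; omega, (mem_cells.1 hv).1, hx, hp⟩
      | succ k ih =>
        obtain ⟨t, hne, h4, h1, h2⟩ := ih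
        have st : ∀ x ∈ XX P T (n+k) t, ∃ t', t'.image P.q = t ∧ t'.card = 4 ∧ x ∈ XX P T (n+(k+1)) t' := by
          intro x hx
          have : ∀ c : LL, ∃ a, c ∈ t → P.q a = c ∧ P.m (P.m^[n+k] x) ∈ KK P T a := by
            intro c
            by_cases hc : c ∈ t
            · obtain ⟨a, ha⟩ := h.child.1 (hx c hc); exact ⟨a, fun _ => ha⟩
            · exact ⟨c, fun h => absurd h hc⟩
          choose g hg using this
          refine ⟨t.image g, ?_, ?_, ?_⟩
          · rw [Finset.image_image]
            conv_rhs => rw [← Finset.image_id (s := t)]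
            exact Finset.image_congr fun c hc => (hg c hc).1
          · rw [Finset.card_image_of_injOn, h4]
            intro c hc d hd hcd
            rw [← (hg c hc).1, ← (hg d hd).1, hcd]
          · intro a ha
            obtain ⟨c, hc, rfl⟩ := Finset.mem_image.1 ha
            rw [← add_assoc, Function.iterate_succ_apply']
            exact (hg c hc).2
        obtain ⟨t1, a1, a2, a3⟩ := st x h1
        obtain ⟨t2, b1, b2, b3⟩ := st z h2
        have : t1 = t2 := by
          apply P.child_unique (h.clique h14 a3) (h.clique h14 b3) a2 b2
          · rw [a1, b1]
          · rw [a1, h4]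
        subst this
        exact ⟨t1, by rw [← Finset.card_pos, a2]; omega, a2, a3, b3⟩
    apply dist_le_zero.1
    apply le_of_forall_pos_le_add
    intro ε hε
    obtain ⟨N, hN⟩ := h.mesh hε
    rw [zero_add]
    obtain ⟨t, ⟨c, hc⟩, -, h1, h2⟩ := key N
    exact hN (n+N) (by omega) c c (Or.inl rfl) _ _ (h1 c hc) (h2 c hc)

theorem Tl.lift_pt (h : Tl P T) (h14 : (NL P T).ncard = 14) {n k : ℕ} {s : Finset LL} (hs : s ∈ cells (P.UU n) k)
    {x : E3} (hx : x ∈ XX P T n s) : ∃ t ∈ cells (P.UU (n+1)) k, t.image P.q = s ∧ x ∈ XX P T (n+1) t := by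
  have : ∀ c : LL, ∃ a, c ∈ s → P.q a = c ∧ P.m (P.m^[n] x) ∈ KK P T a := by
    intro c
    by_cases hc : c ∈ s
    · obtain ⟨a, ha⟩ := h.child.1 (hx c hc); exact ⟨a, fun _ => ha⟩
    · exact ⟨c, fun h => absurd h hc⟩
  choose g hg using this
  have e1 : (s.image g).image P.q = s := by
    rw [Finset.image_image]
    conv_rhs => rw [← Finset.image_id (s := s)]
    exact Finset.image_congr fun c hc => (hg c hc).1
  have e2 : x ∈ XX P T (n+1) (s.image g) := by
    intro a ha
    obtain ⟨c, hc, rfl⟩ := Finset.mem_image.1 ha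
    rw [Function.iterate_succ_apply']
    exact (hg c hc).2
  obtain ⟨i1, i2, i3⟩ := mem_cells.1 hs
  refine ⟨s.image g, mem_cells.2 ⟨?_, h.clique h14 e2, ?_⟩, e1, e2⟩
  · rw [Finset.card_image_of_injOn, i1]
    intro c hc d hd hcd
    rw [← (hg c hc).1, ← (hg d hd).1, hcd]
  · exact (PS.bi_kids P).2 (by rw [e1]; exact i3)

theorem Tl.rf (h : Tl P T) (h14 : (NL P T).ncard = 14) (n : ℕ) :
    Ref (P.SS n) (P.SS (n+1)) (XX P T n) (XX P T (n+1)) P.q where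
  Q1 := by
    intro t x hx c hc
    obtain ⟨a, ha, rfl⟩ := Finset.mem_image.1 hc
    have := hx a ha
    rw [Function.iterate_succ_apply'] at this
    exact h.child.2 ⟨a, rfl, this⟩
  QF := fun s hs x hx => h.lift_pt h14 hs hx
  QE := fun s hs x hx => h.lift_pt h14 hs hx
  QV := fun s hs x hx => h.lift_pt h14 hs hx
  Q2 := fun 𝓖 h𝓖 t ht => P.Q23 h𝓖 ht
  Q3 := fun 𝓖 h𝓖 t ht => P.Q23 h𝓖 ht
  Q4 := fun e he y hy hev => P.fiber_const (Or.inr rfl) he hy hev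

noncomputable def Tl.tower (h : Tl P T) (h14 : (NL P T).ncard = 14) : Tower LL E3 where
  S := P.SS
  X := XX P T
  q := P.q
  rz := h.rz h14
  rf := h.rf h14
  mesh := by
    intro ε hε
    obtain ⟨N, hN⟩ := h.mesh hε
    refine ⟨N, fun n hn f hf x hx y hy => ?_⟩
    have hf : f ∈ cells (P.UU n) 2 := hf
    obtain ⟨-, -, ⟨c, hc, -⟩, -⟩ := mem_cells.1 hf
    exact hN n hn c c (Or.inl rfl) _ _ (hx c hc) (hy c hc)

theorem Tl.sphere0 (h : Tl P T) (h14 : (NL P T).ncard = 14) :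
    Nonempty ((⋃ p ∈ Nb, T ∩ KK P T p : Set E3) ≃ₜ sphere (0 : EuclideanSpace ℝ (Fin 3)) 1) := by
  have hf : ({0, (1,0,0)} : Finset LL) ∈ ((h.tower h14).S 0).F := zero_pair (by decide)
  have := (h.tower h14).sphere hf
  have e : re ((h.tower h14).X 0) ((h.tower h14).S 0).F = ⋃ p ∈ Nb, T ∩ KK P T p := by
    ext x
    rw [mem_re]
    constructor
    · rintro ⟨f, hf, hx⟩
      have hf : f ∈ cells {0} 2 := hf
      obtain ⟨p, hp, rfl⟩ := zero_two hf
      have hx : x ∈ XX P T 0 {0, p} := hx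
      refine mem_biUnion hp ⟨?_, hx p (by simp)⟩
      have := hx 0 (by simp)
      rwa [KK_zero] at this
    · intro hx
      obtain ⟨p, hp, h1, h2⟩ := mem_iUnion₂.1 hx
      refine ⟨{0, p}, zero_pair hp, ?_⟩
      intro c hc
      rcases Finset.mem_insert.1 hc with rfl | hc
      · rw [KK_zero]; exact h1
      · rw [Finset.mem_singleton.1 hc]; exact h2
  rw [e] at this
  exact this

end tower
end ABCT
end

section
open Set Metric Filter Topology

namespace ABCT

section bdry
set_option linter.unusedSectionVars false
set_option linter.unusedVariables false

variable {P : PS} {T : Set E3}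

theorem PS.fin_e (R : ℝ) : {a : LL | ‖P.e a‖ ≤ R}.Finite := by
  let g : LL → (Fin 3 → ℤ) := fun a => ![a.1 + P.s1 * a.2.1 + P.s2 * a.2.2, a.2.1 + P.s1 * a.2.2, a.2.2]
  have hg : ∀ a, P.e a = fun i => (g a i : ℝ) := P.e_int
  have gi : Function.Injective g := by
    intro a b hab
    apply P.e_inj
    rw [hg, hg, hab]
  have : (Set.Icc (fun _ => -⌈R⌉ : Fin 3 → ℤ) (fun _ => ⌈R⌉)).Finite := Set.finite_Icc _ _
  refine (this.preimage (f := g) gi.injOn).subset ?_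
  intro a ha
  have ha : ‖P.e a‖ ≤ R := ha
  have hb : ∀ i, |(g a i : ℝ)| ≤ R := by
    intro i
    have := (norm_le_pi_norm (P.e a) i).trans ha
    rw [hg, Real.norm_eq_abs] at this
    exact this
  have hR : R ≤ ⌈R⌉ := Int.le_ceil R
  refine ⟨fun i => ?_, fun i => ?_⟩
  · have := (abs_le.1 ((hb i).trans hR)).1
    exact_mod_cast this
  · have := (abs_le.1 ((hb i).trans hR)).2
    exact_mod_cast this

theorem Tl.locFin (h : Tl P T) : LocallyFinite (KK P T) := by
  obtain ⟨R, hR0, hR⟩ := h.cpt.isBounded.exists_pos_norm_le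
  intro x
  refine ⟨ball x 1, ball_mem_nhds x one_pos, (PS.fin_e (P := P) (‖x‖ + 1 + R)).subset ?_⟩
  rintro a ⟨y, hy, hyx⟩
  have h1 := hR _ hy
  have h2 : ‖y - x‖ < 1 := by rw [← dist_eq_norm]; exact hyx
  have e : P.e a = x + (y - x) - (y - P.e a) := by abel
  show ‖P.e a‖ ≤ _
  rw [e]
  have := norm_sub_le (x + (y - x)) (y - P.e a)
  have := norm_add_le x (y - x)
  linarith

theorem Tl.child_iter (h : Tl P T) (n : ℕ) {α : LL} {x : E3} :
    x ∈ KK P T α ↔ ∃ a, P.q^[n] a = α ∧ P.m^[n] x ∈ KK P T a := by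
  induction n generalizing α x with
  | zero => simp
  | succ n ih =>
    rw [h.child]
    constructor
    · rintro ⟨b, rfl, hb⟩
      obtain ⟨a, rfl, ha⟩ := ih.1 hb
      exact ⟨a, Function.iterate_succ_apply' _ _ _, ha⟩
    · rintro ⟨a, ha, hx⟩
      rw [Function.iterate_succ_apply'] at ha
      exact ⟨_, ha, ih.2 ⟨a, rfl, hx⟩⟩

theorem Tl.cover (h : Tl P T) (x0 : E3) : ∃ a, x0 ∈ KK P T a := by
  by_contra! hcon
  have hcl : IsClosed (⋃ a, KK P T a) := h.locFin.isClosed_iUnion fun a => (h.cptK a).isClosed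
  have hx0 : x0 ∈ (⋃ a, KK P T a)ᶜ := by
    rw [mem_compl_iff, mem_iUnion]; rintro ⟨a, ha⟩; exact hcon a ha
  obtain ⟨r, hr, hb⟩ := Metric.isOpen_iff.1 hcl.isOpen_compl x0 hx0
  obtain ⟨n, hn⟩ := P.m_expand 1 zero_le_one (half_pos hr)
  have hn := hn n le_rfl
  obtain ⟨y, hy⟩ := h.ne
  obtain ⟨p, hp⟩ := P.e_surj (fun i => ⌊(P.m^[n] x0) i - y i⌋)
  have ri : Function.LeftInverse P.m P.w := P.m_w
  have hx : P.m^[n] (P.w^[n] (y + P.e p)) = y + P.e p := ri.iterate n _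
  have h1 : ‖P.w^[n] (y + P.e p) - x0‖ ≤ r / 2 := by
    apply hn
    rw [iterate_map_sub, hx, pi_norm_le_iff_of_nonneg zero_le_one]
    intro i
    rw [hp, Real.norm_eq_abs, abs_le]
    simp only [Pi.sub_apply, Pi.add_apply]
    have := Int.floor_le ((P.m^[n] x0) i - y i)
    have := Int.lt_floor_add_one ((P.m^[n] x0) i - y i)
    constructor <;> linarith
  have h2 : P.w^[n] (y + P.e p) ∈ ball x0 r := by
    rw [mem_ball, dist_eq_norm]; linarith
  apply hb h2
  refine mem_iUnion.2 ⟨P.q^[n] p, (h.child_iter n).2 ⟨p, rfl, ?_⟩⟩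
  rw [hx, mem_KK, add_sub_cancel_right]
  exact hy

theorem vol_shift (s : Set E3) (v : E3) : MeasureTheory.volume ((fun x => x - v) ⁻¹' s) = MeasureTheory.volume s := by
  simp only [sub_eq_add_neg]
  exact MeasureTheory.measure_preimage_add_right _ _ _

theorem vol_KK (a : LL) : MeasureTheory.volume (KK P T a) = MeasureTheory.volume T := vol_shift _ _

theorem Tl.sib_null (h : Tl P T) {a b : LL} (hq : P.q a = P.q b) (hab : a ≠ b) :
    MeasureTheory.volume (KK P T a ∩ KK P T b) = 0 := by
  classical
  set α := P.q a with hα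
  have hCp := P.rr
  have hC2 : 2 ≤ P.C := by have := P.h1; have := P.h2; have := P.h3; unfold PS.C; omega
  obtain ⟨k, hk⟩ : ∃ k : ℕ, P.C = k + 2 := ⟨(P.C - 2).toNat, by omega⟩
  let S : Finset LL := (Finset.Icc (- P.s α) (P.C - 1 - P.s α)).image (PS.ch α)
  have hS : ∀ c, P.q c = α → c ∈ S := by
    intro c hc
    refine Finset.mem_image.2 ⟨P.u c, Finset.mem_Icc.2 ⟨?_, ?_⟩, ?_⟩
    · rw [← hc]; exact P.u_lo c
    · rw [← hc]; exact P.u_hi c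
    · rw [← hc]; exact P.ch_q_u c
  have hSc : S.card ≤ k + 2 := by
    refine Finset.card_image_le.trans ?_
    rw [Int.card_Icc]; omega
  have hS' : ((S.erase a).erase b).card ≤ k := by
    rw [Finset.card_erase_of_mem, Finset.card_erase_of_mem (hS a rfl)]
    · omega
    · exact Finset.mem_erase.2 ⟨hab.symm, hS b hq.symm⟩
  have hfin : MeasureTheory.volume T ≠ ⊤ := h.cpt.measure_lt_top.ne
  have sub : P.m '' KK P T α ⊆ (KK P T a ∪ KK P T b) ∪ ⋃ c ∈ (S.erase a).erase b, KK P T c := by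
    rintro _ ⟨x, hx, rfl⟩
    obtain ⟨c, hc, hxc⟩ := h.child.1 hx
    by_cases ca : c = a
    · exact Or.inl (Or.inl (ca ▸ hxc))
    by_cases cb : c = b
    · exact Or.inl (Or.inr (cb ▸ hxc))
    · exact Or.inr (mem_biUnion (Finset.mem_erase.2 ⟨cb, Finset.mem_erase.2 ⟨ca, hS c hc⟩⟩) hxc)
  have v1 : MeasureTheory.volume (P.m '' KK P T α) = (k + 2 : ℕ) * MeasureTheory.volume T := by
    rw [MeasureTheory.Measure.addHaar_image_linearMap, P.det_m, vol_KK, abs_neg, abs_of_pos P.rc_pos]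
    congr 1
    unfold PS.rc
    rw [hk]
    have : ((((k:ℕ):ℤ) + 2 : ℤ) : ℝ) = ((k + 2 : ℕ) : ℝ) := by push_cast; ring
    rw [this, ENNReal.ofReal_natCast]
  have v2 : MeasureTheory.volume (⋃ c ∈ (S.erase a).erase b, KK P T c) ≤ k * MeasureTheory.volume T := by
    refine (MeasureTheory.measure_biUnion_finset_le _ _).trans ?_
    simp only [vol_KK, Finset.sum_const, nsmul_eq_mul]
    gcongr
  have v3 := MeasureTheory.measure_union_add_inter (μ := MeasureTheory.volume) (KK P T a) (h.cptK b).measurableSet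
  rw [vol_KK, vol_KK] at v3
  have v4 := (MeasureTheory.measure_mono (μ := MeasureTheory.volume) sub).trans (MeasureTheory.measure_union_le _ _)
  rw [v1] at v4
  have v5 : ((k + 2 : ℕ) : ENNReal) * MeasureTheory.volume T + MeasureTheory.volume (KK P T a ∩ KK P T b)
      ≤ ((k + 2 : ℕ) : ENNReal) * MeasureTheory.volume T + 0 := by
    calc _ ≤ MeasureTheory.volume (KK P T a ∪ KK P T b) + k * MeasureTheory.volume T
          + MeasureTheory.volume (KK P T a ∩ KK P T b) := by
            gcongr; exact v4.trans (by gcongr)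
      _ = (MeasureTheory.volume (KK P T a ∪ KK P T b) + MeasureTheory.volume (KK P T a ∩ KK P T b))
          + k * MeasureTheory.volume T := by ring
      _ = _ := by rw [v3]; push_cast; ring
  have := (ENNReal.add_le_add_iff_left (ENNReal.mul_ne_top (ENNReal.natCast_ne_top _) hfin)).1 v5
  exact le_antisymm this bot_le

theorem Tl.iter_null (h : Tl P T) (n : ℕ) : ∀ a b : LL, P.q^[n] a = P.q^[n] b → a ≠ b →
    MeasureTheory.volume (KK P T a ∩ KK P T b) = 0 := by
  induction n with
  | zero => intro a b hab hne; exact absurd hab hne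
  | succ n ih =>
    intro a b hab hne
    by_cases hq : P.q a = P.q b
    · exact h.sib_null hq hne
    · have h0 := ih _ _ hab hq
      refine MeasureTheory.measure_mono_null (t := P.m '' (KK P T (P.q a) ∩ KK P T (P.q b))) ?_ ?_
      · rintro y ⟨h1, h2⟩
        refine ⟨P.w y, ⟨h.child.2 ⟨a, rfl, ?_⟩, h.child.2 ⟨b, rfl, ?_⟩⟩, P.m_w y⟩
        · rw [P.m_w]; exact h1
        · rw [P.m_w]; exact h2
      · rw [MeasureTheory.Measure.addHaar_image_linearMap, h0, mul_zero]

theorem PS.q01 (x y z : ℤ) (hx : 0 ≤ x) (hx' : x ≤ 1) (hy : 0 ≤ y) (hy' : y ≤ 1) (hz : 0 ≤ z) (hz' : z ≤ 1) :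
    P.q (x, y, z) = (y, z, 0) := by
  have h1 := P.h1
  have h2 := P.h2
  have h3 := P.h3
  have e : ((x, y, z) : LL) = PS.ch (y, z, 0) x := by simp [PS.ch]
  rw [e]
  have y01 : y = 0 ∨ y = 1 := by omega
  have z01 : z = 0 ∨ z = 1 := by omega
  apply P.q_ch
  · simp only [PS.s]
    rcases y01 with rfl | rfl <;> rcases z01 with rfl | rfl <;> simp <;> omega
  · simp only [PS.s, PS.C]
    rcases y01 with rfl | rfl <;> rcases z01 with rfl | rfl <;> simp <;> omega

theorem PS.q3 {x y z : ℤ} (hx : 0 ≤ x) (hx' : x ≤ 1) (hy : 0 ≤ y) (hy' : y ≤ 1) (hz : 0 ≤ z) (hz' : z ≤ 1) :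
    P.q^[3] (x, y, z) = (0, 0, 0) := by
  simp only [Function.iterate_succ_apply, Function.iterate_zero, id]
  rw [PS.q01 x y z hx hx' hy hy' hz hz', PS.q01 y z 0 hy hy' hz hz' le_rfl zero_le_one,
    PS.q01 z 0 0 hz hz' le_rfl zero_le_one le_rfl zero_le_one]

theorem KK_shift_null (a b c : LL) : MeasureTheory.volume (KK P T (a + c) ∩ KK P T (b + c)) =
    MeasureTheory.volume (KK P T a ∩ KK P T b) := by
  rw [← vol_shift (KK P T a ∩ KK P T b) (P.e c)]
  congr 1
  ext x
  simp only [mem_inter_iff, mem_preimage, mem_KK, P.e_add]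
  rw [sub_sub, sub_sub, add_comm (P.e c), add_comm (P.e c)]

theorem Tl.pos_null (h : Tl P T) {p : LL} (hp : RR 0 p) (hp0 : p ≠ 0) :
    MeasureTheory.volume (KK P T 0 ∩ KK P T p) = 0 := by
  obtain ⟨x, y, z⟩ := p
  obtain ⟨h1, h2, h3⟩ := hp
  simp only [Prod.fst_zero, Prod.snd_zero, zero_add] at h1 h2 h3
  refine h.iter_null 3 0 _ ?_ hp0.symm
  have e1 : P.q^[3] (x, y, z) = (0, 0, 0) := PS.q3 (by omega) (by omega) (by omega) (by omega) (by omega) (by omega)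
  have e2 : P.q^[3] 0 = (0, 0, 0) := PS.q3 (x := 0) (y := 0) (z := 0) le_rfl zero_le_one le_rfl zero_le_one le_rfl zero_le_one
  rw [e1, e2]

theorem Tl.nb_null (h : Tl P T) {p : LL} (hp : p ∈ Nb) : MeasureTheory.volume (T ∩ KK P T p) = 0 := by
  have hp := adj_zero.2 hp
  obtain ⟨hne, h1 | h1⟩ := hp
  · have := h.pos_null h1 hne.symm
    rwa [KK_zero] at this
  · have h2 : RR 0 (-p) := by
      obtain ⟨x, y, z⟩ := p
      obtain ⟨i1, i2, i3⟩ := h1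
      simp only [Prod.fst_zero, Prod.snd_zero] at i1 i2 i3
      refine ⟨?_, ?_, ?_⟩ <;> simp <;> omega
    have := h.pos_null h2 (by simpa using hne.symm)
    rw [← KK_shift_null _ _ p, zero_add, neg_add_cancel, KK_zero, inter_comm] at this
    exact this

theorem Tl.frontier_eq (h : Tl P T) (h14 : (NL P T).ncard = 14) : frontier T = ⋃ p ∈ Nb, T ∩ KK P T p := by
  rw [h.cpt.isClosed.frontier_eq]
  ext x
  constructor
  · rintro ⟨hx, hxi⟩
    by_contra hcon
    apply hxi
    have lf : LocallyFinite (fun a : {a : LL // a ≠ 0} => KK P T a.1) :=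
      h.locFin.comp_injective Subtype.val_injective
    have hcl : IsClosed (⋃ a : {a : LL // a ≠ 0}, KK P T a.1) :=
      lf.isClosed_iUnion fun a => (h.cptK a.1).isClosed
    rw [mem_interior]
    refine ⟨(⋃ a : {a : LL // a ≠ 0}, KK P T a.1)ᶜ, ?_, hcl.isOpen_compl, ?_⟩
    · intro y hy
      obtain ⟨a, ha⟩ := h.cover y
      by_cases h0 : a = 0
      · rw [h0, KK_zero] at ha; exact ha
      · exact absurd (mem_iUnion.2 ⟨⟨a, h0⟩, ha⟩) hy
    · intro hm
      obtain ⟨⟨a, ha0⟩, ha⟩ := mem_iUnion.1 hm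
      have hx0 : x ∈ KK P T 0 := by rw [KK_zero]; exact hx
      rcases h.meet h14 hx0 ha with e | e
      · exact ha0 e.symm
      · exact hcon (mem_biUnion (adj_zero.1 e) ⟨hx, ha⟩)
  · intro hx
    obtain ⟨p, hp, hxT, hxp⟩ := mem_iUnion₂.1 hx
    refine ⟨hxT, fun hxi => ?_⟩
    obtain ⟨r, hr, hb⟩ := Metric.isOpen_iff.1 isOpen_interior x hxi
    obtain ⟨N, hN⟩ := h.mesh (half_pos hr)
    obtain ⟨a, ha, hxa⟩ := (h.child_iter N).1 hxp
    have ri : Function.LeftInverse P.m P.w := P.m_w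
    have sub : (P.m^[N]) ⁻¹' KK P T a ⊆ T ∩ KK P T p := by
      intro y hy
      have hd := hN N le_rfl a a (Or.inl rfl) y x hy hxa
      refine ⟨interior_subset (hb ?_), (h.child_iter N).2 ⟨a, ha, hy⟩⟩
      rw [mem_ball]; linarith
    have z1 := MeasureTheory.measure_mono_null sub (h.nb_null hp)
    have z2 : MeasureTheory.volume ((P.m ^ N : E3 →ₗ[ℝ] E3) '' ((P.m^[N]) ⁻¹' KK P T a)) = 0 := by
      rw [MeasureTheory.Measure.addHaar_image_linearMap, z1, mul_zero]
    have z3 : MeasureTheory.volume (KK P T a) = 0 := by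
      refine MeasureTheory.measure_mono_null ?_ z2
      intro y hy
      refine ⟨P.w^[N] y, ?_, ?_⟩
      · rw [mem_preimage, ri.iterate N y]; exact hy
      · rw [Module.End.pow_apply, ri.iterate N y]
    rw [vol_KK] at z3
    exact h.vol.ne' z3

theorem Tl.sphere (h : Tl P T) (h14 : (NL P T).ncard = 14) :
    Nonempty (frontier T ≃ₜ sphere (0 : EuclideanSpace ℝ (Fin 3)) 1) := by
  rw [h.frontier_eq h14]
  exact h.sphere0 h14

end bdry
end ABCT
end

theorem abc_final (A B C : ℤ) (T : Set (Fin 3 → ℝ)) (hT : IsABCTile A B C T)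
    (h14 : (Neighbors T).ncard = 14) :
    Nonempty ((frontier T) ≃ₜ Metric.sphere (0 : EuclideanSpace ℝ (Fin 3)) 1) := by
  obtain ⟨hA, hAB, hBC, hne, hcpt, hvol, heq⟩ := hT
  let P : ABCT.PS := ⟨A - 1, B - A, C - B, by omega, by omega, by omega⟩
  have hPC : P.C = C := by simp only [ABCT.PS.C, P]; ring
  have hm : ∀ x, P.m x = (Mmat A B C).mulVec x := by
    intro x
    have e1 : P.rc = C := by unfold ABCT.PS.rc; rw [hPC]
    have e2 : P.rb = B := by simp [ABCT.PS.rb, P]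
    have e3 : P.ra = A := by simp [ABCT.PS.ra, P]
    unfold ABCT.PS.m ABCT.PS.mat Mmat
    rw [e1, e2, e3, Matrix.toLin'_apply]
  have hTl : ABCT.Tl P T := by
    refine ⟨hne, hcpt, hvol, fun y => ?_⟩
    have h1 : (∃ x ∈ T, P.m x = y) ↔ y ∈ (Mmat A B C).mulVec '' T := by
      simp only [hm, Set.mem_image]
    rw [h1, heq, hPC]
    simp only [Set.mem_iUnion, tileTranslate, Set.mem_image]
    constructor
    · rintro ⟨d, ⟨i, h0, h2, rfl⟩, x, hx, rfl⟩
      refine ⟨i, h0, h2, ?_⟩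
      unfold ABCT.PS.dg
      rw [add_sub_cancel_right]; exact hx
    · rintro ⟨i, h0, h2, hx⟩
      exact ⟨_, ⟨i, h0, h2, rfl⟩, _, hx, sub_add_cancel _ _⟩
  let g : ABCT.LL → (Fin 3 → ℤ) := fun a => ![a.1 + P.s1 * a.2.1 + P.s2 * a.2.2, a.2.1 + P.s1 * a.2.2, a.2.2]
  have hg : ∀ a, P.e a = toR (g a) := P.e_int
  have gi : Function.Injective g := by
    intro a b hab
    apply P.e_inj
    rw [hg, hg, hab]
  have tri : Function.Injective toR := by
    intro a b hab
    funext i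
    have := congrFun hab i
    simpa [toR] using this
  have gs : ∀ v, ∃ a, g a = v := by
    intro v
    obtain ⟨a, ha⟩ := P.e_surj v
    refine ⟨a, tri ?_⟩
    rw [← hg, ha]; rfl
  have g0 : g 0 = 0 := by
    apply tri
    rw [← hg, P.e_zero]
    funext i; simp [toR]
  have hk : ∀ a, tileTranslate (toR (g a)) T = ABCT.KK P T a := by
    intro a
    ext x
    rw [ABCT.mem_KK, hg]
    constructor
    · rintro ⟨y, hy, rfl⟩
      rw [add_sub_cancel_right]; exact hy
    · intro hx
      exact ⟨_, hx, sub_add_cancel _ _⟩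
  have hN : Neighbors T = g '' ABCT.NL P T := by
    ext v
    constructor
    · rintro ⟨h0, h1⟩
      obtain ⟨a, rfl⟩ := gs v
      rw [hk] at h1
      exact ⟨a, ⟨fun e => h0 (by rw [e, g0]), h1⟩, rfl⟩
    · rintro ⟨a, ⟨h0, h1⟩, rfl⟩
      refine ⟨fun e => h0 (gi (by rw [e, g0])), ?_⟩
      rw [hk]; exact h1
  rw [hN, Set.ncard_image_of_injective _ gi] at h14
  exact hTl.sphere h14

theorem stmt4 (A B C : ℤ) (T : Set (Fin 3 → ℝ)) (hT : IsABCTile A B C T)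
    (h14 : (Neighbors T).ncard = 14) :
    Nonempty ((frontier T) ≃ₜ Metric.sphere (0 : EuclideanSpace ℝ (Fin 3)) 1) := by
  exact abc_final A B C T hT h14
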